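/- Let W be a finite Coxeter group on ℝ^n with positive roots R_+ normalized by (α,α)=2, degrees d_1,…,d_n, and equal multiplicity m ∈ ℕ on all roots. Let w_m(x) = ∏_{α∈R_+}(α,x)^{2m+1} be the m-discriminant. Then the canonical bilinear form on quasi-invariants satisfies (w_m, w_m)^{R_+} = (−1)^{m|R_+|} ∏_{j=1}^n (m+2)_{(m+1)(d_j−1)} (m+1)_{m(d_j−1)}, where (x)_k = x(x+1)⋯(x+k−1) is the Pochhammer symbol. -/

import Mathlib

open MeasureTheory Complex Finset

noncomputable section

/-- The standard dot product on `ℝ^n`. -/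
def dotR {n : ℕ} (x y : Fin n → ℝ) : ℝ := ∑ i, x i * y i

/-- The set of orthogonal reflections `s_α : x ↦ x - (α,x)α` (for `(α,α)=2`)
in the hyperplanes orthogonal to the vectors of `R`. -/
def reflSet {n : ℕ} (R : Finset (Fin n → ℝ)) :
    Set ((Fin n → ℝ) ≃ₗ[ℝ] (Fin n → ℝ)) :=
  { e | ∃ α ∈ R, ∀ x, e x = x - dotR α x • α }

/-- The group generated by the reflections in the hyperplanes orthogonal to `R`. -/
def coxGroup {n : ℕ} (R : Finset (Fin n → ℝ)) :
    Subgroup ((Fin n → ℝ) ≃ₗ[ℝ] (Fin n → ℝ)) :=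
  Subgroup.closure (reflSet R)

/-- Data of a finite Coxeter group `W` acting on `ℝ^n`: a system `R` of positive
roots, normalised by `(α,α) = 2`, generating a finite reflection group, together
with the degrees `d j` of a system of basic homogeneous algebraically independent
generators `P j` of the algebra of `W`-invariant polynomials. -/
structure CoxeterData (n : ℕ) where
  /-- the positive roots -/
  R : Finset (Fin n → ℝ)
  norm2 : ∀ α ∈ R, dotR α α = 2
  noncollinear : ∀ α ∈ R, ∀ β ∈ R, α ≠ β → ∀ c : ℝ, β ≠ c • α
  pos : ∃ v, ∀ α ∈ R, 0 < dotR α v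
  finiteW : Finite (coxGroup R)
  stableR : ∀ e ∈ coxGroup R, ∀ α ∈ R, ((e : (Fin n → ℝ) ≃ₗ[ℝ] (Fin n → ℝ)) α ∈ R ∨
      -((e : (Fin n → ℝ) ≃ₗ[ℝ] (Fin n → ℝ)) α) ∈ R)
  /-- the degrees of the basic invariants -/
  d : Fin n → ℕ
  /-- the basic invariants -/
  P : Fin n → MvPolynomial (Fin n) ℝ
  homog : ∀ j, (P j).IsHomogeneous (d j)
  invP : ∀ j, ∀ e ∈ coxGroup R, ∀ x : Fin n → ℝ,
    MvPolynomial.eval ((e : (Fin n → ℝ) ≃ₗ[ℝ] (Fin n → ℝ)) x) (P j) = MvPolynomial.eval x (P j)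
  algInd : AlgebraicIndependent ℝ P
  gen : ∀ q : MvPolynomial (Fin n) ℝ,
    (∀ e ∈ coxGroup R, ∀ x : Fin n → ℝ,
      MvPolynomial.eval ((e : (Fin n → ℝ) ≃ₗ[ℝ] (Fin n → ℝ)) x) q = MvPolynomial.eval x q) →
    q ∈ Algebra.adjoin ℝ (Set.range P)

end
noncomputable section

/-- The pairing `(α, z) = ∑ αᵢ zᵢ` of a real vector with a complex vector. -/
def dotC {n : ℕ} (α : Fin n → ℝ) (z : Fin n → ℂ) : ℂ := ∑ i, (α i : ℂ) * z i

/-- The product `A_m(z) = ∏_{α∈𝒜} (α,z)^{m_α}` of the defining linear forms of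
an arrangement with multiplicities. -/
def AmC {n : ℕ} (A : Finset (Fin n → ℝ)) (mult : (Fin n → ℝ) → ℕ)
    (z : Fin n → ℂ) : ℂ :=
  ∏ α ∈ A, dotC α z ^ mult α

/-- The directional (normal) derivative `∂_α` along the vector `α`. -/
def dirDeriv {n : ℕ} (α : Fin n → ℝ) (f : (Fin n → ℂ) → ℂ) : (Fin n → ℂ) → ℂ :=
  fun z => deriv (fun t : ℂ => f (z + t • fun i => (α i : ℂ))) 0

/-- A configuration for the Baker-Akhiezer problem: a finite collection of
noncollinear nonzero vectors in `ℝ^n` with multiplicities. -/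
structure BAConfig (n : ℕ) where
  /-- the vectors of the arrangement -/
  A : Finset (Fin n → ℝ)
  /-- the multiplicities -/
  mult : (Fin n → ℝ) → ℕ
  nonzero : ∀ α ∈ A, α ≠ 0
  noncollinear : ∀ α ∈ A, ∀ β ∈ A, α ≠ β → ∀ c : ℝ, β ≠ c • α

/-- `φ` is a Baker-Akhiezer function for the configuration `C` (Chalykh–Veselov
axiomatics): `φ(x,λ) = P(x,λ)e^{(x,λ)}` with `P` a polynomial in `x` of degree
`|m| = ∑ m_α` whose top homogeneous term is `A_m(x)A_m(λ)`, and
`∂_α^{2j+1} φ(x,λ) = 0` on the hyperplane `(α,x)=0` for `0 ≤ j < m_α`. -/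
def IsBAFunction {n : ℕ} (C : BAConfig n)
    (φ : (Fin n → ℂ) → (Fin n → ℂ) → ℂ) : Prop :=
  (∀ lam : Fin n → ℂ, ∃ p : MvPolynomial (Fin n) ℂ,
      (∀ x, φ x lam = MvPolynomial.eval x p * Complex.exp (∑ i, x i * lam i)) ∧
      p.totalDegree ≤ ∑ α ∈ C.A, C.mult α ∧
      MvPolynomial.homogeneousComponent (∑ α ∈ C.A, C.mult α) p =
        AmC C.A C.mult lam •
          ∏ α ∈ C.A, (∑ i, MvPolynomial.C ((α i : ℝ) : ℂ) * MvPolynomial.X i) ^ C.mult α) ∧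
  (∀ α ∈ C.A, ∀ j < C.mult α, ∀ lam : Fin n → ℂ, ∀ x : Fin n → ℂ,
      dotC α x = 0 → (dirDeriv α)^[2 * j + 1] (fun y => φ y lam) x = 0)

end

noncomputable section

/-- `D` is a (finite order, variable coefficient) linear differential operator. -/
def partialD {n : ℕ} (i : Fin n) (f : (Fin n → ℂ) → ℂ) : (Fin n → ℂ) → ℂ :=
  fun z => deriv (fun t => f (Function.update z i t)) (z i)

/-- The iterated partial derivative `∂^β` for a multi-index `β`. -/
def multiD {n : ℕ} (β : Fin n → ℕ) (f : (Fin n → ℂ) → ℂ) : (Fin n → ℂ) → ℂ :=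
  ((List.ofFn fun i : Fin n => (partialD i)^[β i]).foldr (· ∘ ·) id) f

/-- `D` is a (finite order, variable coefficient) linear differential operator:
`D f = ∑_β a_β(z) ∂^β f` over a finite set of multi-indices. -/
def IsDiffOp {n : ℕ} (D : ((Fin n → ℂ) → ℂ) → ((Fin n → ℂ) → ℂ)) : Prop :=
  ∃ (s : Finset (Fin n → ℕ)) (a : (Fin n → ℕ) → (Fin n → ℂ) → ℂ),
    ∀ f z, D f z = ∑ β ∈ s, a β z * multiD β f z

end

noncomputable section

open MvPolynomial (X pderiv eval aeval homogeneousComponent)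
open scoped Topology

section LinearForms

variable {n : ℕ} (K : Type*) [Field K] [Algebra ℝ K]

/-- The linear form `(a, x)` as a polynomial over `K`. -/
def lin (a : Fin n → ℝ) : MvPolynomial (Fin n) K :=
  ∑ i, MvPolynomial.C (algebraMap ℝ K (a i)) * X i

/-- The substitution `x ↦ x - t (a, x) a`. -/
def shear (t : ℝ) (a : Fin n → ℝ) : MvPolynomial (Fin n) K →ₐ[K] MvPolynomial (Fin n) K :=
  aeval fun i => X i - MvPolynomial.C (algebraMap ℝ K (t * a i)) * lin K a

theorem dotR_comm (x y : Fin n → ℝ) : dotR x y = dotR y x := by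
  simp [dotR, mul_comm]

theorem dotR_add_left (x y z : Fin n → ℝ) : dotR (x + y) z = dotR x z + dotR y z := by
  simp [dotR, add_mul, sum_add_distrib]

theorem dotR_smul_left (t : ℝ) (x y : Fin n → ℝ) : dotR (t • x) y = t * dotR x y := by
  simp [dotR, mul_sum, mul_assoc]

theorem dotR_neg_left (x y : Fin n → ℝ) : dotR (-x) y = -dotR x y := by
  simp [dotR]

theorem dotR_sub_left (x y z : Fin n → ℝ) : dotR (x - y) z = dotR x z - dotR y z := by
  simp [dotR, sub_mul, Finset.sum_sub_distrib]

theorem dotR_add_right (x y z : Fin n → ℝ) : dotR x (y + z) = dotR x y + dotR x z := by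
  simp [dotR, mul_add, sum_add_distrib]

theorem dotR_smul_right (t : ℝ) (x y : Fin n → ℝ) : dotR x (t • y) = t * dotR x y := by
  rw [dotR_comm, dotR_smul_left, dotR_comm]

theorem dotR_neg_right (x y : Fin n → ℝ) : dotR x (-y) = -dotR x y := by
  simp [dotR]

theorem dotR_sub_right (x y z : Fin n → ℝ) : dotR x (y - z) = dotR x y - dotR x z := by
  simp [dotR, mul_sub, Finset.sum_sub_distrib]

theorem dotR_zero_right (x : Fin n → ℝ) : dotR x 0 = 0 := by simp [dotR]

theorem dotR_zero_left (x : Fin n → ℝ) : dotR 0 x = 0 := by simp [dotR]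

theorem lin_add (a b : Fin n → ℝ) : lin K (a + b) = lin K a + lin K b := by
  simp [lin, add_mul, sum_add_distrib]

theorem lin_smul (t : ℝ) (a : Fin n → ℝ) :
    lin K (t • a) = MvPolynomial.C (algebraMap ℝ K t) * lin K a := by
  simp [lin, mul_sum, mul_assoc]

theorem lin_neg (a : Fin n → ℝ) : lin K (-a) = -lin K a := by
  simp [lin]

theorem lin_sub (a b : Fin n → ℝ) : lin K (a - b) = lin K a - lin K b := by
  rw [sub_eq_add_neg, lin_add, lin_neg, sub_eq_add_neg]

theorem eval_lin_real (a x : Fin n → ℝ) : eval x (lin ℝ a) = dotR a x := by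
  simp [lin, dotR]

theorem eval_lin_complex (a : Fin n → ℝ) (z : Fin n → ℂ) :
    eval z (lin ℂ a) = dotC a z := by
  simp [lin, dotC]

theorem aeval_lin_complex (a : Fin n → ℝ) (z : Fin n → ℂ) :
    aeval z (lin ℝ a) = dotC a z := by
  simp [lin, dotC]

theorem lin_isHomogeneous (a : Fin n → ℝ) : (lin K a).IsHomogeneous 1 := by
  refine MvPolynomial.IsHomogeneous.sum _ _ _ fun i _ => ?_
  simpa using (MvPolynomial.isHomogeneous_C (Fin n) (algebraMap ℝ K (a i))).mul
    (MvPolynomial.isHomogeneous_X K i)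

theorem coeff_lin (a : Fin n → ℝ) (i : Fin n) :
    MvPolynomial.coeff (Finsupp.single i 1) (lin K a) = algebraMap ℝ K (a i) := by
  classical
  simp [lin, MvPolynomial.coeff_sum, MvPolynomial.coeff_C_mul, MvPolynomial.coeff_X,
    Finsupp.single_left_inj]

theorem lin_eq_zero {a : Fin n → ℝ} (h : lin K a = 0) : a = 0 := by
  funext i
  have := coeff_lin K a i
  rw [h] at this
  simpa using this.symm

theorem pderiv_lin (a : Fin n → ℝ) (i : Fin n) :
    pderiv i (lin K a) = MvPolynomial.C (algebraMap ℝ K (a i)) := by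
  classical
  simp [lin, MvPolynomial.pderiv_X, Pi.single_apply]

theorem shear_X (t : ℝ) (a : Fin n → ℝ) (i : Fin n) :
    shear K t a (X i) = X i - MvPolynomial.C (algebraMap ℝ K (t * a i)) * lin K a := by
  simp [shear]

theorem shear_C (t : ℝ) (a : Fin n → ℝ) (z : K) :
    shear K t a (MvPolynomial.C z) = MvPolynomial.C z := by
  simp [shear]

theorem shear_lin (t : ℝ) (a b : Fin n → ℝ) :
    shear K t a (lin K b) = lin K (b - (t * dotR a b) • a) := by
  rw [lin_sub, lin_smul]
  conv_lhs => rw [lin]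
  simp only [map_sum, map_mul, shear_X, shear_C, mul_sub, Finset.sum_sub_distrib]
  congr 1
  simp only [dotR, map_mul, map_sum, mul_sum, Finset.sum_mul]
  refine sum_congr rfl fun i _ => ?_
  ring

theorem lin_dvd_sub_shear (t : ℝ) (a : Fin n → ℝ) (f : MvPolynomial (Fin n) K) :
    lin K a ∣ f - shear K t a f := by
  rw [← Ideal.mem_span_singleton, ← Ideal.Quotient.eq]
  have : (Ideal.Quotient.mkₐ K (Ideal.span {lin K a})) =
      (Ideal.Quotient.mkₐ K (Ideal.span {lin K a})).comp (shear K t a) := by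
    refine MvPolynomial.algHom_ext fun i => ?_
    simp only [AlgHom.comp_apply, shear_X]
    refine Ideal.Quotient.eq.2 (Ideal.mem_span_singleton.2 ?_)
    simp
  exact DFunLike.congr_fun this f

variable {a b : Fin n → ℝ}

theorem shear_half_lin_self (ha : dotR a a = 2) : shear K (1 / 2) a (lin K a) = 0 := by
  rw [shear_lin, ha]
  simp [lin]

theorem shear_one_lin_self (ha : dotR a a = 2) : shear K 1 a (lin K a) = -lin K a := by
  rw [shear_lin, ha, ← lin_neg]
  congr 1
  module

theorem lin_dvd_iff (ha : dotR a a = 2) {f : MvPolynomial (Fin n) K} :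
    lin K a ∣ f ↔ shear K (1 / 2) a f = 0 := by
  constructor
  · rintro ⟨g, rfl⟩
    rw [map_mul, shear_half_lin_self K ha, zero_mul]
  · intro h
    have := lin_dvd_sub_shear K (1 / 2) a f
    rwa [h, sub_zero] at this

theorem lin_ne_zero (ha : dotR a a = 2) : lin K a ≠ 0 := by
  intro h
  rw [lin_eq_zero K h, dotR_zero_left] at ha
  norm_num at ha

theorem lin_prime (ha : dotR a a = 2) : Prime (lin K a) := by
  refine ⟨lin_ne_zero K ha, fun h => ?_, fun f g h => ?_⟩
  · have := h.map (shear K (1 / 2) a)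
    rw [shear_half_lin_self K ha] at this
    exact not_isUnit_zero this
  · rw [lin_dvd_iff K ha, map_mul, mul_eq_zero] at h
    simpa only [lin_dvd_iff K ha] using h

theorem lin_not_dvd (ha : dotR a a = 2) (h : ∀ t : ℝ, b ≠ t • a) : ¬ lin K a ∣ lin K b := by
  rw [lin_dvd_iff K ha, shear_lin]
  intro h0
  exact h _ (sub_eq_zero.1 (lin_eq_zero K h0))

theorem lin_isRelPrime (ha : dotR a a = 2) (h : ∀ t : ℝ, b ≠ t • a) :
    IsRelPrime (lin K a) (lin K b) :=
  ((lin_prime K ha).irreducible.isRelPrime_iff_not_dvd).2 (lin_not_dvd K ha h)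

/-- A polynomial which changes sign under the reflection in `a` is divisible by `(a, x)`. -/
theorem lin_dvd_of_anti [CharZero K] {f : MvPolynomial (Fin n) K}
    (h : shear K 1 a f = -f) : lin K a ∣ f := by
  have h1 := lin_dvd_sub_shear K 1 a f
  rw [h, sub_neg_eq_add, ← two_mul] at h1
  have h2 : f = MvPolynomial.C (2⁻¹ : K) * (2 * f) := by
    have : (2 : MvPolynomial (Fin n) K) = MvPolynomial.C 2 := (map_ofNat _ 2).symm
    rw [this, ← mul_assoc, ← map_mul]
    simp
  rw [h2]
  exact h1.mul_left _

theorem prod_lin_pow_dvd {A : Finset (Fin n → ℝ)} (hA : ∀ α ∈ A, dotR α α = 2)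
    (hc : ∀ α ∈ A, ∀ β ∈ A, α ≠ β → ∀ t : ℝ, β ≠ t • α) (k : ℕ)
    {f : MvPolynomial (Fin n) K} (h : ∀ α ∈ A, lin K α ^ k ∣ f) :
    (∏ α ∈ A, lin K α ^ k) ∣ f := by
  refine Finset.prod_dvd_of_isRelPrime (fun α hα β hβ hne => ?_) h
  exact (lin_isRelPrime K (hA α hα) (hc α hα β hβ hne)).pow

end LinearForms

section Substitution

variable {n : ℕ} (K : Type*) [Field K] [Algebra ℝ K]

/-- The `i`-th row of the matrix of a linear automorphism. -/
def rowVec (e : (Fin n → ℝ) ≃ₗ[ℝ] (Fin n → ℝ)) (i : Fin n) : Fin n → ℝ :=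
  fun j => e (Pi.single j 1) i

theorem dotR_rowVec (e : (Fin n → ℝ) ≃ₗ[ℝ] (Fin n → ℝ)) (i : Fin n) (x : Fin n → ℝ) :
    dotR (rowVec e i) x = e x i := by
  conv_rhs => rw [pi_eq_sum_univ' x]
  simp only [map_sum, Finset.sum_apply, dotR, rowVec]
  refine sum_congr rfl fun j _ => ?_
  rw [map_smul, Pi.smul_apply, smul_eq_mul, mul_comm]

/-- The substitution `f ↦ f ∘ e`. -/
def subst (e : (Fin n → ℝ) ≃ₗ[ℝ] (Fin n → ℝ)) :
    MvPolynomial (Fin n) K →ₐ[K] MvPolynomial (Fin n) K :=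
  aeval fun i => lin K (rowVec e i)

/-- The complexification of a real linear automorphism. -/
def cplx (e : (Fin n → ℝ) ≃ₗ[ℝ] (Fin n → ℝ)) (z : Fin n → ℂ) : Fin n → ℂ :=
  fun i => dotC (rowVec e i) z

theorem subst_X (e : (Fin n → ℝ) ≃ₗ[ℝ] (Fin n → ℝ)) (i : Fin n) :
    subst K e (X i) = lin K (rowVec e i) := by simp [subst]

theorem eval_subst (e : (Fin n → ℝ) ≃ₗ[ℝ] (Fin n → ℝ)) (f : MvPolynomial (Fin n) ℝ)
    (x : Fin n → ℝ) : eval x (subst ℝ e f) = eval (e x) f := by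
  rw [subst, MvPolynomial.aeval_def, MvPolynomial.eval_eval₂, eval]
  congr 1
  · ext; simp
  · funext i
    exact (eval_lin_real _ _).trans (dotR_rowVec _ _ _)

theorem eval_subst_complex (e : (Fin n → ℝ) ≃ₗ[ℝ] (Fin n → ℝ)) (f : MvPolynomial (Fin n) ℂ)
    (z : Fin n → ℂ) : eval z (subst ℂ e f) = eval (cplx e z) f := by
  rw [subst, MvPolynomial.aeval_def, MvPolynomial.eval_eval₂, eval]
  congr 1
  · ext; simp
  · funext i
    exact eval_lin_complex _ _

theorem subst_ext {e : (Fin n → ℝ) ≃ₗ[ℝ] (Fin n → ℝ)}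
    {g : MvPolynomial (Fin n) K →ₐ[K] MvPolynomial (Fin n) K}
    (h : ∀ i, g (X i) = lin K (rowVec e i)) : g = subst K e :=
  MvPolynomial.algHom_ext fun i => by rw [h, subst_X]

theorem subst_one : subst K (1 : (Fin n → ℝ) ≃ₗ[ℝ] (Fin n → ℝ)) = AlgHom.id K _ := by
  classical
  refine (subst_ext K fun i => ?_).symm
  have : rowVec (1 : (Fin n → ℝ) ≃ₗ[ℝ] (Fin n → ℝ)) i = Pi.single i 1 := by
    funext j
    simp [rowVec, Pi.single_apply, eq_comm]
  simp [this, lin, Pi.single_apply]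

theorem subst_lin_of_adjoint {e : (Fin n → ℝ) ≃ₗ[ℝ] (Fin n → ℝ)} {a b : Fin n → ℝ}
    (h : ∀ x, dotR a (e x) = dotR b x) : subst K e (lin K a) = lin K b := by
  classical
  have hb : b = ∑ i, a i • rowVec e i := by
    funext j
    have := h (Pi.single j 1)
    simp only [dotR, Pi.single_apply, mul_ite, mul_one, mul_zero, Finset.sum_ite_eq',
      Finset.mem_univ, if_true] at this
    rw [← this]
    simp [rowVec]
  have hsum : ∀ s : Finset (Fin n), lin K (∑ i ∈ s, a i • rowVec e i) =
      ∑ i ∈ s, MvPolynomial.C (algebraMap ℝ K (a i)) * lin K (rowVec e i) := by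
    intro s
    induction s using Finset.induction_on with
    | empty => simp [lin]
    | insert i s hi ih => rw [Finset.sum_insert hi, Finset.sum_insert hi, lin_add, lin_smul, ih]
  rw [hb, hsum, lin, map_sum]
  exact sum_congr rfl fun i _ => by
    rw [map_mul, subst_X, MvPolynomial.algHom_C, MvPolynomial.algebraMap_eq]

theorem subst_mul (e e' : (Fin n → ℝ) ≃ₗ[ℝ] (Fin n → ℝ)) (f : MvPolynomial (Fin n) K) :
    subst K (e * e') f = subst K e' (subst K e f) := by
  have : subst K (e * e') = (subst K e').comp (subst K e) := by
    refine (subst_ext K fun i => ?_).symm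
    rw [AlgHom.comp_apply, subst_X]
    refine subst_lin_of_adjoint K fun x => ?_
    rw [dotR_rowVec, dotR_rowVec, LinearEquiv.mul_apply]
  rw [this, AlgHom.comp_apply]

theorem subst_isHomogeneous (e : (Fin n → ℝ) ≃ₗ[ℝ] (Fin n → ℝ)) {f : MvPolynomial (Fin n) K}
    {d : ℕ} (hf : f.IsHomogeneous d) : (subst K e f).IsHomogeneous d := by
  have := hf.aeval (n := 1) _ fun i => lin_isHomogeneous K (rowVec e i)
  rwa [one_mul] at this

theorem subst_reflection {e : (Fin n → ℝ) ≃ₗ[ℝ] (Fin n → ℝ)} {a : Fin n → ℝ}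
    (h : ∀ x, e x = x - dotR a x • a) : subst K e = shear K 1 a := by
  classical
  refine (subst_ext K fun i => ?_).symm
  have : rowVec e i = Pi.single i 1 - a i • a := by
    funext j
    simp only [rowVec, h, Pi.sub_apply, Pi.smul_apply, smul_eq_mul, Pi.single_apply]
    congr 1
    · simp [eq_comm]
    · simp [dotR, mul_comm, Pi.single_apply]
  rw [shear_X, this, lin_sub, lin_smul, one_mul]
  simp [lin, Pi.single_apply]

/-- The orthogonal reflection in the hyperplane orthogonal to a vector of square norm `2`. -/
def reflE (a : Fin n → ℝ) (ha : dotR a a = 2) : (Fin n → ℝ) ≃ₗ[ℝ] (Fin n → ℝ) :=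
  LinearEquiv.ofInvolutive
    { toFun := fun x => x - dotR a x • a
      map_add' := fun x y => by rw [dotR_add_right]; module
      map_smul' := fun t x => by rw [dotR_smul_right]; simp only [RingHom.id_apply]; module }
    (fun x => by
      simp only [LinearMap.coe_mk, AddHom.coe_mk]
      rw [dotR_sub_right, dotR_smul_right, ha]
      module)

theorem reflE_apply (a : Fin n → ℝ) (ha : dotR a a = 2) (x : Fin n → ℝ) :
    reflE a ha x = x - dotR a x • a := rfl

end Substitution

namespace CoxeterData

variable {n : ℕ} (c : CoxeterData n)

/-- The Coxeter group as a type. -/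
abbrev W : Type := ↥(coxGroup c.R)

instance : Finite c.W := c.finiteW

instance : Fintype c.W := Fintype.ofFinite _

/-- The action on vectors. -/
def act (w : c.W) (x : Fin n → ℝ) : Fin n → ℝ := (w : (Fin n → ℝ) ≃ₗ[ℝ] (Fin n → ℝ)) x

/-- The reflection in a root. -/
def s (α : Fin n → ℝ) (hα : α ∈ c.R) : c.W :=
  ⟨reflE α (c.norm2 α hα), Subgroup.subset_closure ⟨α, hα, fun x => reflE_apply _ _ x⟩⟩

theorem act_s (α : Fin n → ℝ) (hα : α ∈ c.R) (x : Fin n → ℝ) :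
    c.act (c.s α hα) x = x - dotR α x • α := rfl

theorem act_one (x : Fin n → ℝ) : c.act 1 x = x := rfl

theorem act_mul (u w : c.W) (x : Fin n → ℝ) : c.act (u * w) x = c.act u (c.act w x) := rfl

theorem act_inv_act (u : c.W) (x : Fin n → ℝ) : c.act u⁻¹ (c.act u x) = x := by
  rw [← act_mul, inv_mul_cancel, act_one]

theorem act_act_inv (u : c.W) (x : Fin n → ℝ) : c.act u (c.act u⁻¹ x) = x := by
  rw [← act_mul, mul_inv_cancel, act_one]

theorem act_neg (u : c.W) (x : Fin n → ℝ) : c.act u (-x) = -c.act u x := map_neg _ _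

theorem act_add (u : c.W) (x y : Fin n → ℝ) : c.act u (x + y) = c.act u x + c.act u y :=
  map_add _ _ _

theorem act_smul (u : c.W) (t : ℝ) (x : Fin n → ℝ) : c.act u (t • x) = t • c.act u x :=
  map_smul _ _ _

theorem s_mul_self (α : Fin n → ℝ) (hα : α ∈ c.R) : c.s α hα * c.s α hα = 1 := by
  refine Subtype.ext (LinearEquiv.ext fun x => ?_)
  change c.act (c.s α hα * c.s α hα) x = x
  rw [act_mul, act_s, act_s, dotR_sub_right, dotR_smul_right, c.norm2 α hα]
  module

theorem s_inv (α : Fin n → ℝ) (hα : α ∈ c.R) : (c.s α hα)⁻¹ = c.s α hα :=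
  inv_eq_of_mul_eq_one_left (c.s_mul_self α hα)

/-- The reflections generate the group. -/
theorem closure_s : Subgroup.closure {w : c.W | ∃ α, ∃ hα : α ∈ c.R, w = c.s α hα} = ⊤ := by
  have : {w : c.W | ∃ α, ∃ hα : α ∈ c.R, w = c.s α hα} =
      ((↑) : c.W → _) ⁻¹' reflSet c.R := by
    ext w
    constructor
    · rintro ⟨α, hα, rfl⟩
      exact ⟨α, hα, fun x => rfl⟩
    · rintro ⟨α, hα, h⟩
      exact ⟨α, hα, Subtype.ext (LinearEquiv.ext fun x => h x)⟩
  rw [this]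
  exact Subgroup.closure_closure_coe_preimage

theorem induction_s {p : c.W → Prop} (h1 : p 1)
    (hs : ∀ α (hα : α ∈ c.R) w, p w → p (c.s α hα * w)) (w : c.W) : p w := by
  have hw : w ∈ Subgroup.closure {w : c.W | ∃ α, ∃ hα : α ∈ c.R, w = c.s α hα} := by
    rw [c.closure_s]; trivial
  induction hw using Subgroup.closure_induction_left with
  | one => exact h1
  | mul_left x hx y hy ih =>
    obtain ⟨α, hα, rfl⟩ := hx
    exact hs α hα y ih
  | inv_mul_cancel x hx y hy ih =>
    obtain ⟨α, hα, rfl⟩ := hx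
    rw [s_inv]
    exact hs α hα y ih

theorem dotR_act (w : c.W) (x y : Fin n → ℝ) : dotR (c.act w x) (c.act w y) = dotR x y := by
  induction w using c.induction_s with
  | h1 => rfl
  | hs α hα w ih =>
    rw [act_mul, act_mul, act_s, act_s]
    simp only [dotR_sub_left, dotR_sub_right, dotR_smul_left, dotR_smul_right, c.norm2 α hα, ih]
    rw [dotR_comm (c.act w x) α]
    ring

theorem dotR_act_right (w : c.W) (x y : Fin n → ℝ) :
    dotR x (c.act w y) = dotR (c.act w⁻¹ x) y := by
  rw [← c.dotR_act w⁻¹ x, act_inv_act]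

theorem act_mem_or (w : c.W) {α : Fin n → ℝ} (hα : α ∈ c.R) :
    c.act w α ∈ c.R ∨ -c.act w α ∈ c.R := c.stableR w w.2 α hα

theorem act_mem_iff_pos {v : Fin n → ℝ} (hv : ∀ α ∈ c.R, 0 < dotR α v) (w : c.W)
    {α : Fin n → ℝ} (hα : α ∈ c.R) : c.act w α ∈ c.R ↔ 0 < dotR (c.act w α) v := by
  refine ⟨fun h => hv _ h, fun h => (c.act_mem_or w hα).resolve_right fun h' => ?_⟩
  have := hv _ h'
  rw [dotR_neg_left] at this
  linarith

open Classical in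
/-- The permutation of the positive roots induced by a group element up to sign. -/
def perm (w : c.W) (α : Fin n → ℝ) : Fin n → ℝ :=
  if c.act w α ∈ c.R then c.act w α else -c.act w α

theorem perm_mem (w : c.W) {α : Fin n → ℝ} (hα : α ∈ c.R) : c.perm w α ∈ c.R := by
  unfold perm
  split_ifs with h
  · exact h
  · exact (c.act_mem_or w hα).resolve_left h

theorem perm_eq_or (w : c.W) (α : Fin n → ℝ) :
    c.perm w α = c.act w α ∨ c.perm w α = -c.act w α := by
  unfold perm
  split_ifs <;> simp

theorem perm_injOn (w : c.W) : Set.InjOn (c.perm w) (c.R : Set (Fin n → ℝ)) := by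
  intro α hα β hβ h
  by_contra hne
  have hinj : Function.Injective (c.act w) := (w : (Fin n → ℝ) ≃ₗ[ℝ] (Fin n → ℝ)).injective
  have key : β = α ∨ β = -α := by
    rcases c.perm_eq_or w α with h1 | h1 <;> rcases c.perm_eq_or w β with h2 | h2 <;>
      rw [h1, h2] at h
    · exact Or.inl (hinj h.symm)
    · right; apply hinj; rw [act_neg, h, neg_neg]
    · right; apply hinj; rw [act_neg, h]
    · exact Or.inl (hinj (neg_inj.1 h).symm)
  rcases key with h' | h'
  · exact hne h'.symm
  · exact c.noncollinear α hα β hβ hne (-1) (by rw [h', neg_one_smul])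

theorem prod_perm {M : Type*} [CommMonoid M] (w : c.W) (g : (Fin n → ℝ) → M) :
    ∏ α ∈ c.R, g (c.perm w α) = ∏ α ∈ c.R, g α := by
  classical
  have himg : c.R.image (c.perm w) = c.R := by
    refine Finset.eq_of_subset_of_card_le (Finset.image_subset_iff.2 fun α hα => c.perm_mem w hα) ?_
    rw [Finset.card_image_of_injOn (c.perm_injOn w)]
  conv_rhs => rw [← himg]
  rw [Finset.prod_image (c.perm_injOn w)]

open Classical in
/-- The number of positive roots `α` for which `u⁻¹ α` is negative. -/
def len (u : c.W) : ℕ := (c.R.filter fun α => c.act u⁻¹ α ∉ c.R).card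

/-- The sign character. -/
def chi (u : c.W) : ℤ := (-1) ^ c.len u

theorem chi_mul_self (u : c.W) : c.chi u * c.chi u = 1 := by
  rw [chi, ← pow_add, ← two_mul, pow_mul]; simp

variable (K : Type*) [Field K] [Algebra ℝ K]

/-- The action of a group element on polynomials, `f ↦ f ∘ w`. -/
def sb (w : c.W) : MvPolynomial (Fin n) K →ₐ[K] MvPolynomial (Fin n) K :=
  subst K (w : (Fin n → ℝ) ≃ₗ[ℝ] (Fin n → ℝ))

theorem sb_one (f : MvPolynomial (Fin n) K) : c.sb K 1 f = f := by
  have := DFunLike.congr_fun (subst_one (n := n) K) f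
  exact this

theorem sb_mul (u w : c.W) (f : MvPolynomial (Fin n) K) :
    c.sb K (u * w) f = c.sb K w (c.sb K u f) := subst_mul K _ _ f

theorem sb_s (α : Fin n → ℝ) (hα : α ∈ c.R) : c.sb K (c.s α hα) = shear K 1 α :=
  subst_reflection K fun _ => rfl

theorem sb_lin (w : c.W) (a : Fin n → ℝ) : c.sb K w (lin K a) = lin K (c.act w⁻¹ a) :=
  subst_lin_of_adjoint K fun x => c.dotR_act_right w a x

theorem sb_isHomogeneous (w : c.W) {f : MvPolynomial (Fin n) K}
    {d : ℕ} (hf : f.IsHomogeneous d) : (c.sb K w f).IsHomogeneous d :=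
  subst_isHomogeneous K _ hf

theorem eval_sb (w : c.W) (f : MvPolynomial (Fin n) ℝ) (x : Fin n → ℝ) :
    eval x (c.sb ℝ w f) = eval (c.act w x) f := eval_subst _ f x

/-- The product of the positive roots. -/
def delta : MvPolynomial (Fin n) K := ∏ α ∈ c.R, lin K α

theorem delta_ne_zero : c.delta K ≠ 0 :=
  Finset.prod_ne_zero_iff.2 fun α hα => lin_ne_zero K (c.norm2 α hα)

theorem delta_isHomogeneous : (c.delta K).IsHomogeneous c.R.card := by
  simpa [delta] using MvPolynomial.IsHomogeneous.prod c.R (fun α => lin K α) (fun _ => 1)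
    fun α _ => lin_isHomogeneous K α

theorem sb_delta (w : c.W) : c.sb K w (c.delta K) = (c.chi w : MvPolynomial (Fin n) K) * c.delta K := by
  classical
  have h : ∀ α ∈ c.R, c.sb K w (lin K α) =
      (if c.act w⁻¹ α ∉ c.R then (-1 : MvPolynomial (Fin n) K) else 1) * lin K (c.perm w⁻¹ α) := by
    intro α _
    rw [sb_lin, perm]
    by_cases h : c.act w⁻¹ α ∈ c.R
    · simp [h]
    · simp [h, lin_neg]
  rw [delta, map_prod, Finset.prod_congr rfl h, Finset.prod_mul_distrib, c.prod_perm,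
    Finset.prod_ite]
  simp only [Finset.prod_const, one_pow, mul_one, chi, len, Int.cast_pow, Int.cast_neg,
    Int.cast_one]

theorem chi_mul (u w : c.W) : c.chi (u * w) = c.chi u * c.chi w := by
  have h := c.sb_mul ℝ u w (c.delta ℝ)
  rw [sb_delta, sb_delta, map_mul, sb_delta, map_intCast, ← mul_assoc] at h
  have := mul_right_cancel₀ (c.delta_ne_zero ℝ) h
  exact_mod_cast this

theorem chi_one : c.chi 1 = 1 := by
  have h := c.chi_mul 1 1
  rw [mul_one, c.chi_mul_self] at h
  exact h

theorem chi_inv (u : c.W) : c.chi u⁻¹ = c.chi u := by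
  have h := c.chi_mul u⁻¹ u
  rw [inv_mul_cancel, chi_one] at h
  calc c.chi u⁻¹ = c.chi u⁻¹ * (c.chi u * c.chi u) := by rw [c.chi_mul_self, mul_one]
    _ = c.chi u := by rw [← mul_assoc, ← h, one_mul]

theorem chi_eq_or (u : c.W) : c.chi u = 1 ∨ c.chi u = -1 := neg_one_pow_eq_or ℤ _

theorem lin_dvd_delta {α : Fin n → ℝ} (hα : α ∈ c.R) : lin K α ∣ c.delta K :=
  Finset.dvd_prod_of_mem _ hα

theorem lin_sq_not_dvd_delta {α : Fin n → ℝ} (hα : α ∈ c.R) : ¬ lin K α ^ 2 ∣ c.delta K := by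
  classical
  intro h
  rw [delta, ← Finset.mul_prod_erase _ _ hα, sq] at h
  have h2 := (mul_dvd_mul_iff_left (lin_ne_zero K (c.norm2 α hα))).1 h
  rw [(lin_prime K (c.norm2 α hα)).dvd_finsetProd_iff] at h2
  obtain ⟨β, hβ, hd⟩ := h2
  exact lin_not_dvd K (c.norm2 α hα) (c.noncollinear α hα β (Finset.mem_of_mem_erase hβ)
    (Finset.ne_of_mem_erase hβ).symm) hd

theorem chi_s (α : Fin n → ℝ) (hα : α ∈ c.R) : c.chi (c.s α hα) = -1 := by
  refine (c.chi_eq_or _).resolve_left fun h => ?_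
  obtain ⟨g, hg⟩ := c.lin_dvd_delta ℝ hα
  have h1 := c.sb_delta ℝ (c.s α hα)
  rw [h, Int.cast_one, one_mul, sb_s, hg, map_mul, shear_one_lin_self ℝ (c.norm2 α hα)] at h1
  have h2 : shear ℝ 1 α g = -g := by
    refine mul_left_cancel₀ (lin_ne_zero ℝ (c.norm2 α hα)) ?_
    linear_combination -h1
  obtain ⟨r, hr⟩ := lin_dvd_of_anti ℝ h2
  exact c.lin_sq_not_dvd_delta ℝ hα ⟨r, by rw [hg, hr]; ring⟩

theorem delta_dvd {f : MvPolynomial (Fin n) K} (h : ∀ α ∈ c.R, lin K α ∣ f) : c.delta K ∣ f := by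
  have := prod_lin_pow_dvd K (A := c.R) c.norm2 c.noncollinear 1 (f := f) (by simpa using h)
  simpa [delta] using this

theorem delta_dvd_of_anti [CharZero K] {f : MvPolynomial (Fin n) K}
    (h : ∀ α ∈ c.R, shear K 1 α f = -f) : c.delta K ∣ f :=
  c.delta_dvd K fun α hα => lin_dvd_of_anti K (h α hα)

theorem delta_pow_dvd {f : MvPolynomial (Fin n) K} (k : ℕ) (h : ∀ α ∈ c.R, lin K α ^ k ∣ f) :
    c.delta K ^ k ∣ f := by
  have := prod_lin_pow_dvd K (A := c.R) c.norm2 c.noncollinear k (f := f) h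
  rwa [Finset.prod_pow] at this

theorem eval_delta_real (x : Fin n → ℝ) :
    eval x (c.delta ℝ) = ∏ α ∈ c.R, dotR α x := by
  simp [delta, map_prod, eval_lin_real]

theorem eval_delta_complex (z : Fin n → ℂ) :
    eval z (c.delta ℂ) = ∏ α ∈ c.R, dotC α z := by
  simp [delta, map_prod, eval_lin_complex]

theorem aeval_delta_complex (z : Fin n → ℂ) :
    aeval z (c.delta ℝ) = ∏ α ∈ c.R, dotC α z := by
  simp only [delta, map_prod, aeval_lin_complex]

end CoxeterData

section Derivations

theorem homogeneousComponent_mul_of_isHomogeneous {σ K : Type*} [CommSemiring K]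
    {f : MvPolynomial σ K} {a : ℕ} (hf : f.IsHomogeneous a) (g : MvPolynomial σ K) (k : ℕ) :
    homogeneousComponent (a + k) (f * g) =
      f * homogeneousComponent k g := by
  conv_lhs => rw [← MvPolynomial.sum_homogeneousComponent g, mul_sum, map_sum]
  have h : ∀ i, homogeneousComponent (a + k)
      (f * homogeneousComponent i g) =
      if i = k then f * homogeneousComponent k g else 0 := by
    intro i
    rw [MvPolynomial.homogeneousComponent_of_mem
      (hf.mul (MvPolynomial.homogeneousComponent_isHomogeneous i g))]
    by_cases hik : i = k
    · simp [hik]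
    · rw [if_neg (by omega), if_neg hik]
  simp only [h, Finset.sum_ite_eq', Finset.mem_range]
  split_ifs with hk
  · rfl
  · rw [MvPolynomial.homogeneousComponent_eq_zero _ _ (by omega), mul_zero]

theorem homogeneousComponent_mul_eq_zero {σ K : Type*} [CommSemiring K]
    {f : MvPolynomial σ K} {a : ℕ} (hf : f.IsHomogeneous a) (g : MvPolynomial σ K) {d : ℕ}
    (hd : d < a) : homogeneousComponent d (f * g) = 0 := by
  conv_lhs => rw [← MvPolynomial.sum_homogeneousComponent g, mul_sum, map_sum]
  refine Finset.sum_eq_zero fun i _ => ?_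
  rw [MvPolynomial.homogeneousComponent_of_mem
      (hf.mul (MvPolynomial.homogeneousComponent_isHomogeneous i g)), if_neg (by omega)]

theorem isHomogeneous_of_mul_left {σ K : Type*} [CommRing K] [IsDomain K]
    {f g : MvPolynomial σ K} {a k : ℕ} (hf : f.IsHomogeneous a) (h0 : f ≠ 0)
    (h : (f * g).IsHomogeneous (a + k)) : g.IsHomogeneous k := by
  have h1 := homogeneousComponent_mul_of_isHomogeneous hf g k
  rw [MvPolynomial.homogeneousComponent_eq_self h] at h1
  rw [mul_left_cancel₀ h0 h1]
  exact MvPolynomial.homogeneousComponent_isHomogeneous k g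

theorem eq_zero_of_mul_isHomogeneous {σ K : Type*} [CommRing K] [IsDomain K]
    {f g : MvPolynomial σ K} {a d : ℕ} (hf : f.IsHomogeneous a) (h0 : f ≠ 0)
    (h : (f * g).IsHomogeneous d) (hd : d < a) : g = 0 := by
  have h1 := homogeneousComponent_mul_eq_zero hf g hd
  rw [MvPolynomial.homogeneousComponent_eq_self h] at h1
  exact (mul_eq_zero.1 h1).resolve_left h0

/-- The polarised square of the gradient. -/
def grad2 {n : ℕ} (K : Type*) [Field K] (f g : MvPolynomial (Fin n) K) : MvPolynomial (Fin n) K :=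
  ∑ i, pderiv i f * pderiv i g

/-- The Laplacian. -/
def lapl {n : ℕ} (K : Type*) [Field K] (f : MvPolynomial (Fin n) K) : MvPolynomial (Fin n) K :=
  ∑ i, pderiv i (pderiv i f)

theorem lapl_isHomogeneous {n : ℕ} (K : Type*) [Field K] {f : MvPolynomial (Fin n) K} {d : ℕ}
    (hf : f.IsHomogeneous d) : (lapl K f).IsHomogeneous (d - 2) :=
  MvPolynomial.IsHomogeneous.sum _ _ _ fun _ _ => hf.pderiv.pderiv

theorem grad2_isHomogeneous {n : ℕ} (K : Type*) [Field K] {f g : MvPolynomial (Fin n) K}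
    {d e : ℕ} (hf : f.IsHomogeneous d) (hg : g.IsHomogeneous e) :
    (grad2 K f g).IsHomogeneous (d - 1 + (e - 1)) :=
  MvPolynomial.IsHomogeneous.sum _ _ _ fun _ _ => hf.pderiv.mul hg.pderiv

theorem euler_identity {n : ℕ} {K : Type*} [Field K] {f : MvPolynomial (Fin n) K} {d : ℕ}
    (hf : f.IsHomogeneous d) :
    ∑ i, X i * pderiv i f = (d : MvPolynomial (Fin n) K) * f := by
  have := hf.sum_X_mul_pderiv
  rwa [nsmul_eq_mul] at this

variable {n : ℕ} (K : Type*) [Field K] [Algebra ℝ K]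

/-- The directional derivative along `a` on polynomials. -/
def dd (a : Fin n → ℝ) : Derivation K (MvPolynomial (Fin n) K) (MvPolynomial (Fin n) K) :=
  MvPolynomial.mkDerivation K fun i => MvPolynomial.C (algebraMap ℝ K (a i))

theorem dd_X (a : Fin n → ℝ) (i : Fin n) :
    dd K a (X i) = MvPolynomial.C (algebraMap ℝ K (a i)) := MvPolynomial.mkDerivation_X _ _ _

theorem dd_C (a : Fin n → ℝ) (t : K) : dd K a (MvPolynomial.C t) = 0 :=
  MvPolynomial.derivation_C _ _

theorem dd_mul (a : Fin n → ℝ) (f g : MvPolynomial (Fin n) K) :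
    dd K a (f * g) = f * dd K a g + g * dd K a f := by
  rw [Derivation.leibniz, smul_eq_mul, smul_eq_mul]

theorem dd_eq_sum (a : Fin n → ℝ) (f : MvPolynomial (Fin n) K) :
    dd K a f = ∑ i, MvPolynomial.C (algebraMap ℝ K (a i)) * pderiv i f := by
  classical
  induction f using MvPolynomial.induction_on with
  | C t => simp
  | add f g hf hg => simp only [map_add, hf, hg, mul_add, sum_add_distrib]
  | mul_X f i hf =>
    rw [dd_mul, hf, dd_X]
    simp only [Derivation.leibniz, smul_eq_mul, MvPolynomial.pderiv_X, Pi.single_apply, mul_add,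
      sum_add_distrib, mul_ite, mul_one, mul_zero, Finset.sum_ite_eq, Finset.mem_univ,
      if_true, mul_sum]
    rw [mul_comm f]
    congr 1
    exact sum_congr rfl fun j _ => by ring

theorem pderiv_eq_dd (i : Fin n) (f : MvPolynomial (Fin n) K) :
    pderiv i f = dd K (Pi.single i 1) f := by
  classical
  rw [dd_eq_sum, Finset.sum_eq_single i]
  · simp
  · intro j _ hj
    simp [hj]
  · simp

theorem dd_lin (a b : Fin n → ℝ) :
    dd K a (lin K b) = MvPolynomial.C (algebraMap ℝ K (dotR b a)) := by
  rw [dd_eq_sum]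
  simp only [pderiv_lin, ← map_mul, ← map_sum, dotR]
  simp only [mul_comm]

theorem dd_isHomogeneous (a : Fin n → ℝ) {f : MvPolynomial (Fin n) K} {d : ℕ}
    (hf : f.IsHomogeneous d) : (dd K a f).IsHomogeneous (d - 1) := by
  rw [dd_eq_sum]
  exact MvPolynomial.IsHomogeneous.sum _ _ _ fun i _ => hf.pderiv.C_mul _

theorem dd_subst (e : (Fin n → ℝ) ≃ₗ[ℝ] (Fin n → ℝ)) (a : Fin n → ℝ)
    (f : MvPolynomial (Fin n) K) : dd K a (subst K e f) = subst K e (dd K (e a) f) := by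
  induction f using MvPolynomial.induction_on with
  | C t => simp [MvPolynomial.algHom_C]
  | add f g hf hg => simp only [map_add, hf, hg]
  | mul_X f i hf =>
    rw [map_mul, dd_mul, dd_mul, hf, map_add, map_mul, map_mul, subst_X, dd_lin, dd_X,
      dotR_rowVec, MvPolynomial.algHom_C, MvPolynomial.algebraMap_eq]

theorem dd_neg_vec (a : Fin n → ℝ) (f : MvPolynomial (Fin n) K) :
    dd K (-a) f = -dd K a f := by
  simp [dd_eq_sum]

end Derivations

namespace CoxeterData

variable {n : ℕ} (c : CoxeterData n) (K : Type*) [Field K] [Algebra ℝ K]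

theorem dd_sb (w : c.W) (a : Fin n → ℝ) (f : MvPolynomial (Fin n) K) :
    dd K a (c.sb K w f) = c.sb K w (dd K (c.act w a) f) := dd_subst K _ a f

theorem sum_rowVec_mul (w : c.W) (j k : Fin n) :
    ∑ i, c.act w (Pi.single i 1) j * c.act w (Pi.single i 1) k = if j = k then 1 else 0 := by
  classical
  have h : ∀ j, rowVec (w : (Fin n → ℝ) ≃ₗ[ℝ] (Fin n → ℝ)) j = c.act w⁻¹ (Pi.single j 1) := by
    intro j
    funext i
    have h1 := c.dotR_act_right w (Pi.single j 1) (Pi.single i 1)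
    simp only [dotR, Pi.single_apply, ite_mul, one_mul, zero_mul, mul_ite, mul_one, mul_zero,
      Finset.sum_ite_eq', Finset.mem_univ, if_true] at h1
    exact h1
  have h2 : dotR (rowVec (w : (Fin n → ℝ) ≃ₗ[ℝ] (Fin n → ℝ)) j)
      (rowVec (w : (Fin n → ℝ) ≃ₗ[ℝ] (Fin n → ℝ)) k) = if j = k then 1 else 0 := by
    rw [h, h, c.dotR_act]
    simp [dotR, Pi.single_apply, eq_comm]
  exact h2

theorem grad2_sb (w : c.W) (f g : MvPolynomial (Fin n) K) :
    grad2 K (c.sb K w f) (c.sb K w g) = c.sb K w (grad2 K f g) := by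
  classical
  have h0 : grad2 K (c.sb K w f) (c.sb K w g) = c.sb K w
      (∑ i, dd K (c.act w (Pi.single i 1)) f * dd K (c.act w (Pi.single i 1)) g) := by
    simp only [grad2, pderiv_eq_dd, dd_sb, map_sum, map_mul]
  rw [h0, grad2]
  refine congrArg _ ?_
  simp only [dd_eq_sum K (c.act w _), Finset.sum_mul_sum]
  rw [Finset.sum_comm]
  refine sum_congr rfl fun j _ => ?_
  rw [Finset.sum_comm]
  have : ∀ k, ∑ i, MvPolynomial.C (algebraMap ℝ K (c.act w (Pi.single i 1) j)) * pderiv j f *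
      (MvPolynomial.C (algebraMap ℝ K (c.act w (Pi.single i 1) k)) * pderiv k g) =
      if j = k then pderiv j f * pderiv k g else 0 := by
    intro k
    have h := c.sum_rowVec_mul w j k
    calc _ = MvPolynomial.C (algebraMap ℝ K
        (∑ i, c.act w (Pi.single i 1) j * c.act w (Pi.single i 1) k)) *
          (pderiv j f * pderiv k g) := by
          simp only [map_sum, map_mul, Finset.sum_mul]
          exact sum_congr rfl fun i _ => by ring
      _ = _ := by
          rw [h]
          split_ifs <;> simp
  rw [sum_congr rfl fun k _ => this k]
  simp only [Finset.sum_ite_eq, Finset.mem_univ, if_true]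

theorem lapl_sb (w : c.W) (f : MvPolynomial (Fin n) K) :
    lapl K (c.sb K w f) = c.sb K w (lapl K f) := by
  classical
  have h0 : lapl K (c.sb K w f) = c.sb K w
      (∑ i, dd K (c.act w (Pi.single i 1)) (dd K (c.act w (Pi.single i 1)) f)) := by
    simp only [lapl, pderiv_eq_dd, dd_sb, map_sum]
  rw [h0, lapl]
  refine congrArg _ ?_
  have h1 : ∀ i, dd K (c.act w (Pi.single i 1)) (dd K (c.act w (Pi.single i 1)) f) =
      ∑ j, ∑ k, MvPolynomial.C (algebraMap ℝ K (c.act w (Pi.single i 1) j *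
        c.act w (Pi.single i 1) k)) * pderiv j (pderiv k f) := by
    intro i
    rw [dd_eq_sum K _ (dd K _ f), dd_eq_sum K _ f]
    simp only [map_sum, Derivation.leibniz, MvPolynomial.pderiv_C, smul_eq_mul, mul_zero, add_zero,
      mul_sum, map_mul, mul_assoc]
  simp only [h1]
  rw [Finset.sum_comm]
  refine sum_congr rfl fun j _ => ?_
  rw [Finset.sum_comm]
  simp only [← Finset.sum_mul, ← map_sum, sum_rowVec_mul]
  rw [Finset.sum_eq_single j]
  · simp [pderiv_eq_dd]
  · intro k _ hk
    simp [hk.symm]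
  · simp

/-- Invariant polynomials. -/
def Inv (f : MvPolynomial (Fin n) K) : Prop := ∀ w : c.W, c.sb K w f = f

variable {K}

theorem inv_delta_sq : c.Inv K (c.delta K ^ 2) := fun w => by
  rw [map_pow, sb_delta, mul_pow]
  rcases c.chi_eq_or w with h | h <;> simp [h]

variable [CharZero K]

theorem delta_dvd_of_alternating {f : MvPolynomial (Fin n) K}
    (h : ∀ w, c.sb K w f = (c.chi w : MvPolynomial (Fin n) K) * f) : c.delta K ∣ f :=
  c.delta_dvd_of_anti K fun α hα => by
    rw [← c.sb_s K α hα, h, chi_s]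
    simp

theorem lapl_delta : lapl K (c.delta K) = 0 := by
  have h : c.delta K ∣ lapl K (c.delta K) := c.delta_dvd_of_alternating fun w => by
    rw [← lapl_sb, sb_delta]
    rcases c.chi_eq_or w with h | h <;> simp [h, lapl]
  obtain ⟨g, hg⟩ := h
  have hh := lapl_isHomogeneous K (c.delta_isHomogeneous K)
  rw [hg] at hh
  rcases Nat.eq_zero_or_pos c.R.card with h0 | h0
  · have : c.delta K = 1 := by rw [delta, Finset.card_eq_zero.1 h0, Finset.prod_empty]
    rw [this]
    simp [lapl]
  · rw [hg, eq_zero_of_mul_isHomogeneous (c.delta_isHomogeneous K) (c.delta_ne_zero K) hh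
      (by omega), mul_zero]

theorem exists_grad2_delta {q : MvPolynomial (Fin n) K} (hq : c.Inv K q) {d : ℕ}
    (hd : q.IsHomogeneous (d + 2)) :
    ∃ r, grad2 K (c.delta K) q = c.delta K * r ∧ c.Inv K r ∧ r.IsHomogeneous d := by
  have h0 : ∀ w, c.sb K w (grad2 K (c.delta K) q) =
      (c.chi w : MvPolynomial (Fin n) K) * grad2 K (c.delta K) q := by
    intro w
    rw [← grad2_sb, sb_delta, hq w]
    rcases c.chi_eq_or w with h | h <;> simp [h, grad2]
  obtain ⟨r, hr⟩ := c.delta_dvd_of_alternating h0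
  refine ⟨r, hr, fun w => ?_, ?_⟩
  · have h1 := h0 w
    rw [hr, map_mul, sb_delta] at h1
    have h2 : (c.chi w : MvPolynomial (Fin n) K) * c.chi w = 1 := by
      exact_mod_cast congrArg (Int.cast : ℤ → MvPolynomial (Fin n) K) (c.chi_mul_self w)
    refine mul_left_cancel₀ (c.delta_ne_zero K) ?_
    linear_combination (c.chi w : MvPolynomial (Fin n) K) * h1 +
      (c.delta K * r - c.delta K * c.sb K w r) * h2
  · have h1 := grad2_isHomogeneous K (c.delta_isHomogeneous K) hd
    rw [hr] at h1
    rcases Nat.eq_zero_or_pos c.R.card with hN | hN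
    · have : c.delta K = 1 := by rw [delta, Finset.card_eq_zero.1 hN, Finset.prod_empty]
      rw [this, one_mul] at hr
      have : r = 0 := by rw [← hr]; simp [grad2]
      rw [this]
      exact MvPolynomial.isHomogeneous_zero _ _ _
    · refine isHomogeneous_of_mul_left (c.delta_isHomogeneous K) (c.delta_ne_zero K) ?_
      have e : c.R.card - 1 + (d + 2 - 1) = c.R.card + d := by omega
      rwa [e] at h1

end CoxeterData

namespace CoxeterData

variable {n : ℕ} (c : CoxeterData n)

/-- The vector `β` is a nonnegative combination of the vectors in `A`. -/
def InCone (A : Finset (Fin n → ℝ)) (β : Fin n → ℝ) : Prop :=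
  ∃ t : (Fin n → ℝ) → ℝ, (∀ γ, 0 ≤ t γ) ∧ β = ∑ γ ∈ A, t γ • γ

theorem inCone_of_mem {A : Finset (Fin n → ℝ)} {β : Fin n → ℝ} (h : β ∈ A) : InCone A β := by
  classical
  refine ⟨fun γ => if γ = β then 1 else 0, fun γ => by dsimp only; split_ifs <;> norm_num, ?_⟩
  simp [ite_smul, h]

/-- A simple root: the reflection in it preserves all other positive roots. -/
def IsSimple (α : Fin n → ℝ) : Prop :=
  ∃ hα : α ∈ c.R, ∀ β ∈ c.R, β ≠ α → c.act (c.s α hα) β ∈ c.R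

open Classical in
theorem exists_simple_system :
    ∃ A : Finset (Fin n → ℝ), (∀ α ∈ A, c.IsSimple α) ∧ ∀ β ∈ c.R, InCone A β := by
  obtain ⟨v, hv⟩ := c.pos
  obtain ⟨A, hA, hmin⟩ := Finset.exists_min_image
    (c.R.powerset.filter fun A => ∀ β ∈ c.R, InCone A β) Finset.card
    ⟨c.R, by simpa using fun β hβ => inCone_of_mem hβ⟩
  simp only [Finset.mem_filter, Finset.mem_powerset] at hA hmin
  obtain ⟨hAR, hA⟩ := hA
  refine ⟨A, fun α hα => ⟨hAR hα, fun β hβ hne => ?_⟩, hA⟩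
  by_contra hnot
  have hneg := (c.act_mem_or (c.s α (hAR hα)) hβ).resolve_left hnot
  obtain ⟨p, hp, hpβ⟩ := hA β hβ
  obtain ⟨q, hq, hqβ⟩ := hA _ hneg
  rw [act_s] at hqβ
  have hsplit : ∀ t : (Fin n → ℝ) → ℝ, ∑ γ ∈ A, t γ • γ =
      t α • α + ∑ γ ∈ A.erase α, t γ • γ := fun t => (Finset.add_sum_erase _ _ hα).symm
  set r := dotR α β - p α - q α with hr
  have hsum : r • α = ∑ γ ∈ A.erase α, (p γ + q γ) • γ := by
    simp only [add_smul, sum_add_distrib]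
    have e1 := hsplit p
    have e2 := hsplit q
    rw [← hpβ] at e1
    rw [← hqβ] at e2
    have : ∑ γ ∈ A.erase α, p γ • γ = β - p α • α := by rw [e1]; abel
    rw [this]
    have : ∑ γ ∈ A.erase α, q γ • γ = -(β - dotR α β • α) - q α • α := by rw [e2]; abel
    rw [this, hr]
    module
  rcases lt_or_ge 0 r with h0 | h0
  · have hα' : ∃ t : (Fin n → ℝ) → ℝ, (∀ γ, 0 ≤ t γ) ∧ α = ∑ γ ∈ A.erase α, t γ • γ := by
      refine ⟨fun γ => r⁻¹ * (p γ + q γ), fun γ =>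
        mul_nonneg (inv_nonneg.2 h0.le) (add_nonneg (hp γ) (hq γ)), ?_⟩
      simp only [mul_smul]
      rw [← Finset.smul_sum, ← hsum, smul_smul, inv_mul_cancel₀ h0.ne', one_smul]
    obtain ⟨t, ht, htα⟩ := hα'
    have := hmin (A.erase α) ⟨(Finset.erase_subset _ _).trans hAR, fun γ hγ => by
      obtain ⟨g, hg, hgγ⟩ := hA γ hγ
      refine ⟨fun x => g x + g α * t x, fun x => add_nonneg (hg x) (mul_nonneg (hg α) (ht x)), ?_⟩
      rw [hgγ, hsplit]
      simp only [add_smul, sum_add_distrib, mul_smul]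
      rw [← Finset.smul_sum, ← htα, add_comm]⟩
    have h2 := Finset.card_erase_lt_of_mem hα
    omega
  · have hdot : ∀ (s : Finset (Fin n → ℝ)) (t : (Fin n → ℝ) → ℝ),
        dotR (∑ γ ∈ s, t γ • γ) v = ∑ γ ∈ s, t γ * dotR γ v := by
      intro s t
      induction s using Finset.induction_on with
      | empty => simp [dotR]
      | insert a s ha ih =>
        rw [Finset.sum_insert ha, Finset.sum_insert ha, dotR_add_left, dotR_smul_left, ih]
    have h1 := congrArg (fun x => dotR x v) hsum
    simp only [hdot, dotR_smul_left] at h1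
    have hnn : ∀ γ ∈ A.erase α, 0 ≤ (p γ + q γ) * dotR γ v := fun γ hγ =>
      mul_nonneg (add_nonneg (hp γ) (hq γ)) (hv γ (hAR (Finset.mem_of_mem_erase hγ))).le
    have h2 : ∑ γ ∈ A.erase α, (p γ + q γ) * dotR γ v = 0 :=
      le_antisymm (h1 ▸ mul_nonpos_of_nonpos_of_nonneg h0 (hv α (hAR hα)).le)
        (Finset.sum_nonneg hnn)
    have h3 := (Finset.sum_eq_zero_iff_of_nonneg hnn).1 h2
    have h4 : ∀ γ ∈ A.erase α, p γ = 0 := fun γ hγ => by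
      have h5 := hv γ (hAR (Finset.mem_of_mem_erase hγ))
      have h6 := (mul_eq_zero.1 (h3 γ hγ)).resolve_right h5.ne'
      linarith [hp γ, hq γ]
    refine c.noncollinear α (hAR hα) β hβ hne.symm (p α) ?_
    rw [hpβ, hsplit, Finset.sum_eq_zero fun γ hγ => by rw [h4 γ hγ, zero_smul], add_zero]

theorem s_conj (w : c.W) {α β : Fin n → ℝ} (hα : α ∈ c.R) (hβ : β ∈ c.R)
    (h : β = c.act w α ∨ β = -c.act w α) : c.s β hβ = w * c.s α hα * w⁻¹ := by
  refine Subtype.ext (LinearEquiv.ext fun x => ?_)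
  change c.act _ x = c.act _ x
  rw [act_mul, act_mul, act_s, act_s, sub_eq_add_neg (c.act w⁻¹ x), ← neg_smul, act_add, act_smul,
    act_act_inv, dotR_act_right, inv_inv]
  rcases h with rfl | rfl
  · module
  · rw [dotR_neg_left]
    module

/-- The reflections in the simple roots generate the group. -/
theorem induction_simple {p : c.W → Prop} (h1 : p 1)
    (hs : ∀ α (h : c.IsSimple α) w, p w → p (c.s α h.1 * w)) (w : c.W) : p w := by
  classical
  obtain ⟨A, hA, hcone⟩ := c.exists_simple_system
  obtain ⟨v, hv⟩ := c.pos
  set H : Subgroup c.W := Subgroup.closure {w | ∃ α, ∃ h : c.IsSimple α, w = c.s α h.1}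
  have hsH : ∀ α (h : c.IsSimple α), c.s α h.1 ∈ H := fun α h =>
    Subgroup.subset_closure ⟨α, h, rfl⟩
  have hβ : ∀ β (hβ : β ∈ c.R), c.s β hβ ∈ H := by
    intro β hβ
    obtain ⟨u, hu, hmin⟩ := Set.exists_min_image
      {u : c.W | u ∈ H ∧ c.act u β ∈ c.R} (fun u => dotR (c.act u β) v) (Set.toFinite _)
      ⟨1, H.one_mem, by simpa [act_one] using hβ⟩
    obtain ⟨t, ht, htβ⟩ := hcone _ hu.2
    have hpos : ∃ α ∈ A, 0 < dotR α (c.act u β) := by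
      by_contra hcon
      push Not at hcon
      have h2 := c.norm2 _ hu.2
      have h3 : dotR (∑ γ ∈ A, t γ • γ) (c.act u β) ≤ 0 := by
        have : ∀ s ⊆ A, dotR (∑ γ ∈ s, t γ • γ) (c.act u β) ≤ 0 := by
          intro s hs
          induction s using Finset.induction_on with
          | empty => simp [dotR]
          | insert a s ha ih =>
            rw [Finset.sum_insert ha, dotR_add_left, dotR_smul_left]
            have h5 := ih fun x hx => hs (Finset.mem_insert_of_mem hx)
            have h6 := mul_nonpos_of_nonneg_of_nonpos (ht a) (hcon a (hs (Finset.mem_insert_self _ _)))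
            linarith
        exact this A subset_rfl
      rw [← htβ] at h3
      linarith
    obtain ⟨α, hα, hpos⟩ := hpos
    by_cases heq : c.act u β = α
    · have : c.s β hβ = u⁻¹ * c.s α (hA α hα).1 * u⁻¹⁻¹ :=
        c.s_conj u⁻¹ _ _ (Or.inl (by rw [← heq, act_inv_act]))
      rw [this]
      exact H.mul_mem (H.mul_mem (H.inv_mem hu.1) (hsH α (hA α hα))) (by simpa using hu.1)
    · exfalso
      have h3 := (hA α hα).2 _ hu.2 heq
      have h4 := hmin (c.s α (hA α hα).1 * u) ⟨H.mul_mem (hsH α (hA α hα)) hu.1, by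
        rw [act_mul]; exact h3⟩
      simp only [act_mul, act_s, dotR_sub_left, dotR_smul_left] at h4
      nlinarith [hv α (hA α hα).1]
  have hw : w ∈ H := by
    induction w using c.induction_s with
    | h1 => exact H.one_mem
    | hs α hα w ih => exact H.mul_mem (hβ α hα) ih
  induction hw using Subgroup.closure_induction_left with
  | one => exact h1
  | mul_left x hx y hy ih =>
    obtain ⟨α, hα, rfl⟩ := hx
    exact hs α hα y ih
  | inv_mul_cancel x hx y hy ih =>
    obtain ⟨α, hα, rfl⟩ := hx
    rw [s_inv]
    exact hs α hα y ih

theorem len_mul_s_le {α : Fin n → ℝ} (h : c.IsSimple α) (u : c.W) :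
    c.len (u * c.s α h.1) ≤ c.len u + 1 := by
  classical
  unfold len
  refine (Finset.card_le_card (t := insert (c.act u α)
    (c.R.filter fun β => c.act u⁻¹ β ∉ c.R)) fun β hβ => ?_).trans (Finset.card_insert_le _ _)
  simp only [Finset.mem_filter, Finset.mem_insert] at hβ ⊢
  by_contra hcon
  push Not at hcon
  have h1 := hcon.2 hβ.1
  refine hβ.2 ?_
  rw [mul_inv_rev, s_inv, act_mul]
  exact h.2 _ h1 fun h2 => hcon.1 (by rw [← h2, act_act_inv])

theorem len_one : c.len 1 = 0 := by
  classical
  unfold len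
  rw [Finset.card_eq_zero, Finset.filter_eq_empty_iff]
  intro α hα
  simpa [act_one] using hα

theorem len_eq_card {v : Fin n → ℝ} (hv : ∀ α ∈ c.R, 0 < dotR α v) (u : c.W) :
    c.len u + (c.R.filter fun α => 0 < dotR α (c.act u v)).card = c.R.card := by
  classical
  rw [len, ← Finset.card_filter_add_card_filter_not (s := c.R) fun α => c.act u⁻¹ α ∉ c.R]
  congr 2
  ext α
  simp only [Finset.mem_filter, not_not]
  refine and_congr_right fun hα => ?_
  rw [c.act_mem_iff_pos hv _ hα, dotR_act_right]

/-- Polynomials homogeneous of degree `N - k`, with `N` the number of positive roots. -/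
def codeg (k : ℕ) : Submodule ℝ (MvPolynomial (Fin n) ℝ) :=
  if k ≤ c.R.card then MvPolynomial.homogeneousSubmodule (Fin n) ℝ (c.R.card - k) else ⊥

theorem mem_codeg {k : ℕ} (hk : k ≤ c.R.card) {f : MvPolynomial (Fin n) ℝ} :
    f ∈ c.codeg k ↔ f.IsHomogeneous (c.R.card - k) := by
  rw [codeg, if_pos hk, MvPolynomial.mem_homogeneousSubmodule]

theorem codeg_of_lt {k : ℕ} (hk : c.R.card < k) : c.codeg k = ⊥ := by
  rw [codeg, if_neg (by omega)]

/-- Families of polynomials of degree `N - k` on the group, supported on elements of length at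
most `k`, which are compatible along reflections. -/
def Yk (k : ℕ) : Submodule ℝ (c.W → MvPolynomial (Fin n) ℝ) where
  carrier := {h | (∀ u, h u ∈ c.codeg k) ∧
    (∀ u, ∀ α, ∀ hα : α ∈ c.R, lin ℝ α ∣ h u + h (c.s α hα * u)) ∧ ∀ u, k < c.len u → h u = 0}
  add_mem' := by
    rintro h g ⟨h1, h2, h3⟩ ⟨g1, g2, g3⟩
    refine ⟨fun u => add_mem (h1 u) (g1 u), fun u α hα => ?_, fun u hu => ?_⟩
    · rw [Pi.add_apply, Pi.add_apply, add_add_add_comm]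
      exact dvd_add (h2 u α hα) (g2 u α hα)
    · rw [Pi.add_apply, h3 u hu, g3 u hu, add_zero]
  zero_mem' := ⟨fun u => zero_mem _, fun u α hα => by simp, fun u _ => rfl⟩
  smul_mem' := by
    rintro t h ⟨h1, h2, h3⟩
    refine ⟨fun u => Submodule.smul_mem _ _ (h1 u), fun u α hα => ?_, fun u hu => ?_⟩
    · rw [Pi.smul_apply, Pi.smul_apply, ← smul_add]
      exact (h2 u α hα).trans (dvd_smul_of_dvd t dvd_rfl)
    · rw [Pi.smul_apply, h3 u hu, smul_zero]

theorem Yk_injective {v : Fin n → ℝ} (hv : ∀ α ∈ c.R, 0 < dotR α v) {k : ℕ}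
    {h : c.W → MvPolynomial (Fin n) ℝ} (hh : h ∈ c.Yk k)
    (h0 : ∀ u, c.len u = k → eval v (h u) = 0) : h = 0 := by
  classical
  by_contra hne
  obtain ⟨u0, hu0⟩ := Function.ne_iff.1 hne
  obtain ⟨u, hu, hmin⟩ := Set.exists_min_image {u : c.W | h u ≠ 0}
    (fun u => dotR (c.act u v) v) (Set.toFinite _) ⟨u0, hu0⟩
  simp only [Set.mem_ofPred_eq] at hu hmin
  obtain ⟨h1, h2, h3⟩ := hh
  have hlen : c.len u ≤ k := by
    by_contra hcon
    exact hu (h3 u (by omega))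
  have hcard := c.len_eq_card hv u
  set A := c.R.filter fun α => 0 < dotR α (c.act u v) with hA
  have hkN : k ≤ c.R.card := by
    by_contra hcon
    have := h1 u
    rw [c.codeg_of_lt (by omega), Submodule.mem_bot] at this
    exact hu this
  have hdeg := (c.mem_codeg hkN).1 (h1 u)
  have hdvd : (∏ α ∈ A, lin ℝ α ^ 1) ∣ h u := by
    refine prod_lin_pow_dvd ℝ (fun α hα => c.norm2 α (Finset.mem_filter.1 hα).1)
      (fun α hα β hβ => c.noncollinear α (Finset.mem_filter.1 hα).1 β (Finset.mem_filter.1 hβ).1) 1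
      fun α hα => ?_
    obtain ⟨hαR, hαp⟩ := Finset.mem_filter.1 hα
    have hz : h (c.s α hαR * u) = 0 := by
      by_contra hcon
      have h4 := hmin _ hcon
      rw [act_mul, act_s, dotR_sub_left, dotR_smul_left] at h4
      nlinarith [hv α hαR]
    simpa [hz] using h2 u α hαR
  simp only [pow_one] at hdvd
  obtain ⟨g, hg⟩ := hdvd
  have hAh : (∏ α ∈ A, lin ℝ α).IsHomogeneous A.card := by
    simpa using MvPolynomial.IsHomogeneous.prod A (fun α => lin ℝ α) (fun _ => 1)
      fun α _ => lin_isHomogeneous ℝ α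
  have hA0 : ∏ α ∈ A, lin ℝ α ≠ 0 :=
    Finset.prod_ne_zero_iff.2 fun α hα => lin_ne_zero ℝ (c.norm2 α (Finset.mem_filter.1 hα).1)
  rw [hg] at hdeg hu
  rcases hlen.lt_or_eq with hlt | heq
  · refine hu ?_
    rw [eq_zero_of_mul_isHomogeneous hAh hA0 hdeg (by omega), mul_zero]
  · have hg0 : g.IsHomogeneous 0 := isHomogeneous_of_mul_left hAh hA0 (by
      have : A.card + 0 = c.R.card - k := by omega
      rwa [this])
    rw [← MvPolynomial.totalDegree_zero_iff_isHomogeneous,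
      MvPolynomial.totalDegree_eq_zero_iff_eq_C] at hg0
    have h5 := h0 u heq
    rw [hg, map_mul, map_prod, hg0, MvPolynomial.eval_C, mul_eq_zero] at h5
    rcases h5 with h5 | h5
    · obtain ⟨α, hα, h6⟩ := Finset.prod_eq_zero_iff.1 h5
      rw [eval_lin_real] at h6
      exact (hv α (Finset.mem_filter.1 hα).1).ne' h6
    · rw [hg0, h5] at hu
      simp at hu

/-- The pairing between families and polynomials. -/
def pairB (h : c.W → MvPolynomial (Fin n) ℝ) (f : MvPolynomial (Fin n) ℝ) :
    MvPolynomial (Fin n) ℝ := ∑ u, h u * c.sb ℝ u⁻¹ f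

theorem sum_add_s_mul {M : Type*} [AddCommMonoid M] {α : Fin n → ℝ} (hα : α ∈ c.R)
    (g : c.W → M) : ∑ u, g (c.s α hα * u) = ∑ u, g u :=
  Equiv.sum_comp (Equiv.mulLeft (c.s α hα)) g

theorem sum_mul_s {M : Type*} [AddCommMonoid M] {α : Fin n → ℝ} (hα : α ∈ c.R)
    (g : c.W → M) : ∑ u, g (u * c.s α hα) = ∑ u, g u :=
  Equiv.sum_comp (Equiv.mulRight (c.s α hα)) g

theorem dvd_of_dvd_two_mul {f g : MvPolynomial (Fin n) ℝ} (h : f ∣ 2 * g) : f ∣ g := by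
  have h2 : g = MvPolynomial.C (2⁻¹ : ℝ) * (2 * g) := by
    have : (2 : MvPolynomial (Fin n) ℝ) = MvPolynomial.C 2 := (map_ofNat _ 2).symm
    rw [this, ← mul_assoc, ← map_mul]
    simp
  rw [h2]
  exact h.mul_left _

theorem pairB_eq_C_mul {k : ℕ} {h : c.W → MvPolynomial (Fin n) ℝ} (hh : h ∈ c.Yk k)
    {f : MvPolynomial (Fin n) ℝ} (hf : f.IsHomogeneous k) :
    ∃ t : ℝ, c.pairB h f = MvPolynomial.C t * c.delta ℝ := by
  obtain ⟨h1, h2, h3⟩ := hh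
  have hdvd : c.delta ℝ ∣ c.pairB h f := by
    refine c.delta_dvd ℝ fun α hα => dvd_of_dvd_two_mul ?_
    have e : 2 * c.pairB h f = ∑ u, (h u * (c.sb ℝ u⁻¹ f - shear ℝ 1 α (c.sb ℝ u⁻¹ f)) +
        (h u + h (c.s α hα * u)) * shear ℝ 1 α (c.sb ℝ u⁻¹ f)) := by
      rw [two_mul]
      conv_lhs => rw [pairB]; arg 2; rw [← c.sum_add_s_mul hα]
      rw [← sum_add_distrib]
      refine sum_congr rfl fun u _ => ?_
      rw [mul_inv_rev, s_inv, sb_mul, sb_s]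
      ring
    rw [e]
    exact Finset.dvd_sum fun u _ => dvd_add ((lin_dvd_sub_shear ℝ 1 α _).mul_left _)
      ((h2 u α hα).mul_right _)
  obtain ⟨g, hg⟩ := hdvd
  rcases le_or_gt k c.R.card with hk | hk
  · have hB : (c.pairB h f).IsHomogeneous (c.R.card + 0) := by
      refine MvPolynomial.IsHomogeneous.sum _ _ _ fun u _ => ?_
      have := ((c.mem_codeg hk).1 (h1 u)).mul (c.sb_isHomogeneous ℝ u⁻¹ hf)
      rwa [show c.R.card - k + k = c.R.card + 0 by omega] at this
    rw [hg] at hB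
    have hg0 := isHomogeneous_of_mul_left (c.delta_isHomogeneous ℝ) (c.delta_ne_zero ℝ) hB
    rw [← MvPolynomial.totalDegree_zero_iff_isHomogeneous,
      MvPolynomial.totalDegree_eq_zero_iff_eq_C] at hg0
    exact ⟨_, by rw [hg, mul_comm, ← hg0]⟩
  · refine ⟨0, ?_⟩
    have : ∀ u, h u = 0 := fun u => by
      have := h1 u
      rwa [c.codeg_of_lt hk, Submodule.mem_bot] at this
    simp [pairB, this]

end CoxeterData

namespace CoxeterData

variable {n : ℕ} (c : CoxeterData n)

theorem d_pos (j : Fin n) : 0 < c.d j := by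
  rw [Nat.pos_iff_ne_zero]
  intro h
  have h1 := c.homog j
  rw [h, ← MvPolynomial.totalDegree_zero_iff_isHomogeneous,
    MvPolynomial.totalDegree_eq_zero_iff_eq_C] at h1
  have h2 : aeval c.P (X j : MvPolynomial (Fin n) ℝ) =
      aeval c.P (MvPolynomial.C (MvPolynomial.coeff 0 (c.P j))) := by
    rw [MvPolynomial.aeval_X, MvPolynomial.aeval_C, MvPolynomial.algebraMap_eq, ← h1]
  have h4 : (X j : MvPolynomial (Fin n) ℝ) = _ := c.algInd h2
  have h3 := congrArg MvPolynomial.totalDegree h4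
  simp at h3

theorem inv_P (j : Fin n) : c.Inv ℝ (c.P j) := fun w =>
  MvPolynomial.funext fun x => by rw [eval_sb]; exact c.invP j w w.2 x

theorem mem_adjoin_of_inv {q : MvPolynomial (Fin n) ℝ} (hq : c.Inv ℝ q) :
    q ∈ Algebra.adjoin ℝ (Set.range c.P) :=
  c.gen q fun e he x => by
    have := c.eval_sb ⟨e, he⟩ q x
    rw [hq] at this
    exact this.symm

/-- The ideal generated by the basic invariants. -/
def coinvIdeal : Ideal (MvPolynomial (Fin n) ℝ) := Ideal.span (Set.range c.P)

theorem P_mem_coinvIdeal (j : Fin n) : c.P j ∈ c.coinvIdeal :=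
  Ideal.subset_span ⟨j, rfl⟩

theorem sb_mem_coinvIdeal (w : c.W) {f : MvPolynomial (Fin n) ℝ} (hf : f ∈ c.coinvIdeal) :
    c.sb ℝ w f ∈ c.coinvIdeal := by
  have : c.coinvIdeal ≤ c.coinvIdeal.comap (c.sb ℝ w) := by
    refine Ideal.span_le.2 ?_
    rintro _ ⟨j, rfl⟩
    change c.sb ℝ w (c.P j) ∈ c.coinvIdeal
    rw [c.inv_P j w]
    exact c.P_mem_coinvIdeal j
  exact this hf

theorem coeff_zero_of_mem_coinvIdeal {f : MvPolynomial (Fin n) ℝ} (hf : f ∈ c.coinvIdeal) :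
    MvPolynomial.constantCoeff f = 0 := by
  have : c.coinvIdeal ≤ RingHom.ker MvPolynomial.constantCoeff := by
    refine Ideal.span_le.2 ?_
    rintro _ ⟨j, rfl⟩
    refine (c.homog j).coeff_eq_zero (d := 0) ?_
    simpa using (c.d_pos j).ne
  exact this hf

theorem exists_sub_C_mem {q : MvPolynomial (Fin n) ℝ} (hq : c.Inv ℝ q) :
    ∃ t : ℝ, q - MvPolynomial.C t ∈ c.coinvIdeal := by
  have hq' := c.mem_adjoin_of_inv hq
  clear hq
  induction hq' using Algebra.adjoin_induction with
  | mem x hx =>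
    obtain ⟨j, rfl⟩ := hx
    exact ⟨0, by simpa using c.P_mem_coinvIdeal j⟩
  | algebraMap r => exact ⟨r, by simp [MvPolynomial.algebraMap_eq]⟩
  | add x y _ _ hx hy =>
    obtain ⟨s, hs⟩ := hx
    obtain ⟨t, ht⟩ := hy
    exact ⟨s + t, by
      rw [map_add, add_sub_add_comm]
      exact add_mem hs ht⟩
  | mul x y _ _ hx hy =>
    obtain ⟨s, hs⟩ := hx
    obtain ⟨t, ht⟩ := hy
    refine ⟨s * t, ?_⟩
    have : x * y - MvPolynomial.C (s * t) =
        y * (x - MvPolynomial.C s) + MvPolynomial.C s * (y - MvPolynomial.C t) := by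
      rw [map_mul]
      ring
    rw [this]
    exact add_mem (Ideal.mul_mem_left _ _ hs) (Ideal.mul_mem_left _ _ ht)

theorem inv_sum (f : MvPolynomial (Fin n) ℝ) : c.Inv ℝ (∑ w, c.sb ℝ w f) := fun u => by
  rw [map_sum]
  simp_rw [← sb_mul]
  exact Equiv.sum_comp (Equiv.mulRight u) fun w => c.sb ℝ w f

theorem mem_coinvIdeal_of_sub {f : MvPolynomial (Fin n) ℝ} {k : ℕ} (hf : f.IsHomogeneous (k + 1))
    (h : ∀ w, f - c.sb ℝ w f ∈ c.coinvIdeal) : f ∈ c.coinvIdeal := by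
  obtain ⟨t, ht⟩ := c.exists_sub_C_mem (c.inv_sum f)
  have h0 : MvPolynomial.constantCoeff (∑ w, c.sb ℝ w f) = 0 := by
    rw [map_sum]
    exact Finset.sum_eq_zero fun w _ =>
      (c.sb_isHomogeneous ℝ w hf).coeff_eq_zero (d := 0) (by simp)
  have h1 := c.coeff_zero_of_mem_coinvIdeal ht
  rw [map_sub, h0, MvPolynomial.constantCoeff_C, zero_sub, neg_eq_zero] at h1
  rw [h1, map_zero, sub_zero] at ht
  have h2 : f = MvPolynomial.C ((Fintype.card c.W : ℝ)⁻¹) *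
      (∑ w, (f - c.sb ℝ w f) + ∑ w, c.sb ℝ w f) := by
    rw [← sum_add_distrib]
    simp only [sub_add_cancel, Finset.sum_const, Finset.card_univ, nsmul_eq_mul]
    rw [← MvPolynomial.C_eq_coe_nat, ← mul_assoc, ← map_mul, inv_mul_cancel₀, map_one, one_mul]
    exact_mod_cast Fintype.card_ne_zero
  rw [h2]
  exact Ideal.mul_mem_left _ _ (add_mem (Ideal.sum_mem _ fun w _ => h w) ht)

theorem mul_s_eq (u : c.W) {α γ : Fin n → ℝ} (hα : α ∈ c.R) (hγ : γ ∈ c.R)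
    (h : γ = c.act u α ∨ γ = -c.act u α) : u * c.s α hα = c.s γ hγ * u := by
  rw [c.s_conj u hα hγ h]
  group

theorem exists_root (u : c.W) {α : Fin n → ℝ} (hα : α ∈ c.R) :
    ∃ γ ∈ c.R, γ = c.act u α ∨ γ = -c.act u α := by
  rcases c.act_mem_or u hα with h | h
  · exact ⟨_, h, Or.inl rfl⟩
  · exact ⟨_, h, Or.inr rfl⟩

theorem norm2_act (u : c.W) {α : Fin n → ℝ} (hα : α ∈ c.R) :
    dotR (c.act u α) (c.act u α) = 2 := by rw [dotR_act, c.norm2 α hα]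

/-- Every family in degree `k` lifts to a family in degree `k + 1` along a simple root. -/
theorem exists_lift {k : ℕ} {h : c.W → MvPolynomial (Fin n) ℝ} (hh : h ∈ c.Yk k)
    {α : Fin n → ℝ} (hs : c.IsSimple α) :
    ∃ q ∈ c.Yk (k + 1), ∀ u, h u + h (u * c.s α hs.1) = lin ℝ (c.act u α) * q u := by
  obtain ⟨h1, h2, h3⟩ := hh
  have hα := hs.1
  have hdvd : ∀ u, lin ℝ (c.act u α) ∣ h u + h (u * c.s α hα) := fun u => by
    obtain ⟨γ, hγ, hor⟩ := c.exists_root u hα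
    rw [c.mul_s_eq u hα hγ hor]
    have := h2 u γ hγ
    rcases hor with rfl | rfl
    · exact this
    · rwa [lin_neg, neg_dvd] at this
  choose q hq using hdvd
  have hne : ∀ u, lin ℝ (c.act u α) ≠ 0 := fun u => lin_ne_zero ℝ (c.norm2_act u hα)
  have hqz : ∀ u, h u = 0 → h (u * c.s α hα) = 0 → q u = 0 := fun u e1 e2 => by
    have := hq u
    rw [e1, e2, add_zero] at this
    exact (mul_eq_zero.1 this.symm).resolve_left (hne u)
  have hqs : ∀ u, q u + q (u * c.s α hα) = 0 := fun u => by
    have e1 := hq u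
    have e2 := hq (u * c.s α hα)
    have e3 : c.act (u * c.s α hα) α = -c.act u α := by
      rw [act_mul, act_s, c.norm2 α hα, ← act_neg]
      congr 1
      rw [two_smul]
      abel
    rw [mul_assoc, s_mul_self, mul_one, e3, lin_neg] at e2
    refine (mul_eq_zero.1 (?_ : lin ℝ (c.act u α) * (q u + q (u * c.s α hα)) = 0)).resolve_left
      (hne u)
    linear_combination -e1 + e2
  refine ⟨q, ⟨fun u => ?_, fun u β hβ => ?_, fun u hu => ?_⟩, hq⟩
  · rcases lt_trichotomy k c.R.card with hk | hk | hk
    · rw [c.mem_codeg hk]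
      have e := add_mem (h1 u) (h1 (u * c.s α hα))
      rw [c.mem_codeg hk.le, hq u] at e
      refine isHomogeneous_of_mul_left (lin_isHomogeneous ℝ _) (hne u) (k := c.R.card - (k + 1)) ?_
      rwa [show 1 + (c.R.card - (k + 1)) = c.R.card - k by omega]
    · have e := add_mem (h1 u) (h1 (u * c.s α hα))
      rw [c.mem_codeg hk.le, hq u] at e
      rw [eq_zero_of_mul_isHomogeneous (lin_isHomogeneous ℝ _) (hne u) e (by omega)]
      exact zero_mem _
    · have hz : ∀ u, h u = 0 := fun u => by
        have := h1 u
        rwa [c.codeg_of_lt hk, Submodule.mem_bot] at this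
      rw [hqz u (hz _) (hz _)]
      exact zero_mem _
  · by_cases hc : ∃ t : ℝ, c.act u α = t • β
    · obtain ⟨γ, hγ, hor⟩ := c.exists_root u hα
      have hβγ : β = γ := by
        by_contra hne'
        obtain ⟨t, ht⟩ := hc
        rcases hor with h4 | h4
        · exact c.noncollinear β hβ γ hγ hne' t (h4.trans ht)
        · exact c.noncollinear β hβ γ hγ hne' (-t) (by rw [h4, ht, neg_smul])
      subst hβγ
      rw [← c.mul_s_eq u hα hβ hor, hqs u]
      exact dvd_zero _
    · push Not at hc
      refine ((lin_prime ℝ (c.norm2 β hβ)).dvd_or_dvd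
        (?_ : lin ℝ β ∣ lin ℝ (c.act u α) * (q u + q (c.s β hβ * u)))).resolve_left
        (lin_not_dvd ℝ (c.norm2 β hβ) hc)
      have e1 := hq u
      have e2 := hq (c.s β hβ * u)
      rw [act_mul, act_s, lin_sub, lin_smul] at e2
      have e3 : lin ℝ (c.act u α) * (q u + q (c.s β hβ * u)) =
          (h u + h (c.s β hβ * u)) + (h (u * c.s α hα) + h (c.s β hβ * (u * c.s α hα))) +
          lin ℝ β * (MvPolynomial.C (algebraMap ℝ ℝ (dotR β (c.act u α))) *
            q (c.s β hβ * u)) := by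
        rw [← mul_assoc (c.s β hβ)]
        linear_combination -e1 - e2
      rw [e3]
      exact dvd_add (dvd_add (h2 u β hβ) (h2 _ β hβ)) (dvd_mul_right _ _)
  · refine hqz u (h3 u (by omega)) (h3 _ ?_)
    have := c.len_mul_s_le hs (u * c.s α hα)
    rw [mul_assoc, s_mul_self, mul_one] at this
    omega

theorem pairB_lift {h q : c.W → MvPolynomial (Fin n) ℝ} {α : Fin n → ℝ} (hα : α ∈ c.R)
    (hq : ∀ u, h u + h (u * c.s α hα) = lin ℝ (c.act u α) * q u)
    {f g : MvPolynomial (Fin n) ℝ} (hfg : f - c.sb ℝ (c.s α hα) f = lin ℝ α * g)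
    (hg : c.sb ℝ (c.s α hα) g = g) : c.pairB q f = c.pairB h g := by
  have hne : ∀ u, lin ℝ (c.act u α) ≠ 0 := fun u => lin_ne_zero ℝ (c.norm2_act u hα)
  have hqs : ∀ u, q (u * c.s α hα) = -q u := fun u => by
    have e1 := hq u
    have e2 := hq (u * c.s α hα)
    have e3 : c.act (u * c.s α hα) α = -c.act u α := by
      rw [act_mul, act_s, c.norm2 α hα, ← act_neg]
      congr 1
      rw [two_smul]
      abel
    rw [mul_assoc, s_mul_self, mul_one, e3, lin_neg] at e2
    rw [eq_neg_iff_add_eq_zero]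
    refine (mul_eq_zero.1 (?_ : lin ℝ (c.act u α) * (q (u * c.s α hα) + q u) = 0)).resolve_left
      (hne u)
    linear_combination -e1 + e2
  have e1 : c.pairB q f + c.pairB q f = c.pairB h g + c.pairB h g := by
    conv_lhs => rw [pairB]; arg 2; rw [← c.sum_mul_s hα]
    conv_rhs => rw [pairB]; arg 2; rw [← c.sum_mul_s hα]
    rw [← sum_add_distrib, ← sum_add_distrib]
    refine sum_congr rfl fun u _ => ?_
    have e4 : c.sb ℝ u⁻¹ (f - c.sb ℝ (c.s α hα) f) = lin ℝ (c.act u α) * c.sb ℝ u⁻¹ g := by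
      rw [hfg, map_mul, sb_lin, inv_inv]
    rw [mul_inv_rev, s_inv, sb_mul, sb_mul, hg, hqs]
    rw [map_sub] at e4
    linear_combination q u * e4 - c.sb ℝ u⁻¹ g * hq u
  have e2 : (2 : MvPolynomial (Fin n) ℝ) * (c.pairB q f - c.pairB h g) = 0 := by
    linear_combination e1
  exact sub_eq_zero.1 ((mul_eq_zero.1 e2).resolve_left two_ne_zero)

theorem mem_coinvIdeal_of_pairB (k : ℕ) : ∀ f : MvPolynomial (Fin n) ℝ, f.IsHomogeneous k →
    (∀ h ∈ c.Yk k, c.pairB h f = 0) → f ∈ c.coinvIdeal := by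
  induction k with
  | zero =>
    classical
    intro f hf hB
    have h1 := hB (fun u => if c.len u = 0 then c.delta ℝ else 0) ⟨fun u => ?_,
      fun u α hα => ?_, fun u hu => if_neg hu.ne'⟩
    · rw [← MvPolynomial.totalDegree_zero_iff_isHomogeneous,
        MvPolynomial.totalDegree_eq_zero_iff_eq_C] at hf
      rw [hf, pairB] at h1
      simp only [MvPolynomial.algHom_C, MvPolynomial.algebraMap_eq, ite_mul, zero_mul] at h1
      rw [← Finset.sum_filter, Finset.sum_const, nsmul_eq_mul, mul_eq_zero] at h1
      rcases h1 with h1 | h1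
      · rw [Nat.cast_eq_zero, Finset.card_eq_zero] at h1
        have : (1 : c.W) ∈ Finset.univ.filter fun u : c.W => c.len u = 0 := by
          simp [len_one]
        rw [h1] at this
        simp at this
      · rw [hf, (mul_eq_zero.1 h1).resolve_left (c.delta_ne_zero ℝ)]
        exact zero_mem _
    · dsimp only
      split_ifs
      · rw [c.mem_codeg (Nat.zero_le _)]
        exact c.delta_isHomogeneous ℝ
      · exact zero_mem _
    · refine dvd_add ?_ ?_ <;>
      · dsimp only
        split_ifs
        · exact c.lin_dvd_delta ℝ hα
        · exact dvd_zero _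
  | succ k ih =>
    intro f hf hB
    refine c.mem_coinvIdeal_of_sub hf fun w => ?_
    have hsimple : ∀ α (hs : c.IsSimple α), f - c.sb ℝ (c.s α hs.1) f ∈ c.coinvIdeal := by
      intro α hs
      obtain ⟨g, hg⟩ := lin_dvd_sub_shear ℝ 1 α f
      rw [← c.sb_s ℝ α hs.1] at hg
      have hne := lin_ne_zero ℝ (c.norm2 α hs.1)
      have hgh : g.IsHomogeneous k := by
        refine isHomogeneous_of_mul_left (lin_isHomogeneous ℝ α) hne ?_
        rw [← hg, add_comm]
        exact hf.sub (c.sb_isHomogeneous ℝ _ hf)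
      have hgs : c.sb ℝ (c.s α hs.1) g = g := by
        have h2 := congrArg (c.sb ℝ (c.s α hs.1)) hg
        rw [map_sub, ← sb_mul, s_mul_self, sb_one, map_mul, c.sb_s ℝ α hs.1,
          shear_one_lin_self ℝ (c.norm2 α hs.1), ← c.sb_s ℝ α hs.1] at h2
        refine mul_left_cancel₀ hne ?_
        linear_combination h2 + hg
      rw [hg]
      refine Ideal.mul_mem_left _ _ (ih g hgh fun h hh => ?_)
      obtain ⟨q, hq, hqe⟩ := c.exists_lift hh hs
      rw [← c.pairB_lift hs.1 hqe hg hgs]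
      exact hB q hq
    induction w using c.induction_simple with
    | h1 => simp [sb_one]
    | hs α hs w ih2 =>
      have e : f - c.sb ℝ (c.s α hs.1 * w) f =
          (f - c.sb ℝ w f) + c.sb ℝ w (f - c.sb ℝ (c.s α hs.1) f) := by
        rw [sb_mul, map_sub]
        ring
      rw [e]
      exact add_mem ih2 (c.sb_mem_coinvIdeal w (hsimple α hs))

end CoxeterData

theorem exists_spanning_family {V ι : Type*} [AddCommGroup V] [Module ℝ V] [Module.Finite ℝ V]
    [Fintype ι] (h : Module.finrank ℝ V ≤ Fintype.card ι) :
    ∃ f : ι → V, Submodule.span ℝ (Set.range f) = ⊤ := by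
  obtain ⟨emb⟩ : Nonempty (Fin (Module.finrank ℝ V) ↪ ι) :=
    Function.Embedding.nonempty_of_card_le (by simpa using h)
  let b := Module.finBasis ℝ V
  refine ⟨Function.extend emb b 0, ?_⟩
  rw [eq_top_iff, ← b.span_eq]
  refine Submodule.span_mono ?_
  rintro _ ⟨i, rfl⟩
  exact ⟨emb i, emb.injective.extend_apply _ _ _⟩

namespace CoxeterData

variable {n : ℕ} (c : CoxeterData n)

/-- The pairing evaluated at a point, as a bilinear map. -/
def pairEval (v : Fin n → ℝ) (k : ℕ) :
    MvPolynomial.homogeneousSubmodule (Fin n) ℝ k →ₗ[ℝ] Module.Dual ℝ (c.Yk k) :=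
  LinearMap.mk₂ ℝ (fun f h => eval v (c.pairB h.1 f.1))
    (fun f g h => by simp [pairB, mul_add, sum_add_distrib])
    (fun t f h => by simp [pairB, mul_sum, MvPolynomial.smul_eval])
    (fun f h g => by simp [pairB, add_mul, sum_add_distrib])
    (fun t f h => by simp [pairB, mul_sum, MvPolynomial.smul_eval])

theorem pairEval_apply (v : Fin n → ℝ) (k : ℕ)
    (f : MvPolynomial.homogeneousSubmodule (Fin n) ℝ k) (h : c.Yk k) :
    c.pairEval v k f h = eval v (c.pairB h.1 f.1) := rfl

theorem exists_generators (k : ℕ) : ∃ e : {u : c.W // c.len u = k} → MvPolynomial (Fin n) ℝ,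
    (∀ u, (e u).IsHomogeneous k) ∧ ∀ f : MvPolynomial (Fin n) ℝ, f.IsHomogeneous k →
      ∃ a : {u : c.W // c.len u = k} → ℝ, f - ∑ u, a u • e u ∈ c.coinvIdeal := by
  classical
  obtain ⟨v, hv⟩ := c.pos
  let ev : c.Yk k →ₗ[ℝ] ({u : c.W // c.len u = k} → ℝ) :=
    { toFun := fun h u => eval v (h.1 u.1)
      map_add' := fun h g => by ext u; simp
      map_smul' := fun t h => by ext u; simp [MvPolynomial.smul_eval] }
  have hinj : Function.Injective ev := by
    rw [← LinearMap.ker_eq_bot, LinearMap.ker_eq_bot']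
    intro h hh
    refine Subtype.ext (c.Yk_injective hv h.2 fun u hu => ?_)
    exact congrFun hh ⟨u, hu⟩
  have : Module.Finite ℝ (c.Yk k) := Module.Finite.of_injective ev hinj
  have hle : Module.finrank ℝ (LinearMap.range (c.pairEval v k)) ≤
      Fintype.card {u : c.W // c.len u = k} := by
    refine (Submodule.finrank_le _).trans ?_
    rw [Subspace.dual_finrank_eq]
    refine (LinearMap.finrank_le_finrank_of_injective hinj).trans ?_
    rw [Module.finrank_fintype_fun_eq_card]
  obtain ⟨g, hg⟩ :=
    exists_spanning_family (V := LinearMap.range (c.pairEval v k)) hle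
  have hpre : ∀ u, ∃ f, c.pairEval v k f = (g u).1 := fun u => (g u).2
  choose e he using hpre
  refine ⟨fun u => (e u).1, fun u => (e u).2, fun f hf => ?_⟩
  have hmem : (⟨_, ⟨⟨f, hf⟩, rfl⟩⟩ : LinearMap.range (c.pairEval v k)) ∈
      Submodule.span ℝ (Set.range g) := by rw [hg]; trivial
  obtain ⟨a, ha⟩ := (Submodule.mem_span_range_iff_exists_fun ℝ).1 hmem
  refine ⟨a, c.mem_coinvIdeal_of_pairB k _ ?_ fun h hh => ?_⟩
  · exact hf.sub (Submodule.sum_mem (MvPolynomial.homogeneousSubmodule (Fin n) ℝ k)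
      fun u _ => Submodule.smul_mem _ _ (e u).2)
  · have h1 : c.pairEval v k (⟨f, hf⟩ - ∑ u, a u • e u) = 0 := by
      rw [map_sub, map_sum, sub_eq_zero]
      have := congrArg Subtype.val ha
      simp only [Submodule.coe_sum, Submodule.coe_smul] at this
      rw [← this]
      exact sum_congr rfl fun u _ => by rw [map_smul, he]
    have h2 := LinearMap.congr_fun h1 ⟨h, hh⟩
    rw [pairEval_apply] at h2
    obtain ⟨t, ht⟩ := c.pairB_eq_C_mul hh (⟨f, hf⟩ - ∑ u, a u • e u :
      MvPolynomial.homogeneousSubmodule (Fin n) ℝ k).2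
    have h3 : ((⟨f, hf⟩ - ∑ u, a u • e u : MvPolynomial.homogeneousSubmodule (Fin n) ℝ k) :
      MvPolynomial (Fin n) ℝ) = f - ∑ u, a u • (e u).1 := by simp
    rw [h3] at ht h2
    rw [ht] at h2 ⊢
    rw [map_mul, MvPolynomial.eval_C, eval_delta_real] at h2
    have h4 : ∏ α ∈ c.R, dotR α v ≠ 0 := Finset.prod_ne_zero_iff.2 fun α hα => (hv α hα).ne'
    rw [(mul_eq_zero.1 h2).resolve_right h4]
    simp

theorem exists_coinv_family : ∃ e : c.W → MvPolynomial (Fin n) ℝ,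
    (∀ u, (e u).IsHomogeneous (c.len u)) ∧ ∀ k, ∀ f : MvPolynomial (Fin n) ℝ, f.IsHomogeneous k →
      ∃ a : c.W → ℝ, f - ∑ u with c.len u = k, a u • e u ∈ c.coinvIdeal := by
  classical
  choose e he hf using c.exists_generators
  refine ⟨fun u => e (c.len u) ⟨u, rfl⟩, fun u => he _ _, fun k f hfk => ?_⟩
  obtain ⟨a, ha⟩ := hf k f hfk
  refine ⟨fun u => if h : c.len u = k then a ⟨u, h⟩ else 0, ?_⟩
  convert ha using 2
  rw [Finset.sum_subtype (p := fun u => c.len u = k) _ (by simp)]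
  refine sum_congr rfl fun u _ => ?_
  obtain ⟨u, rfl⟩ := u
  simp

theorem exists_expansion {e : c.W → MvPolynomial (Fin n) ℝ}
    (h : ∀ k, ∀ f : MvPolynomial (Fin n) ℝ, f.IsHomogeneous k →
      ∃ a : c.W → ℝ, f - ∑ u with c.len u = k, a u • e u ∈ c.coinvIdeal)
    (he : ∀ u, (e u).IsHomogeneous (c.len u)) (f : MvPolynomial (Fin n) ℝ) :
    ∃ b : c.W → MvPolynomial (Fin n) ℝ, f = ∑ w, aeval c.P (b w) * e w := by
  classical
  have hsum : ∀ {ι : Type} (s : Finset ι) (F : ι → MvPolynomial (Fin n) ℝ),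
      (∀ i ∈ s, ∃ b : c.W → MvPolynomial (Fin n) ℝ,
        F i = ∑ w, aeval c.P (b w) * e w) →
      ∃ b : c.W → MvPolynomial (Fin n) ℝ,
        ∑ i ∈ s, F i = ∑ w, aeval c.P (b w) * e w := by
    intro ι s F hF
    choose! b hb using hF
    refine ⟨fun w => ∑ i ∈ s, b i w, ?_⟩
    rw [sum_congr rfl hb, Finset.sum_comm]
    exact sum_congr rfl fun w _ => by rw [map_sum, Finset.sum_mul]
  have hhom : ∀ k, ∀ f : MvPolynomial (Fin n) ℝ, f.IsHomogeneous k →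
      ∃ b : c.W → MvPolynomial (Fin n) ℝ, f = ∑ w, aeval c.P (b w) * e w := by
    intro k
    induction k using Nat.strong_induction_on with
    | _ k ih =>
    intro f hf
    obtain ⟨a, ha⟩ := h k f hf
    obtain ⟨g, hg⟩ := Ideal.mem_span_range_iff_exists_fun.1 ha
    have hhg : (f - ∑ u with c.len u = k, a u • e u).IsHomogeneous k :=
      hf.sub (Submodule.sum_mem (MvPolynomial.homogeneousSubmodule (Fin n) ℝ k)
        fun u hu => Submodule.smul_mem _ _ (by
          have := he u
          rwa [(Finset.mem_filter.1 hu).2] at this))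
    have h1 := MvPolynomial.homogeneousComponent_of_mem (m := k) (n := k) hhg
    rw [if_pos rfl, ← hg, map_sum] at h1
    obtain ⟨b1, hb1⟩ := hsum Finset.univ
      (fun j => homogeneousComponent k (g j * c.P j)) fun j _ => by
        rcases lt_or_ge k (c.d j) with hlt | hge
        · refine ⟨0, ?_⟩
          rw [mul_comm, homogeneousComponent_mul_eq_zero (c.homog j) _ hlt]
          simp
        · obtain ⟨b, hb⟩ := ih (k - c.d j) (by have := c.d_pos j; omega) _
            (MvPolynomial.homogeneousComponent_isHomogeneous (k - c.d j) (g j))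
          refine ⟨fun w => X j * b w, ?_⟩
          have := homogeneousComponent_mul_of_isHomogeneous (c.homog j) (g j) (k - c.d j)
          rw [Nat.add_sub_cancel' hge] at this
          rw [mul_comm, this, hb, mul_sum]
          refine sum_congr rfl fun w _ => ?_
          rw [map_mul, MvPolynomial.aeval_X, mul_assoc]
    refine ⟨fun w => b1 w + if c.len w = k then MvPolynomial.C (a w) else 0, ?_⟩
    simp only [map_add, add_mul, sum_add_distrib]
    rw [← hb1, h1, hg]
    have h2 : ∑ w, aeval c.P (if c.len w = k then MvPolynomial.C (a w) else 0 :
        MvPolynomial (Fin n) ℝ) * e w = ∑ u with c.len u = k, a u • e u := by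
      rw [Finset.sum_filter]
      refine sum_congr rfl fun w _ => ?_
      split_ifs
      · rw [MvPolynomial.aeval_C, MvPolynomial.algebraMap_eq, MvPolynomial.smul_eq_C_mul]
      · simp
    rw [h2]
    ring
  rw [← MvPolynomial.sum_homogeneousComponent f]
  exact hsum _ _ fun k _ => hhom k _ (MvPolynomial.homogeneousComponent_isHomogeneous k f)

theorem exists_regular_point : ∃ y : Fin n → ℝ, ∀ u w : c.W, c.act u y = c.act w y → u = w := by
  classical
  let q : c.W → MvPolynomial (Fin n) ℝ := fun w => ∑ i, (c.sb ℝ w (X i) - X i) ^ 2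
  have hev : ∀ w x, eval x (q w) = ∑ i, (c.act w x i - x i) ^ 2 := fun w x => by
    simp [q, eval_sb]
  have hq : ∏ w ∈ Finset.univ.erase (1 : c.W), q w ≠ 0 := by
    refine Finset.prod_ne_zero_iff.2 fun w hw h0 => ?_
    refine (Finset.mem_erase.1 hw).1 (Subtype.ext (LinearEquiv.ext fun x => ?_))
    have := hev w x
    rw [h0, map_zero, eq_comm, Finset.sum_eq_zero_iff_of_nonneg fun i _ => sq_nonneg _] at this
    funext i
    have h1 := this i (Finset.mem_univ i)
    rw [sq_eq_zero_iff, sub_eq_zero] at h1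
    exact h1
  obtain ⟨y, hy⟩ : ∃ y, eval y (∏ w ∈ Finset.univ.erase (1 : c.W), q w) ≠ 0 := by
    by_contra hcon
    push Not at hcon
    exact hq (MvPolynomial.funext fun x => by rw [hcon, map_zero])
  refine ⟨y, fun u w huw => ?_⟩
  by_contra hne
  have h1 : w⁻¹ * u ∈ Finset.univ.erase (1 : c.W) := by
    rw [Finset.mem_erase]
    exact ⟨fun h => hne (inv_mul_eq_one.1 h).symm, Finset.mem_univ _⟩
  rw [map_prod, Finset.prod_ne_zero_iff] at hy
  refine hy _ h1 ?_
  rw [hev, act_mul, huw, act_inv_act]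
  simp

theorem eq_zero_of_expansion {e : c.W → MvPolynomial (Fin n) ℝ}
    (h : ∀ f : MvPolynomial (Fin n) ℝ, ∃ b : c.W → MvPolynomial (Fin n) ℝ,
      f = ∑ w, aeval c.P (b w) * e w)
    {b : c.W → MvPolynomial (Fin n) ℝ} (hb : ∑ w, aeval c.P (b w) * e w = 0) :
    b = 0 := by
  classical
  obtain ⟨y, hy⟩ := c.exists_regular_point
  have hinvP : ∀ (u : c.W) (q : MvPolynomial (Fin n) ℝ),
      c.sb ℝ u (aeval c.P q) = aeval c.P q := fun u q => by
    have : (c.sb ℝ u).comp (aeval c.P) = aeval c.P :=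
      MvPolynomial.algHom_ext fun j => by simp [c.inv_P j u]
    exact DFunLike.congr_fun this q
  let g : c.W → MvPolynomial (Fin n) ℝ := fun u =>
    ∏ w ∈ Finset.univ.erase u, ∑ i, (X i - MvPolynomial.C (c.act w y i)) ^ 2
  have hg0 : ∀ u w, u ≠ w → eval (c.act u y) (g w) = 0 := fun u w huw => by
    rw [map_prod]
    exact Finset.prod_eq_zero (Finset.mem_erase.2 ⟨huw, Finset.mem_univ u⟩) (by simp)
  have hg1 : ∀ u, eval (c.act u y) (g u) ≠ 0 := fun u => by
    rw [map_prod, Finset.prod_ne_zero_iff]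
    intro w hw h0
    refine (Finset.mem_erase.1 hw).1 (hy _ _ ?_).symm
    simp only [map_sum, map_pow, map_sub, MvPolynomial.eval_X, MvPolynomial.eval_C] at h0
    rw [Finset.sum_eq_zero_iff_of_nonneg fun i _ => sq_nonneg _] at h0
    funext i
    have h1 := h0 i (Finset.mem_univ i)
    rwa [sq_eq_zero_iff, sub_eq_zero] at h1
  choose B hB using fun u => h (g u)
  let M : Matrix c.W c.W (MvPolynomial (Fin n) ℝ) := Matrix.of fun u w => c.sb ℝ u (e w)
  have hdet : M.det ≠ 0 := by
    intro h0
    have h1 := congrArg (eval y) h0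
    rw [map_zero, RingHom.map_det] at h1
    let Bm : Matrix c.W c.W ℝ :=
      Matrix.of fun w u => eval y (aeval c.P (B u w))
    have h2 : (eval y).mapMatrix M * Bm =
        Matrix.diagonal fun u => eval (c.act u y) (g u) := by
      ext u w
      rw [Matrix.mul_apply, Matrix.diagonal_apply]
      have h3 : ∑ j, (eval y).mapMatrix M u j * Bm j w =
          eval (c.act u y) (g w) := by
        conv_rhs => rw [hB w, ← eval_sb, map_sum, map_sum]
        refine sum_congr rfl fun j _ => ?_
        rw [map_mul, hinvP, map_mul, mul_comm]
        rfl
      rw [h3]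
      split_ifs with huw
      · rw [huw]
      · exact hg0 u w huw
    have h4 := congrArg Matrix.det h2
    rw [Matrix.det_mul, h1, zero_mul, Matrix.det_diagonal] at h4
    exact Finset.prod_ne_zero_iff.2 (fun u _ => hg1 u) h4.symm
  have hz : (fun w => aeval c.P (b w)) = 0 := by
    refine Matrix.eq_zero_of_mulVec_eq_zero hdet ?_
    funext u
    have h5 := congrArg (c.sb ℝ u) hb
    rw [map_sum, map_zero] at h5
    rw [Pi.zero_apply, ← h5]
    refine sum_congr rfl fun w _ => ?_
    rw [map_mul, hinvP, mul_comm]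
    rfl
  funext w
  have h6 : aeval c.P (b w) = aeval c.P (0 : MvPolynomial (Fin n) ℝ) := by
    rw [map_zero]
    exact congrFun hz w
  exact c.algInd h6

end CoxeterData

theorem homogeneousComponent_image_mem_span {n : ℕ} {ι : Type*}
    (b : Module.Basis ι ℝ (MvPolynomial (Fin n) ℝ)) {g : ι → ℕ}
    (hb : ∀ i, (b i).IsHomogeneous (g i)) (k : ℕ) {f : MvPolynomial (Fin n) ℝ}
    (hf : f.IsHomogeneous k) :
    f ∈ Submodule.span ℝ (Set.range fun i : {i // g i = k} => b i.1) := by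
  have h1 : homogeneousComponent k f = f := by
    rw [MvPolynomial.homogeneousComponent_of_mem (m := k) (n := k) hf, if_pos rfl]
  have h2 : f ∈ Submodule.map (homogeneousComponent k)
      (Submodule.span ℝ (Set.range b)) :=
    ⟨f, by rw [b.span_eq]; trivial, h1⟩
  rw [Submodule.map_span] at h2
  refine Submodule.span_le.2 ?_ h2
  rintro _ ⟨_, ⟨i, rfl⟩, rfl⟩
  rw [MvPolynomial.homogeneousComponent_of_mem (m := k) (n := g i) (hb i)]
  split_ifs with h
  · exact Submodule.subset_span ⟨⟨i, h.symm⟩, rfl⟩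
  · exact zero_mem _

/-- The elements of degree `k` of a homogeneous basis form a basis of the homogeneous part. -/
def fiberBasis {n : ℕ} {ι : Type*}
    (b : Module.Basis ι ℝ (MvPolynomial (Fin n) ℝ)) {g : ι → ℕ}
    (hb : ∀ i, (b i).IsHomogeneous (g i)) (k : ℕ) :
    Module.Basis {i // g i = k} ℝ (MvPolynomial.homogeneousSubmodule (Fin n) ℝ k) :=
  Module.Basis.mk (v := fun i => ⟨b i.1, by
      have := hb i.1
      rwa [i.2] at this⟩)
    (LinearIndependent.of_comp (Submodule.subtype _)
      (b.linearIndependent.comp _ Subtype.val_injective))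
    (by
      rintro ⟨f, hf⟩ -
      have h1 := homogeneousComponent_image_mem_span b hb k hf
      have h2 := Submodule.map_span (MvPolynomial.homogeneousSubmodule (Fin n) ℝ k).subtype
        (Set.range fun i : {i // g i = k} => (⟨b i.1, by
          have := hb i.1
          rwa [i.2] at this⟩ : MvPolynomial.homogeneousSubmodule (Fin n) ℝ k))
      rw [← Set.range_comp] at h2
      have h3 : f ∈ Submodule.span ℝ (Set.range ((MvPolynomial.homogeneousSubmodule
        (Fin n) ℝ k).subtype ∘ fun i : {i // g i = k} => (⟨b i.1, by
          have := hb i.1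
          rwa [i.2] at this⟩ : MvPolynomial.homogeneousSubmodule (Fin n) ℝ k))) := h1
      rw [← h2] at h3
      obtain ⟨x, hx, hxf⟩ := h3
      have : x = ⟨f, hf⟩ := Subtype.ext hxf
      rwa [this] at hx)

theorem tsum_pow_degree_eq {n : ℕ} {ι κ : Type*}
    (b : Module.Basis ι ℝ (MvPolynomial (Fin n) ℝ)) {g : ι → ℕ}
    (hb : ∀ i, (b i).IsHomogeneous (g i))
    (b' : Module.Basis κ ℝ (MvPolynomial (Fin n) ℝ)) {g' : κ → ℕ}
    (hb' : ∀ i, (b' i).IsHomogeneous (g' i)) (t : ENNReal) :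
    ∑' i, t ^ g i = ∑' i, t ^ g' i := by
  let E : ι ≃ κ := (Equiv.sigmaFiberEquiv g).symm.trans ((Equiv.sigmaCongrRight fun k =>
    (fiberBasis b hb k).indexEquiv (fiberBasis b' hb' k)).trans (Equiv.sigmaFiberEquiv g'))
  have hE : ∀ i, g' (E i) = g i := fun i =>
    ((fiberBasis b hb (g i)).indexEquiv (fiberBasis b' hb' (g i)) ⟨i, rfl⟩).2
  rw [← E.tsum_eq]
  exact tsum_congr fun i => by rw [hE]

theorem tsum_pow_sum_mul {n : ℕ} (d : Fin n → ℕ) (t : ENNReal) :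
    ∑' a : Fin n → ℕ, t ^ (∑ j, a j * d j) = ∏ j, (1 - t ^ d j)⁻¹ := by
  induction n with
  | zero => simp
  | succ n ih =>
    rw [← (Fin.consEquiv fun _ => ℕ).tsum_eq, ENNReal.tsum_prod (f := fun a b =>
      t ^ ∑ j, (Fin.consEquiv fun _ => ℕ) (a, b) j * d j), Fin.prod_univ_succ,
      ← ih fun j => d j.succ, ← ENNReal.tsum_geometric, ← ENNReal.tsum_mul_right]
    refine tsum_congr fun a => ?_
    rw [← ENNReal.tsum_mul_left]
    refine tsum_congr fun b => ?_
    rw [← pow_mul, ← pow_add, Fin.sum_univ_succ]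
    simp [Fin.consEquiv, mul_comm]

theorem tsum_finsupp_pow_sum_mul {n : ℕ} (d : Fin n → ℕ) (t : ENNReal) :
    ∑' a : Fin n →₀ ℕ, t ^ (∑ j, a j * d j) = ∏ j, (1 - t ^ d j)⁻¹ := by
  rw [← tsum_pow_sum_mul]
  exact (Finsupp.equivFunOnFinite (α := Fin n) (M := ℕ)).tsum_eq
    fun a : Fin n → ℕ => t ^ (∑ j, a j * d j)

namespace CoxeterData

variable {n : ℕ} (c : CoxeterData n)

theorem aeval_P_monomial_isHomogeneous (a : Fin n →₀ ℕ) :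
    (aeval c.P (MvPolynomial.monomial a (1 : ℝ))).IsHomogeneous
      (∑ j, a j * c.d j) := by
  rw [MvPolynomial.aeval_monomial, map_one, one_mul, Finsupp.prod_fintype _ _ (by simp)]
  refine MvPolynomial.IsHomogeneous.prod _ _ _ fun j _ => ?_
  rw [mul_comm]
  exact (c.homog j).pow (a j)

/-- The length generating function is `∏ (1 - t ^ d j) / (1 - t)`. -/
theorem sum_pow_len_ennreal (t : ENNReal) :
    (∑ w, t ^ c.len w) * ∏ j, (1 - t ^ c.d j)⁻¹ = ∏ _j : Fin n, (1 - t)⁻¹ := by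
  classical
  obtain ⟨e, he, hf⟩ := c.exists_coinv_family
  let L : (c.W → MvPolynomial (Fin n) ℝ) →ₗ[ℝ] MvPolynomial (Fin n) ℝ :=
    { toFun := fun b => ∑ w, aeval c.P (b w) * e w
      map_add' := fun b b' => by simp [add_mul, sum_add_distrib]
      map_smul' := fun r b => by simp [Finset.smul_sum] }
  have hL : ∀ b, L b = ∑ w, aeval c.P (b w) * e w := fun b => rfl
  have hexp := c.exists_expansion hf he
  have hbij : Function.Bijective L := by
    refine ⟨?_, fun f => ?_⟩
    · rw [← LinearMap.ker_eq_bot, LinearMap.ker_eq_bot']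
      exact fun b hb => c.eq_zero_of_expansion hexp hb
    · obtain ⟨b, hb⟩ := hexp f
      exact ⟨b, hb.symm⟩
  let B := (Pi.basis fun _ : c.W => MvPolynomial.basisMonomials (Fin n) ℝ).map
    (LinearEquiv.ofBijective L hbij)
  have hB : ∀ i, B i = aeval c.P (MvPolynomial.monomial i.2 (1 : ℝ)) * e i.1 := by
    rintro ⟨w, a⟩
    simp only [B, Module.Basis.map_apply, LinearEquiv.ofBijective_apply, hL, Pi.basis_apply]
    rw [Finset.sum_eq_single w]
    · simp
    · intro u _ hu
      simp [hu]
    · simp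
  have hBh : ∀ i, (B i).IsHomogeneous ((∑ j, i.2 j * c.d j) + c.len i.1) := fun i => by
    rw [hB]
    exact (c.aeval_P_monomial_isHomogeneous i.2).mul (he i.1)
  have hM : ∀ a, (MvPolynomial.basisMonomials (Fin n) ℝ a).IsHomogeneous (∑ j, a j * 1) :=
    fun a => by
      rw [MvPolynomial.coe_basisMonomials]
      refine MvPolynomial.isHomogeneous_monomial _ ?_
      simp [Finsupp.degree_eq_sum]
  have h := tsum_pow_degree_eq B hBh _ hM t
  rw [tsum_finsupp_pow_sum_mul, ENNReal.tsum_sigma (f := fun w (a : Fin n →₀ ℕ) =>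
    t ^ (∑ j, a j * c.d j + c.len w)), tsum_fintype] at h
  simp only [pow_one] at h
  rw [← h, Finset.sum_mul]
  refine sum_congr rfl fun w _ => ?_
  simp only [pow_add]
  rw [ENNReal.tsum_mul_right, tsum_finsupp_pow_sum_mul, mul_comm]

theorem sum_pow_len_real {t : ℝ} (h0 : 0 < t) (h1 : t < 1) :
    (∑ w, t ^ c.len w) * (1 - t) ^ n = ∏ j, (1 - t ^ c.d j) := by
  have h := congrArg ENNReal.toReal (c.sum_pow_len_ennreal (ENNReal.ofReal t))
  have hlt : ∀ j, t ^ c.d j < 1 := fun j => pow_lt_one₀ h0.le h1 (c.d_pos j).ne'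
  have hr : ∀ s : ℝ, 0 ≤ s → s < 1 → (1 - ENNReal.ofReal s)⁻¹.toReal = (1 - s)⁻¹ := by
    intro s hs0 hs
    rw [ENNReal.toReal_inv, ← ENNReal.ofReal_one, ← ENNReal.ofReal_sub _ hs0,
      ENNReal.toReal_ofReal (by linarith)]
  rw [ENNReal.toReal_mul, ENNReal.toReal_prod, ENNReal.toReal_prod,
    ENNReal.toReal_sum (fun w _ => ENNReal.pow_ne_top ENNReal.ofReal_ne_top)] at h
  simp only [ENNReal.toReal_pow, ENNReal.toReal_ofReal h0.le] at h
  rw [Finset.prod_congr rfl fun j _ => by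
      rw [← ENNReal.ofReal_pow h0.le, hr _ (by positivity) (hlt j)],
    hr t h0.le h1, Finset.prod_const, Finset.card_univ, Fintype.card_fin,
    Finset.prod_inv_distrib] at h
  have h2 : ∏ j, (1 - t ^ c.d j) ≠ 0 := Finset.prod_ne_zero_iff.2 fun j _ => by
    linarith [hlt j]
  have h3 : (1 - t) ≠ 0 := by linarith
  rw [inv_pow] at h
  field_simp at h
  linarith

/-- The length generating polynomial factors as a product of quantum integers. -/
theorem sum_pow_len :
    ∑ w, (Polynomial.X : Polynomial ℝ) ^ c.len w =
      ∏ j, ∑ i ∈ range (c.d j), Polynomial.X ^ i := by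
  have h1 : (∑ w, (Polynomial.X : Polynomial ℝ) ^ c.len w) * (1 - Polynomial.X) ^ n =
      ∏ j, (1 - Polynomial.X ^ c.d j) := by
    refine Polynomial.eq_of_infinite_eval_eq _ _ ((Set.Ioo_infinite (zero_lt_one' ℝ)).mono ?_)
    rintro t ⟨h0, h1⟩
    have := c.sum_pow_len_real h0 h1
    simp only [Set.mem_ofPred_eq, Polynomial.eval_mul, Polynomial.eval_finsetSum,
      Polynomial.eval_pow, Polynomial.eval_X, Polynomial.eval_sub, Polynomial.eval_one,
      Polynomial.eval_prod]
    exact this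
  have h2 : (1 - Polynomial.X : Polynomial ℝ) ^ n ≠ 0 := by
    refine pow_ne_zero _ (sub_ne_zero.2 fun h => ?_)
    have := congrArg (Polynomial.eval 0) h
    simp at this
  refine mul_right_cancel₀ h2 (h1.trans ?_)
  have h3 : (1 - Polynomial.X : Polynomial ℝ) ^ n = ∏ _j : Fin n, (1 - Polynomial.X) := by simp
  rw [h3, ← Finset.prod_mul_distrib]
  refine Finset.prod_congr rfl fun j _ => ?_
  have := geom_sum_mul (Polynomial.X : Polynomial ℝ) (c.d j)
  linear_combination this

end CoxeterData

variable {n : ℕ}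

/-- A weight growing linearly at infinity. -/
def wt (x : Fin n → ℝ) : ℝ := 1 + ∑ i, |x i|

/-- The unnormalised Gaussian density. -/
def gauss (x : Fin n → ℝ) : ℝ := Real.exp (-(∑ i, x i ^ 2) / 2)

theorem one_le_wt (x : Fin n → ℝ) : 1 ≤ wt x := by
  have : 0 ≤ ∑ i, |x i| := Finset.sum_nonneg fun i _ => abs_nonneg _
  unfold wt; linarith

theorem abs_le_wt (x : Fin n → ℝ) (i : Fin n) : |x i| ≤ wt x := by
  have := Finset.single_le_sum (f := fun i => |x i|) (fun i _ => abs_nonneg _) (Finset.mem_univ i)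
  unfold wt; linarith

theorem gauss_pos (x : Fin n → ℝ) : 0 < gauss x := Real.exp_pos _

theorem continuous_gauss : Continuous (gauss : (Fin n → ℝ) → ℝ) := by
  unfold gauss; fun_prop

theorem integrable_exp_wt_gauss (A : ℝ) :
    Integrable fun x : Fin n → ℝ => Real.exp (A * wt x) * gauss x := by
  have h1 : Integrable fun t : ℝ => Real.exp (A * |t| - t ^ 2 / 2) := by
    have h := (integrable_exp_neg_mul_sq (b := 1 / 4) (by norm_num)).const_mul (Real.exp (A ^ 2))
    refine h.mono' (by fun_prop) (Filter.Eventually.of_forall fun t => ?_)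
    rw [Real.norm_eq_abs, abs_of_pos (Real.exp_pos _), ← Real.exp_add]
    refine Real.exp_le_exp.2 ?_
    nlinarith [sq_nonneg (A - |t| / 2), sq_abs t]
  have h2 := Integrable.fintype_prod (μ := fun _ : Fin n => volume) (fun _ => h1)
  refine (h2.const_mul (Real.exp A)).congr (Filter.Eventually.of_forall fun x => ?_)
  dsimp only
  rw [← Real.exp_sum, ← Real.exp_add, gauss, ← Real.exp_add]
  congr 1
  simp only [wt, Finset.sum_sub_distrib, ← mul_sum, ← Finset.sum_div]
  ring

theorem integrable_gauss : Integrable (gauss : (Fin n → ℝ) → ℝ) := by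
  simpa using integrable_exp_wt_gauss (n := n) 0

theorem integral_gauss_pos : 0 < ∫ x : Fin n → ℝ, gauss x := by
  refine (integral_pos_iff_support_of_nonneg (fun x => (gauss_pos x).le) integrable_gauss).2 ?_
  have : Function.support (gauss : (Fin n → ℝ) → ℝ) = Set.univ := by
    ext x; simp [(gauss_pos x).ne']
  rw [this]
  exact isOpen_univ.measure_pos volume Set.univ_nonempty

section growth

variable {T : Type*} {S : Set T}

/-- At most linear growth in `x`, uniformly for parameters in `S`. -/
def LinBdd (S : Set T) (F : T → (Fin n → ℝ) → ℂ) : Prop :=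
  ∃ A : ℝ, 0 ≤ A ∧ ∀ τ ∈ S, ∀ x, ‖F τ x‖ ≤ A * wt x

/-- At most exponential growth in `x`, uniformly for parameters in `S`. -/
def Tame (S : Set T) (F : T → (Fin n → ℝ) → ℂ) : Prop :=
  ∃ A : ℝ, 0 ≤ A ∧ ∀ τ ∈ S, ∀ x, ‖F τ x‖ ≤ Real.exp (A * wt x)

theorem LinBdd.add {F G : T → (Fin n → ℝ) → ℂ} (hF : LinBdd S F) (hG : LinBdd S G) :
    LinBdd S fun τ x => F τ x + G τ x := by
  obtain ⟨A, hA, h1⟩ := hF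
  obtain ⟨B, hB, h2⟩ := hG
  refine ⟨A + B, by positivity, fun τ hτ x => (norm_add_le _ _).trans ?_⟩
  have := h1 τ hτ x
  have := h2 τ hτ x
  linarith

theorem LinBdd.of_bdd {F : T → (Fin n → ℝ) → ℂ} (M : ℝ) (h : ∀ τ ∈ S, ∀ x, ‖F τ x‖ ≤ M) :
    LinBdd S F := by
  refine ⟨|M|, abs_nonneg _, fun τ hτ x => (h τ hτ x).trans ?_⟩
  have := one_le_wt x
  have := le_abs_self M
  have := abs_nonneg M
  nlinarith

theorem LinBdd.mul_bdd {F G : T → (Fin n → ℝ) → ℂ} (M : ℝ) (hG : ∀ τ ∈ S, ∀ x, ‖G τ x‖ ≤ M)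
    (hF : LinBdd S F) : LinBdd S fun τ x => G τ x * F τ x := by
  obtain ⟨A, hA, h1⟩ := hF
  refine ⟨|M| * A, by positivity, fun τ hτ x => ?_⟩
  rw [norm_mul, mul_assoc]
  exact mul_le_mul ((hG τ hτ x).trans (le_abs_self M)) (h1 τ hτ x) (norm_nonneg _) (abs_nonneg _)

theorem LinBdd.sum {ι : Type*} (s : Finset ι) {F : ι → T → (Fin n → ℝ) → ℂ}
    (h : ∀ i ∈ s, LinBdd S (F i)) : LinBdd S fun τ x => ∑ i ∈ s, F i τ x := by
  classical
  induction s using Finset.induction_on with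
  | empty => exact LinBdd.of_bdd 0 (by simp)
  | insert a s ha ih =>
    simp only [Finset.sum_insert ha]
    exact (h a (by simp)).add (ih fun i hi => h i (by simp [hi]))

theorem LinBdd.tame {F : T → (Fin n → ℝ) → ℂ} (h : LinBdd S F) : Tame S F := by
  obtain ⟨A, hA, h1⟩ := h
  refine ⟨A, hA, fun τ hτ x => (h1 τ hτ x).trans ?_⟩
  linarith [Real.add_one_le_exp (A * wt x)]

theorem LinBdd.exp {F : T → (Fin n → ℝ) → ℂ} (h : LinBdd S F) :
    Tame S fun τ x => Complex.exp (F τ x) := by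
  obtain ⟨A, hA, h1⟩ := h
  refine ⟨A, hA, fun τ hτ x => ?_⟩
  rw [Complex.norm_exp]
  exact Real.exp_le_exp.2 ((Complex.re_le_norm _).trans (h1 τ hτ x))

theorem norm_log_le (w : ℂ) (hw : w ≠ 0) : ‖Complex.log w‖ ≤ ‖w‖ + ‖w‖⁻¹ + Real.pi := by
  refine (Complex.norm_le_abs_re_add_abs_im _).trans ?_
  rw [Complex.log_re, Complex.log_im]
  have h0 : 0 < ‖w‖ := norm_pos_iff.2 hw
  have h1 := Real.log_le_sub_one_of_pos h0
  have h2 := Real.log_le_sub_one_of_pos (inv_pos.2 h0)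
  rw [Real.log_inv] at h2
  have h3 := Complex.abs_arg_le_pi w
  have h4 : |Real.log ‖w‖| ≤ ‖w‖ + ‖w‖⁻¹ := by
    rw [abs_le]
    constructor <;> linarith [inv_pos.2 h0]
  linarith

theorem LinBdd.log {F : T → (Fin n → ℝ) → ℂ} (h : LinBdd S F) {ε : ℝ} (hε : 0 < ε)
    (hF : ∀ τ ∈ S, ∀ x, ε ≤ ‖F τ x‖) : LinBdd S fun τ x => Complex.log (F τ x) := by
  obtain ⟨A, hA, h1⟩ := h
  refine ⟨A + (ε⁻¹ + Real.pi), by positivity, fun τ hτ x => ?_⟩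
  have h2 := hF τ hτ x
  have h3 : F τ x ≠ 0 := norm_pos_iff.1 (hε.trans_le h2)
  refine (norm_log_le _ h3).trans ?_
  have h4 : ‖F τ x‖⁻¹ ≤ ε⁻¹ := inv_anti₀ hε h2
  have h5 := h1 τ hτ x
  have h6 : ε⁻¹ + Real.pi ≤ (ε⁻¹ + Real.pi) * wt x :=
    le_mul_of_one_le_right (by positivity) (one_le_wt x)
  linarith

theorem Tame.mul {F G : T → (Fin n → ℝ) → ℂ} (hF : Tame S F) (hG : Tame S G) :
    Tame S fun τ x => F τ x * G τ x := by
  obtain ⟨A, hA, h1⟩ := hF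
  obtain ⟨B, hB, h2⟩ := hG
  refine ⟨A + B, by positivity, fun τ hτ x => ?_⟩
  rw [norm_mul, add_mul, Real.exp_add]
  exact mul_le_mul (h1 τ hτ x) (h2 τ hτ x) (norm_nonneg _) (Real.exp_pos _).le

theorem Tame.add {F G : T → (Fin n → ℝ) → ℂ} (hF : Tame S F) (hG : Tame S G) :
    Tame S fun τ x => F τ x + G τ x := by
  obtain ⟨A, hA, h1⟩ := hF
  obtain ⟨B, hB, h2⟩ := hG
  refine ⟨A + B + 1, by positivity, fun τ hτ x => (norm_add_le _ _).trans ?_⟩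
  have hw := one_le_wt x
  have e1 : ‖F τ x‖ ≤ Real.exp ((A + B) * wt x) :=
    (h1 τ hτ x).trans (Real.exp_le_exp.2 (by nlinarith))
  have e2 : ‖G τ x‖ ≤ Real.exp ((A + B) * wt x) :=
    (h2 τ hτ x).trans (Real.exp_le_exp.2 (by nlinarith))
  rw [add_mul _ 1, Real.exp_add, one_mul]
  have e3 : 2 ≤ Real.exp (wt x) := by linarith [Real.add_one_le_exp (wt x)]
  nlinarith [Real.exp_pos ((A + B) * wt x)]

theorem Tame.of_bdd {F : T → (Fin n → ℝ) → ℂ} (M : ℝ) (h : ∀ τ ∈ S, ∀ x, ‖F τ x‖ ≤ M) :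
    Tame S F := (LinBdd.of_bdd M h).tame

theorem Tame.const (a : ℂ) : Tame S fun (_ : T) (_ : Fin n → ℝ) => a :=
  Tame.of_bdd ‖a‖ fun _ _ _ => le_rfl

theorem Tame.sum {ι : Type*} (s : Finset ι) {F : ι → T → (Fin n → ℝ) → ℂ}
    (h : ∀ i ∈ s, Tame S (F i)) : Tame S fun τ x => ∑ i ∈ s, F i τ x := by
  classical
  induction s using Finset.induction_on with
  | empty => exact Tame.of_bdd 0 (by simp)
  | insert a s ha ih =>
    simp only [Finset.sum_insert ha]
    exact (h a (by simp)).add (ih fun i hi => h i (by simp [hi]))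

theorem Tame.eval {z : T → (Fin n → ℝ) → Fin n → ℂ} (hz : ∀ i, Tame S fun τ x => z τ x i)
    (q : MvPolynomial (Fin n) ℂ) : Tame S fun τ x => eval (z τ x) q := by
  induction q using MvPolynomial.induction_on with
  | C a => simpa using Tame.const a
  | add p q hp hq => simpa using hp.add hq
  | mul_X p i hp => simpa using hp.mul (hz i)

theorem Tame.integrable {F : T → (Fin n → ℝ) → ℂ} (h : Tame S F) {τ : T} (hτ : τ ∈ S)
    (hc : Continuous (F τ)) : Integrable fun x => F τ x * (gauss x : ℂ) := by
  obtain ⟨A, hA, h1⟩ := h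
  have hg : Continuous fun x : Fin n → ℝ => (gauss x : ℂ) :=
    Complex.continuous_ofReal.comp continuous_gauss
  refine (integrable_exp_wt_gauss A).mono' (hc.mul hg).aestronglyMeasurable
    (Filter.Eventually.of_forall fun x => ?_)
  rw [norm_mul, Complex.norm_real, Real.norm_eq_abs, abs_of_pos (gauss_pos x)]
  exact mul_le_mul_of_nonneg_right (h1 τ hτ x) (gauss_pos x).le

end growth

theorem hasDerivAt_integral_of_tame {a b : ℝ} {F F' : ℝ → (Fin n → ℝ) → ℂ}
    (hF : Tame (Set.Ioo a b) F) (hF' : Tame (Set.Ioo a b) F')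
    (hc : ∀ τ ∈ Set.Ioo a b, Continuous (F τ)) (hc' : ∀ τ ∈ Set.Ioo a b, Continuous (F' τ))
    (hd : ∀ τ ∈ Set.Ioo a b, ∀ x, HasDerivAt (fun t => F t x * (gauss x : ℂ))
      (F' τ x * (gauss x : ℂ)) τ) {τ : ℝ} (hτ : τ ∈ Set.Ioo a b) :
    HasDerivAt (fun t => ∫ x, F t x * (gauss x : ℂ)) (∫ x, F' τ x * (gauss x : ℂ)) τ := by
  obtain ⟨A, hA, h1⟩ := id hF'
  have hs : Set.Ioo a b ∈ 𝓝 τ := Ioo_mem_nhds hτ.1 hτ.2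
  refine (hasDerivAt_integral_of_dominated_loc_of_deriv_le hs
    (F := fun t x => F t x * (gauss x : ℂ)) (F' := fun t x => F' t x * (gauss x : ℂ))
    (bound := fun x => Real.exp (A * wt x) * gauss x) ?_ (hF.integrable hτ (hc τ hτ))
    (hF'.integrable hτ (hc' τ hτ)).aestronglyMeasurable ?_ (integrable_exp_wt_gauss A) ?_).2
  · filter_upwards [hs] with t ht using (hF.integrable ht (hc t ht)).aestronglyMeasurable
  · refine Filter.Eventually.of_forall fun x t ht => ?_
    rw [norm_mul, Complex.norm_real, Real.norm_eq_abs, abs_of_pos (gauss_pos x)]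
    exact mul_le_mul_of_nonneg_right (h1 t ht x) (gauss_pos x).le
  · exact Filter.Eventually.of_forall fun x t ht => hd t ht x

theorem integral_lineDeriv_eq_zero {g g' : (Fin n → ℝ) → ℂ} {v : Fin n → ℝ} (hg : Integrable g)
    (hg' : Integrable g') (h : ∀ x, HasLineDerivAt ℝ g (g' x) x v) : ∫ x, g' x = 0 := by
  have := integral_bilinear_hasLineDerivAt_right_eq_neg_left_of_integrable (μ := volume)
    (f := fun _ : Fin n → ℝ => (1 : ℂ)) (f' := fun _ => 0) (g := g) (g' := g') (v := v)
    (B := ContinuousLinearMap.mul ℝ ℂ) (by simp) (by simpa using hg') (by simpa using hg)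
    (fun x _ => ?_) (fun x _ => h x)
  · simpa using this
  · simpa [HasLineDerivAt] using hasDerivAt_const (0 : ℝ) (1 : ℂ)

variable {n : ℕ}

/-- The point `y + i x`. -/
def zpt (y x : Fin n → ℝ) : Fin n → ℂ := fun i => (y i : ℂ) + (x i : ℂ) * I

theorem dotC_zpt (α y x : Fin n → ℝ) :
    dotC α (zpt y x) = (dotR α y : ℂ) + (dotR α x : ℂ) * I := by
  simp only [dotC, zpt, dotR, Complex.ofReal_sum, Complex.ofReal_mul, mul_add,
    sum_add_distrib, Finset.sum_mul, mul_assoc]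

theorem dotC_zpt_re (α y x : Fin n → ℝ) : (dotC α (zpt y x)).re = dotR α y := by
  simp [dotC_zpt]

theorem dotC_zpt_ne_zero {α y : Fin n → ℝ} (h : 0 < dotR α y) (x : Fin n → ℝ) :
    dotC α (zpt y x) ≠ 0 := fun h0 => by
  have := dotC_zpt_re α y x
  rw [h0] at this
  simp at this
  linarith

theorem hasDerivAt_eval {z : ℝ → Fin n → ℂ} {ζ : Fin n → ℂ} {τ : ℝ}
    (hz : ∀ i, HasDerivAt (fun t => z t i) (ζ i) τ) (q : MvPolynomial (Fin n) ℂ) :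
    HasDerivAt (fun t => eval (z t) q)
      (∑ i, ζ i * eval (z τ) (pderiv i q)) τ := by
  induction q using MvPolynomial.induction_on with
  | C a => simpa using hasDerivAt_const τ a
  | add p q hp hq =>
    simpa [mul_add, sum_add_distrib] using hp.fun_add hq
  | mul_X p j hp =>
    have := hp.mul (hz j)
    simp only [MvPolynomial.eval_mul, MvPolynomial.eval_X]
    refine this.congr_deriv ?_
    simp only [Derivation.leibniz, smul_eq_mul, MvPolynomial.eval_add, MvPolynomial.eval_mul,
      MvPolynomial.eval_X, mul_add, sum_add_distrib, MvPolynomial.pderiv_X]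
    rw [add_comm, Finset.sum_mul]
    congr 1
    · rw [Finset.sum_eq_single j]
      · simp; ring
      · intro i _ hij
        simp [hij.symm]
      · simp
    · exact sum_congr rfl fun i _ => by ring

theorem hasDerivAt_dotC {z : ℝ → Fin n → ℂ} {ζ : Fin n → ℂ} {τ : ℝ}
    (hz : ∀ i, HasDerivAt (fun t => z t i) (ζ i) τ) (α : Fin n → ℝ) :
    HasDerivAt (fun t => dotC α (z t)) (dotC α ζ) τ := by
  unfold dotC
  exact HasDerivAt.fun_sum fun i _ => (hz i).const_mul _

namespace CoxeterData

variable (c : CoxeterData n)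

/-- The logarithm of the product of the positive roots. -/
def lg (z : Fin n → ℂ) : ℂ := ∑ α ∈ c.R, Complex.log (dotC α z)

/-- The weight `exp((μ,z)) δ(z)^{2k} exp((z,z)/2)`. -/
def om (k : ℂ) (μ : Fin n → ℝ) (z : Fin n → ℂ) : ℂ :=
  Complex.exp (dotC μ z + 2 * k * c.lg z + (∑ i, z i ^ 2) / 2)

/-- The weight `om` on a vertical contour with its Gaussian factor removed. -/
def pre (k : ℂ) (μ y x : Fin n → ℝ) : ℂ :=
  Complex.exp (dotC μ (zpt y x) + 2 * k * c.lg (zpt y x) +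
    ((∑ i, (y i : ℂ) ^ 2) / 2 + I * ∑ i, (y i : ℂ) * x i))

theorem om_zpt (k : ℂ) (μ y x : Fin n → ℝ) :
    c.om k μ (zpt y x) = c.pre k μ y x * (gauss x : ℂ) := by
  have e : (∑ i, zpt y x i ^ 2) / 2 = (∑ i, (y i : ℂ) ^ 2) / 2 + I * ∑ i, (y i : ℂ) * x i +
      ((-(∑ i, x i ^ 2) / 2 : ℝ) : ℂ) := by
    push_cast
    rw [neg_div, ← sub_eq_add_neg, mul_sum, Finset.sum_div, Finset.sum_div, Finset.sum_div,
      ← sum_add_distrib, ← Finset.sum_sub_distrib]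
    refine sum_congr rfl fun i _ => ?_
    rw [zpt]
    linear_combination (x i : ℂ) ^ 2 / 2 * Complex.I_sq
  rw [om, pre, gauss, Complex.ofReal_exp, ← Complex.exp_add, e, ← add_assoc]

/-- Parameters for which the contour stays in a compact part of the open chamber. -/
structure Good {T : Type*} (S : Set T) (y : T → Fin n → ℝ) (M ε : ℝ) : Prop where
  bdd : ∀ τ ∈ S, ∀ i, |y τ i| ≤ M
  pos : 0 < ε
  le : ∀ τ ∈ S, ∀ α ∈ c.R, ε ≤ dotR α (y τ)

section

variable {c} {T : Type*} {S : Set T} {y : T → Fin n → ℝ} {M ε : ℝ}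

theorem linBdd_zpt (hy : ∀ τ ∈ S, ∀ i, |y τ i| ≤ M) (i : Fin n) :
    LinBdd S fun τ x => zpt (y τ) x i := by
  refine LinBdd.add (LinBdd.of_bdd M fun τ hτ x => ?_) ⟨1, zero_le_one, fun τ _ x => ?_⟩
  · simpa using hy τ hτ i
  · simpa using abs_le_wt x i

theorem linBdd_dotC {μ : T → Fin n → ℝ} {M' : ℝ} (hμ : ∀ τ ∈ S, ∀ i, |μ τ i| ≤ M')
    (hy : ∀ τ ∈ S, ∀ i, |y τ i| ≤ M) :
    LinBdd S fun τ x => dotC (μ τ) (zpt (y τ) x) :=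
  LinBdd.sum _ fun i _ => LinBdd.mul_bdd M' (fun τ hτ x => by simpa using hμ τ hτ i)
    (linBdd_zpt hy i)

theorem Good.norm_le (h : c.Good S y M ε) {τ : T} (hτ : τ ∈ S) {α : Fin n → ℝ} (hα : α ∈ c.R)
    (x : Fin n → ℝ) : ε ≤ ‖dotC α (zpt (y τ) x)‖ := by
  have := Complex.re_le_norm (dotC α (zpt (y τ) x))
  rw [dotC_zpt_re] at this
  exact (h.le τ hτ α hα).trans this

theorem Good.tame_inv (h : c.Good S y M ε) {α : Fin n → ℝ} (hα : α ∈ c.R) :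
    Tame S fun τ x => (dotC α (zpt (y τ) x))⁻¹ := by
  refine Tame.of_bdd ε⁻¹ fun τ hτ x => ?_
  rw [norm_inv]
  exact inv_anti₀ h.pos (h.norm_le hτ hα x)

theorem Good.linBdd_lg (h : c.Good S y M ε) : LinBdd S fun τ x => c.lg (zpt (y τ) x) := by
  refine LinBdd.sum _ fun α hα => LinBdd.log (linBdd_dotC (μ := fun _ => α)
    (M' := ∑ i, |α i|) (fun τ _ i => ?_) h.bdd) h.pos fun τ hτ x => h.norm_le hτ hα x
  exact Finset.single_le_sum (f := fun i => |α i|) (fun i _ => abs_nonneg _) (Finset.mem_univ i)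

theorem Good.tame_pre (h : c.Good S y M ε) {k : T → ℂ} {K : ℝ} (hk : ∀ τ ∈ S, ‖k τ‖ ≤ K)
    {μ : T → Fin n → ℝ} {M' : ℝ} (hμ : ∀ τ ∈ S, ∀ i, |μ τ i| ≤ M') :
    Tame S fun τ x => c.pre (k τ) (μ τ) (y τ) x := by
  refine LinBdd.exp (((linBdd_dotC hμ h.bdd).add
    (LinBdd.mul_bdd (2 * K) (fun τ hτ x => ?_) h.linBdd_lg)).add (LinBdd.add ?_ ?_))
  · rw [norm_mul]
    have := hk τ hτ
    simpa using this
  · refine LinBdd.of_bdd ((∑ _i : Fin n, M ^ 2) / 2) fun τ hτ x => ?_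
    rw [norm_div, Complex.norm_two]
    gcongr
    refine (norm_sum_le _ _).trans (Finset.sum_le_sum fun i _ => ?_)
    rw [norm_pow, Complex.norm_real, Real.norm_eq_abs]
    gcongr
    exact h.bdd τ hτ i
  · refine LinBdd.mul_bdd 1 (G := fun _ _ => I) (fun τ hτ x => by simp) (LinBdd.sum _ fun i _ =>
      LinBdd.mul_bdd M (fun τ hτ x => by simpa using h.bdd τ hτ i)
        ⟨1, zero_le_one, fun τ _ x => ?_⟩)
    simpa using abs_le_wt x i

theorem Good.tame_eval (h : c.Good S y M ε) (q : MvPolynomial (Fin n) ℂ) :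
    Tame S fun τ x => eval (zpt (y τ) x) q :=
  Tame.eval (fun i => (linBdd_zpt h.bdd i).tame) q

end

theorem continuous_zpt (y : Fin n → ℝ) : Continuous (zpt y) := by
  unfold zpt; fun_prop

theorem continuous_eval_zpt (q : MvPolynomial (Fin n) ℂ) (y : Fin n → ℝ) :
    Continuous fun x => eval (zpt y x) q :=
  (MvPolynomial.continuous_eval q).comp (continuous_zpt y)

theorem continuous_dotC (α : Fin n → ℝ) : Continuous (dotC α) := by
  unfold dotC; fun_prop

theorem mem_slitPlane {y : Fin n → ℝ} (hy : ∀ α ∈ c.R, 0 < dotR α y) {α : Fin n → ℝ}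
    (hα : α ∈ c.R) (x : Fin n → ℝ) : dotC α (zpt y x) ∈ Complex.slitPlane :=
  Or.inl (by rw [dotC_zpt_re]; exact hy α hα)

theorem continuous_pre (k : ℂ) (μ : Fin n → ℝ) {y : Fin n → ℝ} (hy : ∀ α ∈ c.R, 0 < dotR α y) :
    Continuous (c.pre k μ y) := by
  have h1 : Continuous fun x => c.lg (zpt y x) :=
    continuous_finsetSum _ fun α hα =>
      ((continuous_dotC α).comp (continuous_zpt y)).clog fun x => c.mem_slitPlane hy hα x
  have h2 : Continuous fun x => dotC μ (zpt y x) := (continuous_dotC μ).comp (continuous_zpt y)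
  unfold pre
  fun_prop

/-- The logarithmic gradient of `om`. -/
def lgrad (k : ℂ) (μ : Fin n → ℝ) (z : Fin n → ℂ) (i : Fin n) : ℂ :=
  (μ i : ℂ) + z i + 2 * k * ∑ α ∈ c.R, (α i : ℂ) * (dotC α z)⁻¹

theorem hasDerivAt_om {z : ℝ → Fin n → ℂ} {ζ : Fin n → ℂ} {τ : ℝ}
    (hz : ∀ i, HasDerivAt (fun t => z t i) (ζ i) τ) (k : ℂ) (μ : Fin n → ℝ)
    (hs : ∀ α ∈ c.R, dotC α (z τ) ∈ Complex.slitPlane) :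
    HasDerivAt (fun t => c.om k μ (z t)) ((∑ i, ζ i * c.lgrad k μ (z τ) i) * c.om k μ (z τ)) τ := by
  have h1 : HasDerivAt (fun t => c.lg (z t)) (∑ α ∈ c.R, dotC α ζ / dotC α (z τ)) τ := by
    unfold lg
    exact HasDerivAt.fun_sum fun α hα => (hasDerivAt_dotC hz α).clog_real (hs α hα)
  have h2 : HasDerivAt (fun t => (∑ i, z t i ^ 2) / 2) ((∑ i, 2 * z τ i * ζ i) / 2) τ := by
    refine HasDerivAt.div_const (HasDerivAt.fun_sum fun i _ => ?_) 2
    simpa using (hz i).fun_pow 2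
  have h3 := (((hasDerivAt_dotC hz μ).add (h1.const_mul (2 * k))).add h2).cexp
  refine h3.congr_deriv ?_
  rw [mul_comm]
  change _ * c.om k μ (z τ) = _
  congr 1
  simp only [lgrad, dotC, mul_add, sum_add_distrib, mul_sum, Finset.sum_div]
  have e : ∑ α ∈ c.R, ∑ i, 2 * k * ((α i : ℂ) * ζ i / ∑ i, (α i : ℂ) * z τ i) =
    ∑ i, ∑ α ∈ c.R, ζ i * (2 * k * ((α i : ℂ) * (∑ i, (α i : ℂ) * z τ i)⁻¹)) := by
    rw [Finset.sum_comm]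
    refine sum_congr rfl fun i _ => sum_congr rfl fun α _ => ?_
    rw [div_eq_mul_inv]; ring
  rw [e]
  have e2 : ∑ i, 2 * z τ i * ζ i / 2 = ∑ i, ζ i * z τ i :=
    sum_congr rfl fun i _ => by ring
  have e3 : ∑ i, (μ i : ℂ) * ζ i = ∑ i, ζ i * (μ i : ℂ) :=
    sum_congr rfl fun i _ => by ring
  rw [e2, e3]
  ring

/-- The gradient of `q · om` divided by `om`. -/
def dG (k : ℂ) (μ : Fin n → ℝ) (q : MvPolynomial (Fin n) ℂ) (z : Fin n → ℂ) (i : Fin n) : ℂ :=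
  eval z (pderiv i q) + c.lgrad k μ z i * eval z q

theorem hasDerivAt_eval_mul_om {z : ℝ → Fin n → ℂ} {ζ : Fin n → ℂ} {τ : ℝ}
    (hz : ∀ i, HasDerivAt (fun t => z t i) (ζ i) τ) (k : ℂ) (μ : Fin n → ℝ)
    (hs : ∀ α ∈ c.R, dotC α (z τ) ∈ Complex.slitPlane) (q : MvPolynomial (Fin n) ℂ) :
    HasDerivAt (fun t => eval (z t) q * c.om k μ (z t))
      ((∑ i, ζ i * c.dG k μ q (z τ) i) * c.om k μ (z τ)) τ := by
  refine ((hasDerivAt_eval hz q).mul (c.hasDerivAt_om hz k μ hs)).congr_deriv ?_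
  simp only [dG, mul_add, sum_add_distrib, add_mul]
  congr 1
  rw [← mul_assoc, mul_comm (eval _ q), Finset.sum_mul]
  congr 1
  exact sum_congr rfl fun i _ => by ring

theorem tame_dG {T : Type*} {S : Set T} {y : T → Fin n → ℝ} {M ε : ℝ} (h : c.Good S y M ε)
    (k : ℂ) (μ : Fin n → ℝ) (q : MvPolynomial (Fin n) ℂ) (i : Fin n) :
    Tame S fun τ x => c.dG k μ q (zpt (y τ) x) i :=
  (h.tame_eval _).add ((((Tame.const _).add (linBdd_zpt h.bdd i).tame).add ((Tame.const _).mul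
    (Tame.sum _ fun _ hα => (Tame.const _).mul (h.tame_inv hα)))).mul (h.tame_eval _))

theorem continuous_dG (k : ℂ) (μ : Fin n → ℝ) {y : Fin n → ℝ} (hy : ∀ α ∈ c.R, 0 < dotR α y)
    (q : MvPolynomial (Fin n) ℂ) (i : Fin n) : Continuous fun x => c.dG k μ q (zpt y x) i := by
  have h1 : Continuous fun x => ∑ α ∈ c.R, (α i : ℂ) * (dotC α (zpt y x))⁻¹ :=
    continuous_finsetSum _ fun α hα => continuous_const.mul
      (((continuous_dotC α).comp (continuous_zpt y)).inv₀
        fun x => dotC_zpt_ne_zero (hy α hα) x)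
  have h2 := continuous_eval_zpt q y
  have h3 := continuous_eval_zpt (pderiv i q) y
  have h4 : Continuous fun x => zpt y x i := (continuous_apply i).comp (continuous_zpt y)
  unfold dG lgrad
  fun_prop

theorem exists_good {y : Fin n → ℝ} (hy : ∀ α ∈ c.R, 0 < dotR α y) :
    ∃ M ε, c.Good (Set.univ : Set Unit) (fun _ => y) M ε := by
  obtain ⟨ε, h0, h⟩ : ∃ ε > 0, ∀ α ∈ c.R, ε ≤ dotR α y := by
    rcases c.R.eq_empty_or_nonempty with h | h
    · exact ⟨1, one_pos, by simp [h]⟩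
    · obtain ⟨β, hβ, hm⟩ := c.R.exists_min_image (fun α => dotR α y) h
      exact ⟨_, hy β hβ, hm⟩
  exact ⟨∑ i, |y i|, ε, fun _ _ i => Finset.single_le_sum (f := fun i => |y i|)
    (fun i _ => abs_nonneg _) (Finset.mem_univ i), h0, fun _ _ => h⟩

theorem integrable_eval_mul_om (k : ℂ) (μ : Fin n → ℝ) {y : Fin n → ℝ}
    (hy : ∀ α ∈ c.R, 0 < dotR α y) (q : MvPolynomial (Fin n) ℂ) :
    Integrable fun x => eval (zpt y x) q * c.om k μ (zpt y x) := by
  obtain ⟨M, ε, h⟩ := c.exists_good hy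
  have := ((h.tame_eval q).mul (h.tame_pre (k := fun _ => k) (K := ‖k‖) (fun _ _ => le_rfl)
    (μ := fun _ => μ) (M' := ∑ i, |μ i|) fun _ _ i => Finset.single_le_sum (f := fun i => |μ i|)
      (fun i _ => abs_nonneg _) (Finset.mem_univ i))).integrable (Set.mem_univ ())
    ((continuous_eval_zpt q y).mul (c.continuous_pre k μ hy))
  refine this.congr (Filter.Eventually.of_forall fun x => ?_)
  simp only [om_zpt, mul_assoc]

theorem integrable_dG_mul_om (k : ℂ) (μ : Fin n → ℝ) {y : Fin n → ℝ}
    (hy : ∀ α ∈ c.R, 0 < dotR α y) (q : MvPolynomial (Fin n) ℂ) (i : Fin n) :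
    Integrable fun x => c.dG k μ q (zpt y x) i * c.om k μ (zpt y x) := by
  obtain ⟨M, ε, h⟩ := c.exists_good hy
  have := ((c.tame_dG h k μ q i).mul (h.tame_pre (k := fun _ => k) (K := ‖k‖) (fun _ _ => le_rfl)
    (μ := fun _ => μ) (M' := ∑ i, |μ i|) fun _ _ i => Finset.single_le_sum (f := fun i => |μ i|)
      (fun i _ => abs_nonneg _) (Finset.mem_univ i))).integrable (Set.mem_univ ())
    ((c.continuous_dG k μ hy q i).mul (c.continuous_pre k μ hy))
  refine this.congr (Filter.Eventually.of_forall fun x => ?_)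
  simp only [om_zpt, mul_assoc]

theorem integral_dG_mul_om (k : ℂ) (μ : Fin n → ℝ) {y : Fin n → ℝ}
    (hy : ∀ α ∈ c.R, 0 < dotR α y) (q : MvPolynomial (Fin n) ℂ) (i : Fin n) :
    ∫ x, c.dG k μ q (zpt y x) i * c.om k μ (zpt y x) = 0 := by
  have h := integral_lineDeriv_eq_zero (v := Pi.single i 1)
    (g' := fun x => I * (c.dG k μ q (zpt y x) i * c.om k μ (zpt y x)))
    (c.integrable_eval_mul_om k μ hy q)
    ((c.integrable_dG_mul_om k μ hy q i).const_mul I) fun x => ?_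
  · rw [integral_const_mul] at h
    exact (mul_eq_zero.1 h).resolve_left I_ne_zero
  · have hz : ∀ j, HasDerivAt (fun t : ℝ => zpt y (x + t • Pi.single i 1) j)
        (((Pi.single i (1 : ℝ) : Fin n → ℝ) j : ℂ) * I) 0 := fun j => by
      have h1 : HasDerivAt (fun t : ℝ => x j + t * (Pi.single i (1 : ℝ) : Fin n → ℝ) j)
          ((Pi.single i (1 : ℝ) : Fin n → ℝ) j) 0 := by
        simpa using ((hasDerivAt_id (0 : ℝ)).mul_const
          ((Pi.single i (1 : ℝ) : Fin n → ℝ) j)).const_add (x j)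
      simpa [zpt] using (h1.ofReal_comp.mul_const I).const_add (y j : ℂ)
    have := c.hasDerivAt_eval_mul_om hz k μ
      (fun α hα => c.mem_slitPlane hy hα _) q
    rw [HasLineDerivAt]
    refine this.congr_deriv ?_
    simp only [zero_smul, add_zero]
    rw [Finset.sum_eq_single i]
    · simp; ring
    · intro j _ hj
      simp [hj]
    · simp

theorem delta_mul_lgrad (k : ℂ) (μ : Fin n → ℝ) {z : Fin n → ℂ} (hz : ∀ α ∈ c.R, dotC α z ≠ 0)
    (i : Fin n) : eval z (c.delta ℂ) * c.lgrad k μ z i =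
      eval z (c.delta ℂ) * ((μ i : ℂ) + z i) +
        2 * k * eval z (pderiv i (c.delta ℂ)) := by
  have : eval z (pderiv i (c.delta ℂ)) =
      eval z (c.delta ℂ) * ∑ α ∈ c.R, (α i : ℂ) * (dotC α z)⁻¹ := by
    unfold delta
    generalize c.R = A at hz
    induction A using Finset.induction_on with
    | empty => simp
    | insert a A ha ih =>
      have ha0 := hz a (by simp)
      rw [Finset.prod_insert ha, Finset.sum_insert ha, Derivation.leibniz, pderiv_lin]
      simp only [smul_eq_mul, map_add, map_mul, MvPolynomial.eval_C, eval_lin_complex,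
        ih fun α hα => hz α (by simp [hα]), Complex.coe_algebraMap]
      field_simp
      ring
  rw [lgrad, this]
  ring

theorem integral_master (k : ℂ) (μ : Fin n → ℝ) {y : Fin n → ℝ} (hy : ∀ α ∈ c.R, 0 < dotR α y)
    (q : Fin n → MvPolynomial (Fin n) ℂ) (r : MvPolynomial (Fin n) ℂ)
    (h : (∑ j, (pderiv j (q j) + (MvPolynomial.C (μ j : ℂ) + X j) * q j)) * c.delta ℂ +
      MvPolynomial.C (2 * k) * ∑ j, q j * pderiv j (c.delta ℂ) = c.delta ℂ * r) :
    ∫ x, eval (zpt y x) r * c.om k μ (zpt y x) = 0 := by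
  have h1 : ∀ x, eval (zpt y x) r = ∑ j, c.dG k μ (q j) (zpt y x) j := fun x => by
    have hne : ∀ α ∈ c.R, dotC α (zpt y x) ≠ 0 := fun α hα => dotC_zpt_ne_zero (hy α hα) x
    have hδ : eval (zpt y x) (c.delta ℂ) ≠ 0 := by
      rw [eval_delta_complex]
      exact Finset.prod_ne_zero_iff.2 hne
    refine mul_left_cancel₀ hδ ?_
    rw [← MvPolynomial.eval_mul, ← h]
    simp only [map_add, map_mul, map_sum, MvPolynomial.eval_C, MvPolynomial.eval_X, dG]
    rw [Finset.sum_mul, mul_sum, mul_sum, ← sum_add_distrib]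
    refine sum_congr rfl fun j _ => ?_
    linear_combination -eval (zpt y x) (q j) * c.delta_mul_lgrad k μ hne j
  simp only [h1, Finset.sum_mul]
  rw [integral_finsetSum _ fun j _ => c.integrable_dG_mul_om k μ hy (q j) j]
  exact Finset.sum_eq_zero fun j _ => c.integral_dG_mul_om k μ hy (q j) j

theorem good_smul {η : Fin n → ℝ} (hη : ∀ α ∈ c.R, 0 < dotR α η) {a b : ℝ} (ha : 0 < a) :
    ∃ M ε, c.Good (Set.Ioo a b) (fun s : ℝ => s • η) M ε := by
  obtain ⟨M, ε, h⟩ := c.exists_good hη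
  refine ⟨|b| * |M|, a * ε, fun s hs i => ?_, mul_pos ha h.pos, fun s hs α hα => ?_⟩
  · rw [Pi.smul_apply, smul_eq_mul, abs_mul]
    refine mul_le_mul ?_ ((h.bdd () trivial i).trans (le_abs_self M)) (abs_nonneg _) (abs_nonneg _)
    rw [abs_of_pos (ha.trans hs.1)]
    exact hs.2.le.trans (le_abs_self b)
  · rw [dotR_smul_right]
    exact mul_le_mul hs.1.le (h.le () trivial α hα) h.pos.le (ha.trans hs.1).le

theorem pos_smul {η : Fin n → ℝ} (hη : ∀ α ∈ c.R, 0 < dotR α η) {s : ℝ} (hs : 0 < s) :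
    ∀ α ∈ c.R, 0 < dotR α (s • η) := fun α hα => by
  rw [dotR_smul_right]; exact mul_pos hs (hη α hα)

theorem integral_shift (k : ℂ) (μ : Fin n → ℝ) {η : Fin n → ℝ} (hη : ∀ α ∈ c.R, 0 < dotR α η)
    (q : MvPolynomial (Fin n) ℂ) {s t : ℝ} (hs : 0 < s) (ht : 0 < t) :
    ∫ x, eval (zpt (s • η) x) q * c.om k μ (zpt (s • η) x) =
      ∫ x, eval (zpt (t • η) x) q * c.om k μ (zpt (t • η) x) := by
  have hμ : ∀ i, |μ i| ≤ ∑ i, |μ i| := fun i => Finset.single_le_sum (f := fun i => |μ i|)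
      (fun i _ => abs_nonneg _) (Finset.mem_univ i)
  have key : ∀ τ > 0, HasDerivAt (fun s : ℝ => ∫ x, eval (zpt (s • η) x) q *
      c.om k μ (zpt (s • η) x)) 0 τ := fun τ hτ => by
    obtain ⟨M, ε, h⟩ := c.good_smul hη (a := τ / 2) (b := τ + 1) (by linarith)
    have hpos : ∀ s ∈ Set.Ioo (τ / 2) (τ + 1), 0 < s := fun s hs => by
      have := hs.1; linarith
    have hp := h.tame_pre (k := fun _ => k) (K := ‖k‖) (fun _ _ => le_rfl)
      (μ := fun _ => μ) (M' := ∑ i, |μ i|) fun _ _ i => hμ i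
    have hd := hasDerivAt_integral_of_tame ((h.tame_eval q).mul hp)
      (F' := fun s x => (∑ i, (η i : ℂ) * c.dG k μ q (zpt (s • η) x) i) * c.pre k μ (s • η) x)
      ((Tame.sum _ fun i _ => (Tame.const _).mul (c.tame_dG h k μ q i)).mul hp)
      (fun s hs => (continuous_eval_zpt q _).mul (c.continuous_pre k μ (c.pos_smul hη (hpos s hs))))
      (fun s hs => (continuous_finsetSum _ fun i _ => continuous_const.mul
        (c.continuous_dG k μ (c.pos_smul hη (hpos s hs)) q i)).mul
          (c.continuous_pre k μ (c.pos_smul hη (hpos s hs))))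
      (fun s hs x => ?_) (τ := τ) ⟨by linarith, by linarith⟩
    · simp only [mul_assoc, ← om_zpt] at hd
      refine hd.congr_deriv ?_
      simp only [Finset.sum_mul, mul_assoc]
      rw [integral_finsetSum _ fun i _ =>
        ((c.integrable_dG_mul_om k μ (c.pos_smul hη hτ) q i).const_mul _)]
      refine Finset.sum_eq_zero fun i _ => ?_
      rw [integral_const_mul, c.integral_dG_mul_om k μ (c.pos_smul hη hτ), mul_zero]
    · have hz : ∀ j, HasDerivAt (fun t : ℝ => zpt (t • η) x j) (η j : ℂ) s := fun j => by
        have h1 : HasDerivAt (fun t : ℝ => t * η j) (η j) s := by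
          simpa using (hasDerivAt_id s).mul_const (η j)
        simpa [zpt] using h1.ofReal_comp.add_const ((x j : ℂ) * I)
      have := c.hasDerivAt_eval_mul_om hz k μ
        (fun α hα => c.mem_slitPlane (c.pos_smul hη (hpos s hs)) hα _) q
      simpa only [mul_assoc, ← om_zpt] using this
  have hc := (convex_Ioi (0 : ℝ)).is_const_of_fderivWithin_eq_zero (𝕜 := ℝ)
    (f := fun s : ℝ => ∫ x, eval (zpt (s • η) x) q * c.om k μ (zpt (s • η) x))
    (fun τ hτ => (key τ hτ).differentiableAt.differentiableWithinAt) (fun τ hτ => ?_) hs ht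
  · exact hc
  · have := (key τ hτ).hasFDerivAt.hasFDerivWithinAt (s := Set.Ioi 0)
    rw [this.fderivWithin (uniqueDiffOn_Ioi 0 τ hτ)]
    ext
    simp

end CoxeterData

namespace CoxeterData

variable {n : ℕ} (c : CoxeterData n)

theorem exists_dominant (x : Fin n → ℝ) : ∃ w : c.W, ∀ α ∈ c.R, 0 ≤ dotR α (c.act w x) := by
  obtain ⟨v, hv⟩ := c.pos
  obtain ⟨w, -, hw⟩ := Finset.exists_max_image (Finset.univ : Finset c.W)
    (fun w => dotR (c.act w x) v) ⟨1, Finset.mem_univ _⟩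
  refine ⟨w, fun α hα => ?_⟩
  have h := hw (c.s α hα * w) (Finset.mem_univ _)
  rw [act_mul, act_s, dotR_sub_left, dotR_smul_left] at h
  have := hv α hα
  by_contra hneg
  push Not at hneg
  nlinarith

theorem abs_delta_act (w : c.W) (x : Fin n → ℝ) :
    |eval (c.act w x) (c.delta ℝ)| = |eval x (c.delta ℝ)| := by
  rw [← eval_sb, sb_delta]
  rcases c.chi_eq_or w with h | h <;> simp [h]

theorem gauss_act (w : c.W) (x : Fin n → ℝ) : gauss (c.act w x) = gauss x := by
  have h := c.dotR_act w x x
  unfold gauss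
  simp only [dotR, ← pow_two] at h
  rw [h]

theorem hasDerivAt_eval_real (q : MvPolynomial (Fin n) ℝ) (y u : Fin n → ℝ) :
    HasDerivAt (fun t : ℝ => eval (y + t • u) q)
      (∑ i, u i * eval y (pderiv i q)) 0 := by
  have hz : ∀ j, HasDerivAt (fun t : ℝ => (y + t • u) j) (u j) 0 := fun j => by
    simpa using ((hasDerivAt_id (0 : ℝ)).mul_const (u j)).const_add (y j)
  induction q using MvPolynomial.induction_on with
  | C a => simpa using hasDerivAt_const (0 : ℝ) a
  | add p q hp hq =>
    simpa [mul_add, sum_add_distrib] using hp.fun_add hq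
  | mul_X p j hp =>
    have := hp.fun_mul (hz j)
    simp only [MvPolynomial.eval_mul, MvPolynomial.eval_X]
    refine this.congr_deriv ?_
    simp only [Derivation.leibniz, smul_eq_mul, MvPolynomial.eval_add, MvPolynomial.eval_mul,
      MvPolynomial.eval_X, mul_add, sum_add_distrib, MvPolynomial.pderiv_X, zero_smul,
      add_zero]
    rw [add_comm, Finset.sum_mul]
    congr 1
    · rw [Finset.sum_eq_single j]
      · simp; ring
      · intro i _ hij
        simp [hij.symm]
      · simp
    · exact sum_congr rfl fun i _ => by ring

theorem continuous_eval_real (q : MvPolynomial (Fin n) ℝ) :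
    Continuous fun x : Fin n → ℝ => eval x q := MvPolynomial.continuous_eval q

theorem exists_bound_eval (q : MvPolynomial (Fin n) ℝ) :
    ∃ A : ℝ, 0 ≤ A ∧ ∀ x : Fin n → ℝ, |eval x q| ≤ Real.exp (A * wt x) := by
  have h := Tame.eval (T := Unit) (S := Set.univ) (n := n)
    (z := fun _ x i => (x i : ℂ)) (fun i => LinBdd.tame ⟨1, zero_le_one, fun _ _ x => by
      simpa using abs_le_wt x i⟩) (MvPolynomial.map (algebraMap ℝ ℂ) q)
  obtain ⟨A, hA, h1⟩ := h
  refine ⟨A, hA, fun x => ?_⟩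
  have h2 := h1 () trivial x
  have h3 : eval (fun i => (x i : ℂ)) (MvPolynomial.map (algebraMap ℝ ℂ) q) =
      ((eval x q : ℝ) : ℂ) := by
    rw [MvPolynomial.eval_map]
    exact (MvPolynomial.eval₂_comp_left (algebraMap ℝ ℂ) (RingHom.id ℝ) x q).symm
  dsimp only at h2
  rwa [h3, Complex.norm_real] at h2

theorem exists_maximizer : ∃ y : Fin n → ℝ, ∀ x : Fin n → ℝ,
    eval x (c.delta ℝ) ^ 2 * gauss x ≤
      eval y (c.delta ℝ) ^ 2 * gauss y := by
  obtain ⟨A, hA, hb⟩ := exists_bound_eval (c.delta ℝ ^ 2)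
  obtain ⟨v, hv⟩ := c.pos
  have hv0 : 0 < eval v (c.delta ℝ) ^ 2 * gauss v := by
    have : 0 < eval v (c.delta ℝ) := by
      rw [eval_delta_real]; exact Finset.prod_pos hv
    have := gauss_pos v
    positivity
  refine Continuous.exists_forall_ge' (f := fun x => eval x (c.delta ℝ) ^ 2 * gauss x)
    (((continuous_eval_real _).pow 2).mul continuous_gauss) v ?_
  set L := Real.log (eval v (c.delta ℝ) ^ 2 * gauss v)
  have h1 := (tendsto_norm_cocompact_atTop (E := Fin n → ℝ)).eventually_ge_atTop
    (1 + 4 * |A + n * A ^ 2 - L|)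
  filter_upwards [h1] with x hx
  have hx2 : ‖x‖ ^ 2 ≤ ∑ i, x i ^ 2 := by
    rcases isEmpty_or_nonempty (Fin n) with hn | hn
    · have : x = 0 := Subsingleton.elim _ _
      simp [this]
    · obtain ⟨i, hi⟩ := Finset.exists_mem_eq_sup' (Finset.univ_nonempty (α := Fin n)) fun i => ‖x i‖
      have h2 : ‖x‖ = ‖x i‖ := by
        refine le_antisymm ?_ (norm_le_pi_norm x i)
        refine (pi_norm_le_iff_of_nonneg (norm_nonneg _)).2 fun j => ?_
        rw [← hi.2]
        exact Finset.le_sup' (fun i => ‖x i‖) (Finset.mem_univ j)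
      rw [h2, Real.norm_eq_abs, sq_abs]
      exact Finset.single_le_sum (f := fun i => x i ^ 2) (fun i _ => sq_nonneg _) (Finset.mem_univ i)
  have h3 : A * wt x ≤ A + n * A ^ 2 + (∑ i, x i ^ 2) / 4 := by
    have : ∑ i, A * |x i| ≤ ∑ i, (A ^ 2 + x i ^ 2 / 4) := Finset.sum_le_sum fun i _ => by
      nlinarith [sq_nonneg (A - |x i| / 2), sq_abs (x i)]
    rw [sum_add_distrib, ← mul_sum, ← Finset.sum_div] at this
    simp only [Finset.sum_const, Finset.card_univ, Fintype.card_fin, nsmul_eq_mul] at this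
    unfold wt
    linarith
  have h4 : eval x (c.delta ℝ) ^ 2 ≤ Real.exp (A * wt x) := by
    have := (le_abs_self _).trans (hb x)
    rwa [map_pow] at this
  calc _ ≤ Real.exp (A * wt x) * gauss x := mul_le_mul_of_nonneg_right h4 (gauss_pos x).le
    _ = Real.exp (A * wt x + -(∑ i, x i ^ 2) / 2) := by rw [gauss, Real.exp_add]
    _ ≤ Real.exp L := by
      refine Real.exp_le_exp.2 ?_
      have := le_abs_self (A + n * A ^ 2 - L)
      have := abs_nonneg (A + n * A ^ 2 - L)
      nlinarith
    _ = _ := Real.exp_log hv0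

theorem exists_eta : ∃ η : Fin n → ℝ, (∀ α ∈ c.R, 0 < dotR α η) ∧
    ∀ u, ∑ α ∈ c.R, 2 * (dotR α u / dotR α η) = dotR η u := by
  obtain ⟨y, hy⟩ := c.exists_maximizer
  obtain ⟨w, hw⟩ := c.exists_dominant y
  set η := c.act w y
  have hm : ∀ x : Fin n → ℝ, eval x (c.delta ℝ) ^ 2 * gauss x ≤
      eval η (c.delta ℝ) ^ 2 * gauss η := fun x => by
    rw [← sq_abs (eval η _), c.abs_delta_act, sq_abs, c.gauss_act]
    exact hy x
  have hδ : eval η (c.delta ℝ) ≠ 0 := fun h0 => by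
    obtain ⟨v, hv⟩ := c.pos
    have h1 := hm v
    have : 0 < eval v (c.delta ℝ) := by
      rw [eval_delta_real]; exact Finset.prod_pos hv
    have := gauss_pos v
    rw [h0] at h1
    have : 0 < eval v (c.delta ℝ) ^ 2 * gauss v := by positivity
    norm_num at h1
    linarith
  have hpos : ∀ α ∈ c.R, 0 < dotR α η := fun α hα => by
    refine lt_of_le_of_ne (hw α hα) fun h => hδ ?_
    rw [eval_delta_real]
    exact Finset.prod_eq_zero hα h.symm
  refine ⟨η, hpos, fun u => ?_⟩
  have hg : HasDerivAt (fun t : ℝ => gauss (η + t • u)) (-dotR η u * gauss η) 0 := by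
    have h1 : HasDerivAt (fun t : ℝ => -(∑ i, (η + t • u) i ^ 2) / 2) (-dotR η u) 0 := by
      have : HasDerivAt (fun t : ℝ => ∑ i, (η + t • u) i ^ 2) (∑ i, 2 * η i * u i) 0 :=
        HasDerivAt.fun_sum fun j _ => by
          have hz : HasDerivAt (fun t : ℝ => (η + t • u) j) (u j) 0 := by
            simpa using ((hasDerivAt_id (0 : ℝ)).mul_const (u j)).const_add (η j)
          simpa using hz.fun_pow 2
      refine (this.neg.div_const 2).congr_deriv ?_
      rw [dotR, neg_div, Finset.sum_div]
      exact congrArg _ (sum_congr rfl fun i _ => by ring)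
    have := h1.exp
    simp only [zero_smul, add_zero] at this
    rw [mul_comm]
    exact this
  have hd := ((hasDerivAt_eval_real (c.delta ℝ) η u).fun_pow 2).fun_mul hg
  have hmax : IsLocalMax (fun t : ℝ => eval (η + t • u) (c.delta ℝ) ^ 2 *
      gauss (η + t • u)) 0 := Filter.Eventually.of_forall fun t => by
    simpa using hm (η + t • u)
  have h0 := hmax.hasDerivAt_eq_zero hd
  simp only [zero_smul, add_zero] at h0
  have hgr : ∑ i, u i * eval η (pderiv i (c.delta ℝ)) =
      eval η (c.delta ℝ) * ∑ α ∈ c.R, dotR α u / dotR α η := by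
    have h2 := hpos
    unfold delta
    generalize c.R = A at h2
    clear * - h2
    induction A using Finset.induction_on with
    | empty => simp
    | insert a A ha ih =>
      have ha0 := (h2 a (by simp)).ne'
      have ih' := ih fun α hα => h2 α (by simp [hα])
      simp only [Finset.prod_insert ha, Finset.sum_insert ha, Derivation.leibniz, pderiv_lin,
        smul_eq_mul, map_add, map_mul, MvPolynomial.eval_C, eval_lin_real, mul_add,
        sum_add_distrib, Algebra.algebraMap_self, RingHom.id_apply]
      have e1 : ∑ i, u i * (dotR a η * eval η (pderiv i (∏ α ∈ A, lin ℝ α))) =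
          dotR a η * ∑ i, u i * eval η (pderiv i (∏ α ∈ A, lin ℝ α)) := by
        rw [mul_sum]; exact sum_congr rfl fun i _ => by ring
      have e2 : ∑ i, u i * (eval η (∏ α ∈ A, lin ℝ α) * a i) =
          eval η (∏ α ∈ A, lin ℝ α) * dotR a u := by
        rw [dotR, mul_sum]; exact sum_congr rfl fun i _ => by ring
      rw [e1, e2, ih']
      field_simp
      ring
  rw [hgr] at h0
  rw [← mul_sum]
  have h3 : eval η (c.delta ℝ) ^ 2 * gauss η *
      (2 * ∑ α ∈ c.R, dotR α u / dotR α η - dotR η u) = 0 := by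
    rw [← h0]; push_cast; ring
  have := (mul_eq_zero.1 h3).resolve_left (by have := gauss_pos η; positivity)
  linarith

/-- A critical point of `δ² e^{-|y|²/2}` in the open fundamental chamber. -/
def eta : Fin n → ℝ := c.exists_eta.choose

theorem eta_pos : ∀ α ∈ c.R, 0 < dotR α c.eta := c.exists_eta.choose_spec.1

theorem eta_crit (u : Fin n → ℝ) : ∑ α ∈ c.R, 2 * (dotR α u / dotR α c.eta) = dotR c.eta u :=
  c.exists_eta.choose_spec.2 u

theorem eta_sq : dotR c.eta c.eta = 2 * c.R.card := by
  rw [← c.eta_crit c.eta, sum_congr rfl fun α hα => by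
    rw [div_self (c.eta_pos α hα).ne']]
  simp [mul_comm]

/-- The regularised integral of `q δ^{2k}` against the Gaussian over a vertical contour. -/
def J (k : ℂ) (q : MvPolynomial (Fin n) ℝ) : ℂ :=
  ∫ x, aeval (zpt c.eta x) q * c.om k 0 (zpt c.eta x)

theorem aeval_eq_eval_map (z : Fin n → ℂ) (q : MvPolynomial (Fin n) ℝ) :
    aeval z q = eval z (MvPolynomial.map (algebraMap ℝ ℂ) q) := by
  rw [MvPolynomial.eval_map, MvPolynomial.aeval_def]

theorem map_delta : MvPolynomial.map (algebraMap ℝ ℂ) (c.delta ℝ) = c.delta ℂ := by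
  simp [delta, lin, map_prod]

theorem J_C_mul (k : ℂ) (a : ℝ) (q : MvPolynomial (Fin n) ℝ) :
    c.J k (MvPolynomial.C a * q) = a * c.J k q := by
  simp only [J, map_mul, MvPolynomial.aeval_C, mul_assoc]
  exact integral_const_mul _ _

theorem J_master (k : ℂ) {q r : MvPolynomial (Fin n) ℝ} {d : ℕ} (hq : q.IsHomogeneous d)
    (hr : grad2 ℝ (c.delta ℝ) q = c.delta ℝ * r) :
    (d : ℂ) * c.J k q = -c.J k (lapl ℝ q) - 2 * k * c.J k r := by
  set φ := MvPolynomial.map (σ := Fin n) (algebraMap ℝ ℂ)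
  have h := c.integral_master k 0 c.eta_pos (fun j => pderiv j (φ q))
    (φ (lapl ℝ q) + MvPolynomial.C (d : ℂ) * φ q + MvPolynomial.C (2 * k) * φ r) ?_
  · simp only [map_add, map_mul, MvPolynomial.eval_C, add_mul, mul_assoc] at h
    have i1 := c.integrable_eval_mul_om k 0 c.eta_pos (φ (lapl ℝ q))
    have i2 := (c.integrable_eval_mul_om k 0 c.eta_pos (φ q)).const_mul (d : ℂ)
    have i3 := ((c.integrable_eval_mul_om k 0 c.eta_pos (φ r)).const_mul k).const_mul 2
    rw [integral_add (i1.fun_add i2) i3, integral_add i1 i2, integral_const_mul, integral_const_mul,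
      integral_const_mul] at h
    simp only [J, aeval_eq_eval_map]
    linear_combination h
  · have e1 : ∑ j, X j * pderiv j (φ q) = MvPolynomial.C (d : ℂ) * φ q := by
      have := congrArg φ (euler_identity hq)
      simpa [φ, MvPolynomial.pderiv_map] using this
    have e2 : ∑ j, pderiv j (pderiv j (φ q)) = φ (lapl ℝ q) := by
      simp [φ, lapl, MvPolynomial.pderiv_map]
    have e3 : ∑ j, pderiv j (φ q) * pderiv j (c.delta ℂ) = c.delta ℂ * φ r := by
      have := congrArg φ hr
      rw [map_mul, grad2, map_sum] at this
      rw [← map_delta, ← this]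
      refine sum_congr rfl fun j _ => ?_
      simp [φ, MvPolynomial.pderiv_map, mul_comm]
    simp only [Pi.zero_apply, Complex.ofReal_zero, map_zero, zero_add, sum_add_distrib]
    rw [e1, e2, e3]
    ring

theorem inv_lapl {q : MvPolynomial (Fin n) ℝ} (hq : c.Inv ℝ q) : c.Inv ℝ (lapl ℝ q) :=
  fun w => by rw [← lapl_sb, hq w]

theorem exists_ratio (d : ℕ) : ∀ q : MvPolynomial (Fin n) ℝ, c.Inv ℝ q → q.IsHomogeneous (2 * d) →
    ∃ b : Polynomial ℝ, b.natDegree ≤ d ∧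
      ∀ k : ℂ, c.J k q = Polynomial.aeval k b * c.J k 1 := by
  induction d with
  | zero =>
    intro q hq hd
    have : q = MvPolynomial.C (MvPolynomial.coeff 0 q) :=
      MvPolynomial.totalDegree_eq_zero_iff_eq_C.1 (Nat.le_zero.1 hd.totalDegree_le)
    refine ⟨Polynomial.C (MvPolynomial.coeff 0 q), by simp, fun k => ?_⟩
    conv_lhs => rw [this, ← mul_one (MvPolynomial.C _)]
    rw [J_C_mul]
    simp
  | succ d ih =>
    intro q hq hd
    obtain ⟨r, hr, hri, hrd⟩ := c.exists_grad2_delta hq (d := 2 * d) hd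
    obtain ⟨b1, hb1, h1⟩ := ih (lapl ℝ q) (c.inv_lapl hq) (lapl_isHomogeneous ℝ hd)
    obtain ⟨b2, hb2, h2⟩ := ih r hri hrd
    refine ⟨Polynomial.C (-(1 / (2 * (d + 1 : ℝ)))) * (b1 + Polynomial.C 2 * (Polynomial.X * b2)), ?_,
      fun k => ?_⟩
    · refine (Polynomial.natDegree_C_mul_le _ _).trans ?_
      refine (Polynomial.natDegree_add_le _ _).trans (max_le (hb1.trans (Nat.le_succ d)) ?_)
      refine (Polynomial.natDegree_C_mul_le _ _).trans (Polynomial.natDegree_mul_le.trans ?_)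
      rw [Polynomial.natDegree_X]; omega
    · have h := c.J_master k hd hr
      rw [h1, h2] at h
      have hd0 : (d : ℂ) + 1 ≠ 0 := by exact_mod_cast Nat.succ_ne_zero d
      simp only [map_mul, map_add, Polynomial.aeval_C, Polynomial.aeval_X, Complex.coe_algebraMap]
      push_cast at h ⊢
      field_simp
      linear_combination h

theorem exp_lg {z : Fin n → ℂ} (hz : ∀ α ∈ c.R, dotC α z ≠ 0) :
    Complex.exp (c.lg z) = aeval z (c.delta ℝ) := by
  rw [lg, Complex.exp_sum, aeval_delta_complex]
  exact Finset.prod_congr rfl fun α hα => Complex.exp_log (hz α hα)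

theorem om_add_one (k : ℂ) (μ : Fin n → ℝ) {z : Fin n → ℂ} (hz : ∀ α ∈ c.R, dotC α z ≠ 0) :
    c.om (k + 1) μ z = aeval z (c.delta ℝ ^ 2) * c.om k μ z := by
  rw [map_pow, ← c.exp_lg hz, ← Complex.exp_nat_mul, om, om, ← Complex.exp_add]
  congr 1
  push_cast
  ring

theorem J_add_one (k : ℂ) : c.J (k + 1) 1 = c.J k (c.delta ℝ ^ 2) := by
  simp only [J, map_one, one_mul]
  exact integral_congr_ae (Filter.Eventually.of_forall fun x =>
    c.om_add_one k 0 fun α hα => dotC_zpt_ne_zero (c.eta_pos α hα) x)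

theorem exists_bpoly : ∃ b : Polynomial ℝ, b.natDegree ≤ c.R.card ∧
    ∀ k : ℂ, c.J (k + 1) 1 = (-1) ^ c.R.card * Polynomial.aeval k b * c.J k 1 := by
  obtain ⟨b, hb, h⟩ := c.exists_ratio c.R.card (c.delta ℝ ^ 2) c.inv_delta_sq
    (by simpa [mul_comm] using (c.delta_isHomogeneous ℝ).pow 2)
  refine ⟨Polynomial.C ((-1) ^ c.R.card) * b, (Polynomial.natDegree_C_mul_le _ _).trans hb,
    fun k => ?_⟩
  rw [J_add_one, h]
  simp only [map_mul, map_pow, map_neg, map_one]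
  rw [← mul_assoc ((-1) ^ c.R.card), ← mul_pow]
  simp

/-- The shift polynomial: `J (k + 1) = (-1)^N b(k) J k`. -/
def bp : Polynomial ℝ := c.exists_bpoly.choose

theorem natDegree_bp_le : c.bp.natDegree ≤ c.R.card := c.exists_bpoly.choose_spec.1

theorem J_succ (k : ℂ) :
    c.J (k + 1) 1 = (-1) ^ c.R.card * Polynomial.aeval k c.bp * c.J k 1 :=
  c.exists_bpoly.choose_spec.2 k

end CoxeterData

namespace CoxeterData

variable {n : ℕ} (c : CoxeterData n)

theorem abs_det (w : c.W) :
    |LinearMap.det ((w : (Fin n → ℝ) ≃ₗ[ℝ] (Fin n → ℝ)) : (Fin n → ℝ) →ₗ[ℝ] (Fin n → ℝ))| = 1 := by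
  have h1 : (w : (Fin n → ℝ) ≃ₗ[ℝ] (Fin n → ℝ)) ^ Fintype.card c.W = 1 := by
    rw [← Subgroup.coe_pow, pow_card_eq_one, Subgroup.coe_one]
  have h2 := congrArg (fun u : ℝˣ => (u : ℝ)) (congrArg LinearEquiv.det h1)
  simp only [map_pow, Units.val_pow_eq_pow_val, LinearEquiv.coe_det, map_one, Units.val_one] at h2
  have h3 := congrArg abs h2
  rw [abs_pow, abs_one] at h3
  exact (pow_eq_one_iff_of_nonneg (abs_nonneg _) Fintype.card_ne_zero).1 h3

theorem measurePreserving_act (w : c.W) :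
    MeasurePreserving (c.act w) (volume : Measure (Fin n → ℝ)) volume := by
  have h := Real.map_linearMap_volume_pi_eq_smul_volume_pi
    (f := ((w : (Fin n → ℝ) ≃ₗ[ℝ] (Fin n → ℝ)) : (Fin n → ℝ) →ₗ[ℝ] (Fin n → ℝ)))
    (fun h0 => by have := c.abs_det w; rw [h0] at this; simp at this)
  rw [abs_inv, c.abs_det] at h
  refine ⟨(LinearMap.continuous_of_finiteDimensional
    ((w : (Fin n → ℝ) ≃ₗ[ℝ] (Fin n → ℝ)) : (Fin n → ℝ) →ₗ[ℝ] (Fin n → ℝ))).measurable, ?_⟩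
  simp only [ENNReal.ofReal_one, inv_one, one_smul] at h
  exact h

theorem measurableEmbedding_act (w : c.W) : MeasurableEmbedding (c.act w) :=
  ((w : (Fin n → ℝ) ≃ₗ[ℝ] (Fin n → ℝ)).toContinuousLinearEquiv.toHomeomorph).measurableEmbedding

theorem integral_act (w : c.W) {E : Type*} [NormedAddCommGroup E] [NormedSpace ℝ E]
    (f : (Fin n → ℝ) → E) : ∫ x, f (c.act w x) = ∫ x, f x :=
  (c.measurePreserving_act w).integral_comp (c.measurableEmbedding_act w) f

theorem integrable_act (w : c.W) {E : Type*} [NormedAddCommGroup E]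
    {f : (Fin n → ℝ) → E} (hf : Integrable f) : Integrable fun x => f (c.act w x) :=
  (c.measurePreserving_act w).integrable_comp_of_integrable hf

theorem ae_regular : ∀ᵐ x : Fin n → ℝ, ∀ α ∈ c.R, dotR α x ≠ 0 := by
  refine (ae_ball_iff (S := (c.R : Set (Fin n → ℝ))) c.R.countable_toSet).2 fun α hα => ?_
  let f : (Fin n → ℝ) →ₗ[ℝ] ℝ :=
    { toFun := dotR α
      map_add' := dotR_add_right α
      map_smul' := fun t x => dotR_smul_right t α x }
  have h := Measure.addHaar_submodule (volume : Measure (Fin n → ℝ)) (LinearMap.ker f) fun h => by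
    have : α ∈ LinearMap.ker f := h ▸ Submodule.mem_top
    have h2 : dotR α α = 0 := this
    rw [c.norm2 α hα] at h2
    norm_num at h2
  rw [ae_iff]
  convert h using 2
  ext x
  simp [f]

/-- `log |δ(x)|`. -/
def lR (x : Fin n → ℝ) : ℝ := Real.log |eval x (c.delta ℝ)|

/-- The number of positive minus the number of negative values of the positive roots. -/
def sg (x : Fin n → ℝ) : ℝ := ∑ α ∈ c.R, if 0 < dotR α x then 1 else -1

theorem lR_act (w : c.W) (x : Fin n → ℝ) : c.lR (c.act w x) = c.lR x := by
  rw [lR, abs_delta_act, lR]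

theorem lR_eq {x : Fin n → ℝ} (hx : ∀ α ∈ c.R, dotR α x ≠ 0) :
    c.lR x = ∑ α ∈ c.R, Real.log |dotR α x| := by
  rw [lR, eval_delta_real, Finset.abs_prod, Real.log_prod fun α hα => abs_ne_zero.2 (hx α hα)]

theorem log_ofReal_mul_I {t : ℝ} (ht : t ≠ 0) :
    Complex.log ((t : ℂ) * I) =
      (Real.log |t| : ℂ) + (Real.pi / 2 : ℂ) * I * ((if 0 < t then 1 else -1 : ℝ) : ℂ) := by
  rcases lt_or_gt_of_ne ht with h | h
  · have e : (t : ℂ) * I = ((-t : ℝ) : ℂ) * (-I) := by push_cast; ring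
    rw [e, Complex.log_ofReal_mul (by linarith) (neg_ne_zero.2 I_ne_zero), Complex.log_neg_I,
      if_neg (by linarith), abs_of_neg h]
    push_cast; ring
  · rw [Complex.log_ofReal_mul h I_ne_zero, Complex.log_I, if_pos h, abs_of_pos h]
    push_cast; ring

theorem lg_zpt_zero {x : Fin n → ℝ} (hx : ∀ α ∈ c.R, dotR α x ≠ 0) :
    c.lg (zpt 0 x) = (c.lR x : ℂ) + (Real.pi / 2 : ℂ) * I * (c.sg x : ℂ) := by
  rw [lg, c.lR_eq hx, sg]
  push_cast
  rw [mul_sum, ← sum_add_distrib]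
  refine sum_congr rfl fun α hα => ?_
  rw [dotC_zpt, dotR_zero_right, Complex.ofReal_zero, zero_add, log_ofReal_mul_I (hx α hα)]

/-- The Macdonald–Mehta integral `∫ |δ|^{2k} e^{-|x|²/2}`. -/
def Ft (k : ℂ) : ℂ := ∫ x, Complex.exp (2 * k * c.lR x) * (gauss x : ℂ)

theorem exists_lR_le : ∃ A : ℝ, 0 ≤ A ∧ ∀ x, c.lR x ≤ A * wt x := by
  obtain ⟨A, hA, h⟩ := exists_bound_eval (c.delta ℝ)
  refine ⟨A, hA, fun x => ?_⟩
  have hw : 0 ≤ A * wt x := mul_nonneg hA (zero_le_one.trans (one_le_wt x))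
  rcases eq_or_ne (eval x (c.delta ℝ)) 0 with h0 | h0
  · rw [lR, h0]; simpa using hw
  · rw [lR, Real.log_le_iff_le_exp (abs_pos.2 h0)]
    exact h x

theorem measurable_lR : Measurable c.lR :=
  Real.measurable_log.comp ((continuous_eval_real (c.delta ℝ)).measurable.abs)

theorem norm_Ft_integrand (k : ℂ) (x : Fin n → ℝ) :
    ‖Complex.exp (2 * k * c.lR x) * (gauss x : ℂ)‖ = Real.exp (2 * k.re * c.lR x) * gauss x := by
  rw [norm_mul, Complex.norm_exp, Complex.norm_real, Real.norm_eq_abs, abs_of_pos (gauss_pos x)]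
  congr 2
  rw [Complex.re_mul_ofReal]
  simp

theorem aestronglyMeasurable_Ft (k : ℂ) : AEStronglyMeasurable
    (fun x => Complex.exp (2 * k * c.lR x) * (gauss x : ℂ)) volume := by
  have h1 := c.measurable_lR
  have h2 := (continuous_gauss (n := n)).measurable
  exact (Measurable.mul (by fun_prop) (by fun_prop)).aestronglyMeasurable

theorem integrable_Ft {k : ℂ} (hk : 0 ≤ k.re) :
    Integrable fun x => Complex.exp (2 * k * c.lR x) * (gauss x : ℂ) := by
  obtain ⟨A, hA, h⟩ := c.exists_lR_le
  refine (integrable_exp_wt_gauss (2 * k.re * A)).mono' (c.aestronglyMeasurable_Ft k)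
    (Filter.Eventually.of_forall fun x => ?_)
  rw [norm_Ft_integrand]
  refine mul_le_mul_of_nonneg_right (Real.exp_le_exp.2 ?_) (gauss_pos x).le
  rw [mul_assoc (2 * k.re)]
  exact mul_le_mul_of_nonneg_left (h x) (by positivity)

theorem J_eq_boundary {k : ℂ} (hk : 0 ≤ k.re) :
    c.J k 1 = ∫ x, Complex.exp (Real.pi * I * k * c.sg x) *
      (Complex.exp (2 * k * c.lR x) * (gauss x : ℂ)) := by
  set σ : ℕ → ℝ := fun j => 1 / ((j : ℝ) + 1)
  have hσ0 : ∀ j, 0 < σ j := fun j => by positivity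
  have hσ1 : ∀ j, σ j ≤ 1 := fun j => by
    rw [div_le_one (by positivity)]; linarith [Nat.cast_nonneg (α := ℝ) j]
  have hJ : ∀ j, ∫ x, c.om k 0 (zpt (σ j • c.eta) x) = c.J k 1 := fun j => by
    have := c.integral_shift k 0 c.eta_pos 1 (hσ0 j) one_pos
    simpa [J] using this
  obtain ⟨A, hA, hb⟩ : ∃ A : ℝ, 0 ≤ A ∧ ∀ j x, ‖c.om k 0 (zpt (σ j • c.eta) x)‖ ≤
      Real.exp (A * wt x) * gauss x := by
    have hB : ∀ α ∈ c.R, ∃ B : ℝ, 0 ≤ B ∧ ∀ j x, ‖dotC α (zpt (σ j • c.eta) x)‖ ≤ B * wt x := by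
      intro α _
      have hy : ∀ j i, |(σ j • c.eta) i| ≤ ∑ i, |c.eta i| := fun j i => by
        rw [Pi.smul_apply, smul_eq_mul, abs_mul, abs_of_pos (hσ0 j)]
        refine (mul_le_of_le_one_left (abs_nonneg _) (hσ1 j)).trans ?_
        exact Finset.single_le_sum (f := fun i => |c.eta i|) (fun i _ => abs_nonneg _)
          (Finset.mem_univ i)
      obtain ⟨B, hB, h⟩ := linBdd_dotC (T := ℕ) (S := Set.univ) (μ := fun _ => α)
        (M' := ∑ i, |α i|) (y := fun j => σ j • c.eta) (M := ∑ i, |c.eta i|)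
        (fun τ _ i => Finset.single_le_sum (f := fun i => |α i|) (fun i _ => abs_nonneg _)
          (Finset.mem_univ i)) (fun j _ i => hy j i)
      exact ⟨B, hB, fun j x => h j trivial x⟩
    choose! B hB0 hB1 using hB
    refine ⟨2 * k.re * (∑ α ∈ c.R, B α) + 2 * |k.im| * (c.R.card * Real.pi) +
      (∑ i, c.eta i ^ 2) / 2, ?_, fun j x => ?_⟩
    · have h1 : 0 ≤ ∑ α ∈ c.R, B α := Finset.sum_nonneg hB0
      have h2 : 0 ≤ ∑ i, c.eta i ^ 2 := Finset.sum_nonneg fun i _ => sq_nonneg _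
      have := Real.pi_pos
      positivity
    · rw [om_zpt, norm_mul, Complex.norm_real, Real.norm_eq_abs, abs_of_pos (gauss_pos x), pre,
        Complex.norm_exp]
      refine mul_le_mul_of_nonneg_right (Real.exp_le_exp.2 ?_) (gauss_pos x).le
      have hw := one_le_wt x
      have e1 : (c.lg (zpt (σ j • c.eta) x)).re ≤ (∑ α ∈ c.R, B α) * wt x := by
        rw [lg, Complex.re_sum, Finset.sum_mul]
        refine Finset.sum_le_sum fun α hα => ?_
        rw [Complex.log_re]
        exact (Real.log_le_self (norm_nonneg _)).trans (hB1 α hα j x)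
      have e2 : |(c.lg (zpt (σ j • c.eta) x)).im| ≤ c.R.card * Real.pi := by
        rw [lg, Complex.im_sum]
        refine (Finset.abs_sum_le_sum_abs _ _).trans ?_
        refine (Finset.sum_le_card_nsmul _ _ Real.pi fun α _ => ?_).trans (by simp)
        rw [Complex.log_im]
        exact Complex.abs_arg_le_pi _
      have e3 : dotC 0 (zpt (σ j • c.eta) x) = 0 := by simp [dotC]
      have e4 : ((∑ i, (((σ j • c.eta) i : ℝ) : ℂ) ^ 2) / 2 +
          I * ∑ i, (((σ j • c.eta) i : ℝ) : ℂ) * x i).re = (∑ i, (σ j * c.eta i) ^ 2) / 2 := by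
        have : (∑ i, (((σ j • c.eta) i : ℝ) : ℂ) ^ 2) / 2 +
          I * ∑ i, (((σ j • c.eta) i : ℝ) : ℂ) * x i =
          (((∑ i, (σ j * c.eta i) ^ 2) / 2 : ℝ) : ℂ) +
            ((∑ i, (σ j * c.eta i) * x i : ℝ) : ℂ) * I := by
          push_cast [Pi.smul_apply, smul_eq_mul]; ring
        rw [this, Complex.add_re, Complex.ofReal_re, Complex.re_ofReal_mul, Complex.I_re, mul_zero,
          add_zero]
      have e5 : ∑ i, (σ j * c.eta i) ^ 2 ≤ ∑ i, c.eta i ^ 2 := Finset.sum_le_sum fun i _ => by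
        rw [mul_pow]
        exact mul_le_of_le_one_left (sq_nonneg _) (pow_le_one₀ (hσ0 j).le (hσ1 j))
      rw [Complex.add_re, Complex.add_re, e3, e4, Complex.zero_re, zero_add, Complex.mul_re]
      have e6 : (2 * k).re = 2 * k.re := by simp
      have e7 : (2 * k).im = 2 * k.im := by simp
      rw [e6, e7]
      have h1 := mul_le_mul_of_nonneg_left e1 (by positivity : 0 ≤ 2 * k.re)
      have h2 : -(2 * k.im * (c.lg (zpt (σ j • c.eta) x)).im) ≤
          2 * |k.im| * (c.R.card * Real.pi) := by
        refine (neg_le_abs _).trans ?_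
        rw [abs_mul, abs_mul, abs_two]
        exact mul_le_mul_of_nonneg_left e2 (by positivity)
      have h3 : 0 ≤ 2 * |k.im| * (c.R.card * Real.pi) := by
        have := Real.pi_pos; positivity
      have h4 : 0 ≤ (∑ i, c.eta i ^ 2) / 2 := by
        have : 0 ≤ ∑ i, c.eta i ^ 2 := Finset.sum_nonneg fun i _ => sq_nonneg _
        positivity
      nlinarith
  have hlim := tendsto_integral_of_dominated_convergence (μ := volume)
    (F := fun j x => c.om k 0 (zpt (σ j • c.eta) x))
    (f := fun x => Complex.exp (Real.pi * I * k * c.sg x) *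
      (Complex.exp (2 * k * c.lR x) * (gauss x : ℂ)))
    (fun x => Real.exp (A * wt x) * gauss x)
    (fun j => by
      have := c.integrable_eval_mul_om k 0 (c.pos_smul c.eta_pos (hσ0 j)) 1
      simp only [map_one, one_mul] at this
      exact this.aestronglyMeasurable) (integrable_exp_wt_gauss A)
    (fun j => Filter.Eventually.of_forall (hb j)) ?_
  · simp only [hJ] at hlim
    exact tendsto_nhds_unique tendsto_const_nhds hlim
  · filter_upwards [c.ae_regular] with x hx
    have hσ : Filter.Tendsto σ Filter.atTop (𝓝 0) := tendsto_one_div_add_atTop_nhds_zero_nat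
    have hz : Continuous fun s : ℝ => zpt (s • c.eta) x := by
      unfold zpt
      simp only [Pi.smul_apply, smul_eq_mul, Complex.ofReal_mul]
      fun_prop
    have hl : ContinuousAt (fun s : ℝ => c.lg (zpt (s • c.eta) x)) 0 := by
      unfold lg
      refine tendsto_finsetSum _ fun α hα => ?_
      refine ContinuousAt.clog ((continuous_dotC α).comp hz).continuousAt (Or.inr ?_)
      simp only [dotC_zpt]
      simpa using hx α hα
    have ho : ContinuousAt (fun s : ℝ => c.om k 0 (zpt (s • c.eta) x)) 0 := by
      have h1 : ContinuousAt (fun s : ℝ => dotC 0 (zpt (s • c.eta) x)) 0 :=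
        ((continuous_dotC 0).comp hz).continuousAt
      have h2 : ContinuousAt (fun s : ℝ => (∑ i, zpt (s • c.eta) x i ^ 2) / 2) 0 := by
        have : ∀ i, Continuous fun s : ℝ => zpt (s • c.eta) x i := fun i =>
          (continuous_apply i).comp hz
        exact Continuous.continuousAt (by fun_prop)
      unfold om
      exact ((h1.add (hl.const_mul _)).add h2).cexp
    have hlim := ho.tendsto.comp hσ
    have e : c.om k 0 (zpt ((0 : ℝ) • c.eta) x) = Complex.exp (Real.pi * I * k * c.sg x) *
        (Complex.exp (2 * k * c.lR x) * (gauss x : ℂ)) := by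
      rw [zero_smul, om_zpt, pre, c.lg_zpt_zero hx, ← mul_assoc, ← Complex.exp_add]
      congr 2
      simp [dotC]
      ring
    rw [e] at hlim
    exact hlim

theorem sg_act {x0 : Fin n → ℝ} (hx : ∀ α ∈ c.R, 0 < dotR α x0) (u : c.W) :
    c.sg (c.act u x0) = c.R.card - 2 * c.len u := by
  have h := c.len_eq_card hx u
  rw [sg, Finset.sum_ite, Finset.sum_const, Finset.sum_const]
  have h2 := Finset.card_filter_add_card_filter_not (s := c.R) fun α => 0 < dotR α (c.act u x0)
  have h3 : (c.R.filter fun α => ¬ 0 < dotR α (c.act u x0)).card = c.len u := by omega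
  rw [h3]
  have h4 : ((c.R.filter fun α => 0 < dotR α (c.act u x0)).card : ℝ) = c.R.card - c.len u := by
    rw [← h]; push_cast; ring
  simp only [nsmul_eq_mul, h4]
  ring

/-- The ratio between the contour integral and the Macdonald–Mehta integral. -/
def Sk (k : ℂ) : ℂ :=
  (∑ w : c.W, Complex.exp (Real.pi * I * k * (c.R.card - 2 * c.len w))) / Fintype.card c.W

theorem sum_exp_sg (k : ℂ) {x : Fin n → ℝ} (hx : ∀ α ∈ c.R, dotR α x ≠ 0) :
    ∑ w : c.W, Complex.exp (Real.pi * I * k * c.sg (c.act w x)) = Fintype.card c.W * c.Sk k := by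
  obtain ⟨w0, hw0⟩ := c.exists_dominant x
  have h0 : ∀ α ∈ c.R, 0 < dotR α (c.act w0 x) := fun α hα => by
    refine lt_of_le_of_ne (hw0 α hα) fun h => ?_
    have : ∏ α ∈ c.R, dotR α (c.act w0 x) = 0 := Finset.prod_eq_zero hα h.symm
    rw [← eval_delta_real, ← abs_eq_zero, abs_delta_act, abs_eq_zero, eval_delta_real,
      Finset.prod_eq_zero_iff] at this
    obtain ⟨β, hβ, h2⟩ := this
    exact hx β hβ h2
  rw [Sk, mul_div_cancel₀ _ (Nat.cast_ne_zero.2 Fintype.card_ne_zero)]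
  rw [← Fintype.sum_equiv (Equiv.mulRight w0) (fun u => Complex.exp (Real.pi * I * k *
    c.sg (c.act (u * w0) x))) (fun w => Complex.exp (Real.pi * I * k * c.sg (c.act w x)))
    fun u => rfl]
  refine sum_congr rfl fun u _ => ?_
  rw [act_mul, c.sg_act h0]
  push_cast
  rfl

theorem J_eq_Sk_mul_Ft {k : ℂ} (hk : 0 ≤ k.re) : c.J k 1 = c.Sk k * c.Ft k := by
  have hc : (Fintype.card c.W : ℂ) ≠ 0 := Nat.cast_ne_zero.2 Fintype.card_ne_zero
  refine mul_left_cancel₀ hc ?_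
  set f : (Fin n → ℝ) → ℂ := fun x => Complex.exp (Real.pi * I * k * c.sg x) *
      (Complex.exp (2 * k * c.lR x) * (gauss x : ℂ))
  have hm : Measurable c.sg := by
    unfold sg
    refine Finset.measurable_sum _ fun α _ => Measurable.ite ?_ measurable_const measurable_const
    have : Continuous fun x : Fin n → ℝ => dotR α x := by unfold dotR; fun_prop
    exact measurableSet_lt measurable_const this.measurable
  have hf : Integrable f := by
    have hb : ∀ x, |c.sg x| ≤ c.R.card := fun x => by
      refine (Finset.abs_sum_le_sum_abs _ _).trans ?_
      refine (Finset.sum_le_card_nsmul _ _ 1 fun α _ => ?_).trans (by simp)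
      split_ifs <;> simp
    refine (c.integrable_Ft hk).bdd_mul (c := Real.exp (Real.pi * |k.im| * c.R.card))
      (Measurable.aestronglyMeasurable (by fun_prop)) (Filter.Eventually.of_forall fun x => ?_)
    rw [Complex.norm_exp, Complex.re_mul_ofReal]
    refine Real.exp_le_exp.2 ?_
    have e : ((Real.pi : ℂ) * I * k).re = -(Real.pi * k.im) := by simp
    rw [e]
    refine (le_abs_self _).trans ?_
    rw [abs_mul, abs_neg, abs_mul, abs_of_pos Real.pi_pos]
    exact mul_le_mul_of_nonneg_left (hb x) (by have := Real.pi_pos; positivity)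
  have h1 : (Fintype.card c.W : ℂ) * c.J k 1 = ∑ w : c.W, ∫ x, f (c.act w x) := by
    simp only [c.integral_act, Finset.sum_const, Finset.card_univ, nsmul_eq_mul]
    rw [c.J_eq_boundary hk]
  rw [h1, ← integral_finsetSum _ fun w _ => c.integrable_act w hf, Ft, ← mul_assoc,
    ← integral_const_mul]
  refine integral_congr_ae ?_
  filter_upwards [c.ae_regular] with x hx
  rw [← c.sum_exp_sg k hx, Finset.sum_mul]
  refine sum_congr rfl fun w _ => ?_
  simp only [f, lR_act, gauss_act]

theorem Sk_eq (k : ℂ) : c.Sk k = Complex.exp (Real.pi * I * k * c.R.card) *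
    (∏ j, ∑ i ∈ range (c.d j), Complex.exp (-(2 * Real.pi * I * k)) ^ i) /
      Fintype.card c.W := by
  have h := congrArg (Polynomial.aeval (Complex.exp (-(2 * Real.pi * I * k)))) c.sum_pow_len
  simp only [map_sum, map_prod, map_pow, Polynomial.aeval_X] at h
  rw [← h, Sk, mul_sum]
  congr 1
  refine sum_congr rfl fun w _ => ?_
  rw [← Complex.exp_nat_mul, ← Complex.exp_add]
  congr 1
  ring

theorem Sk_natCast (M : ℕ) : c.Sk M = (-1) ^ (M * c.R.card) := by
  have hc : (Fintype.card c.W : ℂ) ≠ 0 := Nat.cast_ne_zero.2 Fintype.card_ne_zero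
  rw [Sk, div_eq_iff hc]
  have : ∀ w ∈ (Finset.univ : Finset c.W),
      Complex.exp (Real.pi * I * M * (c.R.card - 2 * c.len w)) = (-1) ^ (M * c.R.card) := by
    intro w _
    have e : (Real.pi : ℂ) * I * M * (c.R.card - 2 * c.len w) =
        ((M * c.R.card : ℕ) : ℂ) * (Real.pi * I) - ((M * c.len w : ℕ) : ℂ) * (2 * Real.pi * I) := by
      push_cast; ring
    rw [e, Complex.exp_sub, Complex.exp_nat_mul, Complex.exp_pi_mul_I,
      Complex.exp_nat_mul_two_pi_mul_I, div_one]
  rw [sum_congr rfl this, Finset.sum_const, nsmul_eq_mul, Finset.card_univ, mul_comm]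

theorem Sk_add_natCast (s : ℂ) (M : ℕ) : c.Sk (s + M) = (-1) ^ (M * c.R.card) * c.Sk s := by
  rw [Sk, Sk, ← mul_div_assoc, mul_sum]
  congr 1
  refine sum_congr rfl fun w _ => ?_
  have e : (Real.pi : ℂ) * I * (s + M) * (c.R.card - 2 * c.len w) =
      Real.pi * I * s * (c.R.card - 2 * c.len w) +
        (((M * c.R.card : ℕ) : ℂ) * (Real.pi * I) -
          ((M * c.len w : ℕ) : ℂ) * (2 * Real.pi * I)) := by
    push_cast; ring
  rw [e, Complex.exp_add, Complex.exp_sub, Complex.exp_nat_mul (Real.pi * I),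
    Complex.exp_pi_mul_I, Complex.exp_nat_mul_two_pi_mul_I, div_one]
  ring

/-- The total mass of the Gaussian. -/
def Z0 (n : ℕ) : ℝ := ∫ x : Fin n → ℝ, gauss x

theorem Z0_pos : 0 < Z0 n := integral_gauss_pos

theorem Ft_zero : c.Ft 0 = Z0 n := by
  simp only [Ft, Z0, mul_zero, zero_mul, Complex.exp_zero, one_mul]
  exact integral_ofReal

theorem J_zero : c.J 0 1 = Z0 n := by
  rw [c.J_eq_Sk_mul_Ft (by simp), c.Ft_zero]
  have := c.Sk_natCast 0
  simp only [Nat.cast_zero, zero_mul, pow_zero] at this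
  rw [this, one_mul]

theorem J_add_natCast (k : ℂ) (M : ℕ) : c.J (k + M) 1 =
    (-1) ^ (M * c.R.card) * (∏ i ∈ range M, Polynomial.aeval (k + i) c.bp) * c.J k 1 := by
  induction M with
  | zero => simp
  | succ M ih =>
    rw [Nat.cast_succ, ← add_assoc, J_succ, ih, Finset.prod_range_succ]
    ring

theorem Ft_add_natCast {s : ℂ} (hs : 0 ≤ s.re) (h0 : c.Sk s ≠ 0) (M : ℕ) : c.Ft (s + M) =
    (∏ i ∈ range M, Polynomial.aeval (s + i) c.bp) * c.Ft s := by
  have h1 := c.J_eq_Sk_mul_Ft (k := s + M) (by simp; positivity)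
  have h2 := c.J_eq_Sk_mul_Ft hs
  rw [J_add_natCast, h2, Sk_add_natCast] at h1
  have h3 : ((-1 : ℂ) ^ (M * c.R.card)) ≠ 0 := pow_ne_zero _ (by norm_num)
  refine mul_left_cancel₀ (mul_ne_zero h3 h0) ?_
  rw [← h1]; ring

end CoxeterData

namespace CoxeterData

variable {n : ℕ} (c : CoxeterData n)

/-- The Macdonald–Mehta integral for a real multiplicity. -/
def Fr (k : ℝ) : ℝ := ∫ x, Real.exp (2 * k * c.lR x) * gauss x

theorem Ft_ofReal (k : ℝ) : c.Ft k = c.Fr k := by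
  rw [Ft, Fr, ← integral_complex_ofReal]
  refine integral_congr_ae (Filter.Eventually.of_forall fun x => ?_)
  push_cast
  rfl

theorem integrable_Fr {k : ℝ} (hk : 0 ≤ k) :
    Integrable fun x => Real.exp (2 * k * c.lR x) * gauss x := by
  have h := (c.integrable_Ft (k := (k : ℂ)) (by simpa using hk)).norm
  refine h.congr (Filter.Eventually.of_forall fun x => ?_)
  simp only [norm_Ft_integrand, Complex.ofReal_re]

theorem Fr_pos {k : ℝ} (hk : 0 ≤ k) : 0 < c.Fr k := by
  have h := c.integrable_Fr hk
  unfold gauss at h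
  simp only [← Real.exp_add] at h
  have := integral_exp_pos h
  unfold Fr gauss
  simpa only [← Real.exp_add] using this

theorem tendsto_Fr {x : ℝ} (hx : 0 ≤ x) {u : ℕ → ℝ} (hu : ∀ j, x ≤ u j)
    (hl : Filter.Tendsto u Filter.atTop (𝓝 x)) :
    Filter.Tendsto (fun j => c.Fr (u j)) Filter.atTop (𝓝 (c.Fr x)) := by
  obtain ⟨B, hB⟩ := hl.bddAbove_range
  have hB' : ∀ j, u j ≤ B := fun j => hB ⟨j, rfl⟩
  have hxB : x ≤ B := (hu 0).trans (hB' 0)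
  refine tendsto_integral_of_dominated_convergence
    (fun y => Real.exp (2 * x * c.lR y) * gauss y + Real.exp (2 * B * c.lR y) * gauss y)
    (fun j => (c.integrable_Fr (hx.trans (hu j))).aestronglyMeasurable)
    ((c.integrable_Fr hx).add (c.integrable_Fr (hx.trans hxB))) (fun j => ?_) ?_
  · refine Filter.Eventually.of_forall fun y => ?_
    rw [Real.norm_of_nonneg (mul_nonneg (Real.exp_pos _).le (gauss_pos y).le), ← add_mul]
    refine mul_le_mul_of_nonneg_right ?_ (gauss_pos y).le
    rcases le_total 0 (c.lR y) with h | h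
    · refine le_add_of_nonneg_of_le (Real.exp_pos _).le (Real.exp_le_exp.2 ?_)
      nlinarith [hB' j]
    · refine le_add_of_le_of_nonneg (Real.exp_le_exp.2 ?_) (Real.exp_pos _).le
      nlinarith [hu j]
  · refine Filter.Eventually.of_forall fun y => ?_
    have hc : Continuous fun t : ℝ => Real.exp (2 * t * c.lR y) * gauss y := by fun_prop
    exact (hc.tendsto x).comp hl

theorem aeval_ofReal (p : Polynomial ℝ) (x : ℝ) :
    Polynomial.aeval (x : ℂ) p = ((p.eval x : ℝ) : ℂ) := by
  have := Polynomial.aeval_algebraMap_apply ℂ x p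
  simpa using this

theorem Sk_ne_zero_of_irrational {x : ℝ} (hx : Irrational x) : c.Sk x ≠ 0 := by
  intro h
  rw [Sk_eq, div_eq_zero_iff, mul_eq_zero, or_assoc] at h
  rcases h with h | h | h
  · exact Complex.exp_ne_zero _ h
  · obtain ⟨j, -, hj⟩ := Finset.prod_eq_zero_iff.1 h
    have h1 := geom_sum_mul (Complex.exp (-(2 * Real.pi * I * x))) (c.d j)
    rw [hj, zero_mul, ← Complex.exp_nat_mul] at h1
    obtain ⟨z, hz⟩ := Complex.exp_eq_one_iff.1 (sub_eq_zero.1 h1.symm)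
    have hpi : (2 * Real.pi * I : ℂ) ≠ 0 := Complex.two_pi_I_ne_zero
    have h2 : ((c.d j : ℂ) * x) = -z := by
      apply mul_right_cancel₀ hpi
      linear_combination -hz
    have h3 : (c.d j : ℝ) * x = -z := by exact_mod_cast h2
    have hd : (c.d j : ℝ) ≠ 0 := by exact_mod_cast (c.d_pos j).ne'
    refine hx ⟨(-z : ℚ) / (c.d j : ℚ), ?_⟩
    push_cast
    rw [div_eq_iff hd, ← h3, mul_comm]
  · exact Nat.cast_ne_zero.2 Fintype.card_ne_zero h

theorem Fr_add_one {x : ℝ} (hx : 0 ≤ x) : c.Fr (x + 1) = c.bp.eval x * c.Fr x := by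
  have key : ∀ y : ℝ, 0 ≤ y → Irrational y → c.Fr (y + 1) = c.bp.eval y * c.Fr y := by
    intro y hy hi
    have h := c.Ft_add_natCast (s := (y : ℂ)) (by simpa using hy) (c.Sk_ne_zero_of_irrational hi) 1
    simp only [Finset.prod_range_one, Nat.cast_zero, add_zero, Nat.cast_one] at h
    rw [aeval_ofReal, Ft_ofReal, show (y : ℂ) + 1 = ((y + 1 : ℝ) : ℂ) by push_cast; rfl,
      Ft_ofReal] at h
    exact_mod_cast h
  by_cases hi : Irrational x
  · exact key x hx hi
  obtain ⟨q, hq⟩ : ∃ q : ℚ, (q : ℝ) = x := by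
    simpa [Irrational] using hi
  have hirr : ∀ j : ℕ, Irrational (x + √2 / ((j + 1 : ℕ) : ℝ)) := fun j => by
    rw [← hq]
    exact (irrational_sqrt_two.div_natCast j.succ_ne_zero).ratCast_add q
  have hpos : ∀ j : ℕ, 0 ≤ √2 / ((j + 1 : ℕ) : ℝ) := fun j => by positivity
  have hlim : Filter.Tendsto (fun j : ℕ => x + √2 / ((j + 1 : ℕ) : ℝ)) Filter.atTop (𝓝 x) := by
    have := (tendsto_const_div_atTop_nhds_zero_nat (√2)).comp (Filter.tendsto_add_atTop_nat 1)
    simpa using this.const_add x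
  have h1 := c.tendsto_Fr hx (fun j => le_add_of_nonneg_right (hpos j)) hlim
  have h2 := c.tendsto_Fr (x := x + 1) (by linarith)
    (u := fun j => x + √2 / ((j + 1 : ℕ) : ℝ) + 1) (fun j => by linarith [hpos j])
    (hlim.add_const 1)
  have h3 := ((c.bp.continuous.tendsto x).comp hlim).mul h1
  refine tendsto_nhds_unique h2 (h3.congr fun j => ?_)
  exact (key _ (by linarith [hpos j]) (hirr j)).symm

theorem bp_pos {x : ℝ} (hx : 0 ≤ x) : 0 < c.bp.eval x := by
  have h := c.Fr_add_one hx
  have h1 := c.Fr_pos (k := x + 1) (by linarith)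
  rw [h] at h1
  exact pos_of_mul_pos_left h1 (c.Fr_pos hx).le

theorem Fr_zero : c.Fr 0 = Z0 n := by
  have := c.Ft_ofReal 0
  rw [Complex.ofReal_zero, Ft_zero] at this
  exact_mod_cast this.symm

theorem Fr_add_natCast {x : ℝ} (hx : 0 ≤ x) (M : ℕ) :
    c.Fr (x + M) = (∏ i ∈ range M, c.bp.eval (x + i)) * c.Fr x := by
  induction M with
  | zero => simp
  | succ M ih =>
    rw [Finset.prod_range_succ, Nat.cast_succ, ← add_assoc, c.Fr_add_one (by positivity), ih]
    ring

theorem Fr_natCast (M : ℕ) : c.Fr M = (∏ i ∈ range M, c.bp.eval (i : ℝ)) * Z0 n := by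
  have := c.Fr_add_natCast le_rfl M
  simpa only [zero_add, Fr_zero] using this

theorem lR_smul_eta {s : ℝ} (hs : 0 < s) :
    c.lR (s • c.eta) = ∑ α ∈ c.R, Real.log (s * dotR α c.eta) := by
  rw [c.lR_eq fun α hα => (pos_smul c c.eta_pos hs α hα).ne']
  refine sum_congr rfl fun α hα => ?_
  rw [dotR_smul_right, abs_of_pos (mul_pos hs (c.eta_pos α hα))]

theorem norm_J_neg_le {m : ℕ} {s : ℝ} (hs : 0 < s) (hsm : s ^ 2 = m) : ‖c.J (-(m : ℂ)) 1‖ ≤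
    Real.exp (-(2 * m * c.lR (s • c.eta)) + m * c.R.card) * Z0 n := by
  have hJ : c.J (-(m : ℂ)) 1 = ∫ x, c.om (-(m : ℂ)) 0 (zpt (s • c.eta) x) := by
    have := c.integral_shift (-(m : ℂ)) 0 c.eta_pos 1 one_pos hs
    simpa [J] using this
  rw [hJ, Z0, ← integral_const_mul]
  refine norm_integral_le_of_norm_le (integrable_gauss.const_mul _)
    (Filter.Eventually.of_forall fun x => ?_)
  rw [om_zpt, norm_mul, Complex.norm_real, Real.norm_of_nonneg (gauss_pos x).le]
  refine mul_le_mul_of_nonneg_right ?_ (gauss_pos x).le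
  rw [pre, Complex.norm_exp]
  refine Real.exp_le_exp.2 ?_
  have h1 : c.lR (s • c.eta) ≤ (c.lg (zpt (s • c.eta) x)).re := by
    rw [c.lR_smul_eta hs, lg, Complex.re_sum]
    refine Finset.sum_le_sum fun α hα => ?_
    rw [Complex.log_re]
    refine Real.log_le_log (mul_pos hs (c.eta_pos α hα)) ?_
    have := Complex.re_le_norm (dotC α (zpt (s • c.eta) x))
    rwa [dotC_zpt_re, dotR_smul_right] at this
  have h2 : ∑ i, (s • c.eta) i ^ 2 = m * (2 * c.R.card) := by
    rw [← c.eta_sq, ← hsm, dotR, mul_sum]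
    refine sum_congr rfl fun i _ => ?_
    rw [Pi.smul_apply, smul_eq_mul]; ring
  have e1 : (∑ i, (((s • c.eta) i : ℝ) : ℂ) ^ 2) = ((m * (2 * c.R.card) : ℝ) : ℂ) := by
    rw [← h2]; push_cast; rfl
  have e2 : ∑ i, (((s • c.eta) i : ℝ) : ℂ) * x i = ((∑ i, (s • c.eta) i * x i : ℝ) : ℂ) := by
    push_cast; rfl
  have e3 : dotC 0 (zpt (s • c.eta) x) = 0 := by simp [dotC]
  have e4 : 2 * -(m : ℂ) * c.lg (zpt (s • c.eta) x) =
      ((-(2 * m) : ℝ) : ℂ) * c.lg (zpt (s • c.eta) x) := by push_cast; ring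
  have e5 : ((m * (2 * c.R.card) : ℝ) : ℂ) / 2 = ((m * c.R.card : ℝ) : ℂ) := by
    push_cast; ring
  rw [e1, e2, e3, e4, e5, zero_add, Complex.add_re, Complex.add_re, Complex.re_ofReal_mul,
    Complex.ofReal_re, Complex.I_mul_re, Complex.ofReal_im]
  have h0 : (0 : ℝ) ≤ m := Nat.cast_nonneg m
  nlinarith [mul_le_mul_of_nonneg_left h1 h0]

theorem integral_exp_mul_gauss (u : Fin n → ℝ) :
    ∫ x, Real.exp (dotR u x) * gauss x = Real.exp (dotR u u / 2) * Z0 n := by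
  have h := integral_add_right_eq_self (μ := (volume : Measure (Fin n → ℝ)))
    (fun x => Real.exp (dotR u x) * gauss x) u
  rw [← h, Z0, ← integral_const_mul]
  refine integral_congr_ae (Filter.Eventually.of_forall fun x => ?_)
  simp only [gauss]
  rw [← Real.exp_add, ← Real.exp_add]
  congr 1
  have : ∑ i, (x + u) i ^ 2 = ∑ i, x i ^ 2 + 2 * dotR u x + dotR u u := by
    rw [dotR, dotR, mul_sum, ← sum_add_distrib, ← sum_add_distrib]
    refine sum_congr rfl fun i _ => ?_
    rw [Pi.add_apply]; ring
  rw [this, dotR_add_right]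
  ring

theorem integrable_exp_mul_gauss (u : Fin n → ℝ) :
    Integrable fun x => Real.exp (dotR u x) * gauss x := by
  have hc : Continuous fun x => Real.exp (dotR u x) * gauss x := by
    have := continuous_gauss (n := n)
    unfold dotR
    fun_prop
  refine (integrable_exp_wt_gauss (∑ i, |u i|)).mono' hc.aestronglyMeasurable
    (Filter.Eventually.of_forall fun x => ?_)
  rw [Real.norm_of_nonneg (mul_nonneg (Real.exp_pos _).le (gauss_pos x).le)]
  refine mul_le_mul_of_nonneg_right (Real.exp_le_exp.2 ?_) (gauss_pos x).le
  rw [dotR, Finset.sum_mul]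
  refine Finset.sum_le_sum fun i _ => (le_abs_self _).trans ?_
  rw [abs_mul]
  exact mul_le_mul_of_nonneg_left (abs_le_wt x i) (abs_nonneg _)

theorem Fr_nat_le {m : ℕ} {s : ℝ} (hs : 0 < s) (hsm : s ^ 2 = m) : c.Fr m ≤
    Fintype.card c.W * Real.exp (2 * m * c.lR (s • c.eta) - m * c.R.card) * Z0 n := by
  have hi : ∀ w : c.W, Integrable fun x =>
      Real.exp (dotR (s • c.eta) (c.act w x)) * gauss x := fun w => by
    have := c.integrable_act w (integrable_exp_mul_gauss (s • c.eta))
    simpa only [gauss_act] using this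
  have hv : ∀ w : c.W, ∫ x, Real.exp (dotR (s • c.eta) (c.act w x)) * gauss x =
      Real.exp (m * c.R.card) * Z0 n := fun w => by
    have := c.integral_act w fun x => Real.exp (dotR (s • c.eta) x) * gauss x
    simp only [gauss_act] at this
    rw [this, integral_exp_mul_gauss, dotR_smul_left, dotR_smul_right, eta_sq, ← hsm]
    congr 2; ring
  set E := Real.exp (2 * m * c.lR (s • c.eta) - 2 * m * c.R.card) with hE
  calc c.Fr m ≤ ∫ x, E * ∑ w : c.W, Real.exp (dotR (s • c.eta) (c.act w x)) * gauss x := by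
        refine integral_mono_ae (c.integrable_Fr (Nat.cast_nonneg m))
          ((integrable_finsetSum _ fun w _ => hi w).const_mul _) ?_
        filter_upwards [c.ae_regular] with x hx
        obtain ⟨w, hw⟩ := c.exists_dominant x
        have hpos : ∀ α ∈ c.R, 0 < dotR α (c.act w x) := fun α hα => by
          refine lt_of_le_of_ne (hw α hα) fun h => ?_
          rw [eq_comm, dotR_act_right] at h
          rcases c.act_mem_or w⁻¹ hα with h' | h'
          · exact hx _ h' h
          · refine hx _ h' ?_
            rw [dotR_neg_left, h, neg_zero]
        refine le_trans ?_ (mul_le_mul_of_nonneg_left (Finset.single_le_sum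
          (f := fun w : c.W => Real.exp (dotR (s • c.eta) (c.act w x)) * gauss x)
          (fun w _ => mul_nonneg (Real.exp_pos _).le (gauss_pos x).le) (Finset.mem_univ w))
          (Real.exp_pos _).le)
        rw [hE, ← mul_assoc, ← Real.exp_add]
        refine mul_le_mul_of_nonneg_right (Real.exp_le_exp.2 ?_) (gauss_pos x).le
        rw [← c.lR_act w x, c.lR_eq fun α hα => (hpos α hα).ne', c.lR_smul_eta hs,
          dotR_smul_left, ← c.eta_crit]
        have key : ∀ α ∈ c.R, Real.log |dotR α (c.act w x)| ≤
            Real.log (s * dotR α c.eta) + (dotR α (c.act w x) / (s * dotR α c.eta) - 1) := by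
          intro α hα
          have h1 := mul_pos hs (c.eta_pos α hα)
          have h2 := Real.log_le_sub_one_of_pos (div_pos (hpos α hα) h1)
          rw [Real.log_div (hpos α hα).ne' h1.ne'] at h2
          rw [abs_of_pos (hpos α hα)]
          linarith
        have h3 := Finset.sum_le_sum key
        rw [sum_add_distrib, Finset.sum_sub_distrib, Finset.sum_const, nsmul_one] at h3
        have h4 : s * ∑ α ∈ c.R, 2 * (dotR α (c.act w x) / dotR α c.eta) =
            2 * m * ∑ α ∈ c.R, dotR α (c.act w x) / (s * dotR α c.eta) := by
          rw [mul_sum, mul_sum, ← hsm]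
          refine sum_congr rfl fun α hα => ?_
          have := (c.eta_pos α hα).ne'
          field_simp
        rw [h4]
        have h5 := mul_le_mul_of_nonneg_left h3 (by positivity : (0 : ℝ) ≤ 2 * m)
        linarith
    _ = _ := by
        rw [integral_const_mul, integral_finsetSum _ fun w _ => hi w, sum_congr rfl
          fun w _ => hv w, Finset.sum_const, Finset.card_univ, nsmul_eq_mul, hE]
        rw [show Real.exp (2 * m * c.lR (s • c.eta) - m * c.R.card) =
          Real.exp (2 * m * c.lR (s • c.eta) - 2 * m * c.R.card) * Real.exp (m * c.R.card) by
            rw [← Real.exp_add]; congr 1; ring]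
        ring

theorem norm_J_neg (m : ℕ) :
    (∏ i ∈ range m, |c.bp.eval (-((i : ℝ) + 1))|) * ‖c.J (-(m : ℂ)) 1‖ = Z0 n := by
  have h := c.J_add_natCast (-(m : ℂ)) m
  rw [neg_add_cancel, J_zero] at h
  have h2 := congrArg norm h
  rw [Complex.norm_real, Real.norm_of_nonneg (Z0_pos (n := n)).le, norm_mul, norm_mul, norm_pow,
    norm_neg, norm_one, one_pow, one_mul, norm_prod, ← Finset.prod_range_reflect] at h2
  rw [h2]
  congr 1
  refine Finset.prod_congr rfl fun i hi => ?_
  have hi' := Finset.mem_range.1 hi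
  have : -(m : ℂ) + ((m - 1 - i : ℕ) : ℂ) = ((-((i : ℝ) + 1) : ℝ) : ℂ) := by
    rw [Nat.cast_sub (by omega), Nat.cast_sub (by omega)]; push_cast; ring
  rw [this, aeval_ofReal, Complex.norm_real, Real.norm_eq_abs]

theorem prod_bp_le (m : ℕ) : ∏ i ∈ range m, c.bp.eval (i : ℝ) ≤
    Fintype.card c.W * ∏ i ∈ range m, |c.bp.eval (-((i : ℝ) + 1))| := by
  rcases Nat.eq_zero_or_pos m with rfl | hm
  · have : (1 : ℝ) ≤ Fintype.card c.W := by exact_mod_cast Fintype.card_pos (α := c.W)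
    simpa only [Finset.range_zero, Finset.prod_empty, mul_one] using this
  have hm' : (0 : ℝ) < m := by exact_mod_cast hm
  have hs : 0 < √(m : ℝ) := Real.sqrt_pos.2 hm'
  have hsm : √(m : ℝ) ^ 2 = m := Real.sq_sqrt hm'.le
  have h1 := c.Fr_nat_le hs hsm
  have h2 := c.norm_J_neg_le hs hsm
  have h3 := c.norm_J_neg m
  have hZ := Z0_pos (n := n)
  rw [Fr_natCast] at h1
  have h1' := le_of_mul_le_mul_right h1 hZ
  set P := ∏ i ∈ range m, |c.bp.eval (-((i : ℝ) + 1))|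
  have hP : 0 ≤ P := Finset.prod_nonneg fun i _ => abs_nonneg _
  set a := 2 * m * c.lR (√(m : ℝ) • c.eta)
  set b := (m : ℝ) * c.R.card
  refine h1'.trans (mul_le_mul_of_nonneg_left ?_ (Nat.cast_nonneg _))
  have h4 := mul_le_mul_of_nonneg_left h2 hP
  rw [h3, ← mul_assoc] at h4
  have h5 : 1 ≤ P * Real.exp (-a + b) := by
    by_contra h
    push Not at h
    nlinarith
  have h6 := mul_le_mul_of_nonneg_right h5 (Real.exp_pos (a - b)).le
  rw [one_mul, mul_assoc, ← Real.exp_add, show -a + b + (a - b) = 0 by ring, Real.exp_zero,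
    mul_one] at h6
  exact h6

theorem le_prod_bp {m : ℕ} (hm : 0 < m) :
    Real.exp (m * c.R.card * Real.log m + m * (2 * c.lR c.eta - c.R.card)) ≤
      ∏ i ∈ range m, |c.bp.eval (-((i : ℝ) + 1))| := by
  have hm' : (0 : ℝ) < m := by exact_mod_cast hm
  have hs : 0 < √(m : ℝ) := Real.sqrt_pos.2 hm'
  have hsm : √(m : ℝ) ^ 2 = m := Real.sq_sqrt hm'.le
  have h2 := c.norm_J_neg_le hs hsm
  have h3 := c.norm_J_neg m
  have hZ := Z0_pos (n := n)
  have hl : c.lR (√(m : ℝ) • c.eta) = c.R.card * (Real.log m / 2) + c.lR c.eta := by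
    have h1 := c.lR_smul_eta one_pos
    simp only [one_smul, one_mul] at h1
    rw [c.lR_smul_eta hs, h1, ← nsmul_eq_mul, ← Finset.sum_const, ← sum_add_distrib]
    refine sum_congr rfl fun α hα => ?_
    rw [Real.log_mul hs.ne' (c.eta_pos α hα).ne', Real.log_sqrt hm'.le]
  set P := ∏ i ∈ range m, |c.bp.eval (-((i : ℝ) + 1))|
  have hP : 0 ≤ P := Finset.prod_nonneg fun i _ => abs_nonneg _
  have h4 := mul_le_mul_of_nonneg_left h2 hP
  rw [h3, ← mul_assoc, hl] at h4
  set a := 2 * (m : ℝ) * (c.R.card * (Real.log m / 2) + c.lR c.eta) with ha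
  set b := (m : ℝ) * c.R.card with hb
  have h5 : 1 ≤ P * Real.exp (-a + b) := by
    by_contra h
    push Not at h
    nlinarith
  have h6 := mul_le_mul_of_nonneg_right h5 (Real.exp_pos (a - b)).le
  rw [one_mul, mul_assoc, ← Real.exp_add, show -a + b + (a - b) = 0 by ring, Real.exp_zero,
    mul_one] at h6
  refine le_trans (le_of_eq ?_) h6
  congr 1
  rw [ha, hb]; ring

theorem exists_poly_bound (p : Polynomial ℝ) : ∃ B : ℝ, 0 < B ∧ ∀ x : ℝ, 1 ≤ x →
    |p.eval (-x)| ≤ B * x ^ p.natDegree := by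
  refine ⟨1 + ∑ i ∈ range (p.natDegree + 1), |p.coeff i|, by positivity, fun x hx => ?_⟩
  rw [Polynomial.eval_eq_sum_range, add_mul, Finset.sum_mul]
  refine le_add_of_nonneg_of_le (by positivity) ((Finset.abs_sum_le_sum_abs _ _).trans ?_)
  refine Finset.sum_le_sum fun i hi => ?_
  rw [abs_mul, abs_pow, abs_neg, abs_of_nonneg (zero_le_one.trans hx)]
  exact mul_le_mul_of_nonneg_left
    (pow_le_pow_right₀ hx (Nat.lt_succ_iff.1 (Finset.mem_range.1 hi))) (abs_nonneg _)

theorem card_le_natDegree_bp : c.R.card ≤ c.bp.natDegree := by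
  by_contra! hlt
  obtain ⟨B, hB, hbd⟩ := exists_poly_bound c.bp
  set D := c.bp.natDegree
  set C := 2 * c.lR c.eta - c.R.card
  obtain ⟨m, hm⟩ := exists_nat_gt (max 1 (B / Real.exp C))
  have hm1 : (1 : ℝ) < m := (le_max_left _ _).trans_lt hm
  have hm2 : B / Real.exp C < m := (le_max_right _ _).trans_lt hm
  have hm0 : 0 < m := by exact_mod_cast (zero_lt_one.trans hm1)
  have h1 := c.le_prod_bp hm0
  have h2 : ∏ i ∈ range m, |c.bp.eval (-((i : ℝ) + 1))| ≤ (B * (m : ℝ) ^ D) ^ m := by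
    have hc : ∏ _i ∈ range m, (B * (m : ℝ) ^ D) = (B * (m : ℝ) ^ D) ^ m := by simp
    rw [← hc]
    refine Finset.prod_le_prod (fun i _ => abs_nonneg _) fun i hi => ?_
    have h0 : (0 : ℝ) ≤ i := Nat.cast_nonneg i
    refine (hbd ((i : ℝ) + 1) (by linarith)).trans (mul_le_mul_of_nonneg_left ?_ hB.le)
    refine pow_le_pow_left₀ (by linarith) ?_ _
    exact_mod_cast Finset.mem_range.1 hi
  have h3 : Real.exp (m * c.R.card * Real.log m + m * C) =
      ((m : ℝ) ^ c.R.card * Real.exp C) ^ m := by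
    rw [← Real.exp_log (show (0 : ℝ) < (m : ℝ) ^ c.R.card by positivity), ← Real.exp_add,
      ← Real.exp_nat_mul, Real.log_pow]
    congr 1; ring
  rw [h3] at h1
  have h4 := le_of_pow_le_pow_left₀ hm0.ne' (by positivity) (h1.trans h2)
  have h5 : (m : ℝ) ^ D * m ≤ (m : ℝ) ^ c.R.card := by
    rw [← pow_succ]; exact pow_le_pow_right₀ hm1.le hlt
  rw [div_lt_iff₀ (Real.exp_pos _)] at hm2
  have h6 : 0 < (m : ℝ) ^ D := by positivity
  have h7 := mul_le_mul_of_nonneg_right h5 (Real.exp_pos C).le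
  nlinarith

theorem natDegree_bp : c.bp.natDegree = c.R.card :=
  le_antisymm c.natDegree_bp_le c.card_le_natDegree_bp

end CoxeterData
namespace CoxeterData

variable {n : ℕ} (c : CoxeterData n)

theorem norm_exp_mul_log_sub_one_le {u : ℝ} (hu : 0 < u) {s : ℂ} (h0 : 0 ≤ s.re) (h1 : s.re ≤ 1) :
    ‖Complex.exp (s * Real.log u) - 1‖ ≤ (2 * ‖s‖ + 4) * |u - 1| := by
  have hs := norm_nonneg s
  rcases le_total (1 / 2) u with h | h
  · have hd : ∀ v ∈ Set.Ici (1 / 2 : ℝ), HasDerivWithinAt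
        (fun v : ℝ => Complex.exp (s * Real.log v)) (Complex.exp (s * Real.log v) *
          (s * ((v⁻¹ : ℝ) : ℂ))) (Set.Ici (1 / 2)) v := by
      intro v hv
      have hv' : v ≠ 0 := by have : (1 / 2 : ℝ) ≤ v := hv; linarith
      exact (((Real.hasDerivAt_log hv').ofReal_comp.const_mul s).cexp).hasDerivWithinAt
    have hb : ∀ v ∈ Set.Ici (1 / 2 : ℝ), ‖Complex.exp (s * Real.log v) *
        (s * ((v⁻¹ : ℝ) : ℂ))‖ ≤ 2 * ‖s‖ := by
      intro v hv
      have hv2 : (1 / 2 : ℝ) ≤ v := hv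
      have hv0 : 0 < v := by linarith
      rw [norm_mul, norm_mul, Complex.norm_exp, Complex.norm_real,
        Real.norm_of_nonneg (inv_nonneg.2 hv0.le), Complex.re_mul_ofReal]
      have h2 : Real.exp (s.re * Real.log v) * v⁻¹ ≤ 2 := by
        rw [← Real.exp_log (inv_pos.2 hv0), ← Real.exp_add, Real.log_inv,
          show s.re * Real.log v + -Real.log v = (1 - s.re) * (-Real.log v) by ring]
        rw [← Real.exp_log (show (0 : ℝ) < 2 by norm_num)]
        refine Real.exp_le_exp.2 ?_
        have h3 : -Real.log v ≤ Real.log 2 := by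
          rw [← Real.log_inv]
          refine Real.log_le_log (inv_pos.2 hv0) ?_
          rw [inv_le_comm₀ hv0 (by norm_num)]
          linarith
        have h4 : 0 < Real.log 2 := Real.log_pos (by norm_num)
        nlinarith
      nlinarith [mul_le_mul_of_nonneg_right h2 hs]
    have := (convex_Ici (1 / 2 : ℝ)).norm_image_sub_le_of_norm_hasDerivWithin_le hd hb
      (show (1 : ℝ) ∈ Set.Ici (1 / 2 : ℝ) by norm_num) (show u ∈ Set.Ici (1 / 2 : ℝ) from h)
    simp only [Real.log_one, Complex.ofReal_zero, mul_zero, Complex.exp_zero, Real.norm_eq_abs]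
      at this
    nlinarith [abs_nonneg (u - 1)]
  · have h2 : ‖Complex.exp (s * Real.log u)‖ ≤ 1 := by
      rw [Complex.norm_exp, Complex.re_mul_ofReal, Real.exp_le_one_iff]
      exact mul_nonpos_of_nonneg_of_nonpos h0 (Real.log_nonpos hu.le (by linarith))
    have h3 := norm_sub_le (Complex.exp (s * Real.log u)) 1
    rw [norm_one] at h3
    rw [abs_of_nonpos (by linarith)]
    nlinarith

theorem norm_Ft_sub_le (M : ℕ) {s : ℂ} (h0 : 0 ≤ s.re) (h1 : s.re ≤ 1) {ε : ℝ} (hε : 0 < ε) :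
    ‖c.Ft (M + s) * Complex.exp (-(s * Real.log (c.bp.eval (M : ℝ)))) - c.Fr M‖ ≤
      (‖s‖ + 2) * (ε + (c.bp.eval ((M : ℝ) + 1) / c.bp.eval (M : ℝ) - 1) / ε) * c.Fr M := by
  have hM : (0 : ℝ) ≤ M := Nat.cast_nonneg M
  set b := c.bp.eval (M : ℝ) with hb
  have hb0 : 0 < b := c.bp_pos hM
  have hi0 := c.integrable_Fr hM
  have hi1 := c.integrable_Fr (k := (M : ℝ) + 1) (by linarith)
  have hi2 := c.integrable_Fr (k := (M : ℝ) + 1 + 1) (by linarith)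
  have hF1 : c.Fr (M + 1) = b * c.Fr M := c.Fr_add_one hM
  have hF2 : c.Fr (M + 1 + 1) = c.bp.eval ((M : ℝ) + 1) * c.Fr (M + 1) :=
    c.Fr_add_one (by linarith)
  rw [← Ft_ofReal, Ft, Ft, ← integral_mul_const, ← integral_sub
    ((c.integrable_Ft (by simp; linarith)).mul_const _) (c.integrable_Ft (by simp))]
  have hA : Integrable fun x => Real.exp (2 * (M + 1 + 1) * c.lR x) * gauss x * (1 / b ^ 2) -
      Real.exp (2 * (M + 1) * c.lR x) * gauss x * (2 / b) :=
    (hi2.mul_const _).sub (hi1.mul_const _)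
  have hB : Integrable fun x => Real.exp (2 * (M + 1 + 1) * c.lR x) * gauss x * (1 / b ^ 2) -
      Real.exp (2 * (M + 1) * c.lR x) * gauss x * (2 / b) +
      Real.exp (2 * M * c.lR x) * gauss x := hA.add hi0
  have hC : Integrable fun x => (‖s‖ + 2) * (ε * (Real.exp (2 * M * c.lR x) * gauss x) +
        (Real.exp (2 * (M + 1 + 1) * c.lR x) * gauss x * (1 / b ^ 2) -
          Real.exp (2 * (M + 1) * c.lR x) * gauss x * (2 / b) +
          Real.exp (2 * M * c.lR x) * gauss x) * (1 / ε)) :=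
    ((hi0.const_mul _).add (hB.mul_const _)).const_mul _
  have hR : (‖s‖ + 2) * (ε + (c.bp.eval ((M : ℝ) + 1) / b - 1) / ε) * c.Fr M =
      ∫ x, (‖s‖ + 2) * (ε * (Real.exp (2 * M * c.lR x) * gauss x) +
        (Real.exp (2 * (M + 1 + 1) * c.lR x) * gauss x * (1 / b ^ 2) -
          Real.exp (2 * (M + 1) * c.lR x) * gauss x * (2 / b) +
          Real.exp (2 * M * c.lR x) * gauss x) * (1 / ε)) := by
    rw [integral_const_mul, integral_add (hi0.const_mul _) (hB.mul_const _), integral_const_mul,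
      integral_mul_const, integral_add hA hi0, integral_sub (hi2.mul_const _) (hi1.mul_const _),
      integral_mul_const, integral_mul_const]
    change _ = (‖s‖ + 2) * (ε * c.Fr M + (c.Fr (M + 1 + 1) * (1 / b ^ 2) -
      c.Fr (M + 1) * (2 / b) + c.Fr M) * (1 / ε))
    rw [hF2, hF1]
    field_simp
    ring
  rw [hR]
  refine norm_integral_le_of_norm_le hC (Filter.Eventually.of_forall fun x => ?_)
  set u := Real.exp (2 * c.lR x) / b with hu
  have hu0 : 0 < u := div_pos (Real.exp_pos _) hb0
  have e0 : Complex.exp (2 * (M + s) * c.lR x) * (gauss x : ℂ) *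
        Complex.exp (-(s * Real.log b)) -
      Complex.exp (2 * ((M : ℝ) : ℂ) * c.lR x) * (gauss x : ℂ) =
      (Complex.exp (s * Real.log u) - 1) *
        ((Real.exp (2 * M * c.lR x) * gauss x : ℝ) : ℂ) := by
    rw [hu, Real.log_div (Real.exp_pos _).ne' hb0.ne', Real.log_exp, sub_mul, one_mul]
    push_cast
    congr 1
    rw [mul_right_comm, ← Complex.exp_add, ← mul_assoc, ← Complex.exp_add]
    congr 2
    ring
  rw [e0, norm_mul, Complex.norm_real,
    Real.norm_of_nonneg (mul_nonneg (Real.exp_pos _).le (gauss_pos x).le)]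
  set g := Real.exp (2 * M * c.lR x) * gauss x with hg
  have hg0 : 0 < g := mul_pos (Real.exp_pos _) (gauss_pos x)
  have e1 : Real.exp (2 * (M + 1) * c.lR x) * gauss x = g * (b * u) := by
    rw [hu, hg, mul_div_cancel₀ _ hb0.ne', mul_right_comm (Real.exp _), ← Real.exp_add]
    congr 2; ring
  have e2 : Real.exp (2 * (M + 1 + 1) * c.lR x) * gauss x = g * (b * u) ^ 2 := by
    rw [hu, hg, mul_div_cancel₀ _ hb0.ne', mul_right_comm (Real.exp _), ← Real.exp_nat_mul,
      ← Real.exp_add]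
    congr 2; push_cast; ring
  rw [e1, e2]
  have e3 : ε * g + (g * (b * u) ^ 2 * (1 / b ^ 2) - g * (b * u) * (2 / b) + g) * (1 / ε) =
      (ε + (u - 1) ^ 2 / ε) * g := by
    field_simp
    ring
  rw [e3, ← mul_assoc (‖s‖ + 2)]
  refine mul_le_mul_of_nonneg_right ?_ hg0.le
  refine (norm_exp_mul_log_sub_one_le hu0 h0 h1).trans ?_
  have h5 : 2 * |u - 1| ≤ ε + (u - 1) ^ 2 / ε := by
    rw [← sub_nonneg]
    have : ε + (u - 1) ^ 2 / ε - 2 * |u - 1| = (ε - |u - 1|) ^ 2 / ε := by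
      rw [sub_sq ε, sq_abs]
      field_simp
      ring
    rw [this]
    positivity
  nlinarith [norm_nonneg s]

theorem bp_ne_zero : c.bp ≠ 0 := fun h => by
  have := c.bp_pos le_rfl
  simp [h] at this

theorem tendsto_bp_ratio : Filter.Tendsto
    (fun M : ℕ => c.bp.eval ((M : ℝ) + 1) / c.bp.eval (M : ℝ)) Filter.atTop (𝓝 1) := by
  have hX : (Polynomial.X + Polynomial.C (1 : ℝ)).natDegree = 1 := Polynomial.natDegree_X_add_C _
  have hdeg : (c.bp.comp (Polynomial.X + Polynomial.C 1)).degree = c.bp.degree := by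
    have h0 : c.bp.comp (Polynomial.X + Polynomial.C 1) ≠ 0 := fun h =>
      c.bp_ne_zero ((Polynomial.comp_eq_zero_iff.1 h).resolve_right fun h => by
        have := congrArg Polynomial.natDegree h.2
        rw [hX, Polynomial.natDegree_C] at this
        exact one_ne_zero this)
    rw [Polynomial.degree_eq_natDegree h0, Polynomial.degree_eq_natDegree c.bp_ne_zero,
      Polynomial.natDegree_comp, hX, mul_one]
  have h := Polynomial.div_tendsto_atTop_leadingCoeff_div_of_degree_eq
    (c.bp.comp (Polynomial.X + Polynomial.C 1)) c.bp hdeg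
  rw [Polynomial.leadingCoeff_comp (by rw [hX]; exact one_ne_zero),
    Polynomial.leadingCoeff_X_add_C, one_pow, mul_one,
    div_self (Polynomial.leadingCoeff_ne_zero.2 c.bp_ne_zero)] at h
  have h2 := h.comp tendsto_natCast_atTop_atTop
  refine h2.congr fun M => ?_
  simp [Polynomial.eval_comp]

theorem eventually_small (B : ℝ) (hB : 0 ≤ B) {δ : ℝ} (hδ : 0 < δ) : ∀ᶠ M : ℕ in Filter.atTop,
    ∀ s : ℂ, 0 ≤ s.re → s.re ≤ 1 → ‖s‖ ≤ B →
      ‖c.Ft (M + s) * Complex.exp (-(s * Real.log (c.bp.eval (M : ℝ)))) - c.Fr M‖ ≤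
        δ * c.Fr M := by
  set ε := δ / (2 * (B + 2)) with hε
  have hε0 : 0 < ε := by positivity
  have h := (c.tendsto_bp_ratio.sub_const 1).div_const ε
  rw [sub_self, zero_div] at h
  filter_upwards [h.eventually (gt_mem_nhds hε0)] with M hM s h0 h1 hs
  refine (c.norm_Ft_sub_le M h0 h1 hε0).trans ?_
  refine mul_le_mul_of_nonneg_right ?_ (c.Fr_pos (Nat.cast_nonneg M)).le
  have e : δ = (B + 2) * (ε + ε) := by rw [hε]; field_simp; ring
  rw [e]
  have h3 : ε + (c.bp.eval ((M : ℝ) + 1) / c.bp.eval (M : ℝ) - 1) / ε ≤ ε + ε := by linarith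
  nlinarith [norm_nonneg s]

theorem exists_Ft_lower (B : ℝ) (hB : 0 ≤ B) (L : ℕ) : ∃ M : ℕ, L ≤ M ∧ ∃ a : ℝ, 0 < a ∧
    ∀ s : ℂ, 0 ≤ s.re → s.re ≤ 1 → ‖s‖ ≤ B → a ≤ ‖c.Ft (s + M)‖ := by
  obtain ⟨M, hM, hL⟩ := ((c.eventually_small B hB one_half_pos).and
    (Filter.eventually_ge_atTop L)).exists
  have hb := c.bp_pos (Nat.cast_nonneg (α := ℝ) M)
  have hF := c.Fr_pos (Nat.cast_nonneg (α := ℝ) M)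
  refine ⟨M, hL, Real.exp (-|Real.log (c.bp.eval (M : ℝ))|) * (c.Fr M / 2), by positivity,
    fun s h0 h1 hs => ?_⟩
  have h := hM s h0 h1 hs
  have h2 := norm_sub_norm_le (c.Fr M : ℂ)
    (c.Ft (M + s) * Complex.exp (-(s * Real.log (c.bp.eval (M : ℝ)))))
  rw [norm_sub_rev, Complex.norm_real, Real.norm_of_nonneg hF.le, norm_mul, Complex.norm_exp] at h2
  have h3 : c.Fr M / 2 ≤ ‖c.Ft (M + s)‖ *
      Real.exp (-(s * Real.log (c.bp.eval (M : ℝ)))).re := by linarith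
  have h4 : Real.exp (-(s * Real.log (c.bp.eval (M : ℝ)))).re ≤
      Real.exp |Real.log (c.bp.eval (M : ℝ))| := by
    refine Real.exp_le_exp.2 ?_
    rw [Complex.neg_re, Complex.re_mul_ofReal]
    have := neg_abs_le (Real.log (c.bp.eval (M : ℝ)))
    have := abs_nonneg (Real.log (c.bp.eval (M : ℝ)))
    nlinarith
  have h5 := h3.trans (mul_le_mul_of_nonneg_left h4 (norm_nonneg _))
  rw [add_comm s]
  have h6 := mul_le_mul_of_nonneg_left h5
    (Real.exp_pos (-|Real.log (c.bp.eval (M : ℝ))|)).le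
  refine h6.trans (le_of_eq ?_)
  rw [mul_comm, mul_assoc, ← Real.exp_add, add_neg_cancel, Real.exp_zero, mul_one]

theorem exists_J_bound (k : ℂ) : ∃ C : ℝ, ∀ t : ℝ, 0 < t → t < 1 → ‖c.J (k + t) 1‖ ≤ C := by
  obtain ⟨M, ε, h⟩ := c.exists_good c.eta_pos
  have hg : c.Good (Set.Ioo (0 : ℝ) 1) (fun _ => c.eta) M ε :=
    ⟨fun _ _ => h.bdd () trivial, h.pos, fun _ _ => h.le () trivial⟩
  obtain ⟨A, hA, hb⟩ := hg.tame_pre (k := fun t : ℝ => k + t) (K := ‖k‖ + 1) (fun t ht => by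
    refine (norm_add_le _ _).trans (add_le_add_right ?_ _)
    rw [Complex.norm_real, Real.norm_of_nonneg ht.1.le]
    exact ht.2.le) (μ := fun _ => 0) (M' := 0) (fun _ _ i => by simp)
  refine ⟨∫ x : Fin n → ℝ, Real.exp (A * wt x) * gauss x, fun t h0 h1 => ?_⟩
  simp only [J, map_one, one_mul, om_zpt]
  refine norm_integral_le_of_norm_le (integrable_exp_wt_gauss A)
    (Filter.Eventually.of_forall fun x => ?_)
  rw [norm_mul, Complex.norm_real, Real.norm_of_nonneg (gauss_pos x).le]
  exact mul_le_mul_of_nonneg_right (hb t ⟨h0, h1⟩ x) (gauss_pos x).le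

end CoxeterData
theorem geom_sum_eq_prod {d : ℕ} (hd : 0 < d) :
    ∑ i ∈ range d, (Polynomial.X : Polynomial ℂ) ^ i =
      ∏ l ∈ Finset.Ico 1 d, (Polynomial.X -
        Polynomial.C (Complex.exp (2 * Real.pi * I * ((l : ℝ) / (d : ℝ) : ℝ)))) := by
  have hz := Complex.isPrimitiveRoot_exp d hd.ne'
  have hm : (Polynomial.X ^ d - Polynomial.C (1 : ℂ)).Monic :=
    Polynomial.monic_X_pow_sub_C _ hd.ne'
  have h1 := (IsAlgClosed.splits (Polynomial.X ^ d - Polynomial.C (1 : ℂ))).eq_prod_roots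
  have h2 : (Polynomial.X ^ d - Polynomial.C (1 : ℂ)).roots =
      Multiset.map (fun x => Complex.exp (2 * Real.pi * I / d) ^ x * 1) (Multiset.range d) :=
    hz.nthRoots_eq (one_pow d)
  rw [hm.leadingCoeff, Polynomial.C_1, one_mul, Polynomial.C_1.symm, h2, Multiset.map_map] at h1
  have h3 : Polynomial.X ^ d - Polynomial.C (1 : ℂ) = ∏ l ∈ range d, (Polynomial.X -
      Polynomial.C (Complex.exp (2 * Real.pi * I * ((l : ℝ) / (d : ℝ) : ℝ)))) := by
    rw [h1]
    change Finset.prod (range d) _ = _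
    refine Finset.prod_congr rfl fun l _ => ?_
    simp only [Function.comp, mul_one]
    rw [← Complex.exp_nat_mul]
    congr 3
    push_cast
    ring
  have h4 := mul_geom_sum (Polynomial.X : Polynomial ℂ) d
  rw [Polynomial.C_1] at h3
  rw [h3, Finset.range_eq_Ico, Finset.prod_eq_prod_Ico_succ_bot hd] at h4
  have h5 : (Polynomial.X - Polynomial.C (Complex.exp (2 * Real.pi * I *
      (((0 : ℕ) : ℝ) / (d : ℝ) : ℝ)))) = Polynomial.X - 1 := by simp
  rw [h5] at h4
  have h6 : (Polynomial.X - 1 : Polynomial ℂ) ≠ 0 := by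
    simpa using Polynomial.X_sub_C_ne_zero (1 : ℂ)
  rw [Finset.range_eq_Ico]
  simpa using mul_left_cancel₀ h6 h4

theorem exists_lift_map {ι : Type*} [DecidableEq ι] (E : ℂ → ℂ) (g : ι → ℂ) (T : Finset ι) :
    ∀ s : Multiset ℂ, s.map E = T.val.map g →
      ∃ f : ι → ℂ, s = T.val.map f ∧ ∀ i ∈ T, E (f i) = g i := by
  induction T using Finset.induction_on with
  | empty =>
    intro s hs
    refine ⟨fun _ => 0, ?_, by simp⟩
    simpa using hs
  | insert a T ha ih =>
    intro s hs
    rw [Finset.insert_val_of_notMem ha, Multiset.map_cons] at hs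
    obtain ⟨x, hx, hxa, hs'⟩ := (Multiset.map_eq_cons _ _ _ _).2 hs
    obtain ⟨f, hf, hfg⟩ := ih _ hs'
    have hne : ∀ i ∈ T, i ≠ a := fun i hi h => ha (h ▸ hi)
    refine ⟨Function.update f a x, ?_, ?_⟩
    · rw [Finset.insert_val_of_notMem ha, Multiset.map_cons, Function.update_self,
        ← Multiset.cons_erase hx, hf]
      refine congrArg _ (Multiset.map_congr rfl fun i hi => ?_)
      rw [Function.update_of_ne (hne i hi)]
    · intro i hi
      rcases Finset.mem_insert.1 hi with rfl | hi
      · simpa using hxa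
      · rw [Function.update_of_ne (hne i hi)]
        exact hfg i hi

theorem card_filter_le_sum_count {ι : Type*} (T : Finset ι) (g : ι → ℂ) (p : ℂ → Prop)
    [DecidablePred p] (s : Multiset ℂ) (h : ∀ x ∈ s, p x → ∃ i ∈ T, g i = x) :
    (s.filter p).card ≤ ∑ i ∈ T, s.count (g i) := by
  induction s using Multiset.induction_on with
  | empty => simp
  | cons a s ih =>
    have ih' := ih fun x hx => h x (Multiset.mem_cons_of_mem hx)
    simp only [Multiset.count_cons, sum_add_distrib]
    by_cases hp : p a
    · obtain ⟨i, hi, hia⟩ := h a (Multiset.mem_cons_self a s) hp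
      rw [Multiset.filter_cons_of_pos _ hp, Multiset.card_cons]
      refine add_le_add ih' ?_
      refine le_trans ?_ (Finset.single_le_sum (fun _ _ => Nat.zero_le _) hi)
      rw [if_pos hia]
    · rw [Multiset.filter_cons_of_neg _ hp]
      exact ih'.trans (Nat.le_add_right _ _)

/-- The exponential whose fibres are the classes of complex numbers modulo the integers. -/
def expo (k : ℂ) : ℂ := Complex.exp (-(2 * Real.pi * I * k))

theorem expo_eq_iff {a b : ℂ} : expo a = expo b ↔ ∃ z : ℤ, a = b + z := by
  have hne : (2 * Real.pi * I : ℂ) ≠ 0 := Complex.two_pi_I_ne_zero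
  rw [expo, expo, Complex.exp_eq_exp_iff_exists_int]
  constructor
  · rintro ⟨z, hz⟩
    refine ⟨-z, mul_left_cancel₀ hne ?_⟩
    push_cast
    linear_combination -hz
  · rintro ⟨z, hz⟩
    refine ⟨-z, ?_⟩
    rw [hz]
    push_cast
    ring

namespace CoxeterData

variable {n : ℕ} (c : CoxeterData n)

/-- The pairs `(j, l)` with `1 ≤ l < d j`. -/
def idx : Finset (Σ _ : Fin n, ℕ) := Finset.univ.sigma fun j => Finset.Ico 1 (c.d j)

/-- The fraction `l / d j` attached to a pair `(j, l)`. -/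
def kap (i : Σ _ : Fin n, ℕ) : ℝ := (i.2 : ℝ) / (c.d i.1 : ℝ)

theorem kap_pos {i} (hi : i ∈ c.idx) : 0 < c.kap i := by
  have := (Finset.mem_Ico.1 (Finset.mem_sigma.1 hi).2).1
  exact div_pos (by exact_mod_cast this) (by exact_mod_cast c.d_pos _)

theorem kap_lt_one {i} (hi : i ∈ c.idx) : c.kap i < 1 := by
  have := (Finset.mem_Ico.1 (Finset.mem_sigma.1 hi).2).2
  rw [kap, div_lt_one (by exact_mod_cast c.d_pos _)]
  exact_mod_cast this

/-- The product of the geometric sums of lengths `d j`. -/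
def geoQ : Polynomial ℂ := ∏ j, ∑ i ∈ range (c.d j), Polynomial.X ^ i

theorem geoQ_eq : c.geoQ = ∏ i ∈ c.idx,
    (Polynomial.X - Polynomial.C (Complex.exp (2 * Real.pi * I * (c.kap i : ℝ)))) := by
  rw [geoQ, idx, Finset.prod_sigma]
  exact Finset.prod_congr rfl fun j _ => geom_sum_eq_prod (c.d_pos j)

theorem geoQ_ne_zero : c.geoQ ≠ 0 := by
  rw [geoQ_eq]
  exact Finset.prod_ne_zero_iff.2 fun _ _ => Polynomial.X_sub_C_ne_zero _

theorem geoQ_roots : c.geoQ.roots =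
    c.idx.val.map fun i => Complex.exp (2 * Real.pi * I * (c.kap i : ℝ)) := by
  have := Polynomial.roots_multiset_prod_X_sub_C
    (c.idx.val.map fun i => Complex.exp (2 * Real.pi * I * (c.kap i : ℝ)))
  rw [Multiset.map_map] at this
  rw [← this, geoQ_eq]
  rfl

theorem card_idx_le : c.idx.card ≤ c.R.card := by
  have h1 : c.geoQ.natDegree = c.idx.card := by
    rw [← IsAlgClosed.card_roots_eq_natDegree, geoQ_roots, Multiset.card_map, Finset.card_val]
  rw [← h1]
  have h2 : c.geoQ = (∑ w, (Polynomial.X : Polynomial ℝ) ^ c.len w).map (algebraMap ℝ ℂ) := by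
    rw [sum_pow_len, geoQ, Polynomial.map_prod]
    refine Finset.prod_congr rfl fun j _ => ?_
    rw [Polynomial.map_sum]
    simp
  rw [h2]
  refine Polynomial.natDegree_map_le.trans
    (Polynomial.natDegree_sum_le_of_forall_le _ _ fun w _ => ?_)
  rw [Polynomial.natDegree_X_pow]
  exact Finset.card_filter_le _ _

theorem Sk_eq_eval (k : ℂ) : c.Sk k =
    Complex.exp (Real.pi * I * k * c.R.card) * c.geoQ.eval (expo k) / Fintype.card c.W := by
  rw [Sk_eq, geoQ, Polynomial.eval_prod]
  simp only [Polynomial.eval_finsetSum, Polynomial.eval_pow, Polynomial.eval_X]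
  rfl

theorem prod_aeval_bound (s0 : ℂ) (K M : ℕ) (r : ℕ)
    (hr : r ≤ ∑ i ∈ range (K + M),
      ((c.bp.map (algebraMap ℝ ℂ)).roots.count (s0 - K + i))) :
    ∃ C : ℝ, ∀ t : ℝ, 0 < t → t < 1 →
      ‖∏ i ∈ range (K + M), Polynomial.aeval (s0 - K + t + i) c.bp‖ ≤ C * t ^ r := by
  classical
  set b := c.bp.map (algebraMap ℝ ℂ) with hb
  have hdvd : Polynomial.X ^ r ∣ ∏ i ∈ range (K + M),
      b.comp (Polynomial.X + Polynomial.C (s0 - K + i)) := by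
    refine (pow_dvd_pow _ hr).trans ?_
    rw [← Finset.prod_pow_eq_pow_sum]
    refine Finset.prod_dvd_prod_of_dvd _ _ fun i _ => ?_
    obtain ⟨q, hq⟩ := Polynomial.pow_rootMultiplicity_dvd b (s0 - K + i)
    refine ⟨q.comp (Polynomial.X + Polynomial.C (s0 - K + i)), ?_⟩
    conv_lhs => rw [hq]
    rw [Polynomial.count_roots, Polynomial.mul_comp, Polynomial.pow_comp, Polynomial.sub_comp,
      Polynomial.X_comp, Polynomial.C_comp, add_sub_cancel_right]
  obtain ⟨H, hH⟩ := hdvd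
  have hcont : Continuous fun t : ℝ => H.eval (t : ℂ) :=
    H.continuous.comp Complex.continuous_ofReal
  obtain ⟨C, hC⟩ := (isCompact_Icc (a := (0 : ℝ)) (b := 1)).exists_bound_of_continuousOn
    hcont.continuousOn
  refine ⟨C, fun t h0 h1 => ?_⟩
  have h2 := congrArg (Polynomial.eval (t : ℂ)) hH
  rw [Polynomial.eval_prod, Polynomial.eval_mul, Polynomial.eval_pow, Polynomial.eval_X] at h2
  have h3 : ∏ i ∈ range (K + M), Polynomial.aeval (s0 - K + t + i) c.bp =
      (t : ℂ) ^ r * H.eval (t : ℂ) := by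
    rw [← h2]
    refine Finset.prod_congr rfl fun i _ => ?_
    rw [Polynomial.eval_comp, hb, Polynomial.eval_map_algebraMap]
    refine congrArg (fun z => Polynomial.aeval z c.bp) ?_
    simp only [Polynomial.eval_add, Polynomial.eval_X, Polynomial.eval_C]
    ring
  rw [h3, norm_mul, norm_pow, Complex.norm_real, Real.norm_of_nonneg h0.le, mul_comm]
  exact mul_le_mul_of_nonneg_right (hC t ⟨h0.le, h1.le⟩) (by positivity)

theorem Sk_bound {s0 : ℂ} (h0 : 0 ≤ s0.re) : ∃ C : ℝ, ∀ t : ℝ, 0 < t →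
    t < 1 - s0.re → ‖c.Sk (s0 + t)‖ ≤
      C * t ^ ((c.bp.map (algebraMap ℝ ℂ)).roots.map expo).count (expo s0) := by
  classical
  set b := c.bp.map (algebraMap ℝ ℂ) with hb
  obtain ⟨L, hL⟩ : ∃ L : ℕ, ∀ x ∈ b.roots.toFinset, ‖x - s0‖ ≤ L := by
    obtain ⟨L, hL⟩ := exists_nat_ge (∑ x ∈ b.roots.toFinset, ‖x - s0‖)
    exact ⟨L, fun x hx => le_trans (Finset.single_le_sum (f := fun x => ‖x - s0‖)
      (fun _ _ => norm_nonneg _) hx) hL⟩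
  obtain ⟨M, hM, a, ha, hlow⟩ := c.exists_Ft_lower (‖s0‖ + 1) (by positivity) (L + 1)
  obtain ⟨C1, hC1⟩ := c.exists_J_bound (s0 - L)
  have hr : (b.roots.map expo).count (expo s0) ≤
      ∑ i ∈ range (L + M), b.roots.count (s0 - L + i) := by
    rw [Multiset.count_map]
    refine card_filter_le_sum_count _ (fun i : ℕ => s0 - L + i) _ _ fun x hx hxs => ?_
    obtain ⟨z, hz⟩ := expo_eq_iff.1 hxs.symm
    have h2 := hL x (Multiset.mem_toFinset.2 hx)
    rw [hz, add_sub_cancel_left, Complex.norm_intCast] at h2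
    have h3 : |z| ≤ (L : ℤ) := by exact_mod_cast h2
    have h4 := abs_le.1 h3
    refine ⟨(z + L).toNat, ?_, ?_⟩
    · rw [Finset.mem_range]
      omega
    · have h5 : (((z + L).toNat : ℤ) : ℂ) = ((z + L : ℤ) : ℂ) := by
        rw [Int.toNat_of_nonneg (by omega)]
      rw [Int.cast_natCast] at h5
      rw [h5, hz]
      push_cast
      ring
  obtain ⟨C2, hC2⟩ := c.prod_aeval_bound s0 L M _ hr
  refine ⟨C2 * C1 / a, fun t ht ht1 => ?_⟩
  have ht' : t < 1 := by linarith
  set r := (b.roots.map expo).count (expo s0)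
  have hsre : (s0 + t : ℂ).re = s0.re + t := by simp
  have e1 := c.J_add_natCast (s0 - L + t) (L + M)
  have e2 : s0 - L + t + ((L + M : ℕ) : ℂ) = s0 + t + (M : ℕ) := by
    push_cast
    ring
  rw [e2, c.J_eq_Sk_mul_Ft (by simp; linarith [Nat.cast_nonneg (α := ℝ) M]),
    Sk_add_natCast] at e1
  have e3 := congrArg norm e1
  simp only [norm_mul, norm_pow, norm_neg, norm_one, one_pow, one_mul] at e3
  have h6 := hlow (s0 + t) (by rw [hsre]; linarith) (by rw [hsre]; linarith)
    ((norm_add_le _ _).trans (by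
      rw [Complex.norm_real, Real.norm_of_nonneg ht.le]; linarith))
  have h7 := hC1 t ht ht'
  have h8 := hC2 t ht ht'
  rw [div_mul_eq_mul_div, le_div_iff₀ ha]
  calc ‖c.Sk (s0 + t)‖ * a ≤ ‖c.Sk (s0 + t)‖ * ‖c.Ft (s0 + t + M)‖ := by gcongr
    _ ≤ (C2 * t ^ r) * C1 := by
      rw [e3]
      exact mul_le_mul h8 h7 (norm_nonneg _) ((norm_nonneg _).trans h8)
    _ = _ := by ring

theorem hasDerivAt_expo (s0 : ℂ) : HasDerivAt (fun t : ℝ => expo (s0 + t))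
    (-(2 * Real.pi * I) * expo s0) 0 := by
  have h1 : HasDerivAt (fun t : ℝ => -(2 * Real.pi * I * (s0 + (t : ℂ)))) (-(2 * Real.pi * I)) 0 := by
    have := (((Complex.ofRealCLM.hasDerivAt (x := (0 : ℝ))).const_add s0).const_mul
      (2 * Real.pi * I)).fun_neg
    simpa using this
  have := h1.cexp
  simp only [Complex.ofReal_zero, add_zero] at this
  rw [mul_comm (-(2 * Real.pi * I : ℂ))]
  exact this

theorem count_roots_le {s0 : ℂ} (h0 : 0 ≤ s0.re) (h1 : s0.re < 1) :
    ((c.bp.map (algebraMap ℝ ℂ)).roots.map expo).count (expo s0) ≤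
      c.geoQ.rootMultiplicity (expo s0) := by
  by_contra! hlt
  obtain ⟨C, hC⟩ := c.Sk_bound h0
  set r := ((c.bp.map (algebraMap ℝ ℂ)).roots.map expo).count (expo s0)
  obtain ⟨H, hH, hnd⟩ := Polynomial.exists_eq_pow_rootMultiplicity_mul_and_not_dvd c.geoQ
    c.geoQ_ne_zero (expo s0)
  set μ := c.geoQ.rootMultiplicity (expo s0)
  have hH0 : H.eval (expo s0) ≠ 0 := fun h => hnd (Polynomial.dvd_iff_isRoot.2 h)
  have hcont : ContinuousAt (fun t : ℝ => expo (s0 + t)) 0 := (hasDerivAt_expo s0).continuousAt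
  have hslope : Filter.Tendsto (fun t : ℝ => (expo (s0 + t) - expo s0) / (t : ℂ))
      (𝓝[>] 0) (𝓝 (-(2 * Real.pi * I) * expo s0)) := by
    have := (hasDerivAt_expo s0).tendsto_slope_zero_right
    refine this.congr fun t => ?_
    rw [zero_add, Complex.ofReal_zero, add_zero, Complex.real_smul, Complex.ofReal_inv]
    field_simp
  have hc0 : Filter.Tendsto (fun t : ℝ => expo (s0 + t)) (𝓝[>] 0) (𝓝 (expo s0)) := by
    have := hcont.tendsto.mono_left (nhdsWithin_le_nhds (s := Set.Ioi 0))
    simpa using this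
  have hce : Filter.Tendsto (fun t : ℝ => Complex.exp (Real.pi * I * (s0 + t) * c.R.card))
      (𝓝[>] 0) (𝓝 (Complex.exp (Real.pi * I * s0 * c.R.card))) := by
    have : Continuous fun t : ℝ => Complex.exp (Real.pi * I * (s0 + t) * c.R.card) := by
      fun_prop
    have h := (this.tendsto 0).mono_left (nhdsWithin_le_nhds (s := Set.Ioi 0))
    simpa using h
  have hlim : Filter.Tendsto (fun t : ℝ => c.Sk (s0 + t) / (t : ℂ) ^ μ) (𝓝[>] 0)
      (𝓝 (Complex.exp (Real.pi * I * s0 * c.R.card) *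
        ((-(2 * Real.pi * I) * expo s0) ^ μ * H.eval (expo s0)) / Fintype.card c.W)) := by
    refine ((hce.mul ((hslope.pow μ).mul ((H.continuous.tendsto _).comp hc0))).div_const _).congr
      fun t => ?_
    rw [Sk_eq_eval, hH, Polynomial.eval_mul, Polynomial.eval_pow, Polynomial.eval_sub,
      Polynomial.eval_X, Polynomial.eval_C, div_pow]
    simp only [Function.comp]
    ring
  have hzero : Filter.Tendsto (fun t : ℝ => c.Sk (s0 + t) / (t : ℂ) ^ μ) (𝓝[>] 0) (𝓝 0) := by
    have hb : Filter.Tendsto (fun t : ℝ => C * t ^ (r - μ)) (𝓝[>] 0) (𝓝 0) := by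
      have : Continuous fun t : ℝ => C * t ^ (r - μ) := by fun_prop
      have h := (this.tendsto 0).mono_left (nhdsWithin_le_nhds (s := Set.Ioi 0))
      rwa [zero_pow (by omega), mul_zero] at h
    refine squeeze_zero_norm' ?_ hb
    have hmem : Set.Ioo 0 (1 - s0.re) ∈ 𝓝[>] (0 : ℝ) := Ioo_mem_nhdsGT (by linarith)
    filter_upwards [hmem] with t ht
    rw [norm_div, norm_pow, Complex.norm_real, Real.norm_of_nonneg ht.1.le,
      div_le_iff₀ (pow_pos ht.1 _), mul_assoc, ← pow_add, Nat.sub_add_cancel hlt.le]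
    exact hC t ht.1 ht.2
  have huniq := tendsto_nhds_unique hlim hzero
  have hW : (Fintype.card c.W : ℂ) ≠ 0 := by exact_mod_cast Fintype.card_ne_zero
  refine div_ne_zero (mul_ne_zero (Complex.exp_ne_zero _)
    (mul_ne_zero (pow_ne_zero _ (mul_ne_zero ?_ (Complex.exp_ne_zero _))) hH0)) hW huniq
  exact neg_ne_zero.2 Complex.two_pi_I_ne_zero

theorem bp_roots_map : (c.bp.map (algebraMap ℝ ℂ)).roots.map expo = c.geoQ.roots := by
  classical
  refine Multiset.eq_of_le_of_card_le (Multiset.le_iff_count.2 fun θ => ?_) ?_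
  · rcases Nat.eq_zero_or_pos (((c.bp.map (algebraMap ℝ ℂ)).roots.map expo).count θ) with h | h
    · rw [h]
      exact Nat.zero_le _
    obtain ⟨κ, -, rfl⟩ := Multiset.mem_map.1 (Multiset.count_pos.1 h)
    have he : expo κ = expo (κ - (⌊κ.re⌋ : ℤ)) :=
      expo_eq_iff.2 ⟨⌊κ.re⌋, by ring⟩
    rw [he, Polynomial.count_roots]
    refine c.count_roots_le ?_ ?_
    · simp
    · have := Int.lt_floor_add_one κ.re
      simp only [Complex.sub_re, Complex.intCast_re]
      linarith
  · rw [geoQ_roots, Multiset.card_map, Multiset.card_map, Finset.card_val,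
      IsAlgClosed.card_roots_eq_natDegree, Polynomial.natDegree_map, natDegree_bp]
    exact c.card_idx_le

theorem card_idx : c.idx.card = c.R.card := by
  have h := congrArg Multiset.card c.bp_roots_map
  rw [geoQ_roots, Multiset.card_map, Multiset.card_map, Finset.card_val,
    IsAlgClosed.card_roots_eq_natDegree, Polynomial.natDegree_map, natDegree_bp] at h
  exact h.symm

theorem exists_bp_eq : ∃ a : (Σ _ : Fin n, ℕ) → ℕ, ∃ c0 : ℝ, 0 < c0 ∧
    ∀ x : ℝ, c.bp.eval x = c0 * ∏ i ∈ c.idx, (x + c.kap i + a i) := by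
  classical
  obtain ⟨f, hf, hfg⟩ := exists_lift_map expo _ c.idx _ (c.bp_roots_map.trans c.geoQ_roots)
  set b := c.bp.map (algebraMap ℝ ℂ) with hb
  have hb0 : b ≠ 0 := (Polynomial.map_ne_zero_iff (algebraMap ℝ ℂ).injective).2 c.bp_ne_zero
  have key : ∀ i ∈ c.idx, ∃ a : ℕ, f i = -((c.kap i + a : ℝ) : ℂ) := by
    intro i hi
    have h1 : expo (f i) = expo (-(c.kap i : ℂ)) := by
      rw [hfg i hi, expo]
      congr 1
      ring
    obtain ⟨z, hz⟩ := expo_eq_iff.1 h1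
    have hroot : c.bp.eval (-c.kap i + z) = 0 := by
      have h2 : f i ∈ b.roots := by
        rw [hf]
        exact Multiset.mem_map_of_mem f hi
      have h3 := (Polynomial.mem_roots hb0).1 h2
      have h4 : f i = ((-c.kap i + z : ℝ) : ℂ) := by
        rw [hz]
        push_cast
        ring
      rw [Polynomial.IsRoot, hb, Polynomial.eval_map_algebraMap, h4, aeval_ofReal] at h3
      exact_mod_cast h3
    have hz0 : z ≤ 0 := by
      by_contra! h
      have h5 : (1 : ℝ) ≤ z := by exact_mod_cast h
      have := c.bp_pos (x := -c.kap i + z) (by linarith [c.kap_lt_one hi])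
      exact this.ne' hroot
    refine ⟨(-z).toNat, ?_⟩
    have h6 : (((-z).toNat : ℤ) : ℂ) = ((-z : ℤ) : ℂ) := by
      rw [Int.toNat_of_nonneg (by omega)]
    rw [Int.cast_natCast] at h6
    push_cast
    rw [h6, hz]
    push_cast
    ring
  choose! a ha using key
  have heval : ∀ x : ℝ, c.bp.eval x =
      c.bp.leadingCoeff * ∏ i ∈ c.idx, (x + c.kap i + a i) := by
    intro x
    have h1 := (IsAlgClosed.splits b).eq_prod_roots
    have h2 := congrArg (Polynomial.eval (x : ℂ)) h1
    rw [hf, Multiset.map_map, Polynomial.eval_mul, Polynomial.eval_C,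
      Polynomial.eval_multiset_prod, Multiset.map_map] at h2
    have h3 : (Multiset.map (Polynomial.eval (x : ℂ) ∘ (fun x => Polynomial.X - Polynomial.C x) ∘ f)
        c.idx.val).prod = ∏ i ∈ c.idx, (((x + c.kap i + a i : ℝ)) : ℂ) := by
      refine Finset.prod_congr rfl fun i hi => ?_
      simp only [Function.comp, Polynomial.eval_sub, Polynomial.eval_X, Polynomial.eval_C]
      rw [ha i hi]
      push_cast
      ring
    rw [h3, hb, Polynomial.leadingCoeff_map, Polynomial.eval_map_algebraMap, aeval_ofReal] at h2
    have h4 : ((c.bp.eval x : ℝ) : ℂ) =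
        ((c.bp.leadingCoeff * ∏ i ∈ c.idx, (x + c.kap i + a i) : ℝ) : ℂ) := by
      push_cast at h2 ⊢
      exact h2
    exact_mod_cast h4
  refine ⟨a, c.bp.leadingCoeff, ?_, heval⟩
  have h0 := c.bp_pos le_rfl
  rw [heval 0] at h0
  refine pos_of_mul_pos_left h0 (Finset.prod_nonneg fun i hi => ?_)
  have := c.kap_pos hi
  positivity

end CoxeterData

theorem pow_min_bound {κ : ℝ} (h1 : κ < 1) (a m : ℕ) :
    ∏ i ∈ range m, |-((i : ℝ) + 1) + κ + a| ≤
      (1 + a / (1 - κ)) ^ a * ∏ i ∈ range m, ((i : ℝ) + 1 - κ) := by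
  have hκ : 0 < 1 - κ := by linarith
  have hg : 1 ≤ 1 + a / (1 - κ) := by
    have : 0 ≤ a / (1 - κ) := by positivity
    linarith
  have hpos : ∀ i : ℕ, 0 < (i : ℝ) + 1 - κ := fun i => by
    have := Nat.cast_nonneg (α := ℝ) i
    linarith
  suffices ∏ i ∈ range m, |-((i : ℝ) + 1) + κ + a| ≤
      (1 + a / (1 - κ)) ^ (min m a) * ∏ i ∈ range m, ((i : ℝ) + 1 - κ) from
    this.trans (mul_le_mul_of_nonneg_right (pow_le_pow_right₀ hg (min_le_right _ _))
      (Finset.prod_nonneg fun i _ => (hpos i).le))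
  induction m with
  | zero => simp
  | succ m ih =>
    rw [Finset.prod_range_succ, Finset.prod_range_succ]
    rcases lt_or_ge m a with h | h
    · rw [min_eq_left h.le] at ih
      rw [min_eq_left h]
      have h2 : |-((m : ℝ) + 1) + κ + a| ≤ (1 + a / (1 - κ)) * ((m : ℝ) + 1 - κ) := by
        have h3 : (a : ℝ) ≤ a / (1 - κ) * ((m : ℝ) + 1 - κ) := by
          rw [div_mul_eq_mul_div, le_div_iff₀ hκ]
          have := Nat.cast_nonneg (α := ℝ) m
          exact mul_le_mul_of_nonneg_left (by linarith) (Nat.cast_nonneg _)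
        have h4 := hpos m
        have h5 := Nat.cast_nonneg (α := ℝ) a
        rw [add_mul, one_mul, abs_le]
        constructor <;> linarith
      refine (mul_le_mul ih h2 (abs_nonneg _) (by
        have := Finset.prod_nonneg (s := range m) fun i _ => (hpos i).le
        positivity)).trans (le_of_eq ?_)
      ring
    · rw [min_eq_right h] at ih
      rw [min_eq_right (by omega)]
      have h2 : |-((m : ℝ) + 1) + κ + a| ≤ (m : ℝ) + 1 - κ := by
        have h5 := Nat.cast_nonneg (α := ℝ) a
        have h6 : (a : ℝ) ≤ m := by exact_mod_cast h
        rw [abs_le]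
        constructor <;> linarith
      rw [← mul_assoc]
      exact mul_le_mul ih h2 (abs_nonneg _) (by
        have := Finset.prod_nonneg (s := range m) fun i _ => (hpos i).le
        positivity)

theorem mul_prod_le {κ : ℝ} (h0 : 0 < κ) (h1 : κ < 1) {a : ℕ} (ha : 1 ≤ a) (m : ℕ) :
    m * ∏ i ∈ range m, ((i : ℝ) + κ) ≤ ∏ i ∈ range m, ((i : ℝ) + κ + a) := by
  have key : ∀ m : ℕ, (m + κ) * ∏ i ∈ range m, ((i : ℝ) + κ) ≤
      κ * ∏ i ∈ range m, ((i : ℝ) + κ + a) := by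
    intro m
    induction m with
    | zero => simp
    | succ m ih =>
      rw [Finset.prod_range_succ, Finset.prod_range_succ]
      have h3 : (1 : ℝ) ≤ a := by exact_mod_cast ha
      have h4 : (0 : ℝ) ≤ m := Nat.cast_nonneg _
      have h5 : 0 ≤ ∏ i ∈ range m, ((i : ℝ) + κ + a) :=
        Finset.prod_nonneg fun i _ => by positivity
      calc ((m + 1 : ℕ) + κ) * ((∏ i ∈ range m, ((i : ℝ) + κ)) * (m + κ))
          = ((m + κ) * ∏ i ∈ range m, ((i : ℝ) + κ)) * (m + κ + 1) := by push_cast; ring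
        _ ≤ (κ * ∏ i ∈ range m, ((i : ℝ) + κ + a)) * (m + κ + a) := by
          gcongr
        _ = _ := by ring
  have h2 := key m
  have h6 : 0 ≤ ∏ i ∈ range m, ((i : ℝ) + κ) :=
    Finset.prod_nonneg fun i _ => by positivity
  have h7 : 0 ≤ ∏ i ∈ range m, ((i : ℝ) + κ + a) :=
    Finset.prod_nonneg fun i _ => by positivity
  nlinarith [mul_nonneg h0.le h6]

namespace CoxeterData

variable {n : ℕ} (c : CoxeterData n)

theorem prod_idx_reflect (f : ℝ → ℝ) :
    ∏ i ∈ c.idx, f (c.kap i) = ∏ i ∈ c.idx, f (1 - c.kap i) := by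
  simp only [idx, Finset.prod_sigma]
  refine Finset.prod_congr rfl fun j _ => ?_
  have hd := c.d_pos j
  refine Finset.prod_nbij' (fun l => c.d j - l) (fun l => c.d j - l) ?_ ?_ ?_ ?_ ?_
  · intro l hl
    rw [Finset.mem_Ico] at hl ⊢
    omega
  · intro l hl
    rw [Finset.mem_Ico] at hl ⊢
    omega
  · intro l hl
    rw [Finset.mem_Ico] at hl
    omega
  · intro l hl
    rw [Finset.mem_Ico] at hl
    omega
  · intro l hl
    rw [Finset.mem_Ico] at hl
    refine congrArg f ?_
    have : (c.d j : ℝ) ≠ 0 := by exact_mod_cast hd.ne'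
    simp only [kap]
    rw [Nat.cast_sub hl.2.le]
    field_simp
    ring

theorem exists_bp_eq_prod : ∃ c0 : ℝ, 0 < c0 ∧
    ∀ x : ℝ, c.bp.eval x = c0 * ∏ i ∈ c.idx, (x + c.kap i) := by
  obtain ⟨a, c0, hc0, hb⟩ := c.exists_bp_eq
  suffices ∀ i ∈ c.idx, a i = 0 by
    refine ⟨c0, hc0, fun x => ?_⟩
    rw [hb]
    refine congrArg _ (Finset.prod_congr rfl fun i hi => ?_)
    rw [this i hi, Nat.cast_zero, add_zero]
  intro i0 hi0
  by_contra hne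
  have ha0 : 1 ≤ a i0 := Nat.one_le_iff_ne_zero.2 hne
  set B : ℝ := ∏ i ∈ c.idx, (1 + a i / (1 - c.kap i)) ^ a i with hB
  obtain ⟨m, hm⟩ := exists_nat_gt ((Fintype.card c.W : ℝ) * B)
  have hp := c.prod_bp_le m
  set β : ℝ := ∏ i ∈ c.idx, ∏ l ∈ range m, ((l : ℝ) + c.kap i) with hβ
  have hβ' : β = ∏ i ∈ c.idx, ∏ l ∈ range m, ((l : ℝ) + 1 - c.kap i) := by
    rw [hβ, c.prod_idx_reflect fun κ => ∏ l ∈ range m, ((l : ℝ) + κ)]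
    simp only [add_sub_assoc]
  have hβ0 : 0 < β := Finset.prod_pos fun i hi => Finset.prod_pos fun l _ => by
    have := c.kap_pos hi
    positivity
  have e1 : ∏ i ∈ range m, c.bp.eval (i : ℝ) =
      c0 ^ m * ∏ i ∈ c.idx, ∏ l ∈ range m, ((l : ℝ) + c.kap i + a i) := by
    simp only [hb]
    rw [Finset.prod_mul_distrib, Finset.prod_const, Finset.card_range, Finset.prod_comm]
  have e2 : ∏ i ∈ range m, |c.bp.eval (-((i : ℝ) + 1))| =
      c0 ^ m * ∏ i ∈ c.idx, ∏ l ∈ range m, |-((l : ℝ) + 1) + c.kap i + a i| := by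
    simp only [hb, abs_mul, abs_of_pos hc0, Finset.abs_prod]
    rw [Finset.prod_mul_distrib, Finset.prod_const, Finset.card_range, Finset.prod_comm]
  have h1 : m * β ≤ ∏ i ∈ c.idx, ∏ l ∈ range m, ((l : ℝ) + c.kap i + a i) := by
    rw [hβ, ← Finset.mul_prod_erase _ _ hi0, ← Finset.mul_prod_erase _ (fun i =>
      ∏ l ∈ range m, ((l : ℝ) + c.kap i + a i)) hi0, ← mul_assoc]
    have hpos : ∀ i ∈ c.idx.erase i0, ∀ l ∈ range m, (0 : ℝ) ≤ (l : ℝ) + c.kap i :=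
      fun i hi l _ => by
        have := c.kap_pos (Finset.mem_of_mem_erase hi)
        positivity
    refine mul_le_mul (mul_prod_le (c.kap_pos hi0) (c.kap_lt_one hi0) ha0 m)
      (Finset.prod_le_prod (fun i hi => Finset.prod_nonneg (hpos i hi)) fun i hi =>
        Finset.prod_le_prod (hpos i hi) fun l _ => ?_)
      (Finset.prod_nonneg fun i hi => Finset.prod_nonneg (hpos i hi))
      (Finset.prod_nonneg fun l _ => ?_)
    · exact le_add_of_nonneg_right (Nat.cast_nonneg _)
    · have := c.kap_pos hi0
      positivity
  have h2 : ∏ i ∈ c.idx, ∏ l ∈ range m, |-((l : ℝ) + 1) + c.kap i + a i| ≤ B * β := by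
    rw [hB, hβ', ← Finset.prod_mul_distrib]
    exact Finset.prod_le_prod (fun i _ => Finset.prod_nonneg fun l _ => abs_nonneg _)
      fun i hi => pow_min_bound (c.kap_lt_one hi) (a i) m
  rw [e1, e2] at hp
  have h3 : c0 ^ m * (m * β) ≤ c0 ^ m * (Fintype.card c.W * B * β) :=
    calc c0 ^ m * (m * β) ≤ _ := mul_le_mul_of_nonneg_left h1 (by positivity)
      _ ≤ _ := hp
      _ ≤ Fintype.card c.W * (c0 ^ m * (B * β)) := by gcongr
      _ = _ := by ring
  have h4 := le_of_mul_le_mul_left h3 (by positivity)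
  have h5 := le_of_mul_le_mul_right h4 hβ0
  linarith

/-- The polynomial `∏_j d_j ∏_{0<l<d_j} (d_j x + l)`. -/
def bs (x : ℝ) : ℝ := ∏ j, (c.d j : ℝ) * ∏ l ∈ Finset.Ico 1 (c.d j), ((c.d j : ℝ) * x + l)

theorem bs_pos {x : ℝ} (hx : 0 ≤ x) : 0 < c.bs x := by
  refine Finset.prod_pos fun j _ => mul_pos (by exact_mod_cast c.d_pos j)
    (Finset.prod_pos fun l hl => ?_)
  have := (Finset.mem_Ico.1 hl).1
  have : (0 : ℝ) < l := by exact_mod_cast this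
  positivity

theorem bs_eq (x : ℝ) : c.bs x = (∏ j, (c.d j : ℝ) ^ (c.d j)) * ∏ i ∈ c.idx, (x + c.kap i) := by
  rw [idx, Finset.prod_sigma, ← Finset.prod_mul_distrib, bs]
  refine Finset.prod_congr rfl fun j _ => ?_
  have hd := c.d_pos j
  have h0 : (c.d j : ℝ) ≠ 0 := by exact_mod_cast hd.ne'
  have h1 : ∀ l : ℕ, (c.d j : ℝ) * x + l = c.d j * (x + c.kap ⟨j, l⟩) := fun l => by
    simp only [kap]
    field_simp
  simp only [h1]
  rw [Finset.prod_mul_distrib, Finset.prod_const, Nat.card_Ico, ← mul_assoc, ← pow_succ',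
    Nat.sub_add_cancel hd]

theorem exists_bp_eq_bs : ∃ cc : ℝ, 0 < cc ∧ ∀ x : ℝ, c.bp.eval x = cc * c.bs x := by
  obtain ⟨c0, hc0, h⟩ := c.exists_bp_eq_prod
  have hD : 0 < ∏ j, (c.d j : ℝ) ^ (c.d j) :=
    Finset.prod_pos fun j _ => pow_pos (by exact_mod_cast c.d_pos j) _
  refine ⟨c0 / ∏ j, (c.d j : ℝ) ^ (c.d j), div_pos hc0 hD, fun x => ?_⟩
  rw [h, bs_eq, ← mul_assoc, div_mul_cancel₀ _ hD.ne']

theorem bs_reflect (x : ℝ) : c.bs (-(x + 1)) = (-1) ^ c.R.card * c.bs x := by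
  rw [bs_eq, bs_eq, c.prod_idx_reflect fun κ => x + κ, ← c.card_idx, mul_left_comm,
    ← Finset.prod_const, ← Finset.prod_mul_distrib]
  refine congrArg _ (Finset.prod_congr rfl fun i _ => ?_)
  ring

theorem prod_bs_step (j : Fin n) (s : ℝ) (M : ℕ) :
    (∏ i ∈ range M, ((c.d j : ℝ) * ∏ l ∈ Finset.Ico 1 (c.d j),
        ((c.d j : ℝ) * (s + i) + l))) * ∏ i ∈ range M, (s + i + 1) =
      ∏ p ∈ range (c.d j * M), ((c.d j : ℝ) * s + p + 1) := by
  set d := c.d j with hd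
  have hd0 : 0 < d := c.d_pos j
  rw [← Finset.prod_mul_distrib]
  induction M with
  | zero => simp
  | succ M ih =>
    rw [Finset.prod_range_succ, ih, Nat.mul_succ, Finset.prod_range_add]
    refine congrArg _ ?_
    have h1 : (range d).prod (fun x => (d : ℝ) * s + ((d * M + x : ℕ) : ℝ) + 1) =
        ∏ l ∈ Finset.Ico 1 (d + 1), ((d : ℝ) * (s + M) + l) := by
      rw [Finset.prod_Ico_eq_prod_range, Nat.add_sub_cancel]
      refine Finset.prod_congr rfl fun x _ => ?_
      push_cast
      ring
    rw [h1, Finset.prod_Ico_succ_top hd0]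
    ring

theorem prod_bs (s : ℝ) (hs : 0 ≤ s) (M : ℕ) :
    ∏ i ∈ range M, c.bs (s + i) = ∏ j,
      (∏ p ∈ range (c.d j * M), ((c.d j : ℝ) * s + p + 1)) /
        ∏ i ∈ range M, (s + i + 1) := by
  simp only [bs]
  rw [Finset.prod_comm]
  refine Finset.prod_congr rfl fun j _ => ?_
  rw [← c.prod_bs_step j s M, mul_div_cancel_right₀]
  exact Finset.prod_ne_zero_iff.2 fun i _ => by positivity

end CoxeterData

/-- The normalised Gaussian measure. -/
def gaussM (n : ℕ) : Measure (Fin n → ℝ) :=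
  volume.withDensity fun x => ENNReal.ofReal (gauss x / CoxeterData.Z0 n)

theorem measurable_gaussM_density {n : ℕ} :
    Measurable fun x : Fin n → ℝ => ENNReal.ofReal (gauss x / CoxeterData.Z0 n) :=
  (continuous_gauss.div_const _).measurable.ennreal_ofReal

theorem integral_gaussM {n : ℕ} (g : (Fin n → ℝ) → ℝ) :
    ∫ x, g x ∂gaussM n = (∫ x, g x * gauss x) / CoxeterData.Z0 n := by
  rw [gaussM, integral_withDensity_eq_integral_toReal_smul measurable_gaussM_density
    (Filter.Eventually.of_forall fun _ => ENNReal.ofReal_lt_top), ← integral_div]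
  refine integral_congr_ae (Filter.Eventually.of_forall fun x => ?_)
  dsimp only
  rw [ENNReal.toReal_ofReal (div_nonneg (gauss_pos x).le CoxeterData.Z0_pos.le), smul_eq_mul]
  ring

instance (n : ℕ) : IsProbabilityMeasure (gaussM n) := by
  constructor
  have hZ := CoxeterData.Z0_pos (n := n)
  rw [gaussM, withDensity_apply _ MeasurableSet.univ, Measure.restrict_univ,
    ← ofReal_integral_eq_lintegral_ofReal (integrable_gauss.div_const _)
      (Filter.Eventually.of_forall fun x => div_nonneg (gauss_pos x).le hZ.le), integral_div]
  change ENNReal.ofReal (CoxeterData.Z0 n / CoxeterData.Z0 n) = 1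
  rw [div_self hZ.ne', ENNReal.ofReal_one]

theorem continuous_dotR {n : ℕ} (a : Fin n → ℝ) : Continuous (dotR a) := by
  unfold dotR
  fun_prop

theorem mgf_gaussM {n : ℕ} {a : Fin n → ℝ} (ha : dotR a a = 2) (t : ℝ) :
    ProbabilityTheory.mgf (dotR a) (gaussM n) t = Real.exp (t ^ 2) := by
  have h1 : ∀ x : Fin n → ℝ, t * dotR a x = dotR (t • a) x := fun x => (dotR_smul_left _ _ _).symm
  rw [ProbabilityTheory.mgf, integral_gaussM]
  simp only [h1]
  rw [CoxeterData.integral_exp_mul_gauss, mul_div_cancel_right₀ _ CoxeterData.Z0_pos.ne',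
    dotR_smul_left, dotR_smul_right, ha]
  congr 1
  ring

theorem map_gaussM {n : ℕ} {a : Fin n → ℝ} (ha : dotR a a = 2) :
    (gaussM n).map (dotR a) = ProbabilityTheory.gaussianReal 0 2 := by
  have hm : AEMeasurable (dotR a) (gaussM n) := (continuous_dotR a).measurable.aemeasurable
  have h1 : ProbabilityTheory.mgf (dotR a) (gaussM n) =
      ProbabilityTheory.mgf id (ProbabilityTheory.gaussianReal 0 2) := by
    funext t
    rw [mgf_gaussM ha, ProbabilityTheory.mgf_id_gaussianReal]
    congr 1
    push_cast
    ring
  have hset : ProbabilityTheory.integrableExpSet (dotR a) (gaussM n) = Set.univ := by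
    refine Set.eq_univ_of_forall fun t => ?_
    change Integrable _ _
    rw [← ProbabilityTheory.mgf_pos_iff, mgf_gaussM ha]
    exact Real.exp_pos _
  have h2 : ProbabilityTheory.complexMGF (dotR a) (gaussM n) =
      ProbabilityTheory.complexMGF id (ProbabilityTheory.gaussianReal 0 2) := by
    funext z
    refine ProbabilityTheory.eqOn_complexMGF_of_mgf h1 ?_
    rw [hset]
    simp
  have := Measure.ext_of_complexMGF_eq hm aemeasurable_id h2
  rwa [Measure.map_id] at this

/-- The absolute moments of a centred Gaussian variable of variance two. -/
def absMoment (k : ℝ) : ℝ := (4 : ℝ) ^ k * Real.Gamma (k + 1 / 2) / √Real.pi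

theorem absMoment_pos {k : ℝ} (hk : -(1 / 2) < k) : 0 < absMoment k := by
  have := Real.Gamma_pos_of_pos (show 0 < k + 1 / 2 by linarith)
  have := Real.pi_pos
  unfold absMoment
  positivity

theorem integral_abs_gaussianReal {k : ℝ} (hk : -(1 / 2) < k) :
    ∫ x, Real.exp (2 * k * Real.log |x|) ∂ProbabilityTheory.gaussianReal 0 2 = absMoment k := by
  rw [ProbabilityTheory.integral_gaussianReal_eq_integral_smul two_ne_zero]
  have h1 : ∀ᵐ x : ℝ, ProbabilityTheory.gaussianPDFReal 0 2 x •
      Real.exp (2 * k * Real.log |x|) =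
      (fun y : ℝ => (√(2 * Real.pi * 2))⁻¹ * (y ^ (2 * k) * Real.exp (-(1 / 4) * y ^ (2 : ℝ))))
        |x| := by
    have h0 : ∀ᵐ x : ℝ, x ≠ 0 := by
      have := Measure.ae_ne volume (0 : ℝ)
      exact this
    filter_upwards [h0] with x hx
    have hx' : 0 < |x| := abs_pos.2 hx
    rw [ProbabilityTheory.gaussianPDFReal, smul_eq_mul, Real.rpow_def_of_pos hx',
      Real.rpow_two, sq_abs, mul_assoc, mul_comm (Real.exp (-(x - 0) ^ 2 / _))]
    congr 3
    · ring
    · rw [sub_zero]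
      push_cast
      ring
  rw [integral_congr_ae h1, integral_comp_abs (f := fun y : ℝ => (√(2 * Real.pi * 2))⁻¹ *
      (y ^ (2 * k) * Real.exp (-(1 / 4) * y ^ (2 : ℝ)))), MeasureTheory.integral_const_mul,
    integral_rpow_mul_exp_neg_mul_rpow two_pos (by linarith) (by norm_num), absMoment]
  have e1 : (2 * k + 1) / 2 = k + 1 / 2 := by ring
  have e2 : (1 / 4 : ℝ) ^ (-(2 * k + 1) / 2) = 4 ^ k * 2 := by
    rw [one_div, Real.inv_rpow (by norm_num), ← Real.rpow_neg (by norm_num)]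
    have : -(-(2 * k + 1) / 2) = k + 1 / 2 := by ring
    rw [this, Real.rpow_add (by norm_num), ← Real.sqrt_eq_rpow,
      show (4 : ℝ) = 2 ^ 2 by norm_num, Real.sqrt_sq (by norm_num)]
  have e3 : √(2 * Real.pi * 2) = 2 * √Real.pi := by
    rw [show 2 * Real.pi * 2 = 2 ^ 2 * Real.pi by ring, Real.sqrt_mul (by positivity),
      Real.sqrt_sq (by norm_num)]
  have hp : √Real.pi ≠ 0 := (Real.sqrt_pos.2 Real.pi_pos).ne'
  rw [e1, e2, e3]
  field_simp

theorem integral_exp_log_dotR {n : ℕ} {a : Fin n → ℝ} (ha : dotR a a = 2) {k : ℝ}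
    (hk : -(1 / 2) < k) :
    ∫ x, Real.exp (2 * k * Real.log |dotR a x|) * gauss x =
      absMoment k * CoxeterData.Z0 n := by
  have hm : AEMeasurable (dotR a) (gaussM n) := (continuous_dotR a).measurable.aemeasurable
  have h1 := integral_map (f := fun x : ℝ => Real.exp (2 * k * Real.log |x|)) hm
    (Measurable.aestronglyMeasurable (by fun_prop))
  rw [map_gaussM ha, integral_abs_gaussianReal hk, integral_gaussM] at h1
  rw [h1, div_mul_cancel₀ _ CoxeterData.Z0_pos.ne']

theorem integrable_exp_log_dotR {n : ℕ} {a : Fin n → ℝ} (ha : dotR a a = 2) {k : ℝ}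
    (hk : -(1 / 2) < k) :
    Integrable fun x => Real.exp (2 * k * Real.log |dotR a x|) * gauss x := by
  by_contra h
  have h1 := integral_exp_log_dotR ha hk
  rw [integral_undef h] at h1
  exact (mul_pos (absMoment_pos hk) CoxeterData.Z0_pos).ne h1

theorem absMoment_zero : absMoment 0 = 1 := by
  rw [absMoment, zero_add, Real.Gamma_one_half_eq, Real.rpow_zero, one_mul,
    div_self (Real.sqrt_pos.2 Real.pi_pos).ne']

theorem hasDerivAt_absMoment : HasDerivAt absMoment (-Real.eulerMascheroniConstant) 0 := by
  have h1 : HasDerivAt (fun k : ℝ => Real.Gamma (k + 1 / 2))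
      (-√Real.pi * (Real.eulerMascheroniConstant + 2 * Real.log 2)) 0 := by
    have h := Real.hasDerivAt_Gamma_one_half
    rw [← zero_add (1 / 2 : ℝ)] at h
    exact h.comp_add_const 0 (1 / 2)
  have h2 : HasDerivAt (fun k : ℝ => (4 : ℝ) ^ k) ((4 : ℝ) ^ (0 : ℝ) * Real.log 4) 0 :=
    (Real.hasStrictDerivAt_const_rpow (by norm_num) 0).hasDerivAt
  have h3 := (h2.fun_mul h1).div_const (√Real.pi)
  have hp : √Real.pi ≠ 0 := (Real.sqrt_pos.2 Real.pi_pos).ne'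
  have h4 : Real.log 4 = 2 * Real.log 2 := by
    rw [show (4 : ℝ) = 2 ^ 2 by norm_num, Real.log_pow]
    norm_num
  refine h3.congr_deriv ?_
  rw [zero_add, Real.Gamma_one_half_eq, Real.rpow_zero, h4]
  field_simp
  ring

namespace CoxeterData

variable {n : ℕ} (c : CoxeterData n)

theorem exp_lR_le {s : ℝ} (hN : 0 < c.R.card) {x : Fin n → ℝ}
    (hx : ∀ α ∈ c.R, dotR α x ≠ 0) : Real.exp (2 * s * c.lR x) ≤
      ∑ α ∈ c.R, (c.R.card : ℝ)⁻¹ * Real.exp (2 * (s * c.R.card) * Real.log |dotR α x|) := by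
  have hN' : (c.R.card : ℝ) ≠ 0 := by exact_mod_cast hN.ne'
  have h := convexOn_exp.map_sum_le (t := c.R) (w := fun _ => (c.R.card : ℝ)⁻¹)
    (p := fun α => 2 * (s * c.R.card) * Real.log |dotR α x|) (fun _ _ => by positivity)
    (by rw [Finset.sum_const, nsmul_eq_mul, mul_inv_cancel₀ hN']) (fun _ _ => Set.mem_univ _)
  simp only [smul_eq_mul] at h
  refine le_trans (le_of_eq ?_) h
  rw [lR_eq _ hx, mul_sum]
  refine congrArg _ (sum_congr rfl fun α _ => ?_)
  field_simp

theorem integral_sum_exp_log (k : ℝ) (hk : -(1 / 2) < k) (hN : 0 < c.R.card) :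
    ∫ x, (∑ α ∈ c.R, (c.R.card : ℝ)⁻¹ * Real.exp (2 * k * Real.log |dotR α x|)) * gauss x =
      absMoment k * Z0 n := by
  have hN' : (c.R.card : ℝ) ≠ 0 := by exact_mod_cast hN.ne'
  have h1 : ∀ x : Fin n → ℝ,
      (∑ α ∈ c.R, (c.R.card : ℝ)⁻¹ * Real.exp (2 * k * Real.log |dotR α x|)) * gauss x =
      ∑ α ∈ c.R, (c.R.card : ℝ)⁻¹ * (Real.exp (2 * k * Real.log |dotR α x|) * gauss x) :=
    fun x => by
      rw [Finset.sum_mul]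
      exact sum_congr rfl fun α _ => by ring
  simp only [h1]
  rw [integral_finsetSum _ fun α hα =>
    (integrable_exp_log_dotR (c.norm2 α hα) hk).const_mul _]
  rw [sum_congr rfl fun α hα => by
    rw [MeasureTheory.integral_const_mul, integral_exp_log_dotR (c.norm2 α hα) hk]]
  rw [Finset.sum_const, nsmul_eq_mul]
  field_simp

theorem integrable_sum_exp_log (k : ℝ) (hk : -(1 / 2) < k) :
    Integrable fun x => (∑ α ∈ c.R, (c.R.card : ℝ)⁻¹ *
      Real.exp (2 * k * Real.log |dotR α x|)) * gauss x := by
  simp only [Finset.sum_mul]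
  refine integrable_finsetSum _ fun α hα => ?_
  simp only [mul_assoc]
  have := (integrable_exp_log_dotR (c.norm2 α hα) hk).const_mul (c.R.card : ℝ)⁻¹
  simpa only [mul_assoc] using this

theorem Fr_le {s : ℝ} (hs : 0 ≤ s) (hN : 0 < c.R.card) :
    c.Fr s ≤ absMoment (s * c.R.card) * Z0 n := by
  have hk : -(1 / 2) < s * c.R.card := by
    have : 0 ≤ s * c.R.card := by positivity
    linarith
  rw [← c.integral_sum_exp_log _ hk hN, Fr]
  refine integral_mono_ae (c.integrable_Fr hs) (c.integrable_sum_exp_log _ hk) ?_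
  filter_upwards [c.ae_regular] with x hx
  exact mul_le_mul_of_nonneg_right (c.exp_lR_le hN hx) (gauss_pos x).le

theorem le_Fr {s : ℝ} (hs : 0 ≤ s) (hN : 0 < c.R.card) (hk : -(1 / 2) < -(s * c.R.card)) :
    (2 - absMoment (-(s * c.R.card))) * Z0 n ≤ c.Fr s := by
  rw [sub_mul, ← c.integral_sum_exp_log _ hk hN, Fr, Z0, ← MeasureTheory.integral_const_mul,
    ← integral_sub (integrable_gauss.const_mul 2) (c.integrable_sum_exp_log _ hk)]
  refine integral_mono_ae ((integrable_gauss.const_mul 2).sub (c.integrable_sum_exp_log _ hk))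
    (c.integrable_Fr hs) ?_
  filter_upwards [c.ae_regular] with x hx
  rw [← sub_mul]
  refine mul_le_mul_of_nonneg_right ?_ (gauss_pos x).le
  have h1 := c.exp_lR_le (s := -s) hN hx
  rw [neg_mul s] at h1
  have h2 : 2 * -s * c.lR x = -(2 * s * c.lR x) := by ring
  rw [h2] at h1
  have h3 := Real.add_one_le_exp (2 * s * c.lR x)
  have h4 := Real.add_one_le_exp (-(2 * s * c.lR x))
  linarith

end CoxeterData

theorem tendsto_prod_div_Gamma {x : ℝ} (hx : 0 < x) : Filter.Tendsto
    (fun N : ℕ => (∏ p ∈ range N, (x + p + 1)) / ((N.factorial : ℝ) * (N : ℝ) ^ x))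
    Filter.atTop (𝓝 (Real.Gamma (1 + x))⁻¹) := by
  have h1 := ((Real.GammaSeq_tendsto_Gamma x).const_mul x).inv₀
    (mul_pos hx (Real.Gamma_pos_of_pos hx)).ne'
  rw [add_comm, Real.Gamma_add_one hx.ne']
  refine h1.congr' ?_
  filter_upwards [Filter.eventually_gt_atTop 0] with N hN
  have h2 : ∏ j ∈ range (N + 1), (x + (j : ℝ)) =
      (∏ p ∈ range N, (x + p + 1)) * x := by
    rw [Finset.prod_range_succ']
    push_cast
    simp only [add_zero, add_assoc]
  have h3 : (0 : ℝ) < (N : ℝ) ^ x := Real.rpow_pos_of_pos (by exact_mod_cast hN) _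
  have h4 : (0 : ℝ) < N.factorial := by exact_mod_cast Nat.factorial_pos N
  have h5 : 0 < ∏ p ∈ range N, (x + (p : ℝ) + 1) :=
    Finset.prod_pos fun p _ => by positivity
  rw [Real.GammaSeq, h2]
  field_simp

theorem prod_range_add_one_cast (N : ℕ) :
    ∏ p ∈ range N, ((p : ℝ) + 1) = N.factorial := by
  rw [← Finset.prod_range_add_one_eq_factorial]
  push_cast
  rfl

theorem deriv_le_of_le {f g : ℝ → ℝ} {f' g' : ℝ} (hf : HasDerivAt f f' 0)
    (hg : HasDerivAt g g' 0) (h0 : f 0 = g 0) (h : ∀ᶠ s in 𝓝[>] (0 : ℝ), f s ≤ g s) :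
    f' ≤ g' := by
  refine le_of_tendsto_of_tendsto hf.tendsto_slope_zero_right hg.tendsto_slope_zero_right ?_
  filter_upwards [h, self_mem_nhdsWithin] with s hs hs0
  rw [zero_add, h0]
  exact smul_le_smul_of_nonneg_left (by linarith) (inv_nonneg.2 (le_of_lt hs0))

namespace CoxeterData

variable {n : ℕ} (c : CoxeterData n)

/-- The product of Gamma values interpolating `∏_j (d_j m)! / m!`. -/
def gam (s : ℝ) : ℝ := ∏ j, Real.Gamma (1 + c.d j * s) / Real.Gamma (1 + s)

theorem bs_zero_add (M : ℕ) : ∏ i ∈ range M, c.bs (i : ℝ) =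
    ∏ j, ((c.d j * M).factorial : ℝ) / (M.factorial : ℝ) := by
  have h := c.prod_bs 0 le_rfl M
  simp only [zero_add, mul_zero] at h
  rw [h]
  simp only [prod_range_add_one_cast]

theorem tendsto_bs_div : Filter.Tendsto
    (fun M : ℕ => (∏ j, ((c.d j : ℝ) * M) ^ (c.d j) / (M : ℝ)) / c.bs M) Filter.atTop (𝓝 1) := by
  have h1 : Filter.Tendsto (fun M : ℕ => ∏ j, ∏ l ∈ Finset.Ico 1 (c.d j),
      (((c.d j : ℝ) * M) / ((c.d j : ℝ) * M + l))) Filter.atTop (𝓝 (∏ j : Fin n,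
        ∏ _l ∈ Finset.Ico 1 (c.d j), (1 : ℝ))) := by
    refine tendsto_finsetProd _ fun j _ => tendsto_finsetProd _ fun l _ => ?_
    have hd : (0 : ℝ) < c.d j := by exact_mod_cast c.d_pos j
    have h2 : Filter.Tendsto (fun M : ℕ => (1 + (l : ℝ) / c.d j * (M : ℝ)⁻¹)⁻¹) Filter.atTop
        (𝓝 (1 + (l : ℝ) / c.d j * 0)⁻¹) :=
      ((tendsto_inv_atTop_nhds_zero_nat.const_mul _).const_add 1).inv₀ (by simp)
    rw [mul_zero, add_zero, inv_one] at h2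
    refine h2.congr' ?_
    filter_upwards [Filter.eventually_gt_atTop 0] with M hM
    have hM' : (0 : ℝ) < M := by exact_mod_cast hM
    have hl : (0 : ℝ) ≤ l := Nat.cast_nonneg _
    field_simp
  simp only [Finset.prod_const_one] at h1
  refine h1.congr' ?_
  filter_upwards [Filter.eventually_gt_atTop 0] with M hM
  rw [bs, ← Finset.prod_div_distrib]
  refine Finset.prod_congr rfl fun j _ => ?_
  have hM' : (0 : ℝ) < M := by exact_mod_cast hM
  have hd : (0 : ℝ) < c.d j := by exact_mod_cast c.d_pos j
  have hp : 0 < ∏ l ∈ Finset.Ico 1 (c.d j), ((c.d j : ℝ) * M + l) :=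
    Finset.prod_pos fun l _ => by positivity
  rw [Finset.prod_div_distrib, Finset.prod_const, Nat.card_Ico]
  have h3 : ((c.d j : ℝ) * M) ^ (c.d j) =
      ((c.d j : ℝ) * M) ^ (c.d j - 1) * ((c.d j : ℝ) * M) := by
    rw [← pow_succ, Nat.sub_add_cancel (c.d_pos j)]
  rw [h3]
  field_simp

theorem gam_pos {s : ℝ} (hs : 0 ≤ s) : 0 < c.gam s := Finset.prod_pos fun j _ =>
  div_pos (Real.Gamma_pos_of_pos (by positivity)) (Real.Gamma_pos_of_pos (by positivity))

theorem tendsto_prod_bs {s : ℝ} (hs : 0 < s) : Filter.Tendsto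
    (fun M : ℕ => (∏ i ∈ range M, c.bs (s + i)) /
      ((∏ i ∈ range M, c.bs (i : ℝ)) * c.bs M ^ s)) Filter.atTop (𝓝 (c.gam s)⁻¹) := by
  have h1 : Filter.Tendsto (fun M : ℕ => ∏ j,
      ((∏ p ∈ range (c.d j * M), ((c.d j : ℝ) * s + p + 1)) /
        (((c.d j * M).factorial : ℝ) * ((c.d j * M : ℕ) : ℝ) ^ ((c.d j : ℝ) * s))) /
      ((∏ p ∈ range M, (s + p + 1)) / ((M.factorial : ℝ) * (M : ℝ) ^ s)))
      Filter.atTop (𝓝 (∏ j, (Real.Gamma (1 + c.d j * s))⁻¹ / (Real.Gamma (1 + s))⁻¹)) := by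
    refine tendsto_finsetProd _ fun j _ => Filter.Tendsto.div ?_ (tendsto_prod_div_Gamma hs)
      (inv_ne_zero (Real.Gamma_pos_of_pos (by positivity)).ne')
    have hd : (0 : ℝ) < c.d j := by exact_mod_cast c.d_pos j
    exact (tendsto_prod_div_Gamma (mul_pos hd hs)).comp
      (Filter.tendsto_id.const_mul_atTop' (c.d_pos j))
  have h2 := h1.mul (c.tendsto_bs_div.rpow_const (p := s) (Or.inl one_ne_zero))
  rw [Real.one_rpow, mul_one] at h2
  have h3 : ∏ j, (Real.Gamma (1 + c.d j * s))⁻¹ / (Real.Gamma (1 + s))⁻¹ = (c.gam s)⁻¹ := by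
    rw [gam, ← Finset.prod_inv_distrib]
    refine Finset.prod_congr rfl fun j _ => ?_
    rw [inv_div_inv, inv_div]
  rw [h3] at h2
  refine h2.congr' ?_
  filter_upwards [Filter.eventually_gt_atTop 0] with M hM
  have hM' : (0 : ℝ) < M := by exact_mod_cast hM
  have hb := c.bs_pos hM'.le
  have hdM : ∀ j, (0 : ℝ) < (c.d j : ℝ) * M := fun j =>
    mul_pos (by exact_mod_cast c.d_pos j) hM'
  rw [c.prod_bs s hs.le, bs_zero_add, Real.div_rpow (Finset.prod_nonneg fun j _ =>
    div_nonneg (pow_nonneg (hdM j).le _) hM'.le) hb.le,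
    ← Real.finsetProd_rpow _ _ fun j _ => div_nonneg (pow_nonneg (hdM j).le _) hM'.le,
    mul_div_assoc', ← Finset.prod_mul_distrib]
  refine Eq.trans ?_ (div_div _ _ _)
  rw [← Finset.prod_div_distrib]
  congr 1
  refine Finset.prod_congr rfl fun j _ => ?_
  rw [Real.div_rpow (pow_nonneg (hdM j).le _) hM'.le, ← Real.rpow_natCast, ← Real.rpow_mul
    (hdM j).le, Nat.cast_mul]
  have e1 : (0 : ℝ) < ((c.d j : ℝ) * M) ^ ((c.d j : ℝ) * s) := Real.rpow_pos_of_pos (hdM j) _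
  have e2 : (0 : ℝ) < (M : ℝ) ^ s := Real.rpow_pos_of_pos hM' _
  have e3 : (0 : ℝ) < M.factorial := by exact_mod_cast Nat.factorial_pos M
  have e4 : (0 : ℝ) < (c.d j * M).factorial := by exact_mod_cast Nat.factorial_pos _
  have e5 : 0 < ∏ p ∈ range M, (s + (p : ℝ) + 1) :=
    Finset.prod_pos fun p _ => by positivity
  field_simp

theorem Fr_eq_gam {cc : ℝ} (hcc : 0 < cc) (hb : ∀ x : ℝ, c.bp.eval x = cc * c.bs x) {s : ℝ}
    (hs : 0 < s) (hs1 : s ≤ 1) : c.Fr s = cc ^ s * c.gam s * Z0 n := by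
  have hZ := Z0_pos (n := n)
  have key : ∀ M : ℕ, c.Fr (M + s) / (c.Fr M * c.bp.eval (M : ℝ) ^ s) =
      c.Fr s / (cc ^ s * Z0 n) * ((∏ i ∈ range M, c.bs (s + i)) /
      ((∏ i ∈ range M, c.bs (i : ℝ)) * c.bs M ^ s)) := by
    intro M
    have e1 := c.Fr_add_natCast hs.le M
    have e2 := c.Fr_natCast M
    simp only [hb, Finset.prod_mul_distrib, Finset.prod_const, Finset.card_range] at e1 e2
    have h0 := c.bs_pos (Nat.cast_nonneg (α := ℝ) M)
    have h1 : 0 < ∏ i ∈ range M, c.bs (i : ℝ) :=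
      Finset.prod_pos fun i _ => c.bs_pos (Nat.cast_nonneg _)
    have h2 : 0 < c.bs M ^ s := Real.rpow_pos_of_pos h0 _
    have h3 : 0 < cc ^ s := Real.rpow_pos_of_pos hcc _
    rw [add_comm (M : ℝ), e1, e2, hb, Real.mul_rpow hcc.le h0.le]
    field_simp
  have hlim := (c.tendsto_prod_bs hs).const_mul (c.Fr s / (cc ^ s * Z0 n))
  have hone : Filter.Tendsto (fun M : ℕ => c.Fr (M + s) / (c.Fr M * c.bp.eval (M : ℝ) ^ s))
      Filter.atTop (𝓝 1) := by
    rw [Metric.tendsto_atTop']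
    intro ε hε
    obtain ⟨M0, hM0⟩ := Filter.eventually_atTop.1 (c.eventually_small 1 zero_le_one (half_pos hε))
    refine ⟨M0, fun M hM => ?_⟩
    have h1 := hM0 M hM.le (s : ℂ) (by simpa using hs.le) (by simpa using hs1)
      (by rw [Complex.norm_real, Real.norm_of_nonneg hs.le]; exact hs1)
    have hbM := c.bp_pos (Nat.cast_nonneg (α := ℝ) M)
    have hF := c.Fr_pos (Nat.cast_nonneg (α := ℝ) M)
    have hr : 0 < c.bp.eval (M : ℝ) ^ s := Real.rpow_pos_of_pos hbM _
    have e0 : ((M : ℂ) + (s : ℂ)) = ((M + s : ℝ) : ℂ) := by push_cast; rfl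
    have e1 : Complex.exp (-((s : ℂ) * (Real.log (c.bp.eval (M : ℝ)) : ℂ))) =
        (((c.bp.eval (M : ℝ) ^ s)⁻¹ : ℝ) : ℂ) := by
      rw [Real.rpow_def_of_pos hbM, ← Real.exp_neg]
      push_cast
      congr 2
      ring
    rw [e0, Ft_ofReal, e1, ← Complex.ofReal_mul, ← Complex.ofReal_sub, Complex.norm_real,
      Real.norm_eq_abs] at h1
    rw [Real.dist_eq]
    have e2 : c.Fr (M + s) / (c.Fr M * c.bp.eval (M : ℝ) ^ s) - 1 =
        (c.Fr (M + s) * (c.bp.eval (M : ℝ) ^ s)⁻¹ - c.Fr M) / c.Fr M := by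
      field_simp
    rw [e2, abs_div, abs_of_pos hF, div_lt_iff₀ hF]
    refine h1.trans_lt (mul_lt_mul_of_pos_right (by linarith) hF)
  simp only [key] at hone
  have h := tendsto_nhds_unique hlim hone
  have h3 : 0 < cc ^ s := Real.rpow_pos_of_pos hcc _
  have h4 := c.gam_pos hs.le
  field_simp at h
  linarith

theorem gam_zero : c.gam 0 = 1 := by simp [gam]

theorem sum_d_sub_one : ∑ j, ((c.d j : ℝ) - 1) = c.R.card := by
  have h := c.card_idx
  rw [idx, Finset.card_sigma] at h
  rw [← h]
  push_cast
  refine sum_congr rfl fun j _ => ?_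
  rw [Nat.card_Ico, Nat.cast_sub (c.d_pos j), Nat.cast_one]

theorem hasDerivAt_gam : HasDerivAt c.gam (-(Real.eulerMascheroniConstant * c.R.card)) 0 := by
  have h1 : ∀ a : ℝ, HasDerivAt (fun s : ℝ => Real.Gamma (1 + a * s))
      (-Real.eulerMascheroniConstant * a) 0 := fun a => by
    have h := Real.hasDerivAt_Gamma_one
    have h2 : HasDerivAt (fun s : ℝ => 1 + a * s) a 0 := by
      simpa using ((hasDerivAt_id (0 : ℝ)).const_mul a).const_add 1
    have h3 : (1 : ℝ) = 1 + a * 0 := by ring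
    rw [h3] at h
    exact h.comp 0 h2
  have h2 : ∀ j ∈ (Finset.univ : Finset (Fin n)), HasDerivAt (fun s : ℝ =>
      Real.Gamma (1 + c.d j * s) / Real.Gamma (1 + s))
      (-(Real.eulerMascheroniConstant * (c.d j - 1))) 0 := fun j _ => by
    have h3 := h1 1
    simp only [one_mul] at h3
    have := (h1 (c.d j)).fun_div h3 (by simp)
    refine this.congr_deriv ?_
    simp
    ring
  have h3 := HasDerivAt.fun_finsetProd h2
  refine h3.congr_deriv ?_
  rw [← c.sum_d_sub_one]
  simp only [mul_zero, add_zero, Real.Gamma_one, div_self one_ne_zero, Finset.prod_const_one,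
    one_smul, Finset.sum_neg_distrib, ← mul_sum]

theorem cc_eq_one {cc : ℝ} (hcc : 0 < cc) (hb : ∀ x : ℝ, c.bp.eval x = cc * c.bs x) :
    cc = 1 := by
  have hZ := Z0_pos (n := n)
  rcases Nat.eq_zero_or_pos c.R.card with hN | hN
  · have hR : c.R = ∅ := Finset.card_eq_zero.1 hN
    have hi : c.idx = ∅ := Finset.card_eq_zero.1 (c.card_idx.trans hN)
    have hd : ∀ j, c.d j = 1 := fun j => by
      have h1 : ((c.d j : ℝ) - 1) = 0 := by
        have h2 := c.sum_d_sub_one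
        rw [hN, Nat.cast_zero, Finset.sum_eq_zero_iff_of_nonneg fun j _ => by
          have : (1 : ℝ) ≤ c.d j := by exact_mod_cast c.d_pos j
          linarith] at h2
        exact h2 j (Finset.mem_univ j)
      have h3 : (c.d j : ℝ) = 1 := by linarith
      exact_mod_cast h3
    have h1 := c.Fr_add_one le_rfl
    have h2 : ∀ k, c.Fr k = Z0 n := fun k => by
      have : ∀ x : Fin n → ℝ, c.lR x = 0 := fun x => by simp [lR, delta, hR]
      simp [Fr, this, Z0]
    rw [h2, h2, hb, bs_eq, hi] at h1
    simp only [hd, Nat.cast_one, one_pow, Finset.prod_const_one, Finset.prod_empty, mul_one] at h1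
    nlinarith
  · have hN' : (0 : ℝ) < (c.R.card : ℝ) := by exact_mod_cast hN
    have hg : HasDerivAt (fun s => cc ^ s * c.gam s)
        (Real.log cc - Real.eulerMascheroniConstant * (c.R.card : ℝ)) 0 := by
      have h2 : HasDerivAt (fun k : ℝ => cc ^ k) (cc ^ (0 : ℝ) * Real.log cc) 0 :=
        (Real.hasStrictDerivAt_const_rpow hcc 0).hasDerivAt
      refine (h2.fun_mul c.hasDerivAt_gam).congr_deriv ?_
      rw [Real.rpow_zero, gam_zero]
      ring
    have hlin : ∀ a : ℝ, HasDerivAt (fun s : ℝ => s * a) a 0 := fun a => by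
      simpa using (hasDerivAt_id (0 : ℝ)).mul_const a
    have hf : ∀ a : ℝ, HasDerivAt (fun s : ℝ => absMoment (s * a))
        (-Real.eulerMascheroniConstant * a) 0 := fun a => by
      have h := hasDerivAt_absMoment
      rw [← zero_mul a] at h
      exact h.comp 0 (hlin a)
    have hev : ∀ᶠ s in 𝓝[>] (0 : ℝ), 0 < s ∧ s ≤ 1 ∧ -(1 / 2) < -(s * (c.R.card : ℝ)) := by
      have hmem : Set.Ioo 0 (min 1 (1 / (2 * (c.R.card : ℝ)))) ∈ 𝓝[>] (0 : ℝ) :=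
        Ioo_mem_nhdsGT (by positivity)
      filter_upwards [hmem] with s hs
      have h1 := hs.2.trans_le (min_le_left _ _)
      have h2 := hs.2.trans_le (min_le_right _ _)
      rw [lt_div_iff₀ (by positivity)] at h2
      exact ⟨hs.1, h1.le, by linarith⟩
    have hup := deriv_le_of_le hg (hf (c.R.card : ℝ)) (by simp [gam_zero, absMoment_zero]) (by
      filter_upwards [hev] with s hs
      have h1 := c.Fr_le hs.1.le hN
      rw [c.Fr_eq_gam hcc hb hs.1 hs.2.1] at h1
      exact le_of_mul_le_mul_right h1 hZ)
    have hlo := deriv_le_of_le ((hf (-(c.R.card : ℝ))).const_sub 2) hg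
      (by simp [gam_zero, absMoment_zero]; norm_num) (by
      filter_upwards [hev] with s hs
      have h1 := c.le_Fr hs.1.le hN hs.2.2
      rw [c.Fr_eq_gam hcc hb hs.1 hs.2.1] at h1
      rw [mul_neg]
      exact le_of_mul_le_mul_right h1 hZ)
    have hlog : Real.log cc = 0 := by linarith
    rcases Real.log_eq_zero.1 hlog with h | h | h
    · exact absurd h hcc.ne'
    · exact h
    · linarith

theorem bp_eval (x : ℝ) : c.bp.eval x = c.bs x := by
  obtain ⟨cc, hcc, hb⟩ := c.exists_bp_eq_bs
  rw [hb, c.cc_eq_one hcc hb, one_mul]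

/-- The quotient `∏_j (d_j m)! / m!`. -/
def facQ (m : ℕ) : ℝ := ∏ j, ((c.d j * m).factorial : ℝ) / (m.factorial : ℝ)

theorem facQ_pos (m : ℕ) : 0 < c.facQ m := Finset.prod_pos fun j _ =>
  div_pos (by exact_mod_cast Nat.factorial_pos _) (by exact_mod_cast Nat.factorial_pos _)

theorem prod_bp (m : ℕ) : ∏ i ∈ range m, c.bp.eval (i : ℝ) = c.facQ m := by
  simp only [bp_eval]
  exact c.bs_zero_add m

/-- The value of the Macdonald–Mehta integral at a natural number. -/
theorem J_natCast (m : ℕ) : c.J m 1 = (-1) ^ (m * c.R.card) * c.facQ m * Z0 n := by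
  have h := c.J_add_natCast 0 m
  rw [zero_add, J_zero] at h
  rw [h, ← prod_bp]
  push_cast
  congr 2
  refine Finset.prod_congr rfl fun i _ => ?_
  rw [zero_add, ← Complex.ofReal_natCast, aeval_ofReal]

/-- The value of the Macdonald–Mehta integral at a negative integer. -/
theorem facQ_mul_J_neg (m : ℕ) : c.facQ m * c.J (-(m : ℂ)) 1 = Z0 n := by
  have h := c.J_add_natCast (-(m : ℂ)) m
  rw [neg_add_cancel, J_zero] at h
  rw [h, ← prod_bp]
  congr 1
  have h2 : ∏ i ∈ range m, Polynomial.aeval (-(m : ℂ) + (i : ℂ)) c.bp =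
      (-1) ^ (m * c.R.card) * ∏ i ∈ range m, ((c.bp.eval (i : ℝ) : ℝ) : ℂ) := by
    rw [← Finset.prod_range_reflect (fun i => ((c.bp.eval (i : ℝ) : ℝ) : ℂ)),
      mul_comm m, pow_mul]
    have e0 : ((-1 : ℂ) ^ c.R.card) ^ m = ∏ _i ∈ range m, (-1 : ℂ) ^ c.R.card := by
      rw [Finset.prod_const, Finset.card_range]
    rw [e0, ← Finset.prod_mul_distrib]
    refine Finset.prod_congr rfl fun i hi => ?_
    have hi' := Finset.mem_range.1 hi
    have e1 : (-(m : ℂ) + (i : ℂ)) = ((-(((m - 1 - i : ℕ) : ℝ) + 1) : ℝ) : ℂ) := by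
      have e2 : (m : ℂ) = ((m - 1 - i : ℕ) : ℂ) + 1 + i := by
        have : m = (m - 1 - i) + 1 + i := by omega
        exact_mod_cast this
      rw [e2]
      push_cast
      ring
    rw [e1, aeval_ofReal, bp_eval, bp_eval, bs_reflect]
    push_cast
    ring
  rw [h2, ← mul_assoc, ← mul_pow, neg_one_mul, neg_neg, one_pow, one_mul]
  push_cast
  rfl

end CoxeterData

section TaylorComponents

variable {n : ℕ}

/-- The operator on polynomials conjugate to the directional derivative along `a` under
multiplication by `exp (μ, x)`. -/
def tw (μ a : Fin n → ℝ) : MvPolynomial (Fin n) ℂ →ₗ[ℂ] MvPolynomial (Fin n) ℂ :=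
  (dd ℂ a : MvPolynomial (Fin n) ℂ →ₗ[ℂ] MvPolynomial (Fin n) ℂ) +
    ((dotR a μ : ℝ) : ℂ) • LinearMap.id

theorem tw_apply (μ a : Fin n → ℝ) (f : MvPolynomial (Fin n) ℂ) :
    tw μ a f = dd ℂ a f + ((dotR a μ : ℝ) : ℂ) • f := rfl

/-- The homogeneous components of the power series `exp (μ, x)`. -/
def expC (μ : Fin n → ℝ) (k : ℤ) : MvPolynomial (Fin n) ℂ :=
  if k < 0 then 0 else ((k.toNat.factorial : ℂ)⁻¹) • lin ℂ μ ^ k.toNat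

theorem expC_of_neg (μ : Fin n → ℝ) {k : ℤ} (hk : k < 0) : expC μ k = 0 := if_pos hk

theorem expC_natCast (μ : Fin n → ℝ) (k : ℕ) :
    expC μ k = ((k.factorial : ℂ)⁻¹) • lin ℂ μ ^ k := by
  rw [expC, if_neg (by omega), Int.toNat_natCast]

theorem dd_expC (μ a : Fin n → ℝ) (k : ℤ) :
    dd ℂ a (expC μ k) = ((dotR a μ : ℝ) : ℂ) • expC μ (k - 1) := by
  rcases lt_trichotomy k 0 with hk | rfl | hk
  · rw [expC_of_neg μ hk, expC_of_neg μ (by omega), smul_zero, map_zero]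
  · have h1 : expC μ ((0 : ℤ) - 1) = 0 := expC_of_neg μ (by norm_num)
    have h2 := expC_natCast μ 0
    simp only [Nat.cast_zero] at h2
    rw [h1, h2]
    simp
  · obtain ⟨k, rfl⟩ : ∃ k' : ℕ, k = ((k' + 1 : ℕ) : ℤ) := ⟨k.toNat - 1, by omega⟩
    have e : (((k + 1 : ℕ) : ℤ) - 1) = (k : ℤ) := by push_cast; ring
    rw [e, expC_natCast, expC_natCast, Derivation.map_smul, Derivation.leibniz_pow, dd_lin, Nat.factorial_succ,
      Nat.add_sub_cancel, dotR_comm μ a]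
    simp only [MvPolynomial.smul_eq_C_mul, nsmul_eq_mul, smul_eq_mul, Nat.cast_mul, mul_inv,
      Nat.cast_add, Nat.cast_one, map_mul, Complex.coe_algebraMap]
    have h : (MvPolynomial.C ((k : ℂ) + 1)⁻¹ : MvPolynomial (Fin n) ℂ) * ((k : MvPolynomial (Fin n) ℂ) + 1)
        = 1 := by
      have h2 : ((k : MvPolynomial (Fin n) ℂ) + 1) = MvPolynomial.C ((k : ℂ) + 1) := by simp
      rw [h2, ← map_mul, inv_mul_cancel₀ (by exact_mod_cast Nat.succ_ne_zero k), map_one]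
    linear_combination (MvPolynomial.C ((k.factorial : ℂ)⁻¹) * lin ℂ μ ^ k *
      MvPolynomial.C ((dotR a μ : ℝ) : ℂ)) * h

theorem expC_isHomogeneous (μ : Fin n → ℝ) (k : ℤ) : (expC μ k).IsHomogeneous k.toNat := by
  rw [expC]
  split_ifs
  · exact MvPolynomial.isHomogeneous_zero _ _ _
  · have h := (lin_isHomogeneous ℂ μ).pow k.toNat
    rw [one_mul] at h
    exact (MvPolynomial.homogeneousSubmodule (Fin n) ℂ _).smul_mem _ h

/-- The degree `d` component of the Taylor expansion of `q(x) exp (μ, x)`. -/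
def tay (μ : Fin n → ℝ) (d : ℤ) : MvPolynomial (Fin n) ℂ →ₗ[ℂ] MvPolynomial (Fin n) ℂ :=
  (MvPolynomial.basisMonomials (Fin n) ℂ).constr ℂ
    fun s => MvPolynomial.monomial s 1 * expC μ (d - (s.degree : ℤ))

theorem tay_monomial (μ : Fin n → ℝ) (d : ℤ) (s : Fin n →₀ ℕ) (z : ℂ) :
    tay μ d (MvPolynomial.monomial s z) =
      MvPolynomial.monomial s z * expC μ (d - (s.degree : ℤ)) := by
  have h : (MvPolynomial.monomial s z : MvPolynomial (Fin n) ℂ) =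
      z • MvPolynomial.basisMonomials (Fin n) ℂ s := by
    simp [MvPolynomial.smul_monomial]
  rw [h, map_smul, tay, Module.Basis.constr_basis, MvPolynomial.coe_basisMonomials, smul_mul_assoc]

theorem tay_of_isHomogeneous (μ : Fin n → ℝ) (d : ℤ) {q : MvPolynomial (Fin n) ℂ} {i : ℕ}
    (hq : q.IsHomogeneous i) : tay μ d q = q * expC μ (d - i) := by
  conv_lhs => rw [q.as_sum]
  conv_rhs => rw [q.as_sum]
  rw [map_sum, Finset.sum_mul]
  refine sum_congr rfl fun s hs => ?_
  rw [tay_monomial, hq.degree_eq_sum_deg_support hs]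
  rfl

theorem induction_isHomogeneous {P : MvPolynomial (Fin n) ℂ → Prop}
    (hh : ∀ i q, q.IsHomogeneous i → P q) (ha : ∀ p q, P p → P q → P (p + q))
    (q : MvPolynomial (Fin n) ℂ) : P q := by
  rw [← MvPolynomial.sum_homogeneousComponent q]
  exact Finset.sum_induction _ P ha (hh 0 0 (MvPolynomial.isHomogeneous_zero _ _ _))
    fun i _ => hh i _ (MvPolynomial.homogeneousComponent_isHomogeneous i q)

theorem tay_of_neg (μ : Fin n → ℝ) {d : ℤ} (hd : d < 0) (q : MvPolynomial (Fin n) ℂ) :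
    tay μ d q = 0 := by
  induction q using induction_isHomogeneous with
  | hh i q hq =>
    rw [tay_of_isHomogeneous μ d hq, expC_of_neg μ (by omega), mul_zero]
  | ha p q hp hq =>
    rw [map_add, hp, hq, add_zero]

theorem tay_mul (μ : Fin n → ℝ) (d : ℤ) {g : MvPolynomial (Fin n) ℂ} {e : ℕ}
    (hg : g.IsHomogeneous e) (q : MvPolynomial (Fin n) ℂ) :
    tay μ d (g * q) = g * tay μ (d - e) q := by
  induction q using induction_isHomogeneous with
  | hh i q hq =>
    rw [tay_of_isHomogeneous μ d (hg.mul hq), tay_of_isHomogeneous μ _ hq, mul_assoc]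
    refine congrArg _ (congrArg _ (congrArg _ ?_))
    push_cast
    ring
  | ha p q hp hq =>
    rw [mul_add, map_add, hp, hq, map_add, mul_add]

theorem dd_tay (μ a : Fin n → ℝ) (d : ℤ) (q : MvPolynomial (Fin n) ℂ) :
    dd ℂ a (tay μ d q) = tay μ (d - 1) (tw μ a q) := by
  induction q using induction_isHomogeneous with
  | hh i q hq =>
    rw [tay_of_isHomogeneous μ d hq, dd_mul, dd_expC, tw_apply, map_add, map_smul,
      tay_of_isHomogeneous μ _ hq, tay_of_isHomogeneous μ _ (dd_isHomogeneous ℂ a hq)]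
    have e1 : d - (i : ℤ) - 1 = d - 1 - i := by ring
    rw [e1, mul_smul_comm, add_comm]
    refine congrArg (· + _) ?_
    rcases Nat.eq_zero_or_pos i with rfl | hi
    · obtain ⟨z, rfl⟩ : ∃ z, q = MvPolynomial.C z :=
        ⟨_, MvPolynomial.totalDegree_eq_zero_iff_eq_C.1 (Nat.le_zero.1 hq.totalDegree_le)⟩
      rw [dd_C, mul_zero, zero_mul]
    · have e2 : d - 1 - ((i - 1 : ℕ) : ℤ) = d - i := by omega
      rw [e2, mul_comm]
  | ha p q hp hq =>
    rw [map_add, map_add, hp, hq, map_add, map_add]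

theorem tay_isHomogeneous (μ : Fin n → ℝ) (d : ℕ) (q : MvPolynomial (Fin n) ℂ) :
    (tay μ d q).IsHomogeneous d := by
  induction q using induction_isHomogeneous with
  | hh i q hq =>
    rw [tay_of_isHomogeneous μ d hq]
    rcases le_or_gt i d with h | h
    · have h2 := hq.mul (expC_isHomogeneous μ ((d : ℤ) - i))
      have e : i + ((d : ℤ) - i).toNat = d := by omega
      rwa [e] at h2
    · rw [expC_of_neg μ (by omega), mul_zero]
      exact MvPolynomial.isHomogeneous_zero _ _ _
  | ha p q hp hq =>
    rw [map_add]
    exact hp.add hq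

theorem eval_zero_tay (μ : Fin n → ℝ) (q : MvPolynomial (Fin n) ℂ) :
    eval 0 (tay μ 0 q) = eval 0 q := by
  induction q using induction_isHomogeneous with
  | hh i q hq =>
    rw [tay_of_isHomogeneous μ 0 hq]
    rcases Nat.eq_zero_or_pos i with rfl | hi
    · have := expC_natCast μ 0
      simp only [Nat.cast_zero] at this
      simp [this]
    · rw [expC_of_neg μ (by omega), mul_zero, map_zero]
      have h2 := hq.coeff_eq_zero (d := 0) (by simp; omega)
      rw [← MvPolynomial.constantCoeff_eq] at h2
      rw [← h2, MvPolynomial.eval_zero]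
  | ha p q hp hq =>
    rw [map_add, map_add, hp, hq, map_add]

theorem tay_eq_sum (μ : Fin n → ℝ) (d : ℤ) (q : MvPolynomial (Fin n) ℂ) {B : ℕ}
    (hB : q.totalDegree < B) : tay μ d q =
      ∑ i ∈ range B, homogeneousComponent i q * expC μ (d - i) := by
  conv_lhs => rw [← MvPolynomial.sum_homogeneousComponent q]
  rw [map_sum]
  have : range (q.totalDegree + 1) ⊆ range B := by
    intro i hi
    rw [Finset.mem_range] at hi ⊢
    omega
  rw [sum_congr rfl fun i _ => tay_of_isHomogeneous μ d
    (MvPolynomial.homogeneousComponent_isHomogeneous i q)]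
  refine Finset.sum_subset this fun i _ hi => ?_
  rw [MvPolynomial.homogeneousComponent_eq_zero _ _ (by simpa using hi), zero_mul]

theorem lin_dvd_tay (μ : Fin n → ℝ) {a : Fin n → ℝ} {q : MvPolynomial (Fin n) ℂ}
    (h : lin ℂ a ∣ q) (d : ℤ) : lin ℂ a ∣ tay μ d q := by
  obtain ⟨r, rfl⟩ := h
  exact ⟨_, tay_mul μ d (lin_isHomogeneous ℂ a) r⟩

theorem lin_dvd_of_tay (μ : Fin n → ℝ) {a : Fin n → ℝ} {q : MvPolynomial (Fin n) ℂ}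
    (h : ∀ d : ℤ, lin ℂ a ∣ tay μ d q) : lin ℂ a ∣ q := by
  have key : ∀ i, lin ℂ a ∣ homogeneousComponent i q := by
    intro i
    induction i using Nat.strong_induction_on with
    | _ i ih =>
      have h1 := h i
      rw [tay_eq_sum μ i q (B := q.totalDegree + 1 + (i + 1)) (by omega)] at h1
      rw [← Finset.add_sum_erase _ _ (Finset.mem_range.2 (by omega :
        i < q.totalDegree + 1 + (i + 1)))] at h1
      have e0 : expC μ 0 = 1 := by
        have := expC_natCast μ 0
        simpa using this
      rw [sub_self, e0, mul_one] at h1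
      refine (dvd_add_left (Finset.dvd_sum fun j hj => ?_)).1 h1
      rcases lt_or_gt_of_ne (Finset.ne_of_mem_erase hj) with hji | hji
      · exact (ih j hji).mul_right _
      · rw [expC_of_neg μ (by omega), mul_zero]
        exact dvd_zero _
  rw [← MvPolynomial.sum_homogeneousComponent q]
  exact Finset.dvd_sum fun i _ => key i

/-- The dilation of a polynomial. -/
def dil (t : ℂ) : MvPolynomial (Fin n) ℂ →ₐ[ℂ] MvPolynomial (Fin n) ℂ :=
  aeval fun i => MvPolynomial.C t * X i

theorem eval_dil (t : ℂ) (q : MvPolynomial (Fin n) ℂ) (z : Fin n → ℂ) :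
    eval z (dil t q) = eval (t • z) q := by
  have h : ((aeval z : MvPolynomial (Fin n) ℂ →ₐ[ℂ] ℂ).comp (dil t)) =
      aeval (t • z) := by
    ext i
    simp [dil]
  have h2 := DFunLike.congr_fun h q
  simpa [MvPolynomial.coe_aeval_eq_eval] using h2

theorem dil_of_isHomogeneous (t : ℂ) {q : MvPolynomial (Fin n) ℂ} {i : ℕ}
    (hq : q.IsHomogeneous i) : dil t q = t ^ i • q := by
  refine MvPolynomial.funext fun z => ?_
  rw [eval_dil, MvPolynomial.smul_eval, MvPolynomial.eval_eq, MvPolynomial.eval_eq, mul_sum]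
  refine sum_congr rfl fun s hs => ?_
  simp only [Pi.smul_apply, smul_eq_mul, mul_pow, Finset.prod_mul_distrib]
  rw [Finset.prod_pow_eq_pow_sum, ← hq.degree_eq_sum_deg_support hs]
  ring

theorem dd_dil (t : ℂ) (a : Fin n → ℝ) (q : MvPolynomial (Fin n) ℂ) :
    dd ℂ a (dil t q) = t • dil t (dd ℂ a q) := by
  induction q using induction_isHomogeneous with
  | hh i q hq =>
    rw [dil_of_isHomogeneous t hq, dil_of_isHomogeneous t (dd_isHomogeneous ℂ a hq),
      Derivation.map_smul,
      smul_smul]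
    rcases Nat.eq_zero_or_pos i with rfl | hi
    · obtain ⟨z, rfl⟩ : ∃ z, q = MvPolynomial.C z :=
        ⟨_, MvPolynomial.totalDegree_eq_zero_iff_eq_C.1 (Nat.le_zero.1 hq.totalDegree_le)⟩
      rw [dd_C, smul_zero, smul_zero]
    · rw [← pow_succ', Nat.sub_add_cancel hi]
  | ha p q hp hq =>
    rw [map_add, map_add, hp, hq, map_add, map_add, smul_add]

theorem expC_smul (t : ℝ) (μ : Fin n → ℝ) (k : ℕ) :
    expC (t • μ) k = ((t : ℂ) ^ k) • expC μ k := by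
  rw [expC_natCast, expC_natCast, lin_smul, mul_pow, ← map_pow, ← MvPolynomial.smul_eq_C_mul,
    smul_comm]
  rfl

theorem tay_dil (t : ℝ) (μ : Fin n → ℝ) (d : ℕ) (q : MvPolynomial (Fin n) ℂ) :
    tay (t • μ) d (dil t q) = ((t : ℂ) ^ d) • tay μ d q := by
  induction q using induction_isHomogeneous with
  | hh i q hq =>
    rw [dil_of_isHomogeneous _ hq, map_smul, tay_of_isHomogeneous _ d hq,
      tay_of_isHomogeneous _ d hq]
    rcases le_or_gt i d with h | h
    · have e : (d : ℤ) - i = ((d - i : ℕ) : ℤ) := by omega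
      rw [e, expC_smul, mul_smul_comm, smul_smul, ← pow_add, Nat.add_sub_cancel' h]
    · rw [expC_of_neg _ (by omega), expC_of_neg _ (by omega), mul_zero, smul_zero, smul_zero]
  | ha p q hp hq =>
    rw [map_add, map_add, hp, hq, map_add, smul_add]

end TaylorComponents

section OddDerivatives

variable {n : ℕ}

theorem exists_dd_iterate_lin_pow_mul {a : Fin n → ℝ} (ha : dotR a a = 2) (i : ℕ) :
    ∀ g : MvPolynomial (Fin n) ℂ, ∃ r, (dd ℂ a)^[i] (lin ℂ a ^ i * g) =
      MvPolynomial.C (2 ^ i * (i.factorial : ℂ)) * g + lin ℂ a * r := by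
  induction i with
  | zero => exact fun g => ⟨0, by simp⟩
  | succ i ih =>
    intro g
    have h1 : dd ℂ a (lin ℂ a ^ (i + 1) * g) =
        lin ℂ a ^ i * (lin ℂ a * dd ℂ a g + MvPolynomial.C (2 * ((i : ℂ) + 1)) * g) := by
      rw [dd_mul, Derivation.leibniz_pow, dd_lin, ha, Nat.add_sub_cancel]
      simp only [nsmul_eq_mul, smul_eq_mul, map_mul, map_add, Complex.coe_algebraMap]
      push_cast
      simp only [map_natCast, map_ofNat, map_one]
      ring
    obtain ⟨r, hr⟩ := ih (lin ℂ a * dd ℂ a g + MvPolynomial.C (2 * ((i : ℂ) + 1)) * g)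
    refine ⟨r + MvPolynomial.C (2 ^ i * (i.factorial : ℂ)) * dd ℂ a g, ?_⟩
    rw [Function.iterate_succ_apply, h1, hr, Nat.factorial_succ, pow_succ]
    push_cast
    simp only [map_mul, map_add, map_one]
    ring

theorem lin_pow_dvd_of_dd {a : Fin n → ℝ} (ha : dotR a a = 2) {f : MvPolynomial (Fin n) ℂ}
    {k : ℕ} (h : ∀ i < k, lin ℂ a ∣ (dd ℂ a)^[i] f) : lin ℂ a ^ k ∣ f := by
  induction k with
  | zero => simp
  | succ k ih =>
    obtain ⟨g, rfl⟩ := ih fun i hi => h i (by omega)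
    obtain ⟨r, hr⟩ := exists_dd_iterate_lin_pow_mul ha k g
    have h1 := h k (by omega)
    rw [hr, dvd_add_left (dvd_mul_right _ _)] at h1
    have hu : IsUnit (MvPolynomial.C (2 ^ k * (k.factorial : ℂ)) : MvPolynomial (Fin n) ℂ) := by
      refine IsUnit.map _ (IsUnit.mk0 _ (mul_ne_zero (pow_ne_zero _ two_ne_zero) ?_))
      exact_mod_cast k.factorial_ne_zero
    rw [hu.dvd_mul_left] at h1
    rw [pow_succ]
    exact mul_dvd_mul_left _ h1

theorem eq_zero_of_sum_choose {c : ℂ} (hc : c ≠ 0) (e k : ℕ) (v : ℕ → ℂ)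
    (h : ∀ s < k, ∑ i ∈ range k, ((e + 2 * s).choose i : ℂ) * c ^ (e + 2 * s - i) * v i = 0)
    : ∀ i < k, v i = 0 := by
  set Q : Polynomial ℂ := ∑ i ∈ range k,
    Polynomial.C (v i * (c ^ i)⁻¹ * ((i.factorial : ℂ))⁻¹) * descPochhammer ℂ i with hQ
  have hev : ∀ j : ℕ, Q.eval (j : ℂ) =
      ∑ i ∈ range k, v i * (c ^ i)⁻¹ * (j.choose i : ℂ) := by
    intro j
    rw [hQ, Polynomial.eval_finsetSum]
    refine sum_congr rfl fun i _ => ?_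
    rw [Polynomial.eval_mul, Polynomial.eval_C, descPochhammer_eval_eq_descFactorial,
      Nat.descFactorial_eq_factorial_mul_choose]
    have : (i.factorial : ℂ) ≠ 0 := by exact_mod_cast i.factorial_ne_zero
    push_cast
    field_simp
  have hdeg : Q.degree < ((range k).image fun s => ((e + 2 * s : ℕ) : ℂ)).card := by
    rw [Finset.card_image_of_injective _ fun s t hst => by
      have : e + 2 * s = e + 2 * t := by exact_mod_cast hst
      omega, Finset.card_range]
    refine (Polynomial.degree_sum_le _ _).trans_lt ?_
    refine (Finset.sup_lt_iff (WithBot.bot_lt_coe k)).2 fun i hi => ?_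
    rw [Polynomial.C_mul']; refine (Polynomial.degree_smul_le _ _).trans_lt ?_
    refine Polynomial.degree_le_natDegree.trans_lt ?_
    rw [descPochhammer_natDegree]
    exact WithBot.coe_lt_coe.2 (Finset.mem_range.1 hi)
  have hQ0 : Q = 0 := by
    refine Polynomial.eq_zero_of_degree_lt_of_eval_finset_eq_zero _ hdeg fun x hx => ?_
    obtain ⟨s, hs, rfl⟩ := Finset.mem_image.1 hx
    rw [hev]
    have h1 := h s (Finset.mem_range.1 hs)
    have h2 : c ^ (e + 2 * s) * ∑ i ∈ range k,
        v i * (c ^ i)⁻¹ * ((e + 2 * s).choose i : ℂ) = 0 := by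
      rw [mul_sum, ← h1]
      refine sum_congr rfl fun i _ => ?_
      rcases le_or_gt i (e + 2 * s) with hi | hi
      · rw [← Nat.sub_add_cancel hi, pow_add, Nat.sub_add_cancel hi]
        field_simp
      · rw [Nat.choose_eq_zero_of_lt hi]
        simp
    exact (mul_eq_zero.1 h2).resolve_left (pow_ne_zero _ hc)
  intro i
  induction i using Nat.strong_induction_on with
  | _ i ih =>
    intro hi
    have h1 := hev i
    rw [hQ0, Polynomial.eval_zero, Finset.sum_eq_single i] at h1
    · rw [Nat.choose_self, Nat.cast_one, mul_one] at h1
      exact (mul_eq_zero.1 h1.symm).resolve_right (inv_ne_zero (pow_ne_zero _ hc))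
    · intro l hl hli
      rcases lt_or_gt_of_ne hli with h2 | h2
      · rw [ih l h2 (h2.trans hi)]
        ring
      · rw [Nat.choose_eq_zero_of_lt h2]
        simp
    · intro h2
      exact absurd (Finset.mem_range.2 hi) h2

theorem tw_iterate (μ a : Fin n → ℝ) (j : ℕ) (f : MvPolynomial (Fin n) ℂ) :
    (tw μ a)^[j] f = ∑ i ∈ range (j + 1),
      ((j.choose i : ℂ) * ((dotR a μ : ℝ) : ℂ) ^ (j - i)) • (dd ℂ a)^[i] f := by
  set A : Module.End ℂ (MvPolynomial (Fin n) ℂ) :=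
    (dd ℂ a : MvPolynomial (Fin n) ℂ →ₗ[ℂ] MvPolynomial (Fin n) ℂ) with hA
  set B : Module.End ℂ (MvPolynomial (Fin n) ℂ) := ((dotR a μ : ℝ) : ℂ) • 1 with hB
  have hAB : Commute A B := (Commute.one_right A).smul_right _
  have h1 : (tw μ a)^[j] f = ((A + B) ^ j) f := by
    rw [Module.End.pow_apply]
    rfl
  rw [h1, hAB.add_pow, LinearMap.sum_apply]
  refine sum_congr rfl fun i _ => ?_
  have h2 : A ^ i * B ^ (j - i) * ((j.choose i : ℕ) : Module.End ℂ (MvPolynomial (Fin n) ℂ)) =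
      ((j.choose i : ℂ) * ((dotR a μ : ℝ) : ℂ) ^ (j - i)) • A ^ i := by
    rw [hB, smul_pow, one_pow, mul_smul_comm, mul_one, smul_mul_assoc, ← Nat.cast_comm, ← nsmul_eq_mul,
      mul_comm, mul_smul, Nat.cast_smul_eq_nsmul]
  rw [h2, LinearMap.smul_apply, Module.End.pow_apply]
  rfl

theorem homogeneousComponent_of_isHomogeneous {i l : ℕ} {q : MvPolynomial (Fin n) ℂ}
    (hq : q.IsHomogeneous i) :
    homogeneousComponent l q = if l = i then q else 0 :=
  MvPolynomial.homogeneousComponent_of_mem hq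

theorem homogeneousComponent_shear (t : ℝ) (a : Fin n → ℝ) (l : ℕ) (q : MvPolynomial (Fin n) ℂ) :
    homogeneousComponent l (shear ℂ t a q) =
      shear ℂ t a (homogeneousComponent l q) := by
  induction q using induction_isHomogeneous with
  | hh i q hq =>
    have h : (shear ℂ t a q).IsHomogeneous i := by
      have := hq.aeval (fun j => X j - MvPolynomial.C (algebraMap ℝ ℂ (t * a j)) * lin ℂ a)
        (n := 1) fun j => (MvPolynomial.isHomogeneous_X ℂ j).sub
          ((lin_isHomogeneous ℂ a).C_mul _)
      rw [one_mul] at this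
      exact this
    rw [homogeneousComponent_of_isHomogeneous hq, homogeneousComponent_of_isHomogeneous h]
    split_ifs <;> simp
  | ha p q hp hq => rw [map_add, map_add, map_add, map_add, hp, hq]

theorem homogeneousComponent_dd (a : Fin n → ℝ) (l : ℕ) (q : MvPolynomial (Fin n) ℂ) :
    homogeneousComponent l (dd ℂ a q) =
      dd ℂ a (homogeneousComponent (l + 1) q) := by
  induction q using induction_isHomogeneous with
  | hh i q hq =>
    rw [homogeneousComponent_of_isHomogeneous hq,
      homogeneousComponent_of_isHomogeneous (dd_isHomogeneous ℂ a hq)]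
    rcases Nat.eq_zero_or_pos i with rfl | hi
    · obtain ⟨z, rfl⟩ : ∃ z, q = MvPolynomial.C z :=
        ⟨_, MvPolynomial.totalDegree_eq_zero_iff_eq_C.1 (Nat.le_zero.1 hq.totalDegree_le)⟩
      simp
    · by_cases h : l + 1 = i
      · rw [if_pos h, if_pos (by omega)]
      · rw [if_neg h, if_neg (by omega), map_zero]
  | ha p q hp hq => rw [map_add, map_add, map_add, map_add, hp, hq]

theorem homogeneousComponent_dd_iterate (a : Fin n → ℝ) (i : ℕ) :
    ∀ (l : ℕ) (q : MvPolynomial (Fin n) ℂ),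
    homogeneousComponent l ((dd ℂ a)^[i] q) =
      (dd ℂ a)^[i] (homogeneousComponent (l + i) q) := by
  induction i with
  | zero => exact fun l q => rfl
  | succ i ih =>
    intro l q
    rw [Function.iterate_succ_apply, ih, homogeneousComponent_dd, Function.iterate_succ_apply]
    rfl

theorem dd_iterate_zero (a : Fin n → ℝ) (i : ℕ) :
    (dd ℂ a)^[i] (0 : MvPolynomial (Fin n) ℂ) = 0 :=
  Function.iterate_fixed (map_zero _) i

theorem dd_iterate_eq_zero (a : Fin n → ℝ) {d i : ℕ} (hdi : d < i) {q : MvPolynomial (Fin n) ℂ}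
    (hq : q.IsHomogeneous d) : (dd ℂ a)^[i] q = 0 := by
  induction d generalizing i q with
  | zero =>
    obtain ⟨z, rfl⟩ : ∃ z, q = MvPolynomial.C z :=
      ⟨_, MvPolynomial.totalDegree_eq_zero_iff_eq_C.1 (Nat.le_zero.1 hq.totalDegree_le)⟩
    obtain ⟨i, rfl⟩ := Nat.exists_eq_succ_of_ne_zero hdi.ne'
    rw [Function.iterate_succ_apply, dd_C, dd_iterate_zero]
  | succ d ih =>
    obtain ⟨i, rfl⟩ := Nat.exists_eq_succ_of_ne_zero (Nat.zero_lt_of_lt hdi).ne'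
    rw [Function.iterate_succ_apply]
    exact ih (by omega) (dd_isHomogeneous ℂ a hq)

theorem lin_pow_dvd_homogeneousComponent {a μ : Fin n → ℝ} (ha : dotR a a = 2)
    (hμ : dotR a μ ≠ 0) (e k : ℕ) {d : ℕ} {f : MvPolynomial (Fin n) ℂ} (hd : f.totalDegree ≤ d)
    (h : ∀ s < k, lin ℂ a ∣ (tw μ a)^[e + 2 * s] f) :
    lin ℂ a ^ k ∣ homogeneousComponent d f := by
  refine lin_pow_dvd_of_dd ha fun i0 hi0 => ?_
  rcases lt_or_ge d i0 with hdi | hdi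
  · rw [dd_iterate_eq_zero a hdi (MvPolynomial.homogeneousComponent_isHomogeneous d f)]
    exact dvd_zero _
  rw [lin_dvd_iff ℂ ha]
  set l := d - i0 with hl
  have hz : ∀ i, i0 < i → homogeneousComponent (l + i) f = 0 := fun i hi =>
    MvPolynomial.homogeneousComponent_eq_zero _ _ (by omega)
  have key : ∀ b : Fin n →₀ ℕ, ∀ i < k, MvPolynomial.coeff b (shear ℂ (1 / 2) a ((dd ℂ a)^[i]
      (homogeneousComponent (l + i) f))) = 0 := by
    intro b
    refine eq_zero_of_sum_choose (c := ((dotR a μ : ℝ) : ℂ)) (by exact_mod_cast hμ) e k _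
      fun s hs => ?_
    have h1 := (lin_dvd_iff ℂ ha).1 (h s hs)
    have h2 := congrArg (fun q => MvPolynomial.coeff b (homogeneousComponent l q)) h1
    simp only [homogeneousComponent_shear, map_zero, MvPolynomial.coeff_zero] at h2
    rw [tw_iterate, map_sum, map_sum, MvPolynomial.coeff_sum] at h2
    simp only [map_smul, homogeneousComponent_dd_iterate, MvPolynomial.coeff_smul,
      smul_eq_mul] at h2
    rw [← h2]
    have h3 : ∀ i, k ≤ i → homogeneousComponent (l + i) f = 0 := fun i hi =>
      hz i (by omega)
    have h4 : ∀ A : ℕ, k ≤ A → ∑ i ∈ range k, ((e + 2 * s).choose i : ℂ) *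
        ((dotR a μ : ℝ) : ℂ) ^ (e + 2 * s - i) * MvPolynomial.coeff b (shear ℂ (1 / 2) a
          ((dd ℂ a)^[i] (homogeneousComponent (l + i) f))) =
        ∑ i ∈ range A, ((e + 2 * s).choose i : ℂ) *
        ((dotR a μ : ℝ) : ℂ) ^ (e + 2 * s - i) * MvPolynomial.coeff b (shear ℂ (1 / 2) a
          ((dd ℂ a)^[i] (homogeneousComponent (l + i) f))) := fun A hA => by
      refine Finset.sum_subset (Finset.range_mono hA) fun i _ hi => ?_
      rw [h3 i (by simpa using hi), dd_iterate_zero, map_zero, MvPolynomial.coeff_zero, mul_zero]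
    rw [h4 (e + 2 * s + 1 + k) (by omega)]
    symm
    refine Finset.sum_subset (Finset.range_mono (by omega)) fun i _ hi => ?_
    rw [Nat.choose_eq_zero_of_lt (by simpa using hi), Nat.cast_zero, zero_mul, zero_mul]
  ext b
  have := key b i0 hi0
  rw [hl, Nat.sub_add_cancel hdi] at this
  rw [this, MvPolynomial.coeff_zero]

end OddDerivatives

namespace CoxeterData

variable {n : ℕ} (c : CoxeterData n)

theorem eq_zero_of_lin_dvd_tw {μ : Fin n → ℝ} (hμ : ∀ α ∈ c.R, dotR α μ ≠ 0) (e k : ℕ)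
    {f : MvPolynomial (Fin n) ℂ} (hd : f.totalDegree < k * c.R.card)
    (h : ∀ α ∈ c.R, ∀ s < k, lin ℂ α ∣ (tw μ α)^[e + 2 * s] f) : f = 0 := by
  have h1 := c.delta_pow_dvd ℂ k fun α hα => lin_pow_dvd_homogeneousComponent (c.norm2 α hα)
    (hμ α hα) e k le_rfl (h α hα)
  obtain ⟨g, hg⟩ := h1
  have h2 := MvPolynomial.homogeneousComponent_isHomogeneous f.totalDegree f
  have hδ := (c.delta_isHomogeneous ℂ).pow k
  rw [hg] at h2
  have h3 := eq_zero_of_mul_isHomogeneous hδ (pow_ne_zero _ (c.delta_ne_zero ℂ)) h2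
    (by rwa [mul_comm])
  rw [h3, mul_zero] at hg
  by_contra hf
  obtain ⟨s, hs, hs2⟩ := Finset.exists_mem_eq_sup f.support (MvPolynomial.support_nonempty.2 hf)
    fun s => s.sum fun _ e => e
  have h4 := congrArg (MvPolynomial.coeff s) hg
  have h5 : Finsupp.degree s = f.totalDegree := hs2.symm
  rw [MvPolynomial.coeff_homogeneousComponent, if_pos h5, MvPolynomial.coeff_zero] at h4
  exact (MvPolynomial.mem_support_iff.1 hs) h4

/-- The defining conditions of the polynomial factor of a Baker-Akhiezer function. -/
structure IsBAPoly (m : ℕ) (μ : Fin n → ℝ) (p : MvPolynomial (Fin n) ℂ) : Prop where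
  totalDegree_le : p.totalDegree ≤ m * c.R.card
  top : homogeneousComponent (m * c.R.card) p =
    ((∏ α ∈ c.R, dotR α μ : ℝ) : ℂ) ^ m • c.delta ℂ ^ m
  dvd : ∀ α ∈ c.R, ∀ j < m, lin ℂ α ∣ (tw μ α)^[1 + 2 * j] p

theorem tw_iterate_sub (μ a : Fin n → ℝ) (j : ℕ) (p q : MvPolynomial (Fin n) ℂ) :
    (tw μ a)^[j] (p - q) = (tw μ a)^[j] p - (tw μ a)^[j] q := by
  simp only [← Module.End.pow_apply, map_sub]

variable {c}

theorem IsBAPoly.unique {m : ℕ} {μ : Fin n → ℝ} (hμ : ∀ α ∈ c.R, dotR α μ ≠ 0)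
    {p q : MvPolynomial (Fin n) ℂ} (hp : c.IsBAPoly m μ p) (hq : c.IsBAPoly m μ q) : p = q := by
  rw [← sub_eq_zero]
  have h1 : (p - q).totalDegree ≤ m * c.R.card :=
    (MvPolynomial.totalDegree_sub _ _).trans (max_le hp.totalDegree_le hq.totalDegree_le)
  have h2 : homogeneousComponent (m * c.R.card) (p - q) = 0 := by
    rw [map_sub, hp.top, hq.top, sub_self]
  by_cases h3 : (p - q).totalDegree < m * c.R.card
  · refine c.eq_zero_of_lin_dvd_tw hμ 1 m h3 fun α hα s hs => ?_
    rw [tw_iterate_sub]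
    exact dvd_sub (hp.dvd α hα s hs) (hq.dvd α hα s hs)
  · by_contra hf
    obtain ⟨s, hs, hs2⟩ := Finset.exists_mem_eq_sup (p - q).support
      (MvPolynomial.support_nonempty.2 hf) fun s => s.sum fun _ e => e
    have h4 := congrArg (MvPolynomial.coeff s) h2
    have h5 : (p - q).totalDegree = m * c.R.card := by omega
    have h6 : Finsupp.degree s = m * c.R.card := hs2.symm.trans h5
    rw [MvPolynomial.coeff_homogeneousComponent, if_pos h6,
      MvPolynomial.coeff_zero] at h4
    exact (MvPolynomial.mem_support_iff.1 hs) h4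

end CoxeterData

section Calculus

variable {n : ℕ}

theorem totalDegree_pderiv_le (i : Fin n) {f : MvPolynomial (Fin n) ℂ} {d : ℕ}
    (h : f.totalDegree ≤ d + 1) : (pderiv i f).totalDegree ≤ d := by
  rw [← MvPolynomial.sum_homogeneousComponent f, map_sum]
  refine MvPolynomial.totalDegree_finsetSum_le fun k hk => ?_
  have hk' := Finset.mem_range.1 hk
  exact (MvPolynomial.homogeneousComponent_isHomogeneous k f).pderiv.totalDegree_le.trans (by omega)

theorem totalDegree_dd_le (a : Fin n → ℝ) {f : MvPolynomial (Fin n) ℂ} {d : ℕ}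
    (h : f.totalDegree ≤ d + 1) : (dd ℂ a f).totalDegree ≤ d := by
  rw [dd_eq_sum]
  refine MvPolynomial.totalDegree_finsetSum_le fun k _ => ?_
  refine (MvPolynomial.totalDegree_mul _ _).trans ?_
  rw [MvPolynomial.totalDegree_C, zero_add]
  exact totalDegree_pderiv_le k h

theorem grad2_mul_right (f g h : MvPolynomial (Fin n) ℂ) :
    grad2 ℂ f (g * h) = g * grad2 ℂ f h + h * grad2 ℂ f g := by
  simp only [grad2, mul_sum, ← sum_add_distrib, Derivation.leibniz, smul_eq_mul]
  exact sum_congr rfl fun i _ => by ring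

theorem lapl_mul (f g : MvPolynomial (Fin n) ℂ) :
    lapl ℂ (f * g) = f * lapl ℂ g + 2 * grad2 ℂ f g + g * lapl ℂ f := by
  simp only [lapl, grad2, mul_sum, ← sum_add_distrib, Derivation.leibniz, smul_eq_mul,
    map_add]
  exact sum_congr rfl fun i _ => by ring

theorem grad2_lin_pow (f : MvPolynomial (Fin n) ℂ) (a : Fin n → ℝ) (k : ℕ) :
    grad2 ℂ f (lin ℂ a ^ (k + 1)) = ((k + 1 : ℕ) : MvPolynomial (Fin n) ℂ) *
      lin ℂ a ^ k * dd ℂ a f := by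
  rw [grad2, dd_eq_sum, mul_sum]
  refine sum_congr rfl fun i _ => ?_
  rw [Derivation.leibniz_pow, pderiv_lin, Nat.add_sub_cancel]
  simp only [smul_eq_mul, nsmul_eq_mul]
  ring

theorem grad2_comm (f g : MvPolynomial (Fin n) ℂ) : grad2 ℂ f g = grad2 ℂ g f :=
  sum_congr rfl fun _ _ => mul_comm _ _

theorem lin_mul_lapl_lin_pow {a : Fin n → ℝ} (ha : dotR a a = 2) (k : ℕ) :
    lin ℂ a * lapl ℂ (lin ℂ a ^ (k + 1)) =
      ((2 * k * (k + 1) : ℕ) : MvPolynomial (Fin n) ℂ) * lin ℂ a ^ k := by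
  have h1 : lapl ℂ (lin ℂ a ^ (k + 1)) =
      ((k + 1 : ℕ) : MvPolynomial (Fin n) ℂ) * dd ℂ a (lin ℂ a ^ k) := by
    rw [lapl, dd_eq_sum, mul_sum]
    refine sum_congr rfl fun i _ => ?_
    rw [Derivation.leibniz_pow, pderiv_lin, Nat.add_sub_cancel]
    simp only [smul_eq_mul, nsmul_eq_mul, Derivation.leibniz, Derivation.map_natCast,
      MvPolynomial.pderiv_C]
    ring
  rw [h1, Derivation.leibniz_pow, dd_lin, ha]
  rcases k with _ | k
  · simp
  · simp only [smul_eq_mul, nsmul_eq_mul, Nat.add_sub_cancel, map_ofNat]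
    push_cast
    ring

theorem lin_dvd_dd_iterate {a : Fin n → ℝ} {k : ℕ} : ∀ {i : ℕ} {f : MvPolynomial (Fin n) ℂ},
    lin ℂ a ^ k ∣ f → i < k → lin ℂ a ∣ (dd ℂ a)^[i] f := by
  induction k with
  | zero => intro i f _ hi; omega
  | succ k ih =>
    intro i f hf hi
    rcases i with _ | i
    · exact (dvd_pow_self _ k.succ_ne_zero).trans hf
    · rw [Function.iterate_succ_apply]
      refine ih ?_ (by omega)
      obtain ⟨g, rfl⟩ := hf
      rw [dd_mul, Derivation.leibniz_pow, Nat.add_sub_cancel]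
      refine dvd_add ((pow_dvd_pow _ k.le_succ).mul_right _) (Dvd.dvd.mul_left ?_ _)
      rw [nsmul_eq_mul, smul_eq_mul]
      exact (Dvd.intro _ rfl).mul_left _

theorem dd_iterate_add (a : Fin n → ℝ) (i : ℕ) (f g : MvPolynomial (Fin n) ℂ) :
    (dd ℂ a)^[i] (f + g) = (dd ℂ a)^[i] f + (dd ℂ a)^[i] g :=
  iterate_map_add (dd ℂ a) i f g

theorem dd_iterate_sub (a : Fin n → ℝ) (i : ℕ) (f g : MvPolynomial (Fin n) ℂ) :
    (dd ℂ a)^[i] (f - g) = (dd ℂ a)^[i] f - (dd ℂ a)^[i] g :=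
  iterate_map_sub (dd ℂ a) i f g

theorem dd_iterate_tay (μ a : Fin n → ℝ) (i : ℕ) : ∀ (d : ℤ) (q : MvPolynomial (Fin n) ℂ),
    (dd ℂ a)^[i] (tay μ d q) = tay μ (d - i) ((tw μ a)^[i] q) := by
  induction i with
  | zero => intro d q; simp
  | succ i ih =>
    intro d q
    rw [Function.iterate_succ_apply, dd_tay, ih, Function.iterate_succ_apply]
    congr 2
    push_cast
    ring

end Calculus

namespace CoxeterData

variable {n : ℕ} (c : CoxeterData n)

theorem dd_iterate_sb_s {α : Fin n → ℝ} (hα : α ∈ c.R) (i : ℕ) :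
    ∀ f : MvPolynomial (Fin n) ℂ,
    (dd ℂ α)^[i] (c.sb ℂ (c.s α hα) f) = (-1) ^ i * c.sb ℂ (c.s α hα) ((dd ℂ α)^[i] f) := by
  have hs : c.act (c.s α hα) α = -α := by
    rw [act_s, c.norm2 α hα]
    ext k
    simp
    ring
  induction i with
  | zero => intro f; simp
  | succ i ih =>
    intro f
    have h1 : dd ℂ α (c.sb ℂ (c.s α hα) f) = c.sb ℂ (c.s α hα) (-dd ℂ α f) := by
      rw [dd_sb, hs, dd_neg_vec]
    have h2 : (dd ℂ α)^[i] (-dd ℂ α f) = -(dd ℂ α)^[i] (dd ℂ α f) :=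
      iterate_map_neg (dd ℂ α) i _
    rw [Function.iterate_succ_apply, h1, ih, Function.iterate_succ_apply, h2, map_neg]
    ring

theorem lin_dvd_sub_sb {α : Fin n → ℝ} (hα : α ∈ c.R) (f : MvPolynomial (Fin n) ℂ) :
    lin ℂ α ∣ f - c.sb ℂ (c.s α hα) f := by
  rw [sb_s]
  exact lin_dvd_sub_shear ℂ 1 α f

theorem lin_pow_dvd_sub_sb {α : Fin n → ℝ} (hα : α ∈ c.R) {m : ℕ} {q : MvPolynomial (Fin n) ℂ}
    (h : ∀ j < m, lin ℂ α ∣ (dd ℂ α)^[1 + 2 * j] q) :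
    lin ℂ α ^ (2 * m + 1) ∣ q - c.sb ℂ (c.s α hα) q := by
  refine lin_pow_dvd_of_dd (c.norm2 α hα) fun i hi => ?_
  rw [dd_iterate_sub, c.dd_iterate_sb_s hα]
  rcases Nat.even_or_odd' i with ⟨j, rfl | rfl⟩
  · rw [pow_mul, neg_one_sq, one_pow, one_mul]
    exact c.lin_dvd_sub_sb hα _
  · have h1 := h j (by omega)
    rw [add_comm] at h1
    refine dvd_sub h1 (Dvd.dvd.mul_left ?_ _)
    have := c.lin_dvd_sub_sb hα ((dd ℂ α)^[2 * j + 1] q)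
    exact (dvd_sub_right h1).1 this

/-- The (gauge transformed, denominator free) Calogero-Moser operator. -/
def cm (m : ℕ) (q : MvPolynomial (Fin n) ℂ) : MvPolynomial (Fin n) ℂ :=
  c.delta ℂ * lapl ℂ q - 2 * (m : MvPolynomial (Fin n) ℂ) * grad2 ℂ (c.delta ℂ) q

theorem cm_sub (m : ℕ) (p q : MvPolynomial (Fin n) ℂ) :
    c.cm m (p - q) = c.cm m p - c.cm m q := by
  simp only [cm, lapl, grad2, map_sub, mul_sub, Finset.sum_sub_distrib]
  ring

theorem cm_sb (m : ℕ) {α : Fin n → ℝ} (hα : α ∈ c.R) (q : MvPolynomial (Fin n) ℂ) :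
    c.cm m (c.sb ℂ (c.s α hα) q) = -c.sb ℂ (c.s α hα) (c.cm m q) := by
  have h1 : c.sb ℂ (c.s α hα) (c.delta ℂ) = -c.delta ℂ := by
    rw [sb_delta, chi_s]
    simp
  have h2 : c.delta ℂ = -c.sb ℂ (c.s α hα) (c.delta ℂ) := by rw [h1, neg_neg]
  have h3 : grad2 ℂ (c.delta ℂ) (c.sb ℂ (c.s α hα) q) =
      -c.sb ℂ (c.s α hα) (grad2 ℂ (c.delta ℂ) q) := by
    rw [← grad2_sb]
    conv_lhs => rw [h2]
    simp [grad2]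
  rw [cm, cm, h3, lapl_sb, map_sub, map_mul, map_mul, map_mul, h1, map_natCast, map_ofNat]
  ring

theorem lin_pow_dvd_cm (m : ℕ) {α : Fin n → ℝ} (hα : α ∈ c.R) {q : MvPolynomial (Fin n) ℂ}
    (h : lin ℂ α ^ (2 * m + 1) ∣ q) : lin ℂ α ^ (2 * m + 1) ∣ c.cm m q := by
  obtain ⟨ψ, rfl⟩ := h
  obtain ⟨g, hg⟩ := c.lin_dvd_delta ℂ hα
  have ha := c.norm2 α hα
  have h1 := lin_mul_lapl_lin_pow ha (2 * m)
  have h2 : dd ℂ α (c.delta ℂ) = lin ℂ α * dd ℂ α g + 2 * g := by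
    rw [hg, dd_mul, dd_lin, ha, map_ofNat, map_ofNat]
    ring
  rw [cm, lapl_mul, grad2_mul_right, grad2_comm _ ψ, grad2_lin_pow, grad2_lin_pow, h2]
  have h3 : c.delta ℂ * (ψ * lapl ℂ (lin ℂ α ^ (2 * m + 1))) =
      g * ψ * (((2 * (2 * m) * (2 * m + 1) : ℕ) : MvPolynomial (Fin n) ℂ) * lin ℂ α ^ (2 * m)) := by
    rw [← h1, hg]
    ring
  rw [mul_add, mul_add, h3, hg]
  refine ⟨lin ℂ α * g * lapl ℂ ψ + 2 * g * (2 * m + 1) * dd ℂ α ψ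
    - 2 * m * (grad2 ℂ (lin ℂ α * g) ψ + ψ * (2 * m + 1) * dd ℂ α g), ?_⟩
  push_cast
  ring

theorem lin_dvd_dd_iterate_of_add_sb {m : ℕ} {α : Fin n → ℝ} (hα : α ∈ c.R)
    {f : MvPolynomial (Fin n) ℂ} (h1 : lin ℂ α ^ (2 * m + 1) ∣ f + c.sb ℂ (c.s α hα) f) {j : ℕ}
    (hj : j < m + 1) : lin ℂ α ∣ (dd ℂ α)^[2 * j] f := by
  have h2 := lin_dvd_dd_iterate (i := 2 * j) h1 (by omega)
  rw [dd_iterate_add, c.dd_iterate_sb_s hα, pow_mul, neg_one_sq, one_pow, one_mul] at h2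
  have h3 := dvd_add h2 (c.lin_dvd_sub_sb hα ((dd ℂ α)^[2 * j] f))
  have h4 : (dd ℂ α)^[2 * j] f = MvPolynomial.C (2⁻¹ : ℂ) *
      ((dd ℂ α)^[2 * j] f + c.sb ℂ (c.s α hα) ((dd ℂ α)^[2 * j] f) +
        ((dd ℂ α)^[2 * j] f - c.sb ℂ (c.s α hα) ((dd ℂ α)^[2 * j] f))) := by
    have : MvPolynomial.C (2⁻¹ : ℂ) * (2 : MvPolynomial (Fin n) ℂ) = 1 := by
      rw [← map_ofNat MvPolynomial.C 2, ← map_mul]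
      norm_num
    linear_combination (-(dd ℂ α)^[2 * j] f) * this
  rw [h4]
  exact h3.mul_left _

/-- The twisted Laplacian. -/
def twl (μ : Fin n → ℝ) (p : MvPolynomial (Fin n) ℂ) : MvPolynomial (Fin n) ℂ :=
  ∑ j, tw μ (Pi.single j 1) (tw μ (Pi.single j 1) p)

/-- The twisted gradient pairing with the discriminant. -/
def twg (μ : Fin n → ℝ) (p : MvPolynomial (Fin n) ℂ) : MvPolynomial (Fin n) ℂ :=
  ∑ j, pderiv j (c.delta ℂ) * tw μ (Pi.single j 1) p

theorem tay_twl (μ : Fin n → ℝ) (d : ℤ) (p : MvPolynomial (Fin n) ℂ) :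
    tay μ d (twl μ p) = lapl ℂ (tay μ (d + 2) p) := by
  rw [twl, map_sum, lapl]
  refine sum_congr rfl fun j _ => ?_
  rw [pderiv_eq_dd ℂ, pderiv_eq_dd ℂ, dd_tay, dd_tay]
  congr 2
  ring

theorem tay_twg (hN : 0 < c.R.card) (μ : Fin n → ℝ) (d : ℤ) (p : MvPolynomial (Fin n) ℂ) :
    tay μ d (c.twg μ p) = grad2 ℂ (c.delta ℂ) (tay μ (d - c.R.card + 2) p) := by
  rw [twg, map_sum, grad2]
  refine sum_congr rfl fun j _ => ?_
  rw [tay_mul μ d (c.delta_isHomogeneous ℂ).pderiv, pderiv_eq_dd ℂ j (tay _ _ _), dd_tay]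
  congr 3
  rw [Nat.cast_sub hN]
  push_cast
  ring

/-- The eigenvalue defect. -/
def defect (m : ℕ) (μ : Fin n → ℝ) (p : MvPolynomial (Fin n) ℂ) : MvPolynomial (Fin n) ℂ :=
  c.delta ℂ * twl μ p - (2 * m : ℂ) • c.twg μ p - c.delta ℂ * ((dotR μ μ : ℝ) : ℂ) • p

theorem tay_defect (hN : 0 < c.R.card) (m : ℕ) (μ : Fin n → ℝ) (d : ℤ)
    (p : MvPolynomial (Fin n) ℂ) :
    tay μ d (c.defect m μ p) = c.cm m (tay μ (d - c.R.card + 2) p) -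
      c.delta ℂ * ((dotR μ μ : ℝ) : ℂ) • tay μ (d - c.R.card) p := by
  rw [defect, map_sub, map_sub, map_smul, tay_mul μ d (c.delta_isHomogeneous ℂ),
    tay_mul μ d (c.delta_isHomogeneous ℂ), tay_twl, c.tay_twg hN, cm, map_smul,
    MvPolynomial.smul_eq_C_mul _ (2 * m : ℂ)]
  simp only [map_mul, map_ofNat, map_natCast]

variable {c}

theorem IsBAPoly.lin_dvd_dd_tay {m : ℕ} {μ : Fin n → ℝ} {p : MvPolynomial (Fin n) ℂ}
    (hp : c.IsBAPoly m μ p) (d : ℤ) {α : Fin n → ℝ} (hα : α ∈ c.R) {j : ℕ} (hj : j < m) :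
    lin ℂ α ∣ (dd ℂ α)^[1 + 2 * j] (tay μ d p) := by
  rw [dd_iterate_tay]
  exact lin_dvd_tay μ (hp.dvd α hα j hj) _

theorem IsBAPoly.defect_eq_zero {m : ℕ} {μ : Fin n → ℝ} (hμ : ∀ α ∈ c.R, dotR α μ ≠ 0)
    {p : MvPolynomial (Fin n) ℂ} (hp : c.IsBAPoly m μ p) : c.defect m μ p = 0 := by
  have hsum : ∑ j, ((dotR (Pi.single j 1) μ : ℝ) : ℂ) * ((dotR (Pi.single j 1) μ : ℝ) : ℂ) =
      ((dotR μ μ : ℝ) : ℂ) := by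
    simp [dotR, Pi.single_apply]
  have hdd : ∑ j, ((dotR (Pi.single j 1) μ : ℝ) : ℂ) • pderiv j (c.delta ℂ) =
      dd ℂ μ (c.delta ℂ) := by
    rw [dd_eq_sum]
    refine sum_congr rfl fun j _ => ?_
    rw [MvPolynomial.smul_eq_C_mul]
    simp [dotR, Pi.single_apply]
  have hddp : ∑ j, ((dotR (Pi.single j 1) μ : ℝ) : ℂ) • pderiv j p = dd ℂ μ p := by
    rw [dd_eq_sum]
    refine sum_congr rfl fun j _ => ?_
    rw [MvPolynomial.smul_eq_C_mul]
    simp [dotR, Pi.single_apply]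
  have hexp : c.defect m μ p = c.delta ℂ * lapl ℂ p + (2 : ℂ) • (c.delta ℂ * dd ℂ μ p)
      - (2 * m : ℂ) • (grad2 ℂ (c.delta ℂ) p + dd ℂ μ (c.delta ℂ) * p) := by
    have h1 : twl μ p = lapl ℂ p + (2 : ℂ) • dd ℂ μ p + ((dotR μ μ : ℝ) : ℂ) • p := by
      rw [← hsum, ← hddp, twl, lapl, Finset.smul_sum, Finset.sum_smul, ← sum_add_distrib,
        ← sum_add_distrib]
      refine sum_congr rfl fun j _ => ?_
      rw [tw_apply, tw_apply, ← pderiv_eq_dd, ← pderiv_eq_dd, map_add, Derivation.map_smul]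
      module
    have h2 : c.twg μ p = grad2 ℂ (c.delta ℂ) p + dd ℂ μ (c.delta ℂ) * p := by
      rw [← hdd, twg, grad2, Finset.sum_mul, ← sum_add_distrib]
      refine sum_congr rfl fun j _ => ?_
      rw [tw_apply, ← pderiv_eq_dd, mul_add, mul_smul_comm, smul_mul_assoc]
    rw [defect, h1, h2, mul_add, mul_add, mul_smul_comm, mul_smul_comm]
    abel
  rcases Nat.eq_zero_or_pos (m * c.R.card) with h0 | h0
  · have hp0 := hp.totalDegree_le
    rw [h0, Nat.le_zero] at hp0
    obtain ⟨z, rfl⟩ : ∃ z, p = MvPolynomial.C z :=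
      ⟨_, MvPolynomial.totalDegree_eq_zero_iff_eq_C.1 hp0⟩
    rw [hexp, dd_C, grad2, lapl]
    rcases Nat.mul_eq_zero.1 h0 with h1 | h1
    · simp [h1]
    · have : c.delta ℂ = 1 := by rw [delta, Finset.card_eq_zero.1 h1, Finset.prod_empty]
      simp [this]
  have hN : 0 < c.R.card := Nat.pos_of_mul_pos_left h0
  have hm : 0 < m := Nat.pos_of_mul_pos_right h0
  refine c.eq_zero_of_lin_dvd_tw hμ 0 (m + 1) ?_ fun α hα s hs => ?_
  · have hdeg := hp.totalDegree_le
    have hδ := (c.delta_isHomogeneous ℂ).totalDegree_le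
    obtain ⟨M, hM⟩ : ∃ M, m * c.R.card = M + 1 := ⟨_, (Nat.succ_pred_eq_of_pos h0).symm⟩
    obtain ⟨N, hNN⟩ : ∃ N, c.R.card = N + 1 := ⟨_, (Nat.succ_pred_eq_of_pos hN).symm⟩
    rw [add_mul, one_mul, hM]
    rw [hM] at hdeg
    rw [hNN] at hδ ⊢
    rw [hexp]
    have key : ∀ f g : MvPolynomial (Fin n) ℂ, ∀ a b : ℕ, f.totalDegree ≤ a → g.totalDegree ≤ b →
        a + b ≤ M + (N + 1) → (f * g).totalDegree ≤ M + (N + 1) := fun f g a b hf hg hab =>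
      (MvPolynomial.totalDegree_mul _ _).trans ((add_le_add hf hg).trans hab)
    have key2 : ∀ (z : ℂ) (f : MvPolynomial (Fin n) ℂ), f.totalDegree ≤ M + (N + 1) →
        (z • f).totalDegree ≤ M + (N + 1) := fun z f hf =>
      (MvPolynomial.totalDegree_smul_le _ _).trans hf
    refine Nat.lt_of_le_of_lt (m := M + (N + 1)) ?_ (by omega)
    refine (MvPolynomial.totalDegree_sub _ _).trans (max_le ((MvPolynomial.totalDegree_add _ _).trans
      (max_le ?_ (key2 _ _ ?_))) (key2 _ _ ((MvPolynomial.totalDegree_add _ _).trans (max_le ?_ ?_))))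
    · refine key _ _ (N + 1) M hδ ?_ (by omega)
      refine MvPolynomial.totalDegree_finsetSum_le fun j _ => ?_
      exact totalDegree_pderiv_le j ((totalDegree_pderiv_le j hdeg).trans (by omega))
    · exact key _ _ (N + 1) M hδ (totalDegree_dd_le μ hdeg) (by omega)
    · refine MvPolynomial.totalDegree_finsetSum_le fun j _ => ?_
      exact key _ _ N M (totalDegree_pderiv_le j hδ) (totalDegree_pderiv_le j hdeg) (by omega)
    · exact key _ _ N (M + 1) (totalDegree_dd_le μ hδ) hdeg (by omega)
  · rw [zero_add]
    refine lin_dvd_of_tay μ fun d => ?_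
    have h1 := dd_iterate_tay μ α (2 * s) (d + (2 * s : ℕ)) (c.defect m μ p)
    rw [add_sub_cancel_right] at h1
    rw [← h1, c.tay_defect hN, dd_iterate_sub]
    refine dvd_sub (c.lin_dvd_dd_iterate_of_add_sb hα ?_ hs)
      (c.lin_dvd_dd_iterate_of_add_sb hα ?_ hs)
    · have h2 := c.lin_pow_dvd_cm m hα (c.lin_pow_dvd_sub_sb hα fun j hj =>
        hp.lin_dvd_dd_tay (d + (2 * s : ℕ) - c.R.card + 2) hα hj)
      rwa [cm_sub, cm_sb, sub_neg_eq_add] at h2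
    · have h2 := c.lin_pow_dvd_sub_sb hα fun j hj =>
        hp.lin_dvd_dd_tay (d + (2 * s : ℕ) - c.R.card) hα hj
      have h3 : c.sb ℂ (c.s α hα) (c.delta ℂ) = -c.delta ℂ := by
        rw [sb_delta, chi_s]
        simp
      rw [map_mul, h3, map_smul, mul_smul_comm, mul_smul_comm, ← smul_add, neg_mul,
        ← sub_eq_add_neg, ← mul_sub, ← mul_smul_comm, MvPolynomial.smul_eq_C_mul]
      exact (h2.mul_left _).mul_left _

end CoxeterData

section Translation

variable {n : ℕ}

theorem homogeneousComponent_comm {L : MvPolynomial (Fin n) ℂ →ₗ[ℂ] MvPolynomial (Fin n) ℂ}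
    (hL : ∀ i q, q.IsHomogeneous i → (L q).IsHomogeneous i) (l : ℕ) (q : MvPolynomial (Fin n) ℂ) :
    homogeneousComponent l (L q) = L (homogeneousComponent l q) := by
  induction q using induction_isHomogeneous with
  | hh i q hq =>
    rw [homogeneousComponent_of_isHomogeneous hq,
      homogeneousComponent_of_isHomogeneous (hL i q hq)]
    split_ifs <;> simp
  | ha p q hp hq => rw [map_add, map_add, map_add, map_add, hp, hq]

theorem totalDegree_le_of_isHomogeneous
    {L : MvPolynomial (Fin n) ℂ →ₗ[ℂ] MvPolynomial (Fin n) ℂ}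
    (hL : ∀ i q, q.IsHomogeneous i → (L q).IsHomogeneous i) (q : MvPolynomial (Fin n) ℂ) :
    (L q).totalDegree ≤ q.totalDegree := by
  conv_lhs => rw [← MvPolynomial.sum_homogeneousComponent q, map_sum]
  refine MvPolynomial.totalDegree_finsetSum_le fun i hi => ?_
  exact (hL i _ (MvPolynomial.homogeneousComponent_isHomogeneous i q)).totalDegree_le.trans
    (by have := Finset.mem_range.1 hi; omega)

theorem dil_isHomogeneous (t : ℂ) (i : ℕ) (q : MvPolynomial (Fin n) ℂ) (hq : q.IsHomogeneous i) :
    ((dil t).toLinearMap q).IsHomogeneous i := by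
  rw [AlgHom.toLinearMap_apply, dil_of_isHomogeneous t hq]
  exact (MvPolynomial.homogeneousSubmodule (Fin n) ℂ i).smul_mem _ hq

theorem tw_dil (t : ℝ) (μ a : Fin n → ℝ) (q : MvPolynomial (Fin n) ℂ) :
    tw (t • μ) a (dil (t : ℂ) q) = (t : ℂ) • dil (t : ℂ) (tw μ a q) := by
  rw [tw_apply, tw_apply, dd_dil, map_add, map_smul, smul_add, smul_smul, dotR_smul_right]
  push_cast
  rfl

theorem tw_dil_iterate (t : ℝ) (μ a : Fin n → ℝ) (i : ℕ) : ∀ q : MvPolynomial (Fin n) ℂ,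
    (tw (t • μ) a)^[i] (dil (t : ℂ) q) = ((t : ℂ) ^ i) • dil (t : ℂ) ((tw μ a)^[i] q) := by
  induction i with
  | zero => intro q; simp
  | succ i ih =>
    intro q
    have h : ∀ (z : ℂ) (f : MvPolynomial (Fin n) ℂ),
        (tw (t • μ) a)^[i] (z • f) = z • (tw (t • μ) a)^[i] f := fun z f => by
      simp only [← Module.End.pow_apply, map_smul]
    rw [Function.iterate_succ_apply, tw_dil, h, ih, Function.iterate_succ_apply, smul_smul, pow_succ']

theorem dil_lin (t : ℂ) (a : Fin n → ℝ) : dil t (lin ℂ a) = t • lin ℂ a := by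
  rw [dil_of_isHomogeneous t (lin_isHomogeneous ℂ a), pow_one]

theorem hasDerivAt_eval_complex {z : ℂ → Fin n → ℂ} {ζ : Fin n → ℂ} {τ : ℂ}
    (hz : ∀ i, HasDerivAt (fun t => z t i) (ζ i) τ) (q : MvPolynomial (Fin n) ℂ) :
    HasDerivAt (fun t => eval (z t) q)
      (∑ i, ζ i * eval (z τ) (pderiv i q)) τ := by
  induction q using MvPolynomial.induction_on with
  | C a => simpa using hasDerivAt_const τ a
  | add p q hp hq =>
    simpa [mul_add, sum_add_distrib] using hp.fun_add hq
  | mul_X p j hp =>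
    have := hp.mul (hz j)
    simp only [MvPolynomial.eval_mul, MvPolynomial.eval_X]
    refine this.congr_deriv ?_
    simp only [Derivation.leibniz, smul_eq_mul, MvPolynomial.eval_add, MvPolynomial.eval_mul,
      MvPolynomial.eval_X, mul_add, sum_add_distrib, MvPolynomial.pderiv_X]
    rw [add_comm, Finset.sum_mul]
    congr 1
    · rw [Finset.sum_eq_single j]
      · simp; ring
      · intro i _ hij
        simp [hij.symm]
      · simp
    · exact sum_congr rfl fun i _ => by ring

/-- The quasi-polynomial `q(z) e^{(z,ν)}`. -/
def qexp (ν : Fin n → ℝ) (q : MvPolynomial (Fin n) ℂ) (z : Fin n → ℂ) : ℂ :=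
  eval z q * Complex.exp (∑ i, z i * (ν i : ℂ))

theorem hasDerivAt_qexp {z : ℂ → Fin n → ℂ} {a : Fin n → ℝ} {τ : ℂ}
    (hz : ∀ i, HasDerivAt (fun t => z t i) (a i : ℂ) τ) (ν : Fin n → ℝ)
    (q : MvPolynomial (Fin n) ℂ) :
    HasDerivAt (fun t => qexp ν q (z t)) (qexp ν (tw ν a q) (z τ)) τ := by
  have h1 : HasDerivAt (fun t => ∑ i, z t i * (ν i : ℂ)) (∑ i, (a i : ℂ) * (ν i : ℂ)) τ :=
    HasDerivAt.fun_sum fun i _ => (hz i).mul_const _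
  refine ((hasDerivAt_eval_complex hz q).mul h1.cexp).congr_deriv ?_
  rw [qexp, tw_apply, dd_eq_sum, MvPolynomial.eval_add, MvPolynomial.smul_eval]
  simp only [map_sum, map_mul, MvPolynomial.eval_C, dotR, Complex.ofReal_sum, Complex.ofReal_mul,
    Complex.coe_algebraMap]
  ring

theorem dirDeriv_qexp (ν a : Fin n → ℝ) (q : MvPolynomial (Fin n) ℂ) :
    dirDeriv a (qexp ν q) = qexp ν (tw ν a q) := by
  funext z
  have h := hasDerivAt_qexp (z := fun t : ℂ => z + t • fun i => (a i : ℂ)) (a := a) (τ := 0)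
    (fun i => by
      simpa using ((hasDerivAt_id (0 : ℂ)).mul_const (a i : ℂ)).const_add (z i)) ν q
  rw [zero_smul, add_zero] at h
  exact h.deriv

theorem dirDeriv_iterate_qexp (ν a : Fin n → ℝ) (i : ℕ) : ∀ q : MvPolynomial (Fin n) ℂ,
    (dirDeriv a)^[i] (qexp ν q) = qexp ν ((tw ν a)^[i] q) := by
  induction i with
  | zero => intro q; rfl
  | succ i ih =>
    intro q
    rw [Function.iterate_succ_apply, dirDeriv_qexp, ih, Function.iterate_succ_apply]

theorem partialD_qexp (ν : Fin n → ℝ) (j : Fin n) (q : MvPolynomial (Fin n) ℂ) :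
    partialD j (qexp ν q) = qexp ν (tw ν (Pi.single j 1) q) := by
  funext z
  have h := hasDerivAt_qexp (z := fun t : ℂ => Function.update z j t) (a := Pi.single j 1)
    (τ := z j) (fun i => by
      rcases eq_or_ne i j with rfl | hij
      · simpa using hasDerivAt_id' (z i)
      · simpa [hij] using hasDerivAt_const (z j) (z i)) ν q
  rw [Function.update_eq_self] at h
  exact h.deriv

theorem partialD_iterate_qexp (ν : Fin n → ℝ) (j : Fin n) (i : ℕ) :
    ∀ q : MvPolynomial (Fin n) ℂ,
    (partialD j)^[i] (qexp ν q) = qexp ν ((tw ν (Pi.single j 1))^[i] q) := by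
  induction i with
  | zero => intro q; rfl
  | succ i ih =>
    intro q
    rw [Function.iterate_succ_apply, partialD_qexp, ih, Function.iterate_succ_apply]

/-- The symbol of `∂^β` conjugated by `e^{(z,ν)}`, acting on polynomials. -/
def mtw (ν : Fin n → ℝ) (β : Fin n → ℕ) : MvPolynomial (Fin n) ℂ →ₗ[ℂ] MvPolynomial (Fin n) ℂ :=
  ((List.finRange n).map fun i => (tw ν (Pi.single i 1) : Module.End ℂ (MvPolynomial (Fin n) ℂ)) ^ β i).prod

theorem multiD_qexp (ν : Fin n → ℝ) (β : Fin n → ℕ) (q : MvPolynomial (Fin n) ℂ) :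
    multiD β (qexp ν q) = qexp ν (mtw ν β q) := by
  rw [multiD, mtw, List.ofFn_eq_map]
  induction List.finRange n with
  | nil => rfl
  | cons i l ih =>
    rw [List.map_cons, List.foldr_cons, Function.comp_apply, ih, partialD_iterate_qexp,
      List.map_cons, List.prod_cons, Module.End.mul_apply, Module.End.pow_apply]

theorem tw_zero (a : Fin n → ℝ) (q : MvPolynomial (Fin n) ℂ) : tw 0 a q = dd ℂ a q := by
  rw [tw_apply, dotR_zero_right]
  simp

theorem mtw_tay (ν : Fin n → ℝ) (β : Fin n → ℕ) (q : MvPolynomial (Fin n) ℂ) :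
    mtw 0 β (tay ν (∑ i, β i : ℕ) q) = tay ν 0 (mtw ν β q) := by
  have key : ∀ (l : List (Fin n)) (d : ℤ),
      (l.map fun i => (tw 0 (Pi.single i 1) : Module.End ℂ (MvPolynomial (Fin n) ℂ)) ^ β i).prod
        (tay ν d q) = tay ν (d - ((l.map β).sum : ℕ))
      ((l.map fun i => (tw ν (Pi.single i 1) : Module.End ℂ (MvPolynomial (Fin n) ℂ)) ^ β i).prod q) := by
    intro l
    induction l with
    | nil => intro d; simp
    | cons i l ih =>
      intro d
      have h1 : ⇑(tw (0 : Fin n → ℝ) (Pi.single i 1)) = ⇑(dd ℂ (Pi.single i 1 : Fin n → ℝ)) :=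
        funext fun q => tw_zero _ q
      rw [List.map_cons, List.prod_cons, Module.End.mul_apply, Module.End.pow_apply, ih, h1,
        dd_iterate_tay, List.map_cons, List.sum_cons, List.map_cons, List.prod_cons, Module.End.mul_apply,
        Module.End.pow_apply]
      congr 2
      push_cast
      ring
  rw [mtw, key, ← mtw]
  congr 2
  rw [← List.ofFn_eq_map, List.sum_ofFn, sub_self]

theorem eval_zero_mtw (ν : Fin n → ℝ) (β : Fin n → ℕ) (q : MvPolynomial (Fin n) ℂ) :
    eval 0 (mtw ν β q) =
      eval 0 (mtw 0 β (tay ν (∑ i, β i : ℕ) q)) := by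
  rw [mtw_tay, eval_zero_tay]

theorem eval_zero_mtw_of_isHomogeneous (β : Fin n → ℕ) {q : MvPolynomial (Fin n) ℂ} {d : ℕ}
    (hq : q.IsHomogeneous d) (h : ∑ i, β i ≠ d) : eval 0 (mtw 0 β q) = 0 := by
  rw [eval_zero_mtw, tay_of_isHomogeneous _ _ hq]
  have : expC (0 : Fin n → ℝ) ((∑ i, β i : ℕ) - d) = 0 := by
    rcases lt_or_gt_of_ne h with h1 | h1
    · exact expC_of_neg _ (by omega)
    · obtain ⟨k, hk⟩ := Nat.exists_eq_add_of_lt h1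
      rw [hk, show ((d + k + 1 : ℕ) : ℤ) - d = ((k + 1 : ℕ) : ℤ) by push_cast; ring, expC_natCast]
      have : lin ℂ (0 : Fin n → ℝ) = 0 := by simp [lin]
      rw [this, zero_pow k.succ_ne_zero, smul_zero]
  rw [this, mul_zero, map_zero, map_zero]

theorem lin_dvd_of_eval {a : Fin n → ℝ} (ha : dotR a a = 2) {f : MvPolynomial (Fin n) ℂ}
    (h : ∀ z, dotC a z = 0 → eval z f = 0) : lin ℂ a ∣ f := by
  rw [lin_dvd_iff ℂ ha]
  refine MvPolynomial.funext fun z => ?_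
  have h1 : eval z (shear ℂ (1 / 2) a f) =
      eval (fun i => z i - ((1 / 2 * a i : ℝ) : ℂ) * dotC a z) f := by
    have : (aeval z).comp (shear ℂ (1 / 2) a) =
        aeval (R := ℂ) fun i => z i - ((1 / 2 * a i : ℝ) : ℂ) * dotC a z := by
      refine MvPolynomial.algHom_ext fun i => ?_
      simp [shear, eval_lin_complex]
    have h2 := DFunLike.congr_fun this f
    simpa [MvPolynomial.coe_aeval_eq_eval] using h2
  rw [h1, map_zero]
  refine h _ ?_
  have h3 : ∑ i, (a i : ℂ) * (a i : ℂ) = 2 := by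
    have := congrArg (fun x : ℝ => (x : ℂ)) ha
    simpa [dotR] using this
  simp only [dotC, mul_sub, Finset.sum_sub_distrib]
  have : ∑ i, (a i : ℂ) * (((1 / 2 * a i : ℝ) : ℂ) * ∑ i, (a i : ℂ) * z i) =
      (1 / 2 * ∑ i, (a i : ℂ) * (a i : ℂ)) * ∑ i, (a i : ℂ) * z i := by
    rw [mul_comm (1 / 2 : ℂ), Finset.sum_mul, Finset.sum_mul]
    refine sum_congr rfl fun i _ => ?_
    push_cast
    ring
  rw [this, h3]
  ring

end Translation

namespace CoxeterData

variable {n : ℕ} {c : CoxeterData n}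

theorem IsBAPoly.dil {m : ℕ} {μ : Fin n → ℝ} {p : MvPolynomial (Fin n) ℂ}
    (hp : c.IsBAPoly m μ p) (t : ℝ) : c.IsBAPoly m (t • μ) (dil (t : ℂ) p) where
  totalDegree_le := (totalDegree_le_of_isHomogeneous (dil_isHomogeneous t) p).trans hp.totalDegree_le
  top := by
    have h := homogeneousComponent_comm (dil_isHomogeneous (t : ℂ)) (m * c.R.card) p
    rw [AlgHom.toLinearMap_apply, AlgHom.toLinearMap_apply, hp.top, map_smul,
      dil_of_isHomogeneous (t : ℂ) ((c.delta_isHomogeneous ℂ).pow m)] at h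
    rw [h, smul_smul]
    congr 1
    simp only [dotR_smul_right, Finset.prod_mul_distrib, Finset.prod_const]
    push_cast
    rw [mul_pow, ← pow_mul, mul_comm]
  dvd := fun α hα j hj => by
    rw [tw_dil_iterate]
    obtain ⟨g, hg⟩ := hp.dvd α hα j hj
    rw [hg, map_mul, dil_lin, MvPolynomial.smul_eq_C_mul, MvPolynomial.smul_eq_C_mul]
    exact Dvd.dvd.mul_left (Dvd.dvd.mul_right (Dvd.intro_left _ rfl) _) _

theorem prod_dotR_act (w : c.W) (μ : Fin n → ℝ) :
    ∏ α ∈ c.R, dotR α (c.act w μ) = (c.chi w : ℝ) * ∏ α ∈ c.R, dotR α μ := by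
  rw [← eval_delta_real, ← eval_delta_real, ← eval_sb, sb_delta]
  simp

theorem tw_act (w : c.W) (μ a : Fin n → ℝ) (q : MvPolynomial (Fin n) ℂ) :
    tw (c.act w μ) a (c.sb ℂ w⁻¹ q) = c.sb ℂ w⁻¹ (tw μ (c.act w⁻¹ a) q) := by
  rw [tw_apply, tw_apply, dd_sb, map_add, map_smul, dotR_act_right]

theorem tw_act_iterate (w : c.W) (μ a : Fin n → ℝ) (i : ℕ) : ∀ q : MvPolynomial (Fin n) ℂ,
    (tw (c.act w μ) a)^[i] (c.sb ℂ w⁻¹ q) = c.sb ℂ w⁻¹ ((tw μ (c.act w⁻¹ a))^[i] q) := by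
  induction i with
  | zero => intro q; rfl
  | succ i ih =>
    intro q
    rw [Function.iterate_succ_apply, tw_act, ih, Function.iterate_succ_apply]

theorem tw_neg_iterate (μ a : Fin n → ℝ) (i : ℕ) (q : MvPolynomial (Fin n) ℂ) :
    (tw μ (-a))^[i] q = ((-1 : ℂ) ^ i) • (tw μ a)^[i] q := by
  have h : tw μ (-a) = (-1 : ℂ) • tw μ a := by
    refine LinearMap.ext fun q => ?_
    rw [LinearMap.smul_apply, tw_apply, tw_apply, dd_neg_vec, dotR_neg_left]
    push_cast
    module
  rw [← Module.End.pow_apply, ← Module.End.pow_apply, h, smul_pow, LinearMap.smul_apply]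

theorem IsBAPoly.act {m : ℕ} {μ : Fin n → ℝ} {p : MvPolynomial (Fin n) ℂ}
    (hp : c.IsBAPoly m μ p) (w : c.W) : c.IsBAPoly m (c.act w μ) (c.sb ℂ w⁻¹ p) where
  totalDegree_le := (totalDegree_le_of_isHomogeneous (L := (c.sb ℂ w⁻¹).toLinearMap)
    (fun _ _ hq => c.sb_isHomogeneous ℂ _ hq) p).trans hp.totalDegree_le
  top := by
    have h := homogeneousComponent_comm (L := (c.sb ℂ w⁻¹).toLinearMap)
      (fun _ _ hq => c.sb_isHomogeneous ℂ _ hq) (m * c.R.card) p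
    rw [AlgHom.toLinearMap_apply, AlgHom.toLinearMap_apply, hp.top, map_smul, map_pow, sb_delta,
      chi_inv] at h
    rw [h, prod_dotR_act]
    rcases c.chi_eq_or w with h1 | h1
    · simp [h1]
    · rw [h1]
      simp only [Int.cast_neg, Int.cast_one, neg_mul, one_mul, Complex.ofReal_neg]
      rw [neg_pow (c.delta ℂ), neg_pow ((_ : ℝ) : ℂ), MvPolynomial.smul_eq_C_mul,
        MvPolynomial.smul_eq_C_mul, map_mul, map_pow _ (-1 : ℂ), map_neg, map_one]
      ring
  dvd := fun α hα j hj => by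
    rw [tw_act_iterate]
    have h1 : lin ℂ (c.act w⁻¹ α) ∣ (tw μ (c.act w⁻¹ α))^[1 + 2 * j] p := by
      rcases c.act_mem_or w⁻¹ hα with h | h
      · exact hp.dvd _ h j hj
      · have h2 := hp.dvd _ h j hj
        rw [tw_neg_iterate, lin_neg, neg_dvd, MvPolynomial.smul_eq_C_mul, pow_add, pow_mul,
          neg_one_sq, one_pow, mul_one, pow_one, map_neg, map_one, neg_one_mul, dvd_neg] at h2
        exact h2
    have h2 := map_dvd (c.sb ℂ w⁻¹) h1
    rwa [sb_lin, inv_inv, act_act_inv] at h2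

theorem tay_act (w : c.W) (μ : Fin n → ℝ) (d : ℤ) (q : MvPolynomial (Fin n) ℂ) :
    tay (c.act w μ) d (c.sb ℂ w⁻¹ q) = c.sb ℂ w⁻¹ (tay μ d q) := by
  induction q using induction_isHomogeneous with
  | hh i q hq =>
    rw [tay_of_isHomogeneous _ _ hq, tay_of_isHomogeneous _ _ (c.sb_isHomogeneous ℂ _ hq), map_mul]
    refine congrArg _ ?_
    rcases lt_or_ge (d - (i : ℤ)) 0 with h | h
    · rw [expC_of_neg _ h, expC_of_neg _ h, map_zero]
    · obtain ⟨k, hk⟩ := Int.eq_ofNat_of_zero_le h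
      rw [hk, expC_natCast, expC_natCast, map_smul, map_pow, sb_lin, inv_inv]
  | ha p q hp hq => rw [map_add, map_add, map_add, map_add, hp, hq]

end CoxeterData

namespace CoxeterData

variable {n : ℕ} {c : CoxeterData n}

theorem exists_isBAPoly {m : ℕ} {B : BAConfig n} (hBA : B.A = c.R) (hBm : B.mult = fun _ => m)
    {φ : (Fin n → ℂ) → (Fin n → ℂ) → ℂ} (hφ : IsBAFunction B φ) (ν : Fin n → ℝ) :
    ∃ p, c.IsBAPoly m ν p ∧ (fun y => φ y fun i => (ν i : ℂ)) = qexp ν p := by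
  obtain ⟨h1, h2⟩ := hφ
  obtain ⟨p, hp, hdeg, htop⟩ := h1 fun i => (ν i : ℂ)
  have hφp : (fun y => φ y fun i => (ν i : ℂ)) = qexp ν p := funext hp
  refine ⟨p, ⟨?_, ?_, ?_⟩, hφp⟩
  · simpa [hBA, hBm, mul_comm] using hdeg
  · rw [hBm, hBA] at htop
    simp only [Finset.sum_const, smul_eq_mul] at htop
    rw [mul_comm, htop, AmC, Finset.prod_pow, Finset.prod_pow]
    congr 2
    rw [Complex.ofReal_prod]
    refine Finset.prod_congr rfl fun α _ => ?_
    simp [dotC, dotR]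
  · intro α hα j hj
    refine lin_dvd_of_eval (c.norm2 α hα) fun z hz => ?_
    have h3 := h2 α (hBA ▸ hα) j (by rw [hBm]; exact hj) (fun i => (ν i : ℂ)) z hz
    rw [hφp, dirDeriv_iterate_qexp, add_comm] at h3
    exact (mul_eq_zero.1 h3).resolve_right (Complex.exp_ne_zero _)

theorem qexp_zero (ν : Fin n → ℝ) (q : MvPolynomial (Fin n) ℂ) :
    qexp ν q 0 = eval 0 q := by
  simp [qexp]

theorem exists_functional {m : ℕ} {B : BAConfig n} (hBA : B.A = c.R) (hBm : B.mult = fun _ => m)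
    {φ : (Fin n → ℂ) → (Fin n → ℂ) → ℂ} (hφ : IsBAFunction B φ)
    {D : ((Fin n → ℂ) → ℂ) → ((Fin n → ℂ) → ℂ)} (hD : IsDiffOp D)
    (hDφ : ∀ (lam : Fin n → ℂ) (z : Fin n → ℂ),
      D (fun y => φ y lam) z = (∏ α ∈ c.R, dotC α lam ^ (2 * m + 1)) * φ z lam) :
    ∃ ℓ : MvPolynomial (Fin n) ℂ →ₗ[ℂ] ℂ,
      D (fun y => ∏ α ∈ c.R, dotC α y ^ (2 * m + 1)) 0 = ℓ (c.delta ℂ ^ (2 * m + 1)) ∧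
      ∀ ν, (∀ α ∈ c.R, dotR α ν ≠ 0) → ∀ p, c.IsBAPoly m ν p →
        ℓ (tay ν ((2 * m + 1) * c.R.card : ℕ) p) =
          ((∏ α ∈ c.R, dotR α ν : ℝ) : ℂ) ^ (2 * m + 1) * eval 0 p := by
  obtain ⟨s, a, hs⟩ := hD
  set d := (2 * m + 1) * c.R.card with hd
  have hδ : (c.delta ℂ ^ (2 * m + 1)).IsHomogeneous d := by
    rw [hd, mul_comm (2 * m + 1)]
    exact (c.delta_isHomogeneous ℂ).pow _
  let ℓ : MvPolynomial (Fin n) ℂ →ₗ[ℂ] ℂ := ∑ β ∈ s with ∑ i, β i = d,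
    a β 0 • ((aeval (0 : Fin n → ℂ)).toLinearMap ∘ₗ mtw 0 β)
  have hℓ : ∀ q, ℓ q = ∑ β ∈ s with ∑ i, β i = d, a β 0 * eval 0 (mtw 0 β q) := by
    intro q
    simp only [ℓ, LinearMap.sum_apply, LinearMap.smul_apply, LinearMap.comp_apply,
      AlgHom.toLinearMap_apply, smul_eq_mul]
    rfl
  refine ⟨ℓ, ?_, fun ν hν p hp => ?_⟩
  · have h1 : (fun y => ∏ α ∈ c.R, dotC α y ^ (2 * m + 1)) = qexp 0 (c.delta ℂ ^ (2 * m + 1)) := by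
      funext y
      simp [qexp, eval_delta_complex, Finset.prod_pow]
    rw [hs, h1, hℓ, Finset.sum_filter]
    refine sum_congr rfl fun β _ => ?_
    rw [multiD_qexp, qexp_zero]
    split_ifs with h
    · rfl
    · rw [eval_zero_mtw_of_isHomogeneous β hδ h, mul_zero]
  · set K := ((∏ α ∈ c.R, dotR α ν : ℝ) : ℂ) ^ (2 * m + 1) * eval 0 p with hK
    have key : ∀ t : ℝ, 0 < t → ∑ β ∈ s, a β 0 *
        eval 0 (mtw 0 β (tay ν (∑ i, β i : ℕ) p)) * (t : ℂ) ^ (∑ i, β i) =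
        K * (t : ℂ) ^ d := by
      intro t ht
      obtain ⟨p', hp', hφ'⟩ := exists_isBAPoly hBA hBm hφ (t • ν)
      have hreg : ∀ α ∈ c.R, dotR α (t • ν) ≠ 0 := fun α hα => by
        rw [dotR_smul_right]
        exact mul_ne_zero ht.ne' (hν α hα)
      rw [hp'.unique hreg (hp.dil t)] at hφ'
      have h1 := hDφ (fun i => ((t • ν) i : ℂ)) 0
      have h2 : φ 0 (fun i => ((t • ν) i : ℂ)) = eval 0 p := by
        have := congrFun hφ' 0
        rw [this, qexp_zero, eval_dil, smul_zero]
      have h3 : ∏ α ∈ c.R, dotC α (fun i => ((t • ν) i : ℂ)) ^ (2 * m + 1) =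
          (t : ℂ) ^ d * ((∏ α ∈ c.R, dotR α ν : ℝ) : ℂ) ^ (2 * m + 1) := by
        rw [Finset.prod_pow, Complex.ofReal_prod, hd, mul_comm (2 * m + 1), pow_mul, ← mul_pow,
          ← Finset.prod_const, ← Finset.prod_mul_distrib]
        congr 1
        refine Finset.prod_congr rfl fun α _ => ?_
        simp only [dotC, dotR, Pi.smul_apply, smul_eq_mul, Complex.ofReal_sum,
          Complex.ofReal_mul, mul_sum]
        exact sum_congr rfl fun i _ => by ring
      rw [h2, h3, hs, hφ'] at h1
      rw [hK, mul_right_comm, mul_comm _ ((t : ℂ) ^ d), ← h1]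
      refine sum_congr rfl fun β _ => ?_
      rw [multiD_qexp, qexp_zero, eval_zero_mtw (t • ν), tay_dil, map_smul, MvPolynomial.smul_eval]
      ring
    let Q : Polynomial ℂ := ∑ β ∈ s, Polynomial.C (a β 0 *
      eval 0 (mtw 0 β (tay ν (∑ i, β i : ℕ) p))) * Polynomial.X ^ (∑ i, β i) -
      Polynomial.C K * Polynomial.X ^ d
    have hQ : Q = 0 := by
      refine Polynomial.eq_zero_of_infinite_isRoot Q ?_
      refine Set.infinite_of_injective_forall_mem (f := fun k : ℕ => (((k : ℝ) + 1 : ℝ) : ℂ))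
        (fun k l hkl => ?_) fun k => ?_
      · simpa using hkl
      · have h1 := key ((k : ℝ) + 1) (by positivity)
        simp only [Set.mem_ofPred_eq, Polynomial.IsRoot.def, Q, Polynomial.eval_sub,
          Polynomial.eval_finsetSum, Polynomial.eval_mul, Polynomial.eval_C, Polynomial.eval_pow,
          Polynomial.eval_X]
        rw [h1, sub_self]
    have h2 := congrArg (fun P => Polynomial.coeff P d) hQ
    simp only [Q, Polynomial.coeff_sub, Polynomial.finsetSum_coeff, Polynomial.coeff_C_mul_X_pow,
      Polynomial.coeff_zero, if_true] at h2
    rw [sub_eq_zero] at h2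
    rw [hℓ, ← h2, Finset.sum_filter]
    refine sum_congr rfl fun β _ => ?_
    by_cases h : ∑ i, β i = d
    · rw [if_pos h, if_pos h.symm, h]
    · rw [if_neg h, if_neg (Ne.symm h)]

end CoxeterData

namespace CoxeterData

variable {n : ℕ} (c : CoxeterData n)

/-- The contour integral of a complex polynomial against the weight `om k 0`. -/
def Ic (k : ℂ) : MvPolynomial (Fin n) ℂ →ₗ[ℂ] ℂ where
  toFun q := ∫ x, eval (zpt c.eta x) q * c.om k 0 (zpt c.eta x)
  map_add' p q := by
    simp only [map_add, add_mul]
    exact integral_add (c.integrable_eval_mul_om k 0 c.eta_pos p)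
      (c.integrable_eval_mul_om k 0 c.eta_pos q)
  map_smul' a q := by
    simp only [MvPolynomial.smul_eval, mul_assoc, integral_const_mul, RingHom.id_apply, smul_eq_mul]

theorem Ic_apply (k : ℂ) (q : MvPolynomial (Fin n) ℂ) :
    c.Ic k q = ∫ x, eval (zpt c.eta x) q * c.om k 0 (zpt c.eta x) := rfl

theorem Ic_map (k : ℂ) (q : MvPolynomial (Fin n) ℝ) :
    c.Ic k (MvPolynomial.map (algebraMap ℝ ℂ) q) = c.J k q := by
  simp only [Ic_apply, J, aeval_eq_eval_map]

theorem Ic_one (k : ℂ) : c.Ic k 1 = c.J k 1 := by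
  simpa using c.Ic_map k 1

theorem Ic_master (k : ℂ) (q : Fin n → MvPolynomial (Fin n) ℂ) (r : MvPolynomial (Fin n) ℂ)
    (h : (∑ j, (pderiv j (q j) + X j * q j)) * c.delta ℂ +
      MvPolynomial.C (2 * k) * ∑ j, q j * pderiv j (c.delta ℂ) = c.delta ℂ * r) :
    c.Ic k r = 0 :=
  c.integral_master k 0 c.eta_pos q r (by simpa using h)

variable {c}

theorem IsBAPoly.cm_tay {m : ℕ} {μ : Fin n → ℝ} (hμ : ∀ α ∈ c.R, dotR α μ ≠ 0)
    {p : MvPolynomial (Fin n) ℂ} (hp : c.IsBAPoly m μ p) (d : ℤ) :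
    c.cm m (tay μ d p) = c.delta ℂ * ((dotR μ μ : ℝ) : ℂ) • tay μ (d - 2) p := by
  have h0 := hp.defect_eq_zero hμ
  rcases Nat.eq_zero_or_pos c.R.card with hN | hN
  · have hδ : c.delta ℂ = 1 := by rw [delta, Finset.card_eq_zero.1 hN, Finset.prod_empty]
    have hg (f : MvPolynomial (Fin n) ℂ) : grad2 ℂ 1 f = 0 := by simp [grad2]
    have ht : c.twg μ p = 0 := by simp [twg, hδ]
    have h := congrArg (tay μ (d - 2)) h0
    rw [defect, hδ, ht, smul_zero, sub_zero, one_mul, one_mul, map_sub, tay_twl, map_smul, map_zero,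
      sub_add_cancel] at h
    rw [cm, hδ, hg, mul_zero, sub_zero, one_mul, one_mul]
    exact sub_eq_zero.1 h
  · have h := c.tay_defect hN m μ (d + c.R.card - 2) p
    rw [h0, map_zero, show d + c.R.card - 2 - c.R.card + 2 = d by ring,
      show d + c.R.card - 2 - c.R.card = d - 2 by ring] at h
    exact (sub_eq_zero.1 h.symm)

theorem IsBAPoly.Ic_tay_neg {m : ℕ} {μ : Fin n → ℝ} (hμ : ∀ α ∈ c.R, dotR α μ ≠ 0)
    {p : MvPolynomial (Fin n) ℂ} (hp : c.IsBAPoly m μ p) (d : ℕ) :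
    (d : ℂ) * c.Ic (-(m : ℂ)) (tay μ d p) +
      ((dotR μ μ : ℝ) : ℂ) * c.Ic (-(m : ℂ)) (tay μ ((d : ℤ) - 2) p) = 0 := by
  have hcm := hp.cm_tay hμ d
  have he := euler_identity (tay_isHomogeneous μ d p)
  rw [cm, lapl] at hcm
  simp only [MvPolynomial.smul_eq_C_mul] at hcm
  rw [← smul_eq_mul, ← smul_eq_mul, ← map_smul (c.Ic _), ← map_smul (c.Ic _), ← map_add]
  refine c.Ic_master _ (fun j => pderiv j (tay μ d p)) _ ?_
  simp only [MvPolynomial.smul_eq_C_mul]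
  rw [sum_add_distrib, he]
  have hg : ∑ j, pderiv j (tay μ d p) * pderiv j (c.delta ℂ) = grad2 ℂ (c.delta ℂ) (tay μ d p) := by
    rw [grad2_comm]; rfl
  rw [hg]
  simp only [map_neg, map_mul, map_ofNat, map_natCast, mul_neg, neg_mul]
  linear_combination hcm

theorem IsBAPoly.Ic_delta_tay {m : ℕ} {μ : Fin n → ℝ} (hμ : ∀ α ∈ c.R, dotR α μ ≠ 0)
    {p : MvPolynomial (Fin n) ℂ} (hp : c.IsBAPoly m μ p) (d : ℕ) :
    ((d : ℂ) - ((2 * m + 1) * c.R.card : ℕ)) * c.Ic 0 (c.delta ℂ * tay μ d p) +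
      ((dotR μ μ : ℝ) : ℂ) * c.Ic 0 (c.delta ℂ * tay μ ((d : ℤ) - 2) p) = 0 := by
  have hcm := hp.cm_tay hμ d
  have he := euler_identity (tay_isHomogeneous μ d p)
  have hδ := euler_identity (c.delta_isHomogeneous ℂ)
  have hl := c.lapl_delta (K := ℂ)
  rw [cm] at hcm
  simp only [MvPolynomial.smul_eq_C_mul] at hcm
  rw [← smul_eq_mul (a := _ - _), ← smul_eq_mul (a := ((dotR μ μ : ℝ) : ℂ)), ← map_smul (c.Ic _), ← map_smul (c.Ic _), ← map_add]
  refine c.Ic_master _ (fun j => c.delta ℂ * pderiv j (tay μ d p) -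
    (2 * m + 1 : MvPolynomial (Fin n) ℂ) * (tay μ d p * pderiv j (c.delta ℂ))) _ ?_
  have h1 : ∑ j, pderiv j (c.delta ℂ * pderiv j (tay μ d p) -
      (2 * m + 1 : MvPolynomial (Fin n) ℂ) * (tay μ d p * pderiv j (c.delta ℂ))) =
      c.cm m (tay μ d p) := by
    have e (j : Fin n) : pderiv j (c.delta ℂ * pderiv j (tay μ d p) -
        (2 * m + 1 : MvPolynomial (Fin n) ℂ) * (tay μ d p * pderiv j (c.delta ℂ))) =
        c.delta ℂ * pderiv j (pderiv j (tay μ d p)) - 2 * (m : MvPolynomial (Fin n) ℂ) *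
          (pderiv j (c.delta ℂ) * pderiv j (tay μ d p)) -
          (2 * m + 1 : MvPolynomial (Fin n) ℂ) * tay μ d p * pderiv j (pderiv j (c.delta ℂ)) := by
      have : pderiv j (2 * m + 1 : MvPolynomial (Fin n) ℂ) = 0 := by
        rw [show (2 * m + 1 : MvPolynomial (Fin n) ℂ) = ((2 * m + 1 : ℕ) : MvPolynomial (Fin n) ℂ) by
          push_cast; ring]
        exact Derivation.map_natCast _ _
      simp only [map_sub, Derivation.leibniz, this, smul_eq_mul, mul_zero, add_zero]
      ring
    rw [sum_congr rfl fun j _ => e j, Finset.sum_sub_distrib, Finset.sum_sub_distrib,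
      ← mul_sum, ← mul_sum, ← mul_sum]
    change c.delta ℂ * lapl ℂ _ - _ * grad2 ℂ _ _ - _ * lapl ℂ _ = _
    rw [hl, mul_zero, sub_zero, cm]
  have h2 : ∑ j, (X j : MvPolynomial (Fin n) ℂ) * (c.delta ℂ * pderiv j (tay μ d p) -
      (2 * m + 1 : MvPolynomial (Fin n) ℂ) * (tay μ d p * pderiv j (c.delta ℂ))) =
      c.delta ℂ * ((d : MvPolynomial (Fin n) ℂ) * tay μ d p) -
        (2 * m + 1 : MvPolynomial (Fin n) ℂ) * tay μ d p *
          ((c.R.card : MvPolynomial (Fin n) ℂ) * c.delta ℂ) := by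
    rw [← he, ← hδ, mul_sum, mul_sum, ← Finset.sum_sub_distrib]
    exact sum_congr rfl fun j _ => by ring
  rw [sum_add_distrib, h1, h2, mul_zero, map_zero, zero_mul, add_zero, cm]
  simp only [MvPolynomial.smul_eq_C_mul, map_sub, map_natCast, Nat.cast_mul, Nat.cast_add,
    Nat.cast_ofNat, Nat.cast_one, map_mul, map_add, map_ofNat, map_one]
  linear_combination (c.delta ℂ) * hcm

end CoxeterData

/-- A sequence satisfying the two-step recursion of a Gaussian generating function. -/
theorem eq_of_two_step {M : ℤ → ℂ} {D : ℕ} {l : ℂ} (h0 : ∀ d < 0, M d = 0)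
    (h : ∀ d : ℕ, ((d : ℂ) - D) * M d + l * M ((d : ℤ) - 2) = 0) :
    (∀ d : ℕ, (∀ j, d ≠ D + 2 * j) → M d = 0) ∧
      ∀ j : ℕ, M ((D + 2 * j : ℕ) : ℤ) = M D * (-l / 2) ^ j / j.factorial := by
  constructor
  · intro d
    induction d using Nat.strong_induction_on with
    | _ d ih =>
      intro hd
      have h2 : M ((d : ℤ) - 2) = 0 := by
        rcases lt_or_ge d 2 with h' | h'
        · exact h0 _ (by omega)
        · have := ih (d - 2) (by omega) fun j hj => hd (j + 1) (by omega)
          rwa [Nat.cast_sub h'] at this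
      have h3 := h d
      rw [h2, mul_zero, add_zero] at h3
      refine (mul_eq_zero.1 h3).resolve_left fun h4 => hd 0 ?_
      have : (d : ℂ) = D := sub_eq_zero.1 h4
      rw [mul_zero, add_zero]
      exact_mod_cast this
  · intro j
    induction j with
    | zero => simp
    | succ j ih =>
      have h3 := h (D + 2 * (j + 1))
      rw [show ((D + 2 * (j + 1) : ℕ) : ℤ) - 2 = ((D + 2 * j : ℕ) : ℤ) by push_cast; ring, ih] at h3
      have hj : (j : ℂ) + 1 ≠ 0 := Nat.cast_add_one_ne_zero j
      have hf : (j.factorial : ℂ) ≠ 0 := by exact_mod_cast j.factorial_ne_zero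
      rw [Nat.factorial_succ]
      push_cast at h3 ⊢
      field_simp at h3 ⊢
      linear_combination (1 / 2) * h3

namespace CoxeterData

variable {n : ℕ} (c : CoxeterData n)

theorem dotC_smul_left (t : ℝ) (μ : Fin n → ℝ) (z : Fin n → ℂ) :
    dotC (t • μ) z = t * dotC μ z := by
  simp [dotC, mul_sum, mul_assoc]

theorem om_smul (k : ℂ) (t : ℝ) (μ : Fin n → ℝ) (z : Fin n → ℂ) :
    c.om k (t • μ) z = Complex.exp (t * dotC μ z) * c.om k 0 z := by
  have h0 : dotC (0 : Fin n → ℝ) z = 0 := by simp [dotC]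
  rw [om, om, ← Complex.exp_add, dotC_smul_left, h0]
  ring_nf

theorem hasSum_Ic_homogeneous (k : ℂ) (t : ℝ) (μ : Fin n → ℝ) (f : MvPolynomial (Fin n) ℂ) :
    HasSum (fun j : ℕ => (t : ℂ) ^ j * c.Ic k (f * expC μ j))
      (∫ x, eval (zpt c.eta x) f * c.om k (t • μ) (zpt c.eta x)) := by
  obtain ⟨M, ε, hG⟩ := c.exists_good c.eta_pos
  obtain ⟨A, hA0, hA⟩ := linBdd_dotC (S := (Set.univ : Set Unit)) (μ := fun _ => t • μ)
    (M' := ∑ i, |(t • μ) i|)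
    (fun _ _ i => Finset.single_le_sum (f := fun i => |(t • μ) i|) (fun i _ => abs_nonneg _)
      (Finset.mem_univ i)) hG.bdd
  obtain ⟨B, hB0, hB⟩ := (hG.tame_eval f).mul (hG.tame_pre (k := fun _ => k) (K := ‖k‖)
    (fun _ _ => le_rfl) (μ := fun _ => 0) (M' := 0) (by simp))
  have hterm (j : ℕ) : (t : ℂ) ^ j * c.Ic k (f * expC μ j) =
      ∫ x, (dotC (t • μ) (zpt c.eta x)) ^ j / (j.factorial : ℂ) *
        (eval (zpt c.eta x) f * c.om k 0 (zpt c.eta x)) := by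
    rw [Ic_apply, ← integral_const_mul]
    refine integral_congr_ae (Filter.Eventually.of_forall fun x => ?_)
    simp only [expC_natCast, map_mul, MvPolynomial.smul_eval, map_pow, eval_lin_complex,
      dotC_smul_left]
    ring
  simp only [hterm]
  refine hasSum_integral_of_dominated_convergence
    (fun j x => (A * wt x) ^ j / (j.factorial : ℝ) * (Real.exp (B * wt x) * gauss x)) ?_ ?_ ?_ ?_ ?_
  · intro j
    have h1 : AEStronglyMeasurable (fun x => eval (zpt c.eta x) f *
        c.om k 0 (zpt c.eta x)) volume :=
      (c.integrable_eval_mul_om k 0 c.eta_pos f).aestronglyMeasurable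
    have h2 : Continuous fun x => (dotC (t • μ) (zpt c.eta x)) ^ j / (j.factorial : ℂ) :=
      (((continuous_dotC _).comp (continuous_zpt _)).pow j).div_const _
    exact h2.aestronglyMeasurable.mul h1
  · intro j
    refine Filter.Eventually.of_forall fun x => ?_
    have h1 := hA () trivial x
    have h2 := hB () trivial x
    rw [om_zpt, norm_mul, norm_div, norm_pow, Complex.norm_natCast, ← mul_assoc, norm_mul,
      Complex.norm_real, Real.norm_of_nonneg (gauss_pos x).le]
    have := (gauss_pos x).le
    have hw : 0 ≤ A * wt x := mul_nonneg hA0 (zero_le_one.trans (one_le_wt x))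
    gcongr
  · refine Filter.Eventually.of_forall fun x => ?_
    exact (Real.summable_pow_div_factorial _).mul_right _
  · refine (integrable_exp_wt_gauss (A + B)).congr (Filter.Eventually.of_forall fun x => ?_)
    have h1 := (NormedSpace.expSeries_div_hasSum_exp (A * wt x)).tsum_eq
    simp only [tsum_mul_right]
    rw [h1, ← Real.exp_eq_exp_ℝ, ← mul_assoc, ← Real.exp_add, add_mul]
  · refine Filter.Eventually.of_forall fun x => ?_
    have h1 := (NormedSpace.expSeries_div_hasSum_exp (dotC (t • μ) (zpt c.eta x))).mul_right
      (eval (zpt c.eta x) f * c.om k 0 (zpt c.eta x))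
    rw [← Complex.exp_eq_exp_ℂ] at h1
    rw [om_smul, ← dotC_smul_left, mul_left_comm]
    exact h1

theorem hasSum_Ic_tay (k : ℂ) (t : ℝ) (μ : Fin n → ℝ) (g q : MvPolynomial (Fin n) ℂ) :
    HasSum (fun d : ℕ => (t : ℂ) ^ d * c.Ic k (g * tay μ d q))
      (∫ x, eval (zpt c.eta x) (g * dil (t : ℂ) q) *
        c.om k (t • μ) (zpt c.eta x)) := by
  induction q using induction_isHomogeneous with
  | hh i q hq =>
    have h := c.hasSum_Ic_homogeneous k t μ (g * dil (t : ℂ) q)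
    have hinj : Function.Injective fun j : ℕ => j + i := add_left_injective i
    refine (hinj.hasSum_iff fun d hd => ?_).1 ?_
    · have hdi : d < i := by
        by_contra! h'
        exact hd ⟨d - i, Nat.sub_add_cancel h'⟩
      rw [tay_of_isHomogeneous μ _ hq, expC_of_neg _ (by omega), mul_zero, mul_zero, map_zero,
        mul_zero]
    · convert h using 2 with j
      simp only [Function.comp]
      rw [tay_of_isHomogeneous μ _ hq, dil_of_isHomogeneous _ hq, Nat.cast_add, add_sub_cancel_right,
        mul_smul_comm, smul_mul_assoc, map_smul, smul_eq_mul, pow_add, mul_assoc, mul_assoc]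
  | ha p q hp hq =>
    have h := hp.add hq
    have i1 := c.integrable_eval_mul_om k (t • μ) c.eta_pos (g * dil (t : ℂ) p)
    have i2 := c.integrable_eval_mul_om k (t • μ) c.eta_pos (g * dil (t : ℂ) q)
    rw [← integral_add i1 i2] at h
    simpa only [map_add, mul_add, add_mul] using h

theorem integral_generating (k : ℂ) (t : ℝ) (μ : Fin n → ℝ) (g p : MvPolynomial (Fin n) ℂ) {D : ℕ}
    (h : ∀ d : ℕ, ((d : ℂ) - D) * c.Ic k (g * tay μ d p) +
      ((dotR μ μ : ℝ) : ℂ) * c.Ic k (g * tay μ ((d : ℤ) - 2) p) = 0) :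
    ∫ x, eval (zpt c.eta x) (g * dil (t : ℂ) p) * c.om k (t • μ) (zpt c.eta x) =
      c.Ic k (g * tay μ D p) * (t : ℂ) ^ D *
        Complex.exp (-((dotR μ μ : ℝ) : ℂ) * (t : ℂ) ^ 2 / 2) := by
  obtain ⟨h1, h2⟩ := eq_of_two_step (M := fun d => c.Ic k (g * tay μ d p))
    (fun d hd => by simp only [tay_of_neg _ hd, mul_zero, map_zero]) h
  refine (c.hasSum_Ic_tay k t μ g p).unique ?_
  have hinj : Function.Injective fun j : ℕ => D + 2 * j := fun a b hab => by
    simp only at hab; omega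
  refine (hinj.hasSum_iff fun d hd => ?_).1 ?_
  · rw [h1 d fun j hj => hd ⟨j, hj.symm⟩, mul_zero]
  · have h3 := (NormedSpace.expSeries_div_hasSum_exp
      (-((dotR μ μ : ℝ) : ℂ) * (t : ℂ) ^ 2 / 2)).mul_left (c.Ic k (g * tay μ D p) * (t : ℂ) ^ D)
    rw [← Complex.exp_eq_exp_ℂ] at h3
    refine h3.congr_fun fun j => ?_
    simp only [Function.comp, h2 j]
    ring

theorem zpt_smul (t : ℝ) (y x : Fin n → ℝ) : zpt (t • y) (t • x) = (t : ℂ) • zpt y x := by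
  funext i
  simp only [zpt, Pi.smul_apply, smul_eq_mul, Complex.ofReal_mul]
  ring

theorem lg_smul {t : ℝ} (ht : 0 < t) {y : Fin n → ℝ} (hy : ∀ α ∈ c.R, 0 < dotR α y)
    (x : Fin n → ℝ) : c.lg ((t : ℂ) • zpt y x) = c.R.card * (Real.log t : ℂ) + c.lg (zpt y x) := by
  rw [lg, lg, ← nsmul_eq_mul, ← Finset.sum_const, ← sum_add_distrib]
  refine sum_congr rfl fun α hα => ?_
  have h : dotC α ((t : ℂ) • zpt y x) = t * dotC α (zpt y x) := by
    simp only [dotC, Pi.smul_apply, smul_eq_mul, mul_sum]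
    exact sum_congr rfl fun i _ => by ring
  rw [h, Complex.log_ofReal_mul ht (dotC_zpt_ne_zero (hy α hα) x)]

/-- On the contour through `t • η` the weight with exponent `-t • η` is real Gaussian. -/
theorem om_neg_eta (k : ℂ) (t : ℝ) (y x : Fin n → ℝ) :
    c.om k (t • (-y)) (zpt (t • y) x) = Complex.exp (2 * k * c.lg (zpt (t • y) x)) *
      Complex.exp (-((dotR (-y) (-y) : ℝ) : ℂ) * (t : ℂ) ^ 2 / 2) * (gauss x : ℂ) := by
  have h1 : (gauss x : ℂ) = Complex.exp (-(∑ i, (x i : ℂ) ^ 2) / 2) := by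
    simp [gauss]
  rw [om, h1, ← Complex.exp_add, ← Complex.exp_add]
  congr 1
  have h2 : dotC (t • (-y)) (zpt (t • y) x) + (∑ i, zpt (t • y) x i ^ 2) / 2 =
      -((dotR (-y) (-y) : ℝ) : ℂ) * (t : ℂ) ^ 2 / 2 + -(∑ i, (x i : ℂ) ^ 2) / 2 := by
    simp only [dotC, dotR, zpt, Complex.ofReal_sum, Finset.sum_div, ← Finset.sum_neg_distrib,
      Finset.sum_mul, ← sum_add_distrib]
    refine sum_congr rfl fun i _ => ?_
    simp only [Pi.smul_apply, Pi.neg_apply, smul_eq_mul]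
    push_cast
    linear_combination ((x i : ℂ) ^ 2 / 2) * Complex.I_sq
  linear_combination h2

theorem tendsto_integral_comp_smul {F : (Fin n → ℝ) → ℂ} (hF : Continuous F) {A : ℝ} (hA : 0 ≤ A)
    (hFA : ∀ x, ‖F x‖ ≤ Real.exp (A * wt x)) :
    Filter.Tendsto (fun j : ℕ => ∫ x, F (((j : ℝ) + 1)⁻¹ • x) * (gauss x : ℂ)) Filter.atTop
      (𝓝 (F 0 * Z0 n)) := by
  have hZ : F 0 * Z0 n = ∫ x : Fin n → ℝ, F 0 * (gauss x : ℂ) := by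
    rw [integral_const_mul]
    exact congrArg (F 0 * ·) integral_complex_ofReal.symm
  rw [hZ]
  refine tendsto_integral_of_dominated_convergence (fun x => Real.exp (A * wt x) * gauss x) ?_
    (integrable_exp_wt_gauss A) ?_ ?_
  · intro j
    exact ((hF.comp (continuous_const_smul _)).mul
      (Complex.continuous_ofReal.comp continuous_gauss)).aestronglyMeasurable
  · refine fun j => Filter.Eventually.of_forall fun x => ?_
    rw [norm_mul, Complex.norm_real, Real.norm_of_nonneg (gauss_pos x).le]
    refine mul_le_mul_of_nonneg_right ((hFA _).trans (Real.exp_le_exp.2 ?_)) (gauss_pos x).le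
    refine mul_le_mul_of_nonneg_left ?_ hA
    refine add_le_add_right (Finset.sum_le_sum fun i _ => ?_) 1
    have hj : ((j : ℝ) + 1)⁻¹ ≤ 1 := inv_le_one_of_one_le₀ (by linarith [j.cast_nonneg (α := ℝ)])
    rw [Pi.smul_apply, smul_eq_mul, abs_mul, abs_of_nonneg (by positivity)]
    exact mul_le_of_le_one_left (abs_nonneg _) hj
  · refine Filter.Eventually.of_forall fun x => ?_
    refine Filter.Tendsto.mul_const _ ?_
    have h1 : Filter.Tendsto (fun j : ℕ => ((j : ℝ) + 1)⁻¹ • x) Filter.atTop (𝓝 ((0 : ℝ) • x)) := by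
      refine Filter.Tendsto.smul_const ?_ x
      simpa [one_div] using tendsto_one_div_add_atTop_nhds_zero_nat (𝕜 := ℝ)
    rw [zero_smul] at h1
    exact (hF.tendsto 0).comp h1

end CoxeterData

theorem eval_smul_of_isHomogeneous {n : ℕ} (t : ℂ) {q : MvPolynomial (Fin n) ℂ} {i : ℕ}
    (hq : q.IsHomogeneous i) (z : Fin n → ℂ) :
    eval (t • z) q = t ^ i * eval z q := by
  rw [← eval_dil, dil_of_isHomogeneous t hq, MvPolynomial.smul_eval]

theorem eq_sum_homogeneousComponent {n : ℕ} {q : MvPolynomial (Fin n) ℂ} {B : ℕ}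
    (h : q.totalDegree ≤ B) :
    q = ∑ i ∈ range (B + 1), homogeneousComponent i q := by
  conv_lhs => rw [← MvPolynomial.sum_homogeneousComponent q]
  refine Finset.sum_subset (Finset.range_mono (Nat.succ_le_succ h)) fun i _ hi => ?_
  rw [Finset.mem_range, not_lt] at hi
  exact MvPolynomial.homogeneousComponent_eq_zero _ _ hi

namespace CoxeterData

variable {n : ℕ} (c : CoxeterData n)

theorem continuous_lg {y : Fin n → ℝ} (hy : ∀ α ∈ c.R, 0 < dotR α y) :
    Continuous fun x => c.lg (zpt y x) :=
  continuous_finsetSum _ fun α hα => Continuous.clog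
    ((continuous_dotC α).comp (continuous_zpt y)) fun x => c.mem_slitPlane hy hα x

/-- The coefficient `M` is read off by letting the contour `t • η` go to infinity. -/
theorem coeff_eq_of_generating {m l e D : ℕ} {p g : MvPolynomial (Fin n) ℂ} {M : ℂ}
    (hp : p.totalDegree ≤ m * c.R.card) (hg : g.IsHomogeneous e)
    (hD : D + 2 * l * c.R.card = 2 * (m * c.R.card) + e)
    (hM : ∀ t : ℝ, 0 < t → ∫ x, eval (zpt c.eta x) (g * dil (t : ℂ) p) *
      c.om (-(l : ℂ)) (t • (-c.eta)) (zpt c.eta x) = M * (t : ℂ) ^ D *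
        Complex.exp (-((dotR (-c.eta) (-c.eta) : ℝ) : ℂ) * (t : ℂ) ^ 2 / 2)) :
    M = eval (zpt c.eta 0)
      (g * homogeneousComponent (m * c.R.card) p) *
        Complex.exp (2 * (-(l : ℂ)) * c.lg (zpt c.eta 0)) * Z0 n := by
  set F : ℕ → (Fin n → ℝ) → ℂ := fun i x => eval (zpt c.eta x)
    (g * homogeneousComponent i p) *
      Complex.exp (2 * (-(l : ℂ)) * c.lg (zpt c.eta x)) with hF
  have hFc (i : ℕ) : Continuous (F i) := (continuous_eval_zpt _ _).mul
    (Complex.continuous_exp.comp ((c.continuous_lg c.eta_pos).const_mul _))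
  obtain ⟨K, ε, hG⟩ := c.exists_good c.eta_pos
  have hFt (i : ℕ) : ∃ A : ℝ, 0 ≤ A ∧ ∀ x, ‖F i x‖ ≤ Real.exp (A * wt x) := by
    have h1 := LinBdd.mul_bdd (S := (Set.univ : Set Unit)) (G := fun _ _ => 2 * (-(l : ℂ)))
      ‖2 * (-(l : ℂ))‖ (fun _ _ _ => le_rfl) hG.linBdd_lg
    obtain ⟨A, hA, h2⟩ := (hG.tame_eval (g * homogeneousComponent i p)).mul h1.exp
    exact ⟨A, hA, fun x => h2 () trivial x⟩
  have hlim (i : ℕ) : Filter.Tendsto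
      (fun j : ℕ => ∫ x, F i (((j : ℝ) + 1)⁻¹ • x) * (gauss x : ℂ)) Filter.atTop
      (𝓝 (F i 0 * Z0 n)) := by
    obtain ⟨A, hA, h⟩ := hFt i
    exact tendsto_integral_comp_smul (hFc i) hA h
  have hpt (t : ℝ) (ht : 0 < t) (x : Fin n → ℝ) :
      eval (zpt (t • c.eta) x) (g * dil (t : ℂ) p) *
        c.om (-(l : ℂ)) (t • (-c.eta)) (zpt (t • c.eta) x) =
      ((t : ℂ) ^ D * Complex.exp (-((dotR (-c.eta) (-c.eta) : ℝ) : ℂ) * (t : ℂ) ^ 2 / 2)) *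
        ∑ i ∈ range (m * c.R.card + 1), (((t⁻¹ : ℝ) : ℂ) ^ 2) ^ (m * c.R.card - i) *
          (F i (t⁻¹ • x) * (gauss x : ℂ)) := by
    have ht0 : (t : ℂ) ≠ 0 := by exact_mod_cast ht.ne'
    have hz : zpt (t • c.eta) x = (t : ℂ) • zpt c.eta (t⁻¹ • x) := by
      rw [← zpt_smul, smul_inv_smul₀ ht.ne']
    have hexp : Complex.exp (2 * (-(l : ℂ)) * (c.R.card * (Real.log t : ℂ))) *
        (t : ℂ) ^ (2 * l * c.R.card) = 1 := by
      have : (t : ℂ) = Complex.exp (Real.log t : ℂ) := by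
        rw [← Complex.ofReal_exp, Real.exp_log ht]
      conv_lhs => rw [this]
      rw [← Complex.exp_nat_mul, ← Complex.exp_add, ← Complex.exp_zero]
      congr 1
      push_cast
      ring
    rw [om_neg_eta, hz, c.lg_smul ht c.eta_pos, mul_add, Complex.exp_add, map_mul,
      eval_smul_of_isHomogeneous _ hg, eval_dil, smul_smul]
    conv_lhs => rw [eq_sum_homogeneousComponent hp]
    rw [map_sum, mul_sum, Finset.sum_mul, mul_sum]
    refine sum_congr rfl fun i hi => ?_
    rw [Finset.mem_range, Nat.lt_succ_iff] at hi
    rw [eval_smul_of_isHomogeneous _ (MvPolynomial.homogeneousComponent_isHomogeneous i p)]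
    have hpow : (t : ℂ) ^ e * ((t : ℂ) * t) ^ i *
        Complex.exp (2 * (-(l : ℂ)) * (c.R.card * (Real.log t : ℂ))) =
        (t : ℂ) ^ D * (((t⁻¹ : ℝ) : ℂ) ^ 2) ^ (m * c.R.card - i) := by
      refine mul_right_cancel₀ (pow_ne_zero (2 * l * c.R.card) ht0) ?_
      rw [mul_assoc, hexp, mul_one]
      refine mul_right_cancel₀ (pow_ne_zero (2 * (m * c.R.card - i)) ht0) ?_
      have e1 : (((t⁻¹ : ℝ) : ℂ) ^ 2) ^ (m * c.R.card - i) * (t : ℂ) ^ (2 * (m * c.R.card - i)) =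
          1 := by
        rw [pow_mul, ← mul_pow, ← mul_pow, Complex.ofReal_inv, inv_mul_cancel₀ ht0, one_pow,
          one_pow]
      have e2 : (t : ℂ) ^ e * ((t : ℂ) * t) ^ i * (t : ℂ) ^ (2 * (m * c.R.card - i)) =
          (t : ℂ) ^ (2 * (m * c.R.card) + e) := by
        rw [← sq, ← pow_mul, ← pow_add, ← pow_add]
        congr 1
        omega
      rw [e2, ← hD, pow_add]
      linear_combination (-(t : ℂ) ^ D * (t : ℂ) ^ (2 * l * c.R.card)) * e1
    simp only [hF, map_mul]
    linear_combination (eval (zpt c.eta (t⁻¹ • x)) g *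
      eval (zpt c.eta (t⁻¹ • x)) (homogeneousComponent i p) *
      Complex.exp (2 * (-(l : ℂ)) * c.lg (zpt c.eta (t⁻¹ • x))) *
      Complex.exp (-((dotR (-c.eta) (-c.eta) : ℝ) : ℂ) * (t : ℂ) ^ 2 / 2) * (gauss x : ℂ)) * hpow
  have hint (t : ℝ) (i : ℕ) : Integrable fun x => F i (t⁻¹ • x) * (gauss x : ℂ) := by
    obtain ⟨A, hA, h⟩ := hFt i
    refine Tame.integrable (S := (Set.univ : Set Unit)) (F := fun _ x => F i (t⁻¹ • x)) (τ := ())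
      ⟨A * (1 + |t⁻¹|), by positivity, fun _ _ x => (h _).trans (Real.exp_le_exp.2 ?_)⟩ trivial
      ((hFc i).comp (continuous_const_smul _))
    rw [mul_assoc]
    refine mul_le_mul_of_nonneg_left ?_ hA
    have h0 : 0 ≤ ∑ i, |x i| := Finset.sum_nonneg fun i _ => abs_nonneg (x i)
    have h1 : ∑ i, |(t⁻¹ • x) i| = |t⁻¹| * ∑ i, |x i| := by
      simp only [Pi.smul_apply, smul_eq_mul, abs_mul, mul_sum]
    rw [wt, wt, h1]
    linarith [abs_nonneg t⁻¹]
  have hMt (t : ℝ) (ht : 0 < t) : M = ∑ i ∈ range (m * c.R.card + 1),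
      (((t⁻¹ : ℝ) : ℂ) ^ 2) ^ (m * c.R.card - i) * ∫ x, F i (t⁻¹ • x) * (gauss x : ℂ) := by
    have ht0 : (t : ℂ) ≠ 0 := by exact_mod_cast ht.ne'
    have h1 := hM t ht
    have h2 := c.integral_shift (-(l : ℂ)) (t • (-c.eta)) c.eta_pos (g * dil (t : ℂ) p) one_pos ht
    rw [one_smul, h1] at h2
    simp only [hpt t ht] at h2
    rw [integral_const_mul, integral_finsetSum _ fun i _ => (hint t i).const_mul _, mul_assoc,
      mul_comm M] at h2
    simp only [integral_const_mul] at h2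
    exact mul_left_cancel₀ (mul_ne_zero (pow_ne_zero _ ht0) (Complex.exp_ne_zero _)) h2
  have hlim2 : Filter.Tendsto (fun j : ℕ => ∑ i ∈ range (m * c.R.card + 1),
      (((((j : ℝ) + 1)⁻¹ : ℝ) : ℂ) ^ 2) ^ (m * c.R.card - i) *
        ∫ x, F i (((j : ℝ) + 1)⁻¹ • x) * (gauss x : ℂ)) Filter.atTop
      (𝓝 (∑ i ∈ range (m * c.R.card + 1),
        ((0 : ℂ) ^ 2) ^ (m * c.R.card - i) * (F i 0 * Z0 n))) := by
    refine tendsto_finsetSum _ fun i _ => Filter.Tendsto.mul ?_ (hlim i)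
    refine Filter.Tendsto.pow (Filter.Tendsto.pow ?_ _) _
    have : Filter.Tendsto (fun j : ℕ => ((j : ℝ) + 1)⁻¹) Filter.atTop (𝓝 0) := by
      simpa [one_div] using tendsto_one_div_add_atTop_nhds_zero_nat (𝕜 := ℝ)
    exact (Complex.continuous_ofReal.tendsto 0).comp this
  have hconst : Filter.Tendsto (fun _ : ℕ => M) Filter.atTop
      (𝓝 (∑ i ∈ range (m * c.R.card + 1),
        ((0 : ℂ) ^ 2) ^ (m * c.R.card - i) * (F i 0 * Z0 n))) :=
    hlim2.congr fun j => (hMt _ (by positivity)).symm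
  rw [tendsto_nhds_unique tendsto_const_nhds hconst, Finset.sum_range_succ, Nat.sub_self, pow_zero,
    one_mul, Finset.sum_eq_zero, zero_add]
  intro i hi
  rw [Finset.mem_range] at hi
  rw [zero_pow two_ne_zero, zero_pow (by omega), zero_mul]

end CoxeterData

theorem eq_C_of_isHomogeneous_zero {n : ℕ} {q : MvPolynomial (Fin n) ℂ} (h : q.IsHomogeneous 0) :
    q = MvPolynomial.C (eval 0 q) := by
  have h1 := MvPolynomial.totalDegree_eq_zero_iff_eq_C.1 (Nat.le_zero.1 h.totalDegree_le)
  rw [h1, MvPolynomial.eval_C]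

theorem factorial_mul_div_factorial (k d : ℕ) (hd : 0 < d) :
    ((ascPochhammer ℂ (k * (d - 1))).eval ((k : ℂ) + 1)) = ((d * k).factorial : ℂ) / k.factorial := by
  have h0 : (k.factorial : ℂ) ≠ 0 := by exact_mod_cast k.factorial_ne_zero
  have h : k.factorial * (k + 1).ascFactorial (k * (d - 1)) = (d * k).factorial := by
    rw [Nat.factorial_mul_ascFactorial]
    congr 1
    obtain ⟨e, rfl⟩ : ∃ e, d = e + 1 := ⟨d - 1, by omega⟩
    rw [Nat.add_sub_cancel]
    ring
  rw [eq_div_iff h0, ← Nat.cast_succ, ← ascPochhammer_eval_cast,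
    ascPochhammer_nat_eq_ascFactorial, mul_comm]
  exact_mod_cast h

namespace CoxeterData

variable {n : ℕ} (c : CoxeterData n)

theorem facQ_eq_prod (k : ℕ) : (c.facQ k : ℂ) =
    ∏ j, (ascPochhammer ℂ (k * (c.d j - 1))).eval ((k : ℂ) + 1) := by
  rw [facQ, Complex.ofReal_prod]
  refine Finset.prod_congr rfl fun j _ => ?_
  rw [factorial_mul_div_factorial k _ (c.d_pos j)]
  push_cast
  rfl

theorem Ic_zero_of_isHomogeneous {q : MvPolynomial (Fin n) ℂ} {d : ℕ} (hq : q.IsHomogeneous d) :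
    (d : ℂ) * c.Ic 0 q = -c.Ic 0 (lapl ℂ q) := by
  have h := c.Ic_master 0 (fun j => pderiv j q) (lapl ℂ q + (d : ℂ) • q) (by
    rw [sum_add_distrib, euler_identity hq, mul_zero, map_zero, zero_mul, add_zero,
      MvPolynomial.smul_eq_C_mul, map_natCast, lapl]
    ring)
  rw [map_add, map_smul, smul_eq_mul] at h
  linear_combination h

theorem Ic_zero_sb (w : c.W) (q : MvPolynomial (Fin n) ℂ) : c.Ic 0 (c.sb ℂ w q) = c.Ic 0 q := by
  have key : ∀ d (q : MvPolynomial (Fin n) ℂ), q.IsHomogeneous d →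
      c.Ic 0 (c.sb ℂ w q) = c.Ic 0 q := by
    intro d
    induction d using Nat.strong_induction_on with
    | _ d ih =>
      intro q hq
      rcases Nat.eq_zero_or_pos d with rfl | hd
      · rw [eq_C_of_isHomogeneous_zero hq]
        exact congrArg _ ((c.sb ℂ w).commutes _)
      · have hd0 : (d : ℂ) ≠ 0 := by exact_mod_cast hd.ne'
        refine mul_left_cancel₀ hd0 ?_
        rw [c.Ic_zero_of_isHomogeneous hq,
          c.Ic_zero_of_isHomogeneous (c.sb_isHomogeneous ℂ w hq), c.lapl_sb,
          ih (d - 2) (by omega) _ (lapl_isHomogeneous ℂ hq)]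
  induction q using induction_isHomogeneous with
  | hh i q hq => exact key i q hq
  | ha p q hp hq => rw [map_add, map_add, map_add, hp, hq]

theorem Ic_delta_sq_mul (k : ℂ) (q : MvPolynomial (Fin n) ℂ) :
    c.Ic k (c.delta ℂ ^ 2 * q) = c.Ic (k + 1) q := by
  rw [Ic_apply, Ic_apply]
  congr 1
  funext x
  rw [c.om_add_one k 0 fun α hα => dotC_zpt_ne_zero (c.eta_pos α hα) x, aeval_eq_eval_map,
    map_pow, map_delta, map_mul]
  ring

theorem Ic_delta_pow (k : ℂ) (l : ℕ) : c.Ic k (c.delta ℂ ^ (2 * l)) = c.J (k + l) 1 := by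
  induction l generalizing k with
  | zero => rw [mul_zero, pow_zero, Ic_one, Nat.cast_zero, add_zero]
  | succ l ih =>
    rw [Nat.mul_succ, add_comm, pow_add, Ic_delta_sq_mul, ih]
    congr 1
    push_cast
    ring

theorem dotR_neg_eta_ne_zero : ∀ α ∈ c.R, dotR α (-c.eta) ≠ 0 := fun α hα => by
  rw [dotR_neg_right]
  exact neg_ne_zero.2 (c.eta_pos α hα).ne'

theorem prod_dotR_neg_eta : ((∏ α ∈ c.R, dotR α (-c.eta) : ℝ) : ℂ) =
    (-1) ^ c.R.card * eval (zpt c.eta 0) (c.delta ℂ) := by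
  have h (α : Fin n → ℝ) : dotC α (zpt c.eta 0) = ((dotR α c.eta : ℝ) : ℂ) := by
    rw [dotC_zpt, show dotR α 0 = 0 by simp [dotR], Complex.ofReal_zero, zero_mul, add_zero]
  rw [eval_delta_complex, Complex.ofReal_prod, ← Finset.prod_const, ← Finset.prod_mul_distrib]
  refine Finset.prod_congr rfl fun α _ => ?_
  rw [h, dotR_neg_right, Complex.ofReal_neg, neg_one_mul]

theorem exp_lg_eta : Complex.exp (c.lg (zpt c.eta 0)) =
    eval (zpt c.eta 0) (c.delta ℂ) := by
  rw [c.exp_lg fun α hα => dotC_zpt_ne_zero (c.eta_pos α hα) 0, aeval_eq_eval_map, map_delta]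

variable {c}

theorem IsBAPoly.eval_top {m : ℕ} {p : MvPolynomial (Fin n) ℂ} (hp : c.IsBAPoly m (-c.eta) p) :
    eval (zpt c.eta 0) (homogeneousComponent (m * c.R.card) p) =
      (-1) ^ (m * c.R.card) * eval (zpt c.eta 0) (c.delta ℂ) ^ (2 * m) := by
  rw [hp.top, prod_dotR_neg_eta, MvPolynomial.smul_eval, map_pow]
  ring

theorem IsBAPoly.eval_zero {m : ℕ} {p : MvPolynomial (Fin n) ℂ} (hp : c.IsBAPoly m (-c.eta) p) :
    eval 0 p = (-1) ^ (m * c.R.card) * c.facQ m := by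
  have h := c.coeff_eq_of_generating (m := m) (l := m) (e := 0) (D := 0) (g := 1) (p := p)
    (M := c.Ic (-(m : ℂ)) (1 * tay (-c.eta) (0 : ℕ) p)) hp.totalDegree_le
    (MvPolynomial.isHomogeneous_one _ _) (by ring) fun t _ =>
      c.integral_generating _ t _ _ _ fun d => by
        simpa using hp.Ic_tay_neg c.dotR_neg_eta_ne_zero d
  have hexp : Complex.exp (2 * (-(m : ℂ)) * c.lg (zpt c.eta 0)) *
      eval (zpt c.eta 0) (c.delta ℂ) ^ (2 * m) = 1 := by
    rw [← exp_lg_eta, ← Complex.exp_nat_mul, ← Complex.exp_add, ← Complex.exp_zero]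
    congr 1
    push_cast
    ring
  rw [one_mul, one_mul, hp.eval_top,
    eq_C_of_isHomogeneous_zero (tay_isHomogeneous (-c.eta) 0 p), Nat.cast_zero, eval_zero_tay,
    ← mul_one (MvPolynomial.C _), ← MvPolynomial.smul_eq_C_mul, map_smul, smul_eq_mul,
    Ic_one] at h
  have hJ : (c.facQ m : ℂ) * c.J (-(m : ℂ)) 1 = Z0 n := c.facQ_mul_J_neg m
  have hZ : (Z0 n : ℂ) ≠ 0 := by exact_mod_cast Z0_pos.ne'
  refine mul_right_cancel₀ hZ ?_
  linear_combination (c.facQ m : ℂ) * h - eval 0 p * hJ +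
    (-1) ^ (m * c.R.card) * c.facQ m * Z0 n * hexp

theorem IsBAPoly.Ic_delta_mul {m : ℕ} {p : MvPolynomial (Fin n) ℂ}
    (hp : c.IsBAPoly m (-c.eta) p) :
    c.Ic 0 (c.delta ℂ * tay (-c.eta) ((2 * m + 1) * c.R.card : ℕ) p) =
      (-1) ^ (m * c.R.card) * eval (zpt c.eta 0) (c.delta ℂ) ^ (2 * m + 1) *
        Z0 n := by
  have h := c.coeff_eq_of_generating (m := m) (l := 0) (e := c.R.card)
    (D := (2 * m + 1) * c.R.card) (g := c.delta ℂ) (p := p)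
    (M := c.Ic 0 (c.delta ℂ * tay (-c.eta) ((2 * m + 1) * c.R.card : ℕ) p)) hp.totalDegree_le
    (c.delta_isHomogeneous ℂ) (by ring) fun t _ => by
      rw [Nat.cast_zero, neg_zero]
      exact c.integral_generating _ t _ _ _ fun d => hp.Ic_delta_tay c.dotR_neg_eta_ne_zero d
  rw [h, map_mul, hp.eval_top, Nat.cast_zero, neg_zero, mul_zero, zero_mul, Complex.exp_zero]
  ring

/-- The alternating sum of the Taylor components is a multiple of the `m`-discriminant. -/
theorem IsBAPoly.exists_alternating_eq {m : ℕ} {μ : Fin n → ℝ} {p : MvPolynomial (Fin n) ℂ}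
    (hp : c.IsBAPoly m μ p) : ∃ κ : ℂ,
      ∑ w : c.W, (c.chi w : ℂ) • c.sb ℂ w⁻¹ (tay μ ((2 * m + 1) * c.R.card : ℕ) p) =
        κ • c.delta ℂ ^ (2 * m + 1) := by
  set T := tay μ ((2 * m + 1) * c.R.card : ℕ) p with hT
  set A := ∑ w : c.W, (c.chi w : ℂ) • c.sb ℂ w⁻¹ T with hA
  have hTh : T.IsHomogeneous ((2 * m + 1) * c.R.card) := tay_isHomogeneous μ _ p
  have hAh : A.IsHomogeneous ((2 * m + 1) * c.R.card) :=
    MvPolynomial.IsHomogeneous.sum _ _ _ fun w _ => by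
      rw [MvPolynomial.smul_eq_C_mul]
      exact (c.sb_isHomogeneous ℂ _ hTh).C_mul _
  have hanti (β : Fin n → ℝ) (hβ : β ∈ c.R) : c.sb ℂ (c.s β hβ) A = -A := by
    rw [hA, map_sum, ← Finset.sum_neg_distrib]
    refine Fintype.sum_equiv (Equiv.mulLeft (c.s β hβ)) _ _ fun w => ?_
    rw [Equiv.coe_mulLeft, map_smul, ← c.sb_mul, mul_inv_rev, c.s_inv, c.chi_mul, c.chi_s β hβ]
    push_cast
    rw [neg_one_mul, neg_smul, neg_neg]
  have hdd (β : Fin n → ℝ) (hβ : β ∈ c.R) (j : ℕ) (hj : j < m) :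
      lin ℂ β ∣ (dd ℂ β)^[1 + 2 * j] A := by
    have e : (dd ℂ β)^[1 + 2 * j] A =
        ∑ w : c.W, (c.chi w : ℂ) • (dd ℂ β)^[1 + 2 * j] (c.sb ℂ w⁻¹ T) := by
      have hl (f : MvPolynomial (Fin n) ℂ) : (dd ℂ β)^[1 + 2 * j] f =
          (((dd ℂ β : MvPolynomial (Fin n) ℂ →ₗ[ℂ] MvPolynomial (Fin n) ℂ)) ^ (1 + 2 * j)) f := by
        rw [Module.End.pow_apply]
        rfl
      simp only [hl, hA, map_sum, map_smul]
    rw [e]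
    refine Finset.dvd_sum fun w _ => ?_
    rw [MvPolynomial.smul_eq_C_mul]
    refine Dvd.dvd.mul_left ?_ _
    rw [hT, ← c.tay_act w]
    exact (hp.act w).lin_dvd_dd_tay _ hβ hj
  obtain ⟨q, hq⟩ := c.delta_pow_dvd ℂ (f := A) (2 * m + 1) fun β hβ => by
    have h := c.lin_pow_dvd_sub_sb hβ (hdd β hβ)
    rw [hanti, sub_neg_eq_add, ← two_mul] at h
    have h2 := h.mul_left (MvPolynomial.C (2⁻¹ : ℂ))
    rwa [← mul_assoc, ← map_ofNat (MvPolynomial.C : ℂ →+* MvPolynomial (Fin n) ℂ) 2, ← map_mul,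
      inv_mul_cancel₀ two_ne_zero, map_one, one_mul] at h2
  have hδ : (c.delta ℂ ^ (2 * m + 1)).IsHomogeneous ((2 * m + 1) * c.R.card) := by
    rw [mul_comm _ c.R.card]
    exact (c.delta_isHomogeneous ℂ).pow _
  have hq0 : q.IsHomogeneous 0 := isHomogeneous_of_mul_left hδ
    (pow_ne_zero _ (c.delta_ne_zero ℂ)) (by rwa [← hq, add_zero])
  refine ⟨eval 0 q, ?_⟩
  rw [hq, MvPolynomial.smul_eq_C_mul, ← eq_C_of_isHomogeneous_zero hq0, mul_comm]

end CoxeterData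

end

/-- The value `(w_m, w_m)^{R_+}` of the canonical bilinear form
`(p,q)^{R_+} = (L_p q)(0)` on the `m`-discriminant
`w_m(x) = ∏_{α∈R_+}(α,x)^{2m+1}` for a Coxeter configuration with equal
multiplicity `m`:
`(w_m,w_m)^{R_+} = (−1)^{m|R_+|} ∏_j (m+2)_{(m+1)(d_j−1)} (m+1)_{m(d_j−1)}`,
where `(x)_k` is the (ascending) Pochhammer symbol.  Here `D` is the differential
operator `L_{w_m}`, characterised by `D φ(·,λ) = w_m(λ) φ(·,λ)` for the
Baker-Akhiezer function `φ` of the configuration `R_+` with multiplicity `m`. -/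
theorem mDiscriminant_norm (n : ℕ) (C : CoxeterData n) (m : ℕ)
    (B : BAConfig n) (hBA : B.A = C.R) (hBm : B.mult = fun _ => m)
    (φ : (Fin n → ℂ) → (Fin n → ℂ) → ℂ) (hφ : IsBAFunction B φ)
    (D : ((Fin n → ℂ) → ℂ) → ((Fin n → ℂ) → ℂ)) (hD : IsDiffOp D)
    (hDφ : ∀ (lam : Fin n → ℂ) (z : Fin n → ℂ),
      D (fun y => φ y lam) z = (∏ α ∈ C.R, dotC α lam ^ (2 * m + 1)) * φ z lam) :
    D (fun y => ∏ α ∈ C.R, dotC α y ^ (2 * m + 1)) 0 =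
      (-1 : ℂ) ^ (m * C.R.card) *
        ∏ j, (ascPochhammer ℂ ((m + 1) * (C.d j - 1))).eval ((m : ℂ) + 2) *
          (ascPochhammer ℂ (m * (C.d j - 1))).eval ((m : ℂ) + 1) := by
  obtain ⟨p, hp, -⟩ := C.exists_isBAPoly hBA hBm hφ (-C.eta)
  obtain ⟨ℓ, hℓ, hℓν⟩ := C.exists_functional hBA hBm hφ hD hDφ
  obtain ⟨κ, hκ⟩ := hp.exists_alternating_eq
  set T := tay (-C.eta) ((2 * m + 1) * C.R.card : ℕ) p with hT
  set N := C.R.card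
  set E := MvPolynomial.eval (zpt C.eta 0) (C.delta ℂ) with hE
  have hE0 : E ≠ 0 := by
    rw [hE, ← CoxeterData.exp_lg_eta]
    exact Complex.exp_ne_zero _
  have hZ : (CoxeterData.Z0 n : ℂ) ≠ 0 := by exact_mod_cast CoxeterData.Z0_pos.ne'
  have hW : (Fintype.card C.W : ℂ) ≠ 0 := by exact_mod_cast Fintype.card_ne_zero
  have hQ : (C.facQ (m + 1) : ℂ) ≠ 0 := by exact_mod_cast (C.facQ_pos (m + 1)).ne'
  have hchi (w : C.W) : (C.chi w : ℂ) * C.chi w = 1 := by exact_mod_cast C.chi_mul_self w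
  have h1 : (Fintype.card C.W : ℂ) * ((-1) ^ (m * N) * E ^ (2 * m + 1) * CoxeterData.Z0 n) =
      κ * ((-1) ^ ((m + 1) * N) * C.facQ (m + 1) * CoxeterData.Z0 n) := by
    have h := congrArg (fun f => C.Ic 0 (C.delta ℂ * f)) hκ
    simp only [Finset.mul_sum, map_sum, mul_smul_comm, map_smul, smul_eq_mul] at h
    have e1 : C.delta ℂ * C.delta ℂ ^ (2 * m + 1) = C.delta ℂ ^ (2 * (m + 1)) := by ring
    have e2 (w : C.W) : (C.chi w : ℂ) * C.Ic 0 (C.delta ℂ * C.sb ℂ w⁻¹ T) =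
        C.Ic 0 (C.delta ℂ * T) := by
      rw [← C.Ic_zero_sb w⁻¹ (C.delta ℂ * T), map_mul (C.sb ℂ w⁻¹), CoxeterData.sb_delta, C.chi_inv, mul_assoc,
        ← map_intCast (MvPolynomial.C : ℂ →+* MvPolynomial (Fin n) ℂ),
        ← MvPolynomial.smul_eq_C_mul, map_smul, smul_eq_mul]
    rw [e1, C.Ic_delta_pow, zero_add, C.J_natCast, Finset.sum_congr rfl fun w _ => e2 w,
      Finset.sum_const, Finset.card_univ, nsmul_eq_mul, hp.Ic_delta_mul] at h
    exact h
  have h2 : (Fintype.card C.W : ℂ) * (((-1) ^ N * E) ^ (2 * m + 1) *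
      ((-1) ^ (m * N) * C.facQ m)) = κ * ℓ (C.delta ℂ ^ (2 * m + 1)) := by
    have h := congrArg ℓ hκ
    simp only [map_sum, map_smul, smul_eq_mul] at h
    have e2 (w : C.W) : (C.chi w : ℂ) * ℓ (C.sb ℂ w⁻¹ T) =
        ((-1) ^ N * E) ^ (2 * m + 1) * ((-1) ^ (m * N) * C.facQ m) := by
      have hreg : ∀ α ∈ C.R, dotR α (C.act w (-C.eta)) ≠ 0 := by
        refine Finset.prod_ne_zero_iff.1 ?_
        rw [CoxeterData.prod_dotR_act]
        refine mul_ne_zero ?_ (Finset.prod_ne_zero_iff.2 C.dotR_neg_eta_ne_zero)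
        rcases C.chi_eq_or w with h | h <;> simp [h]
      have h0 : MvPolynomial.eval 0 (C.sb ℂ w⁻¹ p) = MvPolynomial.eval 0 p := by
        refine (eval_subst_complex _ p 0).trans ?_
        congr 2
        funext i
        simp [cplx, dotC]
      rw [hT, ← C.tay_act w, hℓν _ hreg _ (hp.act w), h0, hp.eval_zero, CoxeterData.prod_dotR_act,
        Complex.ofReal_mul, CoxeterData.prod_dotR_neg_eta, Complex.ofReal_intCast, mul_pow (C.chi w : ℂ),
        pow_succ (C.chi w : ℂ), pow_mul, sq, hchi, one_pow, one_mul]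
      linear_combination (((-1) ^ N * E) ^ (2 * m + 1) * ((-1) ^ (m * N) * C.facQ m)) * hchi w
    rw [Finset.sum_congr rfl fun w _ => e2 w, Finset.sum_const, Finset.card_univ,
      nsmul_eq_mul] at h
    exact h
  have hs : ((-1 : ℂ) ^ N) ^ 2 = 1 := by rw [← pow_mul, mul_comm, pow_mul, neg_one_sq, one_pow]
  have hs2 : ((-1 : ℂ) ^ N) ^ (2 * m + 1) = (-1) ^ N := by
    rw [pow_succ, pow_mul, hs, one_pow, one_mul]
  rw [hℓ, Finset.prod_mul_distrib, ← CoxeterData.facQ_eq_prod]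
  have hQ1 : ∏ j, (ascPochhammer ℂ ((m + 1) * (C.d j - 1))).eval ((m : ℂ) + 2) =
      C.facQ (m + 1) := by
    rw [CoxeterData.facQ_eq_prod]
    refine Finset.prod_congr rfl fun j _ => ?_
    congr 1
    push_cast
    ring
  rw [hQ1]
  have hκ0 : κ ≠ 0 := by
    rintro rfl
    rw [zero_mul] at h1
    exact mul_ne_zero hW (mul_ne_zero (mul_ne_zero (pow_ne_zero _ (by norm_num))
      (pow_ne_zero _ hE0)) hZ) h1
  have h1' : (Fintype.card C.W : ℂ) * E ^ (2 * m + 1) = κ * ((-1) ^ N * C.facQ (m + 1)) := by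
    refine mul_right_cancel₀ hZ (mul_left_cancel₀
      (pow_ne_zero (m * N) (neg_ne_zero.2 one_ne_zero : (-1 : ℂ) ≠ 0)) ?_)
    rw [Nat.succ_mul, pow_add] at h1
    linear_combination h1
  refine mul_left_cancel₀ hκ0 ?_
  rw [← h2, mul_pow, hs2]
  linear_combination ((-1) ^ N * (-1) ^ (m * N) * (C.facQ m : ℂ)) * h1' +
    κ * C.facQ (m + 1) * (-1) ^ (m * N) * C.facQ m * hs
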